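/- Every double-critical 8-chromatic graph contains a minor isomorphic to the complete graph on 8 vertices with one edge removed. -/

import Mathlib

/-- A connected graph `G` with chromatic number `k` is *double-critical* if for every
edge `uv` of `G`, deleting both `u` and `v` yields a graph that is `(k-2)`-colourable. -/
def SimpleGraph.DoubleCritical {V : Type*} (G : SimpleGraph V) (k : ℕ) : Prop :=
  G.Connected ∧ G.chromaticNumber = k ∧
    ∀ u v : V, G.Adj u v →
      (G.induce ({u, v}ᶜ : Set V)).chromaticNumber ≤ (k - 2 : ℕ)

/-- `G.HasMinor H` means `H` is a minor of `G`, witnessed by nonempty pairwise disjoint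
branch sets inducing connected subgraphs, with edges of `G` between branch sets
corresponding to adjacent vertices of `H`. -/
def SimpleGraph.HasMinor {V W : Type*} (G : SimpleGraph V) (H : SimpleGraph W) : Prop :=
  ∃ B : W → Set V,
    (∀ w, (B w).Nonempty) ∧
    (Pairwise fun w₁ w₂ => Disjoint (B w₁) (B w₂)) ∧
    (∀ w, (G.induce (B w)).Connected) ∧
    (∀ w₁ w₂, H.Adj w₁ w₂ → ∃ v₁ ∈ B w₁, ∃ v₂ ∈ B w₂, G.Adj v₁ v₂)

/-- The complete graph on 8 vertices with one edge removed. -/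
def K8minus : SimpleGraph (Fin 8) :=
  (⊤ : SimpleGraph (Fin 8)).deleteEdges {s((0 : Fin 8), (1 : Fin 8))}

/-- The complete graph on 7 vertices with one edge removed. -/
def K7m : SimpleGraph (Fin 7) :=
  (⊤ : SimpleGraph (Fin 7)).deleteEdges {s((0 : Fin 7), (1 : Fin 7))}

namespace KCert

/-! ### A certificate checker for small dense graphs -/

/-- Certificate trees. -/
inductive Tr : Type
  | B (i j : ℕ) (s t : Tr) : Tr
  | F (v : ℕ) (t : Tr) : Tr
  | M (m : ℕ) : Tr
  | R (k p : ℕ) : Tr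
  | X (l : List ℕ) : Tr

/-- Test bit `k` of `m`. -/
def tb (m k : ℕ) : Bool := Nat.beq (Nat.land (Nat.shiftRight m k) 1) 1

theorem tb_eq (m k : ℕ) : tb m k = m.testBit k := by
  unfold tb
  rw [Bool.eq_iff_iff, Nat.beq_eq, Nat.testBit_eq_decide_div_mod_eq]
  change ((m >>> k) &&& 1 = 1) ↔ _
  rw [Nat.and_one_is_mod, Nat.shiftRight_eq_div_pow]
  simp

/-- Evaluate a natural number before passing it on. -/
def force (x : ℕ) (k : ℕ → Bool) : Bool :=
  Nat.rec (motive := fun _ => Bool) (k 0) (fun n _ => k (Nat.succ n)) x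

theorem force_eq (x : ℕ) (k : ℕ → Bool) : force x k = k x := by cases x <;> rfl

/-- Bounded universal quantifier. -/
def allB (k : ℕ) (p : ℕ → Bool) : Bool :=
  Nat.rec (motive := fun _ => Bool) true (fun n r => and (p n) r) k

theorem allB_iff (k : ℕ) (p : ℕ → Bool) : allB k p = true ↔ ∀ i < k, p i = true := by
  induction k with
  | zero => simp [allB]
  | succ k ih =>
    have : allB (k+1) p = (p k && allB k p) := rfl
    rw [this, Bool.and_eq_true, ih]
    constructor
    · rintro ⟨h1, h2⟩ i hi
      rcases Nat.lt_succ_iff_lt_or_eq.1 hi with h | h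
      · exact h2 i h
      · exact h ▸ h1
    · intro h
      exact ⟨h k (by omega), fun i hi => h i (by omega)⟩

/-- Bounded counting. -/
def cnt (k : ℕ) (p : ℕ → Bool) : ℕ :=
  Nat.rec (motive := fun _ => ℕ) 0 (fun n r => cond (p n) (Nat.succ r) r) k

theorem cnt_eq (k : ℕ) (p : ℕ → Bool) :
    cnt k p = ((Finset.range k).filter (fun i => p i = true)).card := by
  induction k with
  | zero => simp [cnt]
  | succ k ih =>
    have : cnt (k+1) p = cond (p k) (cnt k p + 1) (cnt k p) := rfl
    rw [this, Finset.range_add_one, Finset.filter_insert, ih]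
    cases h : p k <;> simp

/-- Insert an unordered pair. -/
def ins (S i j : ℕ) : ℕ :=
  Nat.lor (Nat.lor S (Nat.shiftLeft 1 (Nat.add (Nat.mul 16 i) j)))
    (Nat.shiftLeft 1 (Nat.add (Nat.mul 16 j) i))

theorem tb_ins {S i j a b : ℕ} (hi : i < 16) (hj : j < 16) (hb : b < 16)
    (h : tb (ins S i j) (16 * a + b) = true) :
    tb S (16 * a + b) = true ∨ (a = i ∧ b = j) ∨ (a = j ∧ b = i) := by
  rw [tb_eq] at *
  have : ins S i j = (S ||| (1 <<< (16 * i + j))) ||| (1 <<< (16 * j + i)) := rfl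
  rw [this] at h
  simp only [Nat.testBit_or, Nat.one_shiftLeft, Nat.testBit_two_pow, Bool.or_eq_true,
    decide_eq_true_eq] at h
  rcases h with (h | h) | h
  · exact Or.inl h
  · right; left; omega
  · right; right; omega

/-- Bit position of an ordered pair. -/
def ix (i j : ℕ) : ℕ := Nat.add (Nat.mul 16 i) j

def mA (m i : ℕ) : ℕ := Nat.land (Nat.shiftRight m (Nat.mul 8 i)) 15
def mB (m i : ℕ) : ℕ := Nat.land (Nat.shiftRight m (Nat.add (Nat.mul 8 i) 4)) 15

/-- Check a model of `K7m` whose branch sets are singletons or edges. -/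
noncomputable def chkM (n E m : ℕ) : Bool :=
  allB 7 fun j => force (mA m j) fun a => force (mB m j) fun b =>
    and (and (Nat.blt a n) (Nat.blt b n)) <|
    and (or (Nat.beq a b) (tb E (ix a b))) <|
    allB j fun i => force (mA m i) fun c => force (mB m i) fun d =>
      and (and (and (not (Nat.beq a c)) (not (Nat.beq a d)))
               (and (not (Nat.beq b c)) (not (Nat.beq b d))))
          (or (or (or (tb E (ix a c)) (tb E (ix a d))) (or (tb E (ix b c)) (tb E (ix b d))))
              (Nat.beq j 1))

/-- Row predicate: known non-neighbours of `v`, including `v`. -/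
def rowN (N v w : ℕ) : Bool := or (tb N (ix v w)) (Nat.beq w v)

/-- Add all edges from `v` to vertices not known to be non-neighbours. -/
def fillE (N v : ℕ) (k E : ℕ) : ℕ :=
  Nat.rec (motive := fun _ => ℕ) E (fun w r => cond (rowN N v w) r (ins r v w)) k

def pv (p i : ℕ) : ℕ := Nat.land (Nat.shiftRight p (Nat.mul 4 i)) 15

def perm (n p : ℕ) : Bool :=
  allB n fun i => force (pv p i) fun x => and (Nat.blt x n) (allB i fun j => not (Nat.beq (pv p j) x))

/-- All facts in the list, transported by `p`, hold in `S`. -/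
def facts (S p : ℕ) (l : List ℕ) : Bool :=
  l.all fun f => tb S (ix (pv p (Nat.div f 16)) (pv p (Nat.mod f 16)))

/-- A lemma: edge facts, non-edge facts, proof tree. -/
structure Lem : Type where
  e : ℕ
  f : ℕ
  t : Tr

/-- Evaluate a natural number before passing it on. -/
def forceL (x : ℕ) (k : ℕ → List ℕ) : List ℕ :=
  Nat.rec (motive := fun _ => List ℕ) (k 0) (fun n _ => k (Nat.succ n)) x

/-- Unpack a list of nonzero bytes. -/
def unp (fuel : ℕ) : ℕ → List ℕ :=
  Nat.rec (motive := fun _ => ℕ → List ℕ) (fun _ => [])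
    (fun _ r x => cond (Nat.beq x 0) []
      (forceL (Nat.mod x 256) fun y => forceL (Nat.div x 256) fun z => y :: r z)) fuel

/-- Edge facts of a lemma. -/
def Lem.le (L : Lem) : List ℕ := unp 60 L.e

/-- Non-edge facts of a lemma. -/
def Lem.lf (L : Lem) : List ℕ := unp 60 L.f

noncomputable def chk (n : ℕ) (D : ℕ → Lem) (c : ℕ) (t : Tr) : ℕ → ℕ → Bool :=
  Tr.rec (motive := fun _ => ℕ → ℕ → Bool)
    (fun i j _ _ f g E N => and (and (Nat.blt i n) (Nat.blt j n)) <|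
      and (force (ins N i j) fun N' => f E N') (force (ins E i j) fun E' => g E' N))
    (fun v _ f E N => and (and (Nat.blt v n) (Nat.ble n (Nat.add (cnt n (rowN N v)) 6))) <|
      force (fillE N v n E) fun E' => f E' N)
    (fun m E _ => chkM n E m)
    (fun k p E N => and (and (Nat.blt k c) (perm n p))
      (and (facts E p (D k).le) (facts N p (D k).lf)))
    (fun l E N => and (and (Nat.ble 8 n) (Nat.ble n (Nat.add (cnt n (rowN N 0)) 6))) <|
      allB n fun i => allB n fun j => or (or (Nat.beq i j) (tb E (ix i j))) <|
        l.any fun m => force (ins E i j) fun E' => chkM n E' m)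
    t

def ini (l : List ℕ) : ℕ :=
  List.rec (motive := fun _ => ℕ) 0 (fun f _ r => ins r (Nat.div f 16) (Nat.mod f 16)) l

noncomputable def chkL (n : ℕ) (D : ℕ → Lem) (c : ℕ) : Bool :=
  and (and ((D c).le.all fun f => Nat.blt f 256) ((D c).lf.all fun f => Nat.blt f 256)) <|
  force (ini (D c).le) fun E => force (ini (D c).lf) fun N => chk n D c (D c).t E N

/-- Two-level lookup. -/
def look (l : List (List Lem)) (k : ℕ) : Lem :=
  (l.getD (Nat.div k 32) []).getD (Nat.mod k 32) ⟨0, 0, Tr.M 0⟩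

end KCert

namespace KCert

open Tr

def seven_0 : List Lem := [
  ⟨0, 0, F 0 (F 1 (F 2 (F 3 (F 4 (F 5 (F 6 (M 28804199028494592)))))))⟩]

def seven : ℕ → Lem := look [seven_0]

def eight_0 : List Lem := [
  ⟨0, 1985229328,
  F 0 (F 1 (F 2 (F 3 (F 4 (F 5 (X [28767012629009732, 28766669038966084, 28804198463189794,
  33607964762845986]))))))⟩,
  ⟨0, 5517840,
  F 0 (F 1 (F 2 (F 3 (F 4 (F 5 (B 6 7 (R 0 1985229328) (M 33608038613127424)))))))⟩,
  ⟨0, 12816,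
  F 0 (F 1 (F 2 (F 3 (B 4 5 (F 4 (F 5 (R 1 1985229328))) (B 4 6 (F 4 (F 6 (R 1 1969500688))) (B 5
  6 (F 5 (F 6 (R 1 1952789008))) (M 28804200102236416)))))))⟩,
  ⟨0, 16,
  F 0 (F 1 (B 2 3 (F 2 (F 3 (R 2 1985229328))) (B 2 4 (F 2 (F 4 (R 2 1985167888))) (B 2 5 (F 2 (F
  5 (R 2 1984123408))) (B 2 6 (F 2 (F 6 (R 2 1967350288))) (B 3 4 (F 3 (F 4 (R 2 1985102608))) (B
  3 5 (F 3 (F 5 (R 2 1984058128))) (B 3 6 (F 3 (F 6 (R 2 1967285008))) (B 4 5 (F 4 (F 5 (R 2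
  1983009808))) (B 4 6 (F 4 (F 6 (R 2 1966236688))) (M 19196521434080853)))))))))))⟩,
  ⟨0, 0,
  B 0 1 (F 0 (F 1 (R 3 1985229328))) (B 0 2 (F 0 (F 2 (R 3 1985229088))) (B 0 3 (F 0 (F 3 (R 3
  1985225008))) (B 0 4 (F 0 (F 4 (R 3 1985159488))) (B 0 5 (F 0 (F 5 (R 3 1984110928))) (B 0 6 (F
  0 (F 6 (R 3 1967333728))) (B 1 2 (F 1 (F 2 (R 3 1985228833))) (B 1 3 (F 1 (F 3 (R 3
  1985224753))) (B 1 4 (F 1 (F 4 (R 3 1985159233))) (B 1 5 (F 1 (F 5 (R 3 1984110673))) (B 1 6 (F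
  1 (F 6 (R 3 1967333473))) (B 2 3 (F 2 (F 3 (R 3 1985220658))) (B 2 4 (F 2 (F 4 (R 3
  1985155138))) (B 2 5 (F 2 (F 5 (R 3 1984106578))) (B 2 6 (F 2 (F 6 (R 3 1967329378))) (B 3 4 (F
  3 (F 4 (R 3 1985089603))) (B 3 5 (F 3 (F 5 (R 3 1984041043))) (B 3 6 (F 3 (F 6 (R 3
  1967263843))) (B 4 5 (F 4 (F 5 (R 3 1982992468))) (B 4 6 (F 4 (F 6 (R 3 1966215268))) (M
  19196519823468117))))))))))))))))))))⟩]

def eight : ℕ → Lem := look [eight_0]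

def nine_0 : List Lem := [
  ⟨0, 2499999474315708932112,
  F 0 (F 1 (F 2 (F 3 (F 4 (F 5 (X [28854973559231812, 28854631572460868, 28854629969188164,
  28856975591744017, 28804473911517713, 28804200375788049, 33607820613010483, 38392894948656179,
  38411586377892915]))))))⟩,
  ⟨7759188, 2499999210432918265872,
  F 0 (F 1 (F 2 (F 3 (F 4 (F 5 (X [24069898955155012, 24069556968384068, 24069555365111364,
  38355511554364723, 28804405193089553, 28804200375788049, 33589274978820625, 33608240211173905,
  38411586377892915]))))))⟩,
  ⟨25940, 33042881046454288,
  F 0 (F 1 (F 2 (F 3 (F 4 (F 5 (B 6 7 (F 6 (F 7 (M 38337025203533670))) (B 6 8 (B 7 8 (R 1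
  36344967696) (M 33551950599456870)) (M 28766875995375735))))))))⟩,
  ⟨84, 110308771307536,
  F 0 (F 1 (F 2 (F 3 (F 4 (B 5 6 (F 5 (F 6 (M 38393250389823744))) (B 5 7 (F 5 (R 2 36344967696))
  (B 5 8 (R 2 31814136336) (M 24000561540008055))))))))⟩,
  ⟨0, 357608529936,
  F 0 (F 1 (F 2 (F 3 (B 4 5 (F 4 (F 5 (B 6 7 (B 6 8 (B 7 8 (R 0 36344967696) (M
  38411873652183296)) (M 38393250673987840)) (M 33608244789383424)))) (B 4 6 (F 4 (R 3
  36344967696)) (B 4 7 (F 4 (R 3 36061790736)) (B 5 6 (F 5 (R 3 36312404496)) (B 5 7 (F 5 (R 3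
  36045017616)) (M 24000698978957158)))))))))⟩,
  ⟨0, 1126244368,
  F 0 (F 1 (F 2 (B 3 5 (F 3 (R 4 36344967696)) (B 3 6 (F 3 (R 4 36329239056)) (B 3 7 (F 3 (R 4
  36061852176)) (B 4 5 (F 4 (R 4 36344906256)) (B 4 6 (F 4 (R 4 36329177616)) (B 4 7 (F 4 (R 4
  36061790736)) (B 5 6 (B 5 7 (F 5 (R 4 35491566096)) (M 33589540690084915)) (M
  28804466354439219))))))))))⟩,
  ⟨0, 2170896,
  F 0 (F 1 (F 2 (B 3 4 (R 5 36344967696) (B 3 5 (R 5 36343984656) (B 3 6 (R 5 36327272976) (B 4 5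
  (R 5 36342940176) (B 4 6 (R 5 36326228496) (M 19196933750941269))))))))⟩,
  ⟨0, 361619333136,
  F 0 (F 1 (F 2 (F 3 (B 4 6 (F 4 (M 19196795775125623)) (B 4 7 (F 4 (M 19196864494602342)) (M
  19196933214074726))))))⟩,
  ⟨4403745, 357592801296,
  F 0 (F 1 (F 2 (F 3 (B 4 5 (F 4 (F 5 (B 6 7 (B 6 8 (B 7 8 (R 6 22601074806) (M
  38411805453787648)) (M 38393114024550912)) (M 33608039688905216)))) (B 4 6 (F 4 (M
  19196727324084343)) (B 4 7 (F 4 (M 19196727592519782)) (M 19196727860950886)))))))⟩,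
  ⟨12833, 1110515728,
  F 0 (F 1 (F 2 (B 3 4 (F 3 (F 4 (B 5 6 (B 5 7 (F 5 (M 38374349314593024)) (M 33589274978947328))
  (M 28804200375914752)))) (B 3 6 (F 3 (R 8 36329239056)) (B 3 7 (F 3 (R 8 36061852176)) (B 3 8 (F
  3 (R 8 31767933456)) (B 4 5 (F 4 (R 8 36344906016)) (B 4 6 (F 4 (R 8 36329177376)) (B 4 7 (F 4
  (R 8 36061790496)) (M 19196727860950886))))))))))⟩,
  ⟨621036404806241426293298, 1412505616,
  F 0 (F 1 (B 4 6 (F 4 (M 19196795775125623)) (B 4 7 (F 4 (M 19196864494602342)) (M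
  19196933214074726))))⟩,
  ⟨33, 3219472,
  F 0 (F 1 (B 2 3 (F 2 (F 3 (B 4 5 (R 7 36344967696) (B 4 6 (R 7 36329239056) (M
  19196933750941269))))) (B 2 4 (F 2 (R 9 36344967696)) (B 2 5 (F 2 (R 9 36343861536)) (B 2 6 (F 2
  (R 9 36327088416)) (B 2 7 (F 2 (R 9 36058657056)) (B 2 8 (R 9 31763693856) (B 3 4 (F 3 (R 9
  36344840241)) (B 3 5 (F 3 (R 9 36343795761)) (B 3 6 (F 3 (R 9 36327022641)) (B 3 7 (F 3 (R 9
  36058591281)) (B 3 8 (R 9 31763628081) (B 4 5 (R 10 36344967696) (B 4 6 (R 10 36329239056) (M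
  19196933750941269)))))))))))))))⟩,
  ⟨157771652920694799212884257, 1396908048,
  F 0 (F 3 (B 4 6 (F 4 (R 11 36273411636)) (B 4 7 (F 4 (R 11 36004976436)) (B 4 8 (F 4 (R 11
  31710009396)) (M 28203719083460727)))))⟩,
  ⟨10339723046106959709160344793377, 4399120,
  F 0 (B 3 5 (F 3 (R 12 36344967696)) (B 3 6 (F 3 (R 12 31547732496)) (B 3 7 (F 3 (R 12
  27253813776)) (B 4 5 (F 4 (R 12 31815057936)) (B 4 6 (F 4 (R 12 31547671056)) (B 4 7 (F 4 (R 12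
  27253752336)) (M 23700119459231590)))))))⟩,
  ⟨0, 8208,
  F 0 (B 1 2 (F 1 (F 2 (R 6 36344967696))) (B 1 3 (F 1 (R 11 36344967696)) (B 1 4 (F 1 (R 11
  36344898561)) (B 1 5 (F 1 (R 11 36343850241)) (B 1 6 (F 1 (R 11 36327073281)) (B 1 7 (F 1 (R 11
  36058638081)) (B 1 8 (R 11 31763671041) (B 2 3 (F 2 (R 11 36344959746)) (B 2 4 (F 2 (R 11
  36344894466)) (B 2 5 (F 2 (R 11 36343846146)) (B 2 6 (F 2 (R 11 36327069186)) (B 2 7 (F 2 (R 11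
  36058633986)) (B 2 8 (R 11 31763666946) (B 3 4 (R 13 36344967696) (B 3 5 (R 13 36343984656) (B 3
  6 (R 13 36327272976) (B 4 5 (R 13 36342940176) (B 4 6 (R 13 36326228496) (M
  19196933750941269)))))))))))))))))))⟩,
  ⟨750786944709590256623189257009555067581859111200, 84,
  B 4 6 (F 4 (R 14 36291282516)) (B 4 7 (F 4 (R 14 36022847316)) (M 19284481827436390))⟩,
  ⟨49203573208487707058057331768832443720837120681582880, 0,
  B 4 5 (R 15 36344967696) (B 4 6 (R 15 36329239056) (M 19284482364302933))⟩,
  ⟨35107665647904355524338000160, 50,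
  B 2 4 (F 2 (R 14 36344759346)) (B 2 5 (F 2 (R 14 36343711026)) (B 2 6 (F 2 (R 14 36326934066))
  (B 2 7 (F 2 (R 14 36058498866)) (B 2 8 (R 14 31763531826) (B 3 4 (F 3 (R 14 36344759331)) (B 3 5
  (F 3 (R 14 36343711011)) (B 3 6 (F 3 (R 14 36326934051)) (B 3 7 (F 3 (R 14 36058498851)) (B 3 8
  (R 14 31763531811) (R 16 36344967696))))))))))⟩,
  ⟨0, 16,
  B 0 2 (F 0 (R 14 36344967696)) (B 0 3 (F 0 (R 14 36344963856)) (B 0 4 (F 0 (R 14 36344898576))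
  (B 0 5 (F 0 (R 14 36343850256)) (B 0 6 (F 0 (R 14 36327073296)) (B 0 7 (F 0 (R 14 36058638096))
  (B 1 2 (F 1 (R 14 36344967681)) (B 1 3 (F 1 (R 14 36344963841)) (B 1 4 (F 1 (R 14 36344898561))
  (B 1 5 (F 1 (R 14 36343850241)) (B 1 6 (F 1 (R 14 36327073281)) (B 1 7 (F 1 (R 14 36058638081))
  (B 2 4 (R 17 36344906256) (B 2 5 (R 17 36343861776) (B 2 6 (R 17 36327088656) (B 2 7 (R 17
  36058657296) (B 3 4 (R 17 36344840976) (B 3 5 (R 17 36343796496) (B 3 6 (R 17 36327023376) (B 3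
  7 (R 17 36058592016) (R 17 36344959026))))))))))))))))))))⟩,
  ⟨0, 0,
  B 0 1 (R 18 36344967696) (B 0 3 (R 18 36344963376) (B 0 4 (R 18 36344897856) (B 0 5 (R 18
  36343849296) (B 0 6 (R 18 36327072096) (B 0 7 (R 18 36058636656) (B 0 8 (R 18 31763669376) (B 1
  2 (R 18 36344967201) (B 1 4 (R 18 36344897601) (B 1 5 (R 18 36343849041) (B 1 6 (R 18
  36327071841) (B 1 7 (R 18 36058636401) (B 2 3 (R 18 36344959026) (B 2 4 (R 18 36344893506) (B 2
  5 (R 18 36343844946) (B 2 6 (R 18 36327067746) (B 2 7 (R 18 36058632306) (B 2 8 (R 18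
  31763665026) (B 3 4 (R 18 36344827971) (B 3 5 (R 18 36343779411) (B 3 6 (R 18 36327002211) (B 3
  7 (R 18 36058566771) (R 16 36344963121))))))))))))))))))))))⟩]

def nine : ℕ → Lem := look [nine_0]

def ten_0 : List Lem := [
  ⟨51924331674070652638898846937491480654113, 781878296291733170622218036352917520,
  F 0 (F 1 (F 2 (F 4 (X [37880593933956898, 37880594221258001, 24053137586284066,
  33307800255935232, 23982008899233348, 28804404907946896, 28785435646907793, 37880594221258001,
  33589202216043649, 38374691838173808, 33307800255935232, 33641978774176785, 24053137586284066,
  23982008899233348, 28873396577129745]))))⟩,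
  ⟨0, 7229458488678752272,
  F 0 (F 1 (F 2 (F 3 (B 4 7 (F 4 (M 19267164519307656)) (B 4 8 (F 4 (M 19284756705352055)) (M
  19302348891392119))))))⟩,
  ⟨0, 23699084885958672,
  F 0 (F 1 (F 2 (F 3 (B 4 6 (R 1 654820258320) (B 4 7 (R 1 654568600080) (M
  19302486330341222))))))⟩,
  ⟨21571, 7229194605888086032,
  F 0 (F 1 (F 2 (F 3 (B 4 7 (F 4 (M 19267096068266376)) (B 4 8 (F 4 (M 19284688254310775)) (M
  19302280440350839))))))⟩,
  ⟨67, 23435202095292432,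
  F 0 (F 1 (F 2 (F 3 (B 4 5 (B 4 6 (F 4 (M 19249641052739976)) (B 4 7 (F 4 (M 19267164519307656))
  (B 4 8 (F 4 (M 19284756705352055)) (M 19302348891392119)))) (B 4 6 (R 3 654820258320) (B 4 7 (R
  3 654568600080) (M 19302280977217382)))))))⟩,
  ⟨633565569859, 23716677072003088,
  F 0 (F 1 (F 2 (B 4 6 (F 4 (M 19249641052739976)) (B 4 7 (F 4 (M 19267164519307656)) (B 4 8 (F 4
  (M 19284756705352055)) (M 19302348891392119))))))⟩,
  ⟨50, 72779028307984,
  F 0 (F 1 (F 2 (B 3 4 (F 3 (B 4 5 (F 4 (M 19267164519307656)) (B 4 6 (F 4 (M 19267096068266376))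
  (B 4 7 (F 4 (M 19249504150657416)) (M 23700121606715238))))) (B 3 5 (F 3 (R 4 654820258320)) (B
  3 6 (F 3 (R 4 654802559760)) (B 3 7 (F 3 (R 4 654534189840)) (B 3 8 (F 3 (R 4 650239288080)) (B
  3 9 (R 4 581519876880) (B 4 5 (R 5 654820258320) (B 4 6 (R 5 654804529680) (B 4 7 (R 5
  654537142800) (M 19302280977217382))))))))))))⟩,
  ⟨696890573880100493935154, 28240067908673552,
  F 0 (F 1 (B 4 7 (F 4 (M 19267164519307656)) (B 4 8 (F 4 (M 19284756705352055)) (M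
  19302348891392119))))⟩,
  ⟨45671420649806267203459433010, 92570237607952,
  F 0 (F 1 (B 4 6 (R 7 654820258320) (B 4 7 (R 7 654537142800) (M 19302486330341222))))⟩,
  ⟨0, 211260874768,
  F 0 (F 1 (B 2 3 (F 2 (F 3 (B 4 5 (R 2 654820258320) (B 4 6 (R 2 654804529680) (M
  19302486867207765))))) (B 2 4 (F 2 (R 6 654820258320)) (B 2 5 (F 2 (R 6 654819275280)) (B 2 6 (F
  2 (R 6 654802563600)) (B 2 7 (F 2 (R 6 654534193680)) (B 2 8 (F 2 (R 6 650239291920)) (B 2 9 (R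
  6 581519880720) (B 3 4 (F 3 (R 6 654820254480)) (B 3 5 (F 3 (R 6 654819271440)) (B 3 6 (F 3 (R 6
  654802559760)) (B 3 7 (F 3 (R 6 654534189840)) (B 3 8 (F 3 (R 6 650239288080)) (B 3 9 (R 6
  581519876880) (B 4 5 (R 8 654820258320) (B 4 6 (R 8 654804529680) (M
  19302486867207765)))))))))))))))))⟩,
  ⟨66, 6003935200497704976,
  F 0 (F 1 (F 2 (F 3 (B 4 5 (F 4 (F 5 (M 43159698796581120))) (B 4 6 (F 4 (M 19267164519307656))
  (B 4 7 (F 4 (M 19249641052739976)) (B 4 8 (F 4 (M 19249709772216695)) (M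
  19249778491689079))))))))⟩,
  ⟨21314, 7156856705104551952,
  F 0 (F 1 (F 2 (F 3 (B 4 5 (F 4 (R 10 654818230305)) (B 4 6 (F 4 (M 19267164519307656)) (B 4 7 (F
  4 (M 19232049135131016)) (B 4 8 (F 4 (M 19232117854607735)) (M 19232186574080119))))))))⟩,
  ⟨4338225, 23154895349686288,
  F 0 (F 1 (F 2 (B 3 5 (F 3 (R 10 654820258320)) (B 3 6 (F 3 (R 11 654820258320)) (B 3 7 (F 3 (R
  11 654568600080)) (B 3 8 (F 3 (R 11 650290410000)) (B 4 5 (F 4 (R 10 654818230305)) (B 4 6 (F 4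
  (R 11 654820196865)) (B 4 7 (F 4 (R 11 654568538625)) (M 23700600495568742))))))))))⟩,
  ⟨499630949186, 625480985023136187621392,
  F 0 (F 1 (F 2 (F 3 (F 4 (B 6 5 (F 6 (M 43210198445221444)) (M 19284757242222933))))))⟩,
  ⟨362174169650, 2128609284343019413520,
  F 0 (F 1 (F 2 (F 3 (B 4 7 (F 4 (B 6 5 (F 6 (M 43210198445221444)) (B 6 8 (F 6 (M
  43157422692394564)) (M 38372348356748868)))) (B 4 8 (F 4 (R 13 654820258320)) (B 4 9 (R 13
  582342623745) (M 19231980684089736)))))))⟩,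
  ⟨41786202076168753, 8314579776989896720,
  F 0 (F 1 (F 2 (F 3 (B 5 6 (R 14 654819275040) (M 19284757242222933)))))⟩,
  ⟨357610697265, 8314579776989896720,
  F 0 (F 1 (F 2 (F 3 (B 4 5 (R 12 654818168850) (B 4 6 (R 14 654820258320) (B 4 7 (R 14
  654568600080) (B 4 8 (B 4 9 (B 5 7 (R 14 654567616800) (B 5 8 (R 14 509359767585) (M
  24087492483385412))) (R 15 654820258320)) (R 15 590144090640))))))))⟩,
  ⟨162192784900930, 32741537232265232,
  F 0 (F 1 (F 2 (B 4 8 (F 4 (R 16 646513508385)) (B 4 9 (F 4 (R 16 578062467105)) (M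
  19267164519307656)))))⟩,
  ⟨357610697265, 27956462628184080,
  F 0 (F 1 (F 2 (B 3 7 (F 3 (R 16 654820258320)) (B 3 8 (F 3 (R 16 650792743200)) (B 3 9 (R 16
  582341701920) (B 4 5 (R 12 654818168850) (B 4 6 (B 4 7 (F 4 (R 16 654818230305)) (B 4 8 (F 4 (R
  16 650791698465)) (M 19302348891392119))) (B 4 7 (R 17 654820258320) (B 4 8 (R 17 650793726480)
  (R 17 581587649025))))))))))⟩,
  ⟨4338225, 90439933829136,
  F 0 (F 1 (F 2 (B 3 4 (R 12 654820258320) (B 3 5 (R 12 654819152130) (B 3 6 (R 18 654820258320)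
  (B 3 7 (R 18 654567616800) (B 3 9 (R 18 581586727200) (B 4 5 (R 12 654818168850) (B 4 6 (R 18
  654818230305) (B 4 7 (R 18 654566572065) (M 19302486330341222)))))))))))⟩,
  ⟨41238774387196466, 23436370326396944,
  F 0 (F 1 (F 3 (B 4 5 (F 4 (M 19267096068266376)) (B 4 6 (F 4 (M 19267164519307656)) (B 4 7 (F 4
  (M 19249641052739976)) (B 4 8 (F 4 (M 19249709772216695)) (M 19249778491689079)))))))⟩,
  ⟨10557126243122364978, 7157437247244017680,
  F 0 (F 1 (F 3 (B 4 6 (F 4 (B 5 7 (F 5 (M 43210130262611268)) (B 5 8 (F 5 (M 43192538345002308))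
  (M 38407464009356612)))) (B 4 7 (F 4 (M 19267096068266376)) (B 4 8 (F 4 (M 19284688254310775))
  (M 19302280440350839))))))⟩,
  ⟨691871826049882734674481, 2443356856200200265744,
  F 0 (F 1 (F 3 (F 4 (B 5 6 (B 5 7 (F 5 (M 23999531553167752)) (M 19267302226696533)) (B 5 7 (B 5
  8 (F 5 (M 43140929481102723)) (M 23999669260552294)) (M 23999669528983398))))))⟩,
  ⟨177119187468769980076667441, 8386638470539452432,
  F 0 (F 1 (F 3 (B 4 8 (F 4 (R 22 654820258320)) (B 4 9 (R 22 577026343425) (M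
  19267164519307656)))))⟩,
  ⟨2702624318239325434417, 27957562139811856,
  F 0 (F 1 (F 3 (B 4 5 (R 21 654820258320) (B 4 6 (R 21 654804529680) (B 4 7 (R 23 654820258320)
  (B 4 8 (R 23 650793726480) (M 19302348891392119)))))))⟩,
  ⟨178403986913305726699127346, 92638957084688,
  F 0 (F 1 (B 4 6 (F 4 (R 24 654820196865)) (B 4 7 (F 4 (R 24 654568538625)) (B 4 8 (F 4 (R 24
  650290348545)) (M 19302280440350839)))))⟩,
  ⟨45671420649806267203459433010, 279980351504,
  F 0 (F 1 (B 4 5 (R 25 654820258320) (B 4 6 (R 25 654804529680) (B 4 7 (R 25 654537142800) (M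
  19302486330341222)))))⟩,
  ⟨2702624318239325434417, 91539445456912,
  F 0 (F 1 (B 3 6 (F 3 (R 24 654820258320)) (B 3 7 (F 3 (R 24 654568600080)) (B 3 8 (F 3 (R 24
  650290410000)) (B 3 9 (R 24 581587710480) (R 26 654820258320))))))⟩,
  ⟨49, 279980351504,
  F 0 (F 1 (B 2 3 (F 2 (R 9 654820258080)) (B 2 4 (F 2 (R 9 654820196385)) (B 2 5 (F 2 (R 19
  654820258320)) (B 2 6 (F 2 (R 19 654801395730)) (B 2 7 (F 2 (R 19 654532964370)) (B 2 8 (F 2 (R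
  19 650238001170)) (B 2 9 (R 19 581518528530) (B 3 4 (B 3 5 (F 3 (R 20 654820258320)) (B 3 6 (F 3
  (R 20 654804529680)) (B 3 7 (F 3 (R 20 654537142800)) (B 3 8 (F 3 (R 20 650243224080)) (B 4 5 (F
  4 (R 20 654820196865)) (B 4 6 (F 4 (R 20 654804468225)) (B 4 7 (F 4 (R 20 654537081345)) (M
  23700600495568742)))))))) (B 3 5 (R 27 654820258320) (B 3 6 (R 27 654804529680) (B 3 7 (R 27
  654537142800) (B 3 8 (R 27 650243224080) (R 26 581524795920))))))))))))))⟩,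
  ⟨692148530869063564476993, 8387220189819707408,
  F 0 (F 3 (F 4 (B 5 8 (F 5 (M 43140929481102723)) (M 19284825693264213))))⟩,
  ⟨2972760275240861066160930038104369, 32761406070726672,
  F 0 (F 3 (F 4 (B 5 6 (R 29 654820258320) (B 5 7 (R 29 590144090640) (B 6 7 (B 6 8 (F 6 (R 28
  640504006470)) (M 28837519617460309)) (M 33608231850890643))))))⟩,
  ⟨2972760275240861066160930038104369, 110308772290576,
  F 0 (F 3 (B 4 7 (F 4 (R 30 654820258320)) (B 4 8 (F 4 (R 30 650793726480)) (B 4 9 (R 30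
  582342685200) (M 19267164519307656)))))⟩]

def ten_1 : List Lem := [
  ⟨11612344825159613539682525266225, 357609512976,
  F 0 (F 3 (B 4 5 (B 4 6 (F 4 (R 28 654748706100)) (B 4 7 (F 4 (R 28 654480274740)) (B 4 8 (F 4 (R
  28 650185311540)) (M 19249778491689079)))) (B 4 6 (R 31 654820258320) (B 4 7 (R 31 654568600080)
  (B 4 8 (R 31 650290410000) (M 19249778491689079))))))⟩,
  ⟨196157542090400084902215052765429838385, 361904480272,
  F 0 (B 4 7 (F 4 (M 19249641052739976)) (B 4 8 (F 4 (M 19249709772216695)) (M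
  19249778491689079)))⟩,
  ⟨50216330775142421734966981186537652302385, 361904480272,
  F 0 (B 4 6 (F 4 (M 19267164519307656)) (R 33 654820258320))⟩,
  ⟨2972760275240861066158726468153905, 1127227408,
  F 0 (B 3 5 (F 3 (R 32 654820258320)) (B 3 6 (F 3 (R 32 654804529680)) (B 3 7 (F 3 (R 32
  654537142800)) (B 3 8 (F 3 (R 32 650243224080)) (B 3 9 (R 32 581524795920) (B 4 5 (R 34
  654820258320) (B 4 6 (R 34 654804529680) (B 4 7 (R 34 654537142800) (M
  19232187110946662)))))))))⟩,
  ⟨50216330775142421734966908829816322077233, 430909169680,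
  F 0 (B 4 7 (F 4 (M 19267164519307656)) (B 4 8 (F 4 (M 19284756705352055)) (M
  19302348891392119)))⟩,
  ⟨3290977453679733750822796079041229557799662129, 1412440080,
  F 0 (B 4 6 (R 36 654820258320) (B 4 7 (R 36 654537142800) (M 19302486330341222)))⟩,
  ⟨2972760275240861066158726468153905, 3153936,
  F 0 (B 3 4 (R 35 654820258320) (B 3 5 (R 35 654819275280) (B 3 6 (R 35 654802563600) (B 3 7 (R
  35 654534193680) (B 3 8 (R 35 650239291920) (B 3 9 (R 35 581519880720) (B 4 5 (R 37
  654820258320) (B 4 6 (R 37 654804529680) (M 19302486867207765)))))))))⟩,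
  ⟨0, 807477264,
  F 0 (B 1 3 (F 1 (R 9 654820258320)) (B 1 4 (F 1 (R 28 654820258320)) (B 1 5 (F 1 (R 28
  654819152385)) (B 1 6 (F 1 (R 28 654802379265)) (B 1 7 (F 1 (R 28 654533947905)) (B 1 8 (F 1 (R
  28 650238984705)) (B 1 9 (R 28 581519512065) (B 2 3 (F 2 (R 9 654820258080)) (B 2 4 (F 2 (R 28
  654820196610)) (B 2 5 (F 2 (R 28 654819152130)) (B 2 6 (F 2 (R 28 654802379010)) (B 2 7 (F 2 (R
  28 654533947650)) (B 2 8 (F 2 (R 28 650238984450)) (B 2 9 (R 28 581519511810) (R 38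
  654820258320)))))))))))))))⟩,
  ⟨5517873, 5931596136064229392,
  F 0 (F 1 (F 2 (F 4 (B 3 5 (F 3 (F 5 (M 43159424188178688))) (B 3 6 (F 3 (M 19232049135131016))
  (B 3 7 (F 3 (M 19232049135131016)) (M 19232187110946662)))))))⟩,
  ⟨361904615713, 7228929696886431760,
  F 0 (F 1 (F 2 (F 4 (B 5 3 (F 5 (R 40 654817969410)) (B 5 7 (F 5 (M 32742503083973000)) (B 5 8 (F
  5 (M 37246102711343479)) (M 41749702338709623)))))))⟩,
  ⟨3289377, 23170293093638160,
  F 0 (F 1 (F 2 (B 4 5 (F 4 (F 5 (R 39 654818018625))) (B 4 3 (F 4 (R 40 654820258320)) (B 4 6 (F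
  4 (R 41 654820258320)) (B 4 7 (F 4 (R 41 654501245460)) (B 4 8 (F 4 (R 41 650206282260)) (B 4 9
  (R 41 581486809620) (B 5 3 (F 5 (R 40 654817969410)) (B 5 6 (F 5 (R 41 654768628245)) (B 5 7 (F
  5 (R 41 654500196885)) (M 19232187110946662))))))))))))⟩,
  ⟨28256711479603745, 549922972677339230511120,
  F 0 (F 1 (F 2 (F 3 (F 4 (B 5 7 (F 5 (F 7 (R 39 654514915155))) (B 5 6 (F 5 (B 6 7 (F 6 (F 7 (M
  43210061274707780))) (B 6 8 (F 6 (M 43139830506350165)) (M 38354756170704469)))) (B 5 8 (F 5 (M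
  43159698529133056)) (M 38374692644528640))))))))⟩,
  ⟨8314880025841316401, 620776916664457618268176,
  F 0 (F 1 (F 2 (F 3 (F 4 (B 5 6 (F 5 (R 43 650289423120)) (M 19267096605137254))))))⟩,
  ⟨28240209962479905, 2146907408534095274000,
  F 0 (F 1 (F 2 (F 4 (B 3 6 (F 3 (M 19267096068266376)) (B 3 7 (F 3 (R 43 654820258320)) (B 3 8 (F
  3 (R 44 654820258320)) (B 3 9 (R 44 590395748880) (M 19267096068266376))))))))⟩,
  ⟨620481841100615056503073, 8386354801120649232,
  F 0 (F 1 (F 2 (F 4 (B 7 5 (R 45 654503465025) (B 7 6 (R 45 654234968130) (M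
  33095519333017122))))))⟩,
  ⟨1851831844691533508897, 2148136609757390708752,
  F 0 (F 1 (F 2 (F 4 (B 3 8 (F 3 (B 7 5 (F 7 (R 45 654503465025)) (B 7 6 (F 7 (R 45 654234968130))
  (M 33077927148021282)))) (R 46 654820258320)))))⟩,
  ⟨28240209962479905, 8386354801120649232,
  F 0 (F 1 (F 2 (F 4 (B 3 5 (R 45 654820258320) (B 3 6 (R 45 654804529440) (B 3 7 (R 47
  654820258320) (B 3 8 (B 3 9 (B 5 6 (B 5 7 (F 5 (R 45 654503465025)) (R 47 654503465025)) (B 5 7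
  (R 45 654503465025) (B 5 8 (B 8 9 (F 8 (R 39 508217592195)) (B 8 6 (F 8 (M 38354617926457719))
  (M 38354618194893158))) (R 46 654503465025)))) (R 46 590380020000)) (R 46 654804529440))))))))⟩,
  ⟨2739662486732638728737, 7085095983787286544,
  F 0 (F 1 (F 2 (B 3 6 (F 3 (M 19267096068266376)) (B 3 7 (F 3 (M 19249504150657416)) (B 3 8 (F 3
  (M 19249504419092855)) (M 19249504687523959))))))⟩,
  ⟨701353596603560062300721, 2424837770863033982992,
  F 0 (F 1 (F 2 (F 3 (B 5 6 (B 5 7 (F 5 (M 19232049135131016)) (M 19232117854607735)) (B 5 7 (B 5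
  8 (F 5 (M 43159698779747072)) (M 19232049135131016)) (M 19232117854607735))))))⟩,
  ⟨179546520734734604659012145, 8314297207082721296,
  F 0 (F 1 (F 2 (B 3 8 (F 3 (R 50 654820258320)) (B 3 9 (R 50 590380020000) (M
  19232049135131016)))))⟩,
  ⟨1379021089, 27673892721008656,
  F 0 (F 1 (F 2 (B 4 3 (F 4 (R 42 654818038785)) (B 4 5 (F 4 (R 39 654818018625)) (B 4 6 (F 4 (R
  39 654801176130)) (B 4 7 (F 4 (R 48 654820258320)) (B 4 8 (F 4 (R 48 649941049410)) (B 4 9 (R 48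
  581222621250) (B 3 5 (R 49 654820258320) (B 3 6 (R 49 654804529440) (B 3 7 (R 51 654820258320)
  (B 3 8 (R 51 650777997600) (M 19232186574080119)))))))))))))⟩,
  ⟨179612931179945913166803505, 109200637173776,
  F 0 (F 1 (B 3 7 (F 3 (M 19232049135131016)) (B 3 8 (F 3 (M 19232117854607735)) (M
  19232186574080119))))⟩,
  ⟨3289377, 89345003364368,
  F 0 (F 1 (B 2 5 (F 2 (R 42 654820258320)) (B 2 6 (F 2 (R 52 654820258320)) (B 2 7 (F 2 (R 52
  654537142560)) (B 2 8 (F 2 (R 52 650243223840)) (B 2 9 (R 52 581524795680) (B 4 3 (F 4 (R 42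
  654818038785)) (B 4 5 (F 4 (R 39 654818018625)) (B 4 6 (F 4 (R 52 654770851905)) (B 4 7 (F 4 (R
  52 654503465025)) (B 4 8 (F 4 (R 52 650209546305)) (B 4 9 (R 52 581491118145) (B 3 5 (B 3 6 (F 3
  (R 52 654787813680)) (B 3 7 (F 3 (R 52 654520426800)) (B 3 8 (F 3 (R 52 650226508080)) (M
  19249504687523959)))) (B 3 6 (R 53 654820258320) (B 3 7 (R 53 654568600080) (M
  19232187110946662))))))))))))))))⟩,
  ⟨27956471521227041, 2148065133869428383760,
  F 0 (F 1 (F 2 (F 4 (B 6 7 (F 6 (F 7 (R 39 654247528290))) (B 6 5 (F 6 (R 54 653674247700)) (B 6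
  8 (F 6 (R 54 640772703270)) (B 6 9 (R 54 572053230630) (M 28784468986730888))))))))⟩,
  ⟨140780299524781061790904609, 178337872625384256921673744,
  F 0 (F 1 (F 2 (F 4 (B 6 8 (F 6 (F 8 (R 39 649934674020))) (B 6 5 (F 6 (R 55 654252060960)) (B 6
  7 (F 6 (R 39 654247528290)) (B 6 9 (B 8 9 (F 8 (F 9 (R 54 503318063430))) (B 8 5 (F 8 (R 55
  508225397040)) (B 8 7 (B 7 9 (F 7 (F 9 (R 55 362765947440))) (B 7 5 (B 5 9 (R 0 654820258320) (M
  43157215997102199)) (M 24034853632641092))) (M 38411797631362626)))) (M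
  28873396577129745))))))))⟩,
  ⟨544904449484077524988193, 696612639276812918071312,
  F 0 (F 1 (F 2 (B 4 7 (F 4 (R 55 654820258320)) (B 4 8 (F 4 (R 56 654820258320)) (B 4 9 (R 56
  509110133520) (B 6 7 (F 6 (R 39 654247528290)) (B 6 8 (F 6 (R 56 363335127840)) (M
  37792635151218466))))))))⟩,
  ⟨45656842130382052359123644705, 8242821319120396304,
  F 0 (F 1 (F 2 (B 6 5 (F 6 (R 55 654252060960)) (B 6 7 (F 6 (R 39 654247528290)) (M
  28838212207138065)))))⟩,
  ⟨178256999932834566206796065, 8242821319120396304,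
  F 0 (F 1 (F 2 (B 4 7 (F 4 (R 55 654820258320)) (B 4 8 (F 4 (B 6 8 (F 6 (R 39 649934674020)) (R
  58 654820258320))) (B 6 5 (F 6 (R 58 654820258320)) (B 6 7 (F 6 (R 58 654820258320)) (R 58
  654252060960)))))))⟩,
  ⟨696316405704996093571361, 32196248470560784,
  F 0 (F 1 (F 2 (B 4 5 (R 39 654818018625) (B 4 6 (R 59 654820258320) (B 4 7 (R 59 654568600080)
  (B 5 6 (R 59 654819275280) (B 5 7 (R 59 654567617040) (M 24000772798707586))))))))⟩,
  ⟨353297903905, 32196248470560784,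
  F 0 (F 1 (F 2 (B 3 4 (R 54 654820254480) (B 3 5 (R 54 654819271440) (B 3 6 (R 54 654252053280)
  (B 3 7 (R 54 654251070240) (B 3 8 (B 3 9 (B 4 5 (R 39 654818018625) (B 4 6 (R 57 654820258320)
  (B 4 8 (R 57 509361791760) (B 5 6 (R 57 654819275280) (B 5 8 (R 57 509360808720) (M
  24000768503744627)))))) (R 60 654820258320)) (R 60 589827551520))))))))⟩,
  ⟨178403986908769072751718945, 110300148801552,
  F 0 (F 1 (B 4 7 (F 4 (R 61 653681643585)) (B 4 8 (F 4 (R 61 649387724865)) (B 4 9 (R 61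
  580669296705) (M 19249504150657416)))))⟩,
  ⟨771453057286855211925119986827407905, 348986023952,
  F 0 (F 1 (B 5 6 (R 62 654819275280) (M 19284825693264213)))⟩]

def ten_2 : List Lem := [
  ⟨45671420649729969823613596193, 348986023952,
  F 0 (F 1 (B 4 5 (R 39 654818018625) (B 4 6 (R 62 654820258320) (B 4 8 (B 4 9 (F 4 (R 61
  507654983745)) (R 63 654820258320)) (R 63 590395748880)))))⟩,
  ⟨177119187392487997922488609, 126792823218192,
  F 0 (F 1 (B 3 8 (F 3 (R 61 645663236400)) (B 3 9 (R 61 576944808240) (R 64 654820258320))))⟩,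
  ⟨353297903905, 108101125546000,
  F 0 (F 1 (B 2 7 (F 2 (R 61 654820258320)) (B 2 8 (F 2 (R 61 649958142240)) (B 2 9 (R 61
  581239714080) (B 3 4 (R 54 654820254480) (B 3 5 (R 54 654819271440) (B 3 6 (B 3 7 (F 3 (R 61
  654252056880)) (B 3 8 (F 3 (R 61 649958138160)) (B 3 9 (R 61 581239710000) (B 6 4 (F 6 (M
  28485195669739912)) (B 6 5 (F 6 (M 28203720694077832)) (B 6 7 (F 6 (M 28801992453298568)) (B 6 8
  (F 6 (M 28801992721734007)) (M 28801992990165111)))))))) (B 3 7 (R 65 654820258320) (B 3 8 (R 65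
  650793726480) (R 65 581587706640))))))))))⟩,
  ⟨12577, 348986023952,
  F 0 (F 1 (B 2 3 (R 39 654820250400) (B 2 4 (R 54 654820258320) (B 2 5 (R 54 654819275280) (B 2 6
  (R 66 654820258320) (B 2 7 (R 66 654568600080) (B 2 9 (R 66 581587710480) (B 3 4 (R 54
  654820254480) (B 3 5 (R 54 654819271440) (B 3 6 (R 66 654820254480) (B 3 7 (R 66 654568596240)
  (B 3 8 (R 66 650290406160) (R 64 509361795600)))))))))))))⟩,
  ⟨177119465182973824846672161, 27958666232602640,
  F 0 (F 4 (B 3 7 (F 3 (R 67 654246508035)) (B 3 8 (F 3 (R 67 649951544835)) (M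
  19232186574080119))))⟩,
  ⟨2972760275240861066158726483947809, 92643538247696,
  F 0 (F 4 (B 3 5 (B 3 6 (F 3 (R 67 654783374595)) (B 3 7 (F 3 (R 67 654514943235)) (B 3 8 (F 3 (R
  67 650219980035)) (M 41767294523705463)))) (B 3 6 (R 68 654820258320) (B 3 7 (R 68 654568600080)
  (M 19232187110946662)))))⟩,
  ⟨3013404942860516128551550219071777, 1395662864,
  F 0 (B 3 6 (F 3 (R 67 654783374595)) (B 3 7 (F 3 (R 67 654514943235)) (B 3 8 (F 3 (R 67
  650219980035)) (M 19249778491689079))))⟩,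
  ⟨10484786070283235617, 284561514512,
  F 0 (B 2 5 (F 2 (R 67 654817973250)) (B 2 6 (F 2 (R 67 654801200130)) (B 2 7 (F 2 (R 67
  654532768770)) (B 2 8 (F 2 (R 67 650237805570)) (B 2 9 (R 67 581518332930) (B 4 3 (F 4 (B 3 5 (F
  3 (R 67 654816924675)) (B 3 6 (F 3 (R 67 654800151555)) (B 3 7 (F 3 (R 67 654531720195)) (M
  19232187110946662))))) (B 4 5 (F 4 (R 69 654820258320)) (B 4 6 (F 4 (R 69 654801134100)) (B 4 7
  (F 4 (R 69 654532702740)) (B 4 8 (F 4 (R 69 650237739540)) (B 4 9 (R 69 581518266900) (B 3 5 (R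
  70 654820258320) (B 3 6 (R 70 581320323600) (B 3 7 (R 70 577026404880) (M
  19232187110946662)))))))))))))))⟩,
  ⟨50216330775142421734966908832015344349473, 361870925840,
  F 0 (B 4 6 (F 4 (M 19231980684089736)) (R 33 654820250160))⟩,
  ⟨50216330775138087669494298971904408695073, 37282593555619856,
  F 0 (F 4 (B 5 7 (B 5 8 (F 5 (M 43141002495546738)) (M 19267302226696533)) (M
  19284825693264213)))⟩,
  ⟨12855380678436459964090118513241224289333537, 127896629813264,
  F 0 (B 4 8 (F 4 (R 73 654820258320)) (B 4 9 (R 73 590395748880) (R 70 453242003760)))⟩,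
  ⟨12855380678436459964151528661011325879726369, 353280991248,
  F 0 (B 4 5 (R 72 654820258320) (B 4 6 (R 72 654804525840) (B 4 7 (R 74 654820258320) (B 4 8 (R
  74 650793726480) (R 70 448712155440)))))⟩,
  ⟨761026630461660432936915455135854881, 109204932141072,
  F 0 (B 3 7 (F 3 (R 67 654246508035)) (B 3 8 (F 3 (R 67 649951544835)) (B 3 9 (R 67 581232072195)
  (R 75 654820258320))))⟩,
  ⟨2684105233992776823073, 353280991248,
  F 0 (B 2 6 (F 2 (R 67 654784423170)) (B 2 7 (F 2 (R 67 654515991810)) (B 2 8 (F 2 (R 67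
  650221028610)) (B 2 9 (R 67 581501555970) (B 3 4 (R 71 654820254480) (B 3 5 (R 71 654819267360)
  (B 3 6 (R 76 654820258320) (B 3 7 (R 76 654568600080) (B 3 8 (R 76 650290410000) (R 75
  581587710480))))))))))⟩,
  ⟨12577, 1093672976,
  F 0 (B 1 5 (F 1 (R 67 654820258320)) (B 1 6 (F 1 (R 67 654801265665)) (B 1 7 (F 1 (R 67
  654532834305)) (B 1 8 (F 1 (R 67 650237871105)) (B 1 9 (R 67 581518398465) (B 2 3 (R 39
  654820250400) (B 2 4 (R 71 654820258320) (B 2 5 (R 77 654820258320) (B 2 6 (R 77 654804529680)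
  (B 2 7 (R 77 654537142800) (B 2 8 (R 77 650243224080) (B 2 9 (R 77 581524795920) (B 3 4 (R 71
  654820254480) (B 3 5 (R 77 654820254480) (B 3 6 (R 77 654804525840) (B 3 7 (R 77 654537138960)
  (B 3 8 (R 77 650243220240) (B 3 9 (R 77 581524792080) (R 38 654820250400)))))))))))))))))))⟩,
  ⟨0, 3153936,
  F 0 (B 1 2 (R 39 654820258320) (B 1 3 (R 39 654820254480) (B 1 4 (R 78 654820258320) (B 1 5 (R
  78 654819275280) (B 1 6 (R 78 654802563600) (B 1 7 (R 78 654534193680) (B 1 8 (R 78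
  650239291920) (B 1 9 (R 78 581519880720) (B 2 3 (R 39 654820250400) (B 2 4 (R 78 654820258080)
  (B 2 5 (R 78 654819275040) (B 2 6 (R 78 654802563360) (B 2 7 (R 78 654534193440) (B 2 8 (R 78
  650239291680) (B 2 9 (R 78 581519880480) (R 38 654820258320))))))))))))))))⟩,
  ⟨836758849513703802053893956121812342291609825584, 21571,
  B 4 6 (F 4 (R 79 654748706100)) (B 4 7 (F 4 (R 79 654480274740)) (B 4 8 (F 4 (R 79
  650185311540)) (M 28204201188296823)))⟩,
  ⟨214210265388054203066235927298121921658941240127792, 21315,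
  B 3 6 (F 3 (R 79 654748706115)) (B 3 7 (F 3 (R 79 654480274755)) (B 3 8 (F 3 (R 79
  650185311555)) (B 3 9 (R 79 581465838915) (B 4 6 (R 80 379993731600) (B 4 7 (R 80 379726344720)
  (B 4 8 (R 80 375432426000) (R 80 650290348560)))))))⟩,
  ⟨214210265388054203066235927298121921658941240127792, 67,
  B 3 5 (R 81 654820258320) (B 3 6 (R 81 654804529680) (B 3 7 (R 81 654537142800) (B 4 5 (R 81
  654820196880) (B 4 6 (R 81 654804468240) (B 4 7 (R 81 654537081360) (M 23700602366228326))))))⟩,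
  ⟨214210265388054203066235927298121921658941240127792, 0,
  B 3 4 (R 82 654820258320) (B 3 5 (R 82 654819275280) (B 3 6 (R 82 654802563600) (B 4 5 (R 82
  654818230800) (B 4 6 (R 82 654801519120) (M 19196933750941269)))))⟩,
  ⟨2952398326776018604870371580588336, 8480,
  B 2 3 (F 2 (R 79 654820258050)) (B 2 4 (F 2 (R 79 654820196610)) (B 2 5 (F 2 (R 79
  654819152130)) (B 2 6 (F 2 (R 79 654802379010)) (B 2 7 (F 2 (R 79 654533947650)) (B 2 8 (F 2 (R
  79 650238984450)) (B 2 9 (R 79 581519511810) (R 83 654820258320)))))))⟩,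
  ⟨750788169048215563808617884718676087603929821217, 25684,
  B 4 7 (F 4 (R 79 653674968660)) (B 4 8 (F 4 (R 79 649380005460)) (M 19196795775125623))⟩,
  ⟨192201771276343184335006179758334631524560575410209, 84,
  B 4 6 (R 85 654820258320) (B 4 7 (R 85 654568600080) (M 19196933214074726))⟩,
  ⟨40078844472328784549815267361, 3289376,
  B 2 4 (F 2 (R 79 654820066050)) (B 2 5 (F 2 (R 79 654819021570)) (B 2 6 (F 2 (R 79
  654802248450)) (B 2 7 (F 2 (R 79 654533817090)) (B 2 8 (F 2 (R 79 650238853890)) (B 3 4 (F 3 (R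
  79 654820000275)) (B 3 5 (F 3 (R 79 654818955795)) (B 3 6 (F 3 (R 79 654802182675)) (B 3 7 (F 3
  (R 79 654533751315)) (B 3 8 (F 3 (R 79 650238788115)) (B 4 5 (R 86 654820258320) (B 4 6 (R 86
  654804529680) (M 19196933750941269))))))))))))⟩,
  ⟨55213439881512046791166864477546661383393510134263841, 0,
  B 4 6 (R 86 384521613840) (B 4 7 (R 86 384504902160) (B 4 8 (R 86 384236532240) (M
  19196796848867447)))⟩,
  ⟨12767926775697124187125916916003469410840609, 21297,
  B 3 6 (F 3 (R 79 654783309075)) (B 3 7 (F 3 (R 79 654514877715)) (B 3 8 (F 3 (R 79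
  650219914515)) (B 3 9 (R 79 581500441875) (R 88 654820258320))))⟩,
  ⟨755813971654660762846815124630679585, 4337952,
  B 2 5 (F 2 (R 79 654817973250)) (B 2 6 (F 2 (R 79 654801200130)) (B 2 7 (F 2 (R 79
  654532768770)) (B 2 8 (F 2 (R 79 650237805570)) (B 2 9 (R 79 581518332930) (B 3 4 (R 87
  40926266145) (B 3 5 (R 89 654820258320) (B 3 6 (R 89 654804529680) (B 3 7 (R 89 654537142800) (B
  3 8 (R 89 650243224080) (R 89 581519876865))))))))))⟩,
  ⟨2952398326776018604870371580588065, 12576,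
  B 2 3 (R 87 654820258320) (B 2 4 (R 90 654820258320) (B 2 5 (R 90 654819275280) (B 2 6 (R 90
  654802563600) (B 2 7 (R 90 654534193680) (B 2 8 (R 90 650239291920) (B 3 4 (R 90 654820254465)
  (B 3 5 (R 90 654819271425) (B 3 6 (R 90 654802559745) (B 3 7 (R 90 654534189825) (R 88
  508225397505))))))))))⟩,
  ⟨10412445897446141985, 3219472,
  B 1 4 (F 1 (R 79 654820131585)) (B 1 5 (F 1 (R 79 654819087105)) (B 1 6 (F 1 (R 79
  654802313985)) (B 1 7 (F 1 (R 79 654533882625)) (B 1 8 (F 1 (R 79 650238919425)) (B 1 9 (R 79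
  581519446785) (R 91 654820258320))))))⟩,
  ⟨0, 8208,
  B 0 3 (F 0 (R 79 654820258320)) (B 0 4 (F 0 (R 79 654820196880)) (B 0 5 (F 0 (R 79
  654819152400)) (B 0 6 (F 0 (R 79 654802379280)) (B 0 7 (F 0 (R 79 654533947920)) (B 0 8 (F 0 (R
  79 650238984720)) (B 0 9 (R 79 581519512080) (B 1 2 (B 1 3 (F 1 (R 79 654820258305)) (B 1 4 (F 1
  (R 79 654820196865)) (B 1 5 (F 1 (R 79 654819152385)) (B 1 6 (F 1 (R 79 654802379265)) (B 1 7 (F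
  1 (R 79 654533947905)) (B 1 8 (F 1 (R 79 650238984705)) (B 1 9 (R 79 581519512065) (R 84
  654820258320)))))))) (B 1 3 (R 92 654820258320) (B 1 4 (R 92 654820196880) (B 1 5 (R 92
  654819152400) (B 1 6 (R 92 654802379280) (B 1 7 (R 92 654533947920) (B 1 8 (R 92 650238984720)
  (B 1 9 (R 92 581519512080) (B 2 3 (R 92 654820258080) (B 2 4 (R 92 654820196640) (B 2 5 (R 92
  654819152160) (B 2 6 (R 92 654802379040) (B 2 7 (R 92 654533947680) (B 2 8 (R 92 650238984480)
  (B 2 9 (R 92 581519511840) (R 84 654820257825))))))))))))))))))))))⟩,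
  ⟨10412445897446141985, 12816,
  B 2 4 (R 93 654820049970) (B 2 5 (R 93 654819001650) (B 2 6 (R 93 654802224690) (B 2 7 (R 93
  654533789490) (B 2 8 (R 93 650238822450) (B 2 9 (R 93 581519345970) (R 91 654820258080))))))⟩,
  ⟨0, 16,
  B 0 3 (R 93 654820254480) (B 0 4 (R 93 654820189200) (B 0 5 (R 93 654819140880) (B 0 6 (R 93
  654802363920) (B 0 7 (R 93 654533928720) (B 0 8 (R 93 650238961680) (B 0 9 (R 93 581519485200)
  (B 1 2 (R 93 654820258305) (B 1 3 (R 93 654820254465) (B 1 4 (R 93 654820189185) (B 1 5 (R 93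
  654819140865) (B 1 6 (R 93 654802363905) (B 1 7 (R 93 654533928705) (B 1 8 (R 93 650238961665)
  (B 1 9 (R 93 581519485185) (B 2 3 (R 94 654820258320) (B 2 4 (R 94 654820196880) (B 2 5 (R 94
  654819152400) (B 2 6 (R 94 654802379280) (B 2 7 (R 94 654533947920) (B 2 8 (R 94 650238984720)
  (B 2 9 (R 94 581519512080) (R 83 654820258320))))))))))))))))))))))⟩]

def ten_3 : List Lem := [
  ⟨0, 0,
  B 0 3 (R 95 654820254000) (B 0 4 (R 95 654820188480) (B 0 5 (R 95 654819139920) (B 0 6 (R 95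
  654802362720) (B 0 7 (R 95 654533927280) (B 0 8 (R 95 650238960000) (B 0 9 (R 95 581519483280)
  (B 1 3 (R 95 654820253745) (B 1 4 (R 95 654820188225) (B 1 5 (R 95 654819139665) (B 1 6 (R 95
  654802362465) (B 1 7 (R 95 654533927025) (B 1 8 (R 95 650238959745) (B 1 9 (R 95 581519483025)
  (B 2 3 (R 95 654820249650) (B 2 4 (R 95 654820184130) (B 2 5 (R 95 654819135570) (B 2 6 (R 95
  654802358370) (B 2 7 (R 95 654533922930) (B 2 8 (R 95 650238955650) (B 2 9 (R 95 581519478930)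
  (R 83 654820258320)))))))))))))))))))))⟩]

def ten : ℕ → Lem := look [ten_0, ten_1, ten_2, ten_3]

def eleven_0 : List Lem := [
  ⟨67, 393178605000243200204816,
  F 0 (F 1 (F 2 (F 3 (B 4 5 (F 4 (M 37281563028794009)) (B 4 6 (F 4 (M 37281563028794009)) (B 4 7
  (F 4 (M 37281563028794009)) (M 23823747668539238)))))))⟩,
  ⟨0, 1222186922062647468048,
  F 0 (F 1 (F 2 (B 3 4 (F 3 (F 4 (M 37281563028794009))) (B 3 6 (F 3 (R 0 11649920807440)) (B 3 7
  (F 3 (R 0 11649653420560)) (B 3 10 (F 3 (R 0 10477130494480)) (B 4 5 (F 4 (R 0 11649936474640))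
  (B 4 6 (F 4 (R 0 11649920746000)) (B 4 7 (F 4 (R 0 11649653359120)) (M
  23823747668539238))))))))))⟩,
  ⟨67, 120081852261236580494155792,
  F 0 (F 1 (F 2 (F 3 (B 4 6 (F 4 (M 37281563028794009)) (B 4 7 (F 4 (M 37281563028794009)) (B 4 8
  (F 4 (M 32795555587467929)) (M 28327346490607735)))))))⟩,
  ⟨25667, 140704426691928321142366224,
  F 0 (F 1 (F 2 (F 3 (B 4 8 (F 4 (M 28292024679574169)) (B 4 9 (F 4 (M 28309616865618568)) (M
  28327209051658632))))))⟩,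
  ⟨17218, 469031616631336876449808,
  F 0 (F 1 (F 2 (F 3 (B 4 5 (R 2 11649936536080) (B 4 6 (R 2 11649920803600) (B 4 7 (R 3
  11649936536080) (B 4 8 (R 3 11645894271760) (M 28327346490607735))))))))⟩,
  ⟨46042613988737858, 473753983114206521663504,
  F 0 (F 1 (F 2 (B 4 7 (F 4 (M 37281563028794009)) (B 4 8 (F 4 (M 32795555587467929)) (M
  23823747131672695)))))⟩,
  ⟨66, 1517334827242000293904,
  F 0 (F 1 (F 2 (B 3 4 (F 3 (R 1 11649936532240)) (B 3 6 (F 3 (R 4 11649936536080)) (B 3 7 (F 3 (R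
  4 11649684877840)) (B 3 8 (F 3 (R 4 11645406687760)) (B 3 9 (F 3 (R 4 11576703988240)) (B 3 10
  (F 3 (R 4 10477209137680)) (B 4 5 (B 4 6 (F 4 (M 37281563028794009)) (B 4 7 (F 4 (M
  37281563028794009)) (B 4 8 (F 4 (M 32795555587467929)) (M 28327346490607735)))) (B 4 6 (R 5
  11649936536080) (B 4 7 (R 5 11649684877840) (M 23823747668539238))))))))))))⟩,
  ⟨197822654196213657144279874, 6071204352677191696,
  F 0 (F 1 (B 4 6 (F 4 (M 37281563028794009)) (B 4 7 (F 4 (M 37281563028794009)) (B 4 8 (F 4 (M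
  32795555587467929)) (M 28327346490607735)))))⟩,
  ⟨0, 4701813197817061392,
  F 0 (F 1 (B 2 4 (F 2 (R 1 11649936536080)) (B 2 5 (F 2 (R 6 11649936536080)) (B 2 6 (F 2 (R 6
  11649920807440)) (B 2 7 (F 2 (R 6 11649653420560)) (B 2 8 (F 2 (R 6 11645359501840)) (B 2 9 (F 2
  (R 6 11576641073680)) (B 2 10 (R 6 10477130494480) (B 3 4 (F 3 (R 1 11649936532240)) (B 3 5 (F 3
  (R 6 11649936532240)) (B 3 6 (F 3 (R 6 11649920803600)) (B 3 7 (F 3 (R 6 11649653416720)) (B 3 8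
  (F 3 (R 6 11645359498000)) (B 3 9 (F 3 (R 6 11576641069840)) (B 3 10 (R 6 10477130490640) (B 4 5
  (R 7 11649936536080) (B 4 6 (R 7 10476941750800) (B 4 7 (R 7 10472647832080) (M
  23823747668539238)))))))))))))))))))⟩,
  ⟨4407858, 30757888918426803795566600208,
  F 0 (F 1 (F 2 (F 3 (B 4 6 (F 4 (B 5 7 (F 5 (M 48014038029849970)) (M 19196521979357813))) (B 4 7
  (F 4 (M 28292024679574169)) (B 4 8 (F 4 (M 28292024679574169)) (M 28327346490607735)))))))⟩,
  ⟨6570818, 36020409124340044768095576080,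
  F 0 (F 1 (F 2 (F 3 (B 4 8 (F 4 (M 28292024679574169)) (B 4 9 (F 4 (M 28309616865618568)) (M
  28327209051658632))))))⟩,
  ⟨4407858, 120147985064016796020973584,
  F 0 (F 1 (F 2 (F 3 (B 4 5 (R 9 11649936536080) (B 4 6 (R 9 11649920807440) (B 4 7 (R 10
  11649936536080) (B 4 8 (R 10 11645894275600) (M 28327346490607735))))))))⟩,
  ⟨5522242, 3012290452134296273235498711982096,
  F 0 (F 1 (F 2 (F 3 (F 4 (B 5 8 (F 5 (M 23788425320639129)) (M 23806017506683528))))))⟩,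
  ⟨1683243842, 11766759564205717363778992021520,
  F 0 (F 1 (F 2 (F 3 (F 4 (B 5 7 (R 12 11649684874000) (B 5 8 (B 5 9 (F 5 (M 47961188994143635))
  (M 23788425320639129)) (M 23806017506683528)))))))⟩,
  ⟨1683243842, 40991512094595399934487371792,
  F 0 (F 1 (F 2 (F 3 (B 4 9 (F 4 (R 13 11649936536080)) (B 4 10 (F 4 (R 13 10619144385040)) (M
  28292024679574169))))))⟩,
  ⟨1665352242, 139490798177850862816272400,
  F 0 (F 1 (F 2 (F 3 (B 4 5 (B 4 6 (F 4 (R 11 11649936474640)) (B 4 8 (F 4 (M 28292024679574169))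
  (B 4 9 (F 4 (M 28309616865618568)) (M 28327209051658632)))) (B 4 6 (B 4 7 (F 4 (M
  37264039562226329)) (B 4 8 (F 4 (M 32760508654332569)) (B 4 9 (F 4 (M 32760577373809288)) (M
  32760646093281672)))) (B 4 8 (R 14 11649936536080) (B 4 9 (R 14 11585512026640) (M
  28327209051658632))))))))⟩,
  ⟨179853959906114, 549608220021266982182928,
  F 0 (F 1 (F 2 (B 4 8 (F 4 (M 28292024679574169)) (B 4 9 (F 4 (M 28309616865618568)) (M
  28327209051658632)))))⟩,
  ⟨11786909181368549938, 1813708008388137394192,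
  F 0 (F 1 (F 2 (B 4 5 (R 7 11649936532240) (B 4 6 (B 4 7 (F 4 (R 15 11649417421840)) (B 4 8 (F 4
  (R 15 11645139231760)) (M 23823747131672695))) (B 4 7 (R 16 11649936536080) (B 4 8 (R 16
  11645894275600) (M 28327346490607735)))))))⟩,
  ⟨4407858, 464328922168507725062160,
  F 0 (F 1 (F 2 (B 3 6 (F 3 (R 11 11649936536080)) (B 3 7 (F 3 (R 15 11649936536080)) (B 3 8 (F 3
  (R 15 11645406683920)) (B 3 9 (F 3 (R 15 11576703984400)) (B 3 10 (R 15 10477209133840) (R 17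
  11649936536080))))))))⟩,
  ⟨32760311123755570, 10415238540759704058372452065296,
  F 0 (F 1 (F 2 (F 3 (B 5 8 (F 5 (M 23753309936462489)) (B 5 9 (F 5 (M 24087561202870900)) (M
  24105153388910964))))))⟩,
  ⟨426598679090, 158914168223054819223478288,
  F 0 (F 1 (F 2 (F 3 (B 4 5 (R 18 11649936474640) (B 4 6 (R 18 11649920746000) (B 4 7 (R 18
  11640845255440) (B 4 8 (R 18 11640829526800) (B 5 6 (B 5 7 (R 19 11649936536080) (B 5 8 (R 19
  11645910004240) (M 28239455353604215))) (B 5 7 (B 5 8 (B 5 9 (F 5 (M 24087286869174886)) (M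
  24104879055214950)) (M 24053133828196454)) (M 24070726014236518))))))))))⟩,
  ⟨46042613735965234, 625166083747181305602064,
  F 0 (F 1 (F 2 (B 4 9 (F 4 (R 20 11503424185360)) (B 4 10 (F 4 (R 20 10403929334800)) (M
  28292024679574169)))))⟩,
  ⟨426598679090, 544885853538397336969232,
  F 0 (F 1 (F 2 (B 3 8 (F 3 (R 20 11649936536080)) (B 3 9 (F 3 (R 20 11572142678800)) (B 3 10 (R
  20 10472647828240) (B 4 5 (R 18 11649936474640) (B 4 6 (R 18 11649920746000) (B 4 7 (R 16
  11649920807440) (B 4 8 (R 21 11649936536080) (B 4 9 (R 21 11585496298000) (R 21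
  10478199980560)))))))))))⟩,
  ⟨16946, 1813708008388137394192,
  F 0 (F 1 (F 2 (B 3 4 (R 8 11649936409360) (B 3 5 (R 18 11649936536080) (B 3 6 (R 18
  11649920807440) (B 3 7 (R 22 11649936536080) (B 3 8 (R 22 11645910004240) (B 3 9 (R 22
  11577458962960) (B 3 10 (R 22 10478215770640) (R 17 11649920807440))))))))))⟩,
  ⟨772448437606014582473266, 7224125857284038672,
  F 0 (F 1 (B 4 7 (F 4 (R 23 11649417421840)) (B 4 8 (F 4 (R 23 11645139231760)) (M
  23823747131672695))))⟩,
  ⟨50623180806947788303089484338, 18366453491245072,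
  F 0 (F 1 (B 4 6 (R 24 11649936536080) (B 4 7 (R 24 11649684877840) (M 23823747668539238))))⟩,
  ⟨11714569008530539058, 5999146758639263760,
  F 0 (F 1 (B 3 6 (F 3 (R 23 11649936532240)) (B 3 7 (F 3 (R 23 11649684874000)) (B 3 8 (F 3 (R 23
  11645406683920)) (B 3 9 (F 3 (R 23 11576703984400)) (B 3 10 (R 23 10477209133840) (B 4 5 (R 7
  10477209137680) (R 25 11649936536080))))))))⟩,
  ⟨50642599474230696228935647794, 18366453491245072,
  F 0 (F 1 (B 4 5 (R 26 11649936474640) (R 25 11448358285840)))⟩,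
  ⟨11714569008530539058, 7152068263246110736,
  F 0 (F 1 (B 3 7 (F 3 (R 23 11649417487120)) (B 3 8 (F 3 (R 23 11645139297040)) (B 3 9 (F 3 (R 23
  11576436597520)) (B 3 10 (F 3 (R 23 10476941746960)) (R 27 11649936536080))))))⟩,
  ⟨16946, 5927089164601335824,
  F 0 (F 1 (B 2 6 (F 2 (R 23 11649936536080)) (B 2 7 (F 2 (R 23 11649684877840)) (B 2 8 (F 2 (R 23
  11645406687760)) (B 2 9 (F 2 (R 23 11576703988240)) (B 2 10 (R 23 10477209137680) (B 3 4 (R 8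
  11649936409360) (B 3 5 (R 26 11649936536080) (B 3 6 (R 28 11649936536080) (B 3 7 (R 28
  11649684877840) (B 3 8 (R 28 11645406687760) (B 3 9 (R 28 11576703988240) (R 28
  10477130490640)))))))))))))⟩,
  ⟨0, 18366453491245072,
  F 0 (F 1 (B 2 3 (R 8 11649936536080) (B 2 4 (R 8 11649936474640) (B 2 5 (R 29 11649936536080) (B
  2 6 (R 29 11649920807440) (B 2 7 (R 29 11649653420560) (B 2 8 (R 29 11645359501840) (B 2 9 (R 29
  11576641073680) (B 3 4 (R 8 11649936409360) (B 3 5 (R 29 11649936532240) (B 3 6 (R 29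
  11649920803600) (B 3 7 (R 29 11649653416720) (B 3 8 (R 29 11645359498000) (R 27
  9304403096080))))))))))))))⟩,
  ⟨1666404931, 35712133058712703940077625360,
  F 0 (F 1 (F 2 (F 3 (B 4 7 (F 4 (M 37246447644617369)) (B 4 8 (F 4 (M 32742916736723609)) (B 4 9
  (F 4 (M 32742985456200328)) (M 32743054175672712)))))))⟩]

def eleven_1 : List Lem := [
  ⟨127974511956547, 11766759564224091753390524145680,
  F 0 (F 1 (F 2 (F 3 (F 4 (B 5 6 (R 31 11649904095265) (M 32813079859341926))))))⟩,
  ⟨32761475060876098, 40991512112969789546019495952,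
  F 0 (F 1 (F 2 (F 3 (B 4 9 (F 4 (R 32 11649936536080)) (B 4 10 (R 32 10618892722960) (M
  32742916736723609))))))⟩,
  ⟨426599662402, 139490816552240474348396560,
  F 0 (F 1 (F 2 (F 3 (B 4 6 (R 31 11649936536080) (B 4 7 (R 31 11649653416240) (B 4 8 (R 33
  11649936536080) (B 4 9 (R 33 11585260364560) (M 32743054175672712))))))))⟩,
  ⟨2166656276882827395906, 12084002331568388523345297088528,
  F 0 (F 1 (F 2 (F 3 (B 8 10 (F 8 (M 38390902615472035)) (B 8 6 (F 8 (M 38372484990413431)) (M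
  38442579125119590))))))⟩,
  ⟨8386937619897008962, 160123093970314986220757008,
  F 0 (F 1 (F 2 (F 3 (B 5 6 (R 34 11649149109025) (B 5 7 (R 34 11649133380145) (B 5 8 (B 8 9 (R 35
  11649936536080) (B 8 10 (R 35 10618892722960) (M 38372347551459993))) (M
  24105222108383348)))))))⟩,
  ⟨109209513574977, 544885781183935159541776,
  F 0 (F 1 (F 2 (F 3 (B 4 5 (R 34 11649936536080) (B 4 6 (R 34 11649417483040) (B 4 7 (R 34
  11649401754160) (B 4 8 (R 36 11649936536080) (B 4 9 (R 36 11584977244720) (M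
  23823609692723592)))))))))⟩,
  ⟨46042613736948546, 140699742371855103523102736,
  F 0 (F 1 (F 2 (B 4 8 (F 4 (M 28291887777491609)) (B 4 9 (F 4 (M 28309479963536008)) (M
  28327072149576072)))))⟩,
  ⟨3017448750430618272578, 464347296558119257186320,
  F 0 (F 1 (F 2 (B 4 6 (B 4 7 (F 4 (M 37246447644617369)) (B 4 8 (F 4 (M 32742916736723609)) (B 4
  9 (F 4 (M 32742985456200328)) (M 32743054175672712)))) (B 4 7 (R 38 11649936536080) (B 4 8 (R 38
  11645910004240) (M 28327072686442615))))))⟩,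
  ⟨197751521308503578146718273, 45963909269895868027133566992,
  F 0 (F 1 (F 2 (F 4 (B 5 7 (B 5 8 (B 5 9 (F 5 (M 47961330744841585)) (M 23788425320639129)) (M
  23806017506683528)) (M 23806086226160247)))))⟩,
  ⟨50624389454981139234268856897, 160127816336797855865970704,
  F 0 (F 1 (F 2 (B 4 9 (F 4 (R 40 11649936536080)) (B 4 10 (R 40 10619128656160) (M
  23788425320639129)))))⟩,
  ⟨50624389454981139234268856897, 549608147666804804755472,
  F 0 (F 1 (F 2 (B 4 8 (R 41 11649936536080) (B 4 9 (R 41 11585496297760) (M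
  23823609692723592)))))⟩,
  ⟨5390913, 1813635653925959966736,
  F 0 (F 1 (F 2 (B 3 4 (F 3 (R 30 11649936531760)) (B 3 5 (F 3 (R 30 11649935548465)) (B 3 6 (F 3
  (R 30 11649918832690)) (B 3 7 (F 3 (R 37 11649936536080)) (B 3 8 (F 3 (R 37 11644820783395)) (B
  3 9 (F 3 (R 37 11576101372195)) (B 3 10 (R 37 10476589809955) (B 4 5 (R 39 11649936536080) (B 4
  6 (R 39 11649920807200) (B 4 7 (R 42 11649936536080) (B 4 8 (R 42 11645894275360) (M
  23823747131672695))))))))))))))⟩,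
  ⟨197822654196213661169763138, 1850750115323259723792,
  F 0 (F 1 (B 4 8 (F 4 (M 32795487136426649)) (B 4 9 (F 4 (M 32813079322471048)) (M
  32830671508511112))))⟩,
  ⟨50642599474230696228936631106, 1850750115323259723792,
  F 0 (F 1 (B 4 7 (F 4 (M 37281494577752729)) (R 44 11649936536080)))⟩,
  ⟨197822654196213652343964225, 2147050942007219396624,
  F 0 (F 1 (B 4 8 (F 4 (M 23788425320639129)) (B 4 9 (F 4 (M 23806017506683528)) (M
  23823609692723592))))⟩,
  ⟨12964505465403058234607811117633, 7228629456911409168,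
  F 0 (F 1 (B 4 7 (R 46 11649936536080) (B 4 8 (R 46 11645406687760) (M 23823747131672695))))⟩,
  ⟨3318913399143182908060759572562497, 22870053118615568,
  F 0 (F 1 (B 4 6 (R 47 11649936536080) (B 4 7 (R 47 11649684877840) (M 23823747668539238))))⟩,
  ⟨3318913399143182908060759539008065, 22870053118615568,
  F 0 (F 1 (B 4 5 (B 4 6 (R 45 11649936536080) (B 4 7 (R 45 11649684877840) (B 4 8 (R 45
  11645406687760) (M 28327072686442615)))) (R 48 11649936536080)))⟩,
  ⟨50, 100729576112386231890944016,
  F 0 (F 1 (F 2 (F 3 (B 4 6 (F 4 (M 37210919949871769)) (B 4 7 (F 4 (M 37210919949871769)) (B 4 8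
  (F 4 (M 32707320590936729)) (M 28203721503574135)))))))⟩,
  ⟨5456178, 120072389226220298686242832,
  F 0 (F 1 (F 2 (F 3 (B 4 5 (F 4 (R 50 11649936474400)) (B 4 6 (F 4 (M 23788425320639129)) (B 4 7
  (F 4 (M 37246379193576089)) (B 4 8 (F 4 (M 28239317377788569)) (M 28239455353604215))))))))⟩,
  ⟨16690, 388733084372010390331408,
  F 0 (F 1 (F 2 (B 3 5 (F 3 (R 50 11649936536080)) (B 3 7 (F 3 (R 51 11649684877840)) (B 3 8 (F 3
  (R 51 11645406687760)) (B 3 10 (F 3 (R 51 10477209137680)) (B 4 5 (F 4 (R 50 11649936474400)) (B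
  4 6 (F 4 (R 51 11649936474400)) (B 4 7 (F 4 (R 51 11649684816160)) (B 4 8 (F 4 (R 51
  11645406626080)) (M 23823541778548855)))))))))))⟩,
  ⟨362174169394, 35712137744186277005419946000,
  F 0 (F 1 (F 2 (F 3 (B 4 7 (F 4 (B 5 6 (B 6 8 (F 6 (M 48012934491694676)) (B 6 9 (F 6 (M
  47995411025126996)) (M 43210405140522580))) (M 37246447644617369))) (B 4 8 (F 4 (M
  23788425320639129)) (B 4 9 (F 4 (M 23806017506683528)) (M 23823609692723592)))))))⟩,
  ⟨127974260294450, 11766759568909565326455866466320,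
  F 0 (F 1 (F 2 (F 3 (F 4 (B 5 6 (R 53 11649935553025) (M 32742985993071206))))))⟩,
  ⟨32761410635383090, 40991516798443362611361816592,
  F 0 (F 1 (F 2 (F 3 (B 4 9 (F 4 (R 54 11649936536080)) (B 4 10 (R 54 10405234819360) (M
  23788425320639129))))))⟩,
  ⟨1396916530, 139495502025813539690717200,
  F 0 (F 1 (F 2 (F 3 (B 4 5 (R 52 11649934508290) (B 4 6 (R 53 11649936536080) (B 4 7 (R 53
  11649684877840) (B 4 8 (R 55 11649936536080) (B 4 9 (R 55 11585512026640) (M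
  23823609692723592)))))))))⟩,
  ⟨179853958857537, 473755136614054244720656,
  F 0 (F 1 (F 2 (B 4 7 (F 4 (R 56 11649934508290)) (B 4 8 (F 4 (R 56 11645907976450)) (B 4 9 (F 4
  (R 56 11577456935170)) (M 23823609692723592))))))⟩,
  ⟨179853960889153, 1518488327089723351056,
  F 0 (F 1 (F 2 (B 4 5 (R 52 11649934508290) (B 4 6 (R 57 11649936536080) (B 4 7 (R 57
  11649684877840) (B 4 8 (R 57 11645406687760) (M 23823541778548855)))))))⟩,
  ⟨1396916530, 469032770131184599506960,
  F 0 (F 1 (F 2 (B 3 7 (F 3 (R 56 11649936536080)) (B 3 8 (F 3 (R 56 11645909021185)) (B 3 9 (F 3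
  (R 56 11577457979905)) (B 3 10 (R 56 10478214787585) (R 58 11649936536080)))))))⟩,
  ⟨16690, 1518488327089723351056,
  F 0 (F 1 (F 2 (B 3 4 (R 52 11649936536080) (B 3 5 (R 52 11649935553025) (B 3 6 (R 59
  11649936536080) (B 3 7 (R 59 11649683894785) (B 3 8 (R 59 11645405704705) (B 3 9 (R 59
  11576703005185) (R 58 10477208154625)))))))))⟩,
  ⟨1397899570, 120147947089946213009661968,
  F 0 (F 1 (F 2 (F 3 (B 4 6 (F 4 (R 60 11649915695620)) (B 4 5 (F 4 (M 19284824357382809)) (B 4 7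
  (F 4 (M 23788425320639129)) (B 4 8 (F 4 (M 23788425320639129)) (M 23823747131672695))))))))⟩,
  ⟨1397899570, 139490760203780279804960784,
  F 0 (F 1 (F 2 (F 3 (B 4 5 (F 4 (R 61 11649920745760)) (B 4 8 (F 4 (M 23788425320639129)) (B 4 9
  (F 4 (M 23806017506683528)) (M 23823609692723592)))))))⟩,
  ⟨1414677313, 36020409124268268649034358800,
  F 0 (F 1 (F 2 (F 3 (B 4 8 (F 4 (M 23788425320639129)) (B 4 9 (F 4 (M 23806017506683528)) (M
  23823609692723592))))))⟩]

def eleven_2 : List Lem := [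
  ⟨5391169, 120147984992240676959756304,
  F 0 (F 1 (F 2 (F 3 (B 4 5 (B 4 6 (F 4 (B 5 6 (F 5 (F 6 (M 28892504903520512))) (M
  37281494577752729))) (B 4 7 (F 4 (M 19267300890815129)) (B 4 8 (F 4 (M 19284824357382809)) (B 4
  9 (F 4 (M 19302416543427208)) (M 19320008729467272))))) (B 4 7 (R 63 11649936536080) (B 4 8 (R
  63 11645910004240) (M 23823747131672695)))))))⟩,
  ⟨1414677313, 36039751937382102715829657616,
  F 0 (F 1 (F 2 (F 3 (B 4 8 (F 4 (M 23788425320639129)) (B 4 9 (F 4 (M 23806017506683528)) (M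
  23823609692723592))))))⟩,
  ⟨127974512022083, 11766759564205645587659930804240,
  F 0 (F 1 (F 2 (F 3 (F 4 (B 5 6 (R 65 11649683890945) (M 32813079859341926))))))⟩,
  ⟨32761475077653313, 40991512094523623815426154512,
  F 0 (F 1 (F 2 (F 3 (B 4 9 (F 4 (R 66 11649936536080)) (B 4 10 (R 66 10619144385040) (M
  23788425320639129))))))⟩,
  ⟨426581901618, 139490798106074743755055120,
  F 0 (F 1 (F 2 (F 3 (B 4 5 (B 4 6 (F 4 (R 64 11649917785090)) (B 4 7 (F 4 (M 37263902660143769))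
  (B 4 8 (F 4 (M 19284824357382809)) (B 4 9 (F 4 (M 19302416543427208)) (M 19320008729467272)))))
  (B 4 6 (B 4 8 (F 4 (M 23788425320639129)) (B 4 9 (F 4 (M 23806017506683528)) (M
  23823609692723592))) (B 4 7 (R 65 11649936536080) (B 4 8 (R 67 11649936536080) (B 4 9 (R 67
  11585512026640) (M 23823609692723592)))))))))⟩,
  ⟨46042613720171314, 464347297136462373396496,
  F 0 (F 1 (F 2 (B 4 7 (F 4 (M 37263902660143769)) (B 4 8 (F 4 (M 32760303301208729)) (B 4 9 (F 4
  (M 32760303569644168)) (M 32760303838075272))))))⟩,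
  ⟨46042613468513089, 549608148245147920965648,
  F 0 (F 1 (F 2 (B 4 8 (F 4 (M 23788425320639129)) (B 4 9 (F 4 (M 23806017506683528)) (M
  23823609692723592)))))⟩,
  ⟨11786909181117875009, 1813636232269076176912,
  F 0 (F 1 (F 2 (B 4 7 (R 70 11649936536080) (B 4 8 (R 70 11645910004240) (M
  23823747131672695)))))⟩,
  ⟨1380139314, 464328850392388663844880,
  F 0 (F 1 (F 2 (B 3 6 (F 3 (R 64 11649936536080)) (B 3 7 (F 3 (R 68 11649936536080)) (B 3 8 (F 3
  (R 68 11645405700865)) (B 3 9 (F 3 (R 68 11576703001345)) (B 3 10 (R 68 10477208150785) (B 4 5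
  (R 69 11649936536080) (R 71 11649936536080)))))))))⟩,
  ⟨127974260298307, 11766759569204713231635219292176,
  F 0 (F 1 (F 2 (F 3 (F 4 (B 6 5 (B 6 8 (F 6 (M 28291887777491609)) (M 28309479963536008)) (M
  32813285480901205))))))⟩,
  ⟨32761410636366657, 40991517093591267790714642448,
  F 0 (F 1 (F 2 (F 3 (B 4 9 (F 4 (R 73 11649936536080)) (B 4 10 (R 73 10619144385040) (R 69
  11645894213920))))))⟩,
  ⟨357862424882, 139495797173718719043543056,
  F 0 (F 1 (F 2 (F 3 (B 4 6 (R 72 11649920745760) (B 4 5 (B 4 7 (F 4 (B 5 6 (B 5 7 (F 5 (M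
  48014038315062625)) (M 28239317377788569)) (M 37246447644617369))) (B 4 8 (F 4 (M
  19284824357382809)) (B 4 9 (F 4 (M 19302416543427208)) (M 19320008729467272)))) (B 4 7 (R 70
  11649936536080) (B 4 8 (R 74 11649936536080) (B 4 9 (R 74 11585512026640) (R 69
  10478199980320)))))))))⟩,
  ⟨11786909181083337010, 1813636232269076176912,
  F 0 (F 1 (F 2 (B 4 6 (R 72 11649920745760) (B 4 5 (B 4 7 (F 4 (R 75 11649920745760)) (B 4 8 (F 4
  (R 75 11645894213920)) (B 4 9 (F 4 (R 75 11577443172640)) (M 19320008729467272)))) (R 71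
  11649936536080)))))⟩,
  ⟨357862424882, 469327918036363952332816,
  F 0 (F 1 (F 2 (B 3 7 (F 3 (R 75 11649936536080)) (B 3 8 (F 3 (R 75 11645910004240)) (B 3 9 (F 3
  (R 75 11577458962960)) (B 3 10 (R 75 10478215770640) (R 76 11649936536080)))))))⟩,
  ⟨4407602, 464347297136462373396496,
  F 0 (F 1 (F 2 (B 4 6 (F 4 (R 76 11649920745760)) (R 77 11649920745760))))⟩,
  ⟨9539859124503855937, 11766451368678575227109992636432,
  F 0 (F 1 (F 2 (F 3 (F 4 (B 7 5 (B 7 6 (F 7 (M 47982157326471777)) (M 23806018043554406)) (M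
  28309686121966165))))))⟩,
  ⟨7233718143326306610, 40683316567453263265487986704,
  F 0 (F 1 (F 2 (F 3 (B 4 8 (F 4 (M 23753309936462489)) (B 4 9 (F 4 (R 79 11649936536080)) (B 4 10
  (R 79 10490279575840) (R 70 11649920745760)))))))⟩,
  ⟨2147056030693634294066, 10415238540759632282253390848016,
  F 0 (F 1 (F 2 (F 3 (B 5 8 (F 5 (M 23753309936462489)) (B 5 9 (F 5 (M 24087493020265060)) (M
  24105085206305124))))))⟩,
  ⟨37282675481072195, 158914168151278700162261008,
  F 0 (F 1 (F 2 (F 3 (B 5 7 (B 5 8 (B 5 9 (F 5 (M 24087492483394180)) (M 24105084669434244)) (M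
  24053545061877923)) (M 24071137247917987)))))⟩,
  ⟨198889333848568671454314802, 158914168151278700162261008,
  F 0 (F 1 (F 2 (F 3 (B 5 6 (B 5 7 (R 81 11649936536080) (M 37246585083570807)) (R 82
  11649936536080)))))⟩,
  ⟨109209513574706, 158914168151278700162261008,
  F 0 (F 1 (F 2 (F 3 (B 4 5 (R 78 11649936536080) (B 4 6 (R 72 11649920745760) (B 4 7 (R 80
  11649936536080) (B 4 8 (R 80 11645910004240) (B 4 9 (B 4 10 (B 5 6 (B 5 7 (R 81 11649936536080)
  (B 6 9 (R 81 9322585342240) (M 28327278308006229))) (R 82 11649936536080)) (R 83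
  11649936536080)) (R 83 10619144385040)))))))))⟩,
  ⟨3017448733873501585714, 625166011971062244384784,
  F 0 (F 1 (F 2 (B 4 9 (F 4 (R 84 11517045195040)) (B 4 10 (F 4 (R 84 10421828534560)) (M
  23788425320639129)))))⟩,
  ⟨109209513574706, 544885781762278275751952,
  F 0 (F 1 (F 2 (B 3 8 (F 3 (R 84 11649936536080)) (B 3 9 (F 3 (R 84 11585512026640)) (B 3 10 (R
  84 10490295366160) (B 4 5 (R 78 11649936536080) (B 4 6 (R 72 11649920745760) (B 4 7 (R 70
  11649936536080) (B 4 8 (R 85 11649936536080) (B 4 9 (R 85 11585512026640) (R 85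
  10478199980320)))))))))))⟩,
  ⟨5390642, 1813636232269076176912,
  F 0 (F 1 (F 2 (B 3 4 (B 3 5 (F 3 (R 60 11649933459715)) (B 3 7 (F 3 (R 62 11649936536080)) (B 3
  8 (F 3 (R 62 11645910004240)) (B 3 10 (F 3 (R 62 10478215770640)) (B 4 5 (F 4 (R 61
  11649920745760)) (B 4 6 (F 4 (R 60 11649915695620)) (B 4 7 (F 4 (R 62 11649920745760)) (B 4 8 (F
  4 (R 62 11645894213920)) (M 23823747131672695))))))))) (B 3 5 (R 72 11649936536080) (B 3 6 (R 77
  11649936536080) (B 3 7 (R 86 11649936536080) (B 3 8 (R 86 11645910004240) (B 3 9 (R 86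
  11577458962960) (B 3 10 (R 86 10478215770640) (R 76 11649936536080))))))))))⟩,
  ⟨50642599474230696228936631090, 1555381815237142454288,
  F 0 (F 1 (B 4 6 (F 4 (M 37281494577752729)) (B 4 7 (F 4 (M 37281494577752729)) (B 4 8 (F 4 (M
  32795487136426649)) (M 28327072686442615)))))⟩,
  ⟨3318913399143182908059599897837874, 1850529720416495280144,
  F 0 (F 1 (B 4 7 (F 4 (M 37281494577752729)) (B 4 8 (F 4 (M 32795487136426649)) (M
  23823747131672695))))⟩,
  ⟨767725994543130691715378, 139500537986945662398308368,
  F 0 (F 1 (F 3 (B 4 7 (F 4 (M 23788425320639129)) (B 4 8 (F 4 (M 32795487136426649)) (B 4 9 (F 4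
  (M 32813079322471048)) (M 32830671508511112))))))⟩,
  ⟨196537854751677905974284867, 45963904565976707574314115088,
  F 0 (F 1 (F 3 (F 4 (B 5 6 (B 5 7 (R 46 11649683894785) (M 28309686121966165)) (M
  32813285480901205)))))⟩,
  ⟨50313690816429543929416926002, 160123112417637403046518800,
  F 0 (F 1 (F 3 (B 4 9 (F 4 (R 91 11649936536080)) (B 4 10 (R 91 10619144385040) (M
  32795487136426649)))))⟩,
  ⟨767725994543126396748082, 544904228506351985303568,
  F 0 (F 1 (F 3 (B 4 5 (B 4 6 (F 4 (M 32795487136426649)) (B 4 7 (F 4 (M 28291887777491609)) (B 4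
  8 (F 4 (M 32795487136426649)) (B 4 9 (F 4 (M 32813079322471048)) (M 32830671508511112))))) (B 4
  6 (R 90 11649936536080) (B 4 7 (R 90 11649684877840) (B 4 8 (R 92 11649936536080) (B 4 9 (R 92
  11585512026640) (M 32830671508511112))))))))⟩,
  ⟨50642599474230695000306565426, 2145677625595848106000,
  F 0 (F 1 (B 4 8 (F 4 (M 23788425320639129)) (B 4 9 (F 4 (M 23806017506683528)) (M
  23823609692723592))))⟩,
  ⟨12964505465403058234607777562930, 5855313045540118544,
  F 0 (F 1 (B 4 5 (R 88 11649936536080) (B 4 7 (R 94 11649936536080) (B 4 8 (R 94 11645910004240)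
  (M 23823747131672695)))))⟩]

def eleven_3 : List Lem := [
  ⟨767725994543126396748082, 1832082976342785728528,
  F 0 (F 1 (B 3 7 (F 3 (R 93 11649936536080)) (B 3 8 (F 3 (R 93 11645910004240)) (B 3 9 (F 3 (R 93
  11577458962960)) (B 3 10 (R 93 10478215770640) (R 95 11649936536080))))))⟩,
  ⟨16690, 5855313045540118544,
  F 0 (F 1 (B 2 5 (F 2 (R 60 11649936536080)) (B 2 6 (F 2 (R 87 11649936536080)) (B 2 7 (F 2 (R 87
  11649653358880)) (B 2 8 (F 2 (R 87 11645359440160)) (B 2 9 (F 2 (R 87 11576641012000)) (B 2 10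
  (R 87 10477130432800) (B 3 4 (B 3 5 (F 3 (R 60 11649933459715)) (B 3 6 (F 3 (R 87
  11649920680240)) (B 3 7 (F 3 (R 87 11649653293360)) (B 3 8 (F 3 (R 87 11645359374640)) (B 3 9 (F
  3 (R 87 11576640946480)) (B 3 10 (R 87 10477130367280) (B 4 5 (F 4 (M 19284824357382809)) (R 48
  11649935553025)))))))) (B 3 5 (B 3 6 (F 3 (R 87 11649903906865)) (B 3 7 (F 3 (R 87
  11649636519985)) (B 3 8 (F 3 (R 87 11645342601265)) (B 3 9 (F 3 (R 87 11576624173105)) (B 3 10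
  (R 87 10477113593905) (B 4 5 (R 88 11649936536080) (B 4 6 (R 89 11649936536080) (B 4 7 (R 89
  11649684877840) (M 23823747668539238))))))))) (B 3 6 (R 96 11649936536080) (B 3 7 (R 96
  11649684877840) (B 3 8 (R 96 11645406687760) (B 3 9 (R 96 11576703988240) (R 95
  10477209137680))))))))))))))⟩,
  ⟨33305660032696626, 35729067742851215159868858384,
  F 0 (F 1 (F 2 (F 3 (B 6 5 (F 6 (B 4 5 (B 4 7 (F 4 (M 48015892407206992)) (M 42277469798050420))
  (M 37773869096938137))) (B 6 8 (F 6 (M 28485194868632217)) (B 6 9 (F 6 (M 28485194869680776)) (M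
  28485194870725000)))))))⟩,
  ⟨2184021856806009717042, 11925834935108057785301439946768,
  F 0 (F 1 (F 2 (F 3 (F 6 (B 7 4 (R 98 11649684877840) (M 28591159495404100))))))⟩,
  ⟨2184021856806009717042, 41610557968407146269847396368,
  F 0 (F 1 (F 2 (F 3 (B 6 9 (F 6 (R 99 11649936536080)) (B 6 10 (R 99 10619143401985) (M
  28203720962517657))))))⟩,
  ⟨634982139649129976054066, 11924905205039643375291057905680,
  F 0 (F 1 (F 2 (F 3 (F 6 (B 4 5 (B 4 7 (F 4 (M 37281494577752729)) (M 28802267868080756)) (M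
  28837452240169556))))))⟩,
  ⟨32461235102564658, 40680827899992736259465355280,
  F 0 (F 1 (F 2 (F 3 (B 6 5 (F 6 (B 4 5 (B 4 7 (F 4 (M 47963533819908352)) (B 4 8 (F 4 (M
  47963533819908352)) (M 46852537949653043))) (M 28837450903235225))) (B 6 7 (F 6 (M
  28802267331209881)) (B 6 8 (F 6 (M 28837245813303961)) (B 6 9 (F 6 (R 101 11649936536080)) (B 6
  10 (R 101 10615117849360) (M 28802267331209881)))))))))⟩,
  ⟨2480178868473114608178, 11924910106856052593982789722128,
  F 0 (F 1 (F 2 (F 3 (F 6 (B 7 4 (B 7 5 (F 7 (M 33587341666855577)) (M 28309686121966165)) (M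
  28802267868080756))))))⟩,
  ⟨8315162596034691634, 40685729716401954951197171728,
  F 0 (F 1 (F 2 (F 3 (B 6 8 (F 6 (M 28239317377788569)) (B 6 9 (F 6 (R 103 11649936536080)) (B 6
  10 (R 103 10619144385040) (M 28802267331209881)))))))⟩,
  ⟨634982139667826220417586, 10414927837379478751722965377040,
  F 0 (F 1 (F 2 (F 3 (B 4 8 (F 4 (M 28239317377788569)) (B 4 9 (F 4 (M 28891122151491699)) (M
  28873530233882739))))))⟩,
  ⟨162555427754964616485224754, 40683311864762725692847759376,
  F 0 (F 1 (F 2 (F 3 (B 4 8 (B 4 9 (F 4 (M 28891263633741201)) (M 28873671447696801)) (B 7 9 (B 7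
  10 (F 7 (M 24071210262362002)) (M 28503336006223991)) (M 28503267287795831))))))⟩,
  ⟨32461235102564658, 158909465460741127522033680,
  F 0 (F 1 (F 2 (F 3 (B 6 4 (R 102 11649936536080) (B 6 5 (R 102 11645909017345) (B 6 7 (R 104
  11649936536080) (B 6 8 (R 104 11645910000400) (B 4 5 (B 4 7 (R 105 11649936536080) (B 4 8 (R 105
  11645910000400) (M 28504366796277923))) (B 4 7 (R 106 11649936536080) (B 4 8 (R 106
  11645910000400) (M 28504366796277923)))))))))))⟩,
  ⟨3017448750361880969522, 138291613396532256519036944,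
  F 0 (F 1 (F 2 (B 6 5 (F 6 (M 37774007341197977)) (B 6 7 (F 6 (M 28802267331209881)) (B 6 8 (F 6
  (M 28837245813303961)) (B 6 9 (F 6 (M 28837246081739400)) (M 28837246350170504)))))))⟩,
  ⟨50624389455053477199225176370, 46585287716121345323763310608,
  F 0 (F 1 (F 2 (F 6 (B 4 5 (B 4 7 (R 44 11649684874000) (M 28591159495404100)) (B 4 7 (B 4 8 (B 4
  9 (F 4 (M 47962430263870464)) (M 28239317377788569)) (M 28239386097265288)) (M
  28591159495404100))))))⟩,
  ⟨12959843714919120872475109507378, 162536242919585015046152208,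
  F 0 (F 1 (F 2 (B 6 9 (F 6 (R 109 11649936536080)) (B 6 10 (R 109 10619143401985) (M
  28837245813303961)))))⟩,
  ⟨91612780839218, 540183091224705635524624,
  F 0 (F 1 (F 2 (B 3 7 (F 3 (B 6 7 (B 6 4 (F 6 (M 28854836932946585)) (B 6 8 (F 6 (M
  28203720962517657)) (B 6 9 (F 6 (M 28203721230953096)) (M 28203721499384200)))) (B 6 4 (R 98
  11649936536080) (B 6 5 (R 98 11649935553025) (B 6 8 (R 100 11649936536080) (B 6 9 (R 100
  11585511043585) (M 28203721499384200))))))) (B 3 8 (F 3 (R 107 11649936536080)) (B 3 9 (F 3 (R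
  107 11577457976065)) (B 3 10 (R 107 10478214783745) (B 6 4 (R 108 11649936536080) (B 6 5 (R 108
  11649935553025) (B 6 7 (B 6 8 (F 6 (M 28239317377788569)) (B 6 9 (F 6 (M 28239386097265288)) (M
  28239454816737672))) (B 6 8 (R 110 11649936536080) (B 6 9 (R 110 11585511043585) (M
  28837246350170504))))))))))))⟩,
  ⟨126870436856626, 2991929139578897397554838549635088,
  F 0 (F 1 (F 2 (F 3 (F 4 (B 5 6 (B 5 7 (F 5 (M 48013969864021345)) (B 5 8 (F 5 (M
  24106253168974179)) (M 37264177538050645))) (B 5 8 (B 5 9 (F 5 (M 47977749851166100)) (M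
  41785300363553365)) (M 37281769455659605)))))))⟩,
  ⟨8391159740234940978, 2992013010016558982068462965301264,
  F 0 (F 1 (F 2 (F 3 (F 4 (B 5 6 (B 5 7 (F 5 (R 112 11649935553025)) (M 41767502555949687)) (B 5 7
  (B 5 9 (F 5 (M 47977749851166100)) (M 32742916736723609)) (M 41767502555949687)))))))⟩,
  ⟨2738581623917286474290, 11687860305349101711128638070800,
  F 0 (F 1 (F 2 (F 3 (B 5 9 (F 5 (R 112 11504477086465)) (M 24053476342405539)))))⟩,
  ⟨8314580949836906802, 11687220717477394812120185511952,
  F 0 (F 1 (F 2 (F 3 (B 4 7 (F 4 (R 112 11649936536080)) (B 4 8 (F 4 (R 113 11649936536080)) (B 4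
  9 (F 4 (R 113 11504226411280)) (B 5 6 (B 5 7 (F 5 (R 112 11649935553025)) (B 5 8 (F 5 (R 113
  11504477086465)) (M 33008035145222243))) (B 5 7 (B 5 8 (F 5 (R 113 11440052577025)) (B 5 9 (F 5
  (R 113 11439800918785)) (M 32743054175672712))) (B 5 8 (R 114 11649936536080) (R 114
  11504225428225))))))))))⟩,
  ⟨2128533005797177835826, 2992013012500561654352360297799696,
  F 0 (F 1 (F 2 (F 3 (F 4 (B 6 8 (B 6 5 (F 6 (M 23753309936462489)) (M 41785300363553365)) (B 6 5
  (B 6 9 (F 6 (M 47942565747517076)) (M 41750116259900006)) (M 41785300363553365)))))))⟩,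
  ⟨2128533005797177835826, 11687223201480067096017518010384,
  F 0 (F 1 (F 2 (F 3 (B 4 8 (F 4 (R 116 11649936536080)) (B 4 9 (F 4 (R 116 11585512026640)) (B 6
  5 (B 6 8 (F 6 (M 42277881846475332)) (B 6 9 (F 6 (M 37774350938581572)) (M 23753447375411592)))
  (B 6 8 (B 6 9 (F 6 (M 28556043843840580)) (M 28504435516807539)) (M 28504435517851763))))))))⟩,
  ⟨179470944347983793879138610, 45653205927645210303774400528,
  F 0 (F 1 (F 2 (F 3 (B 6 8 (B 6 5 (F 6 (M 42347838542228036)) (B 6 7 (F 6 (M 28837245813303956))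
  (M 28504439812814722))) (B 6 5 (B 6 7 (F 6 (M 28802267331209876)) (B 6 9 (F 6 (B 5 8 (B 5 9 (F 5
  (R 117 11504477086465)) (M 32830878472234581)) (M 37563311819089476))) (M 28838552020228435)))
  (B 6 7 (B 6 9 (F 6 (M 28837452240169556)) (M 28803366842833315)) (M 28803509113616258)))))))⟩,
  ⟨2128533005797177835826, 45653205927645210303774400528,
  F 0 (F 1 (F 2 (F 3 (B 4 7 (R 117 11649936536080) (B 4 8 (B 4 9 (F 4 (R 117 11504478069520)) (R
  118 11649936536080)) (R 118 11585512026640))))))⟩,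
  ⟨8314580949836906802, 178332835505945083929239568,
  F 0 (F 1 (F 2 (F 3 (B 4 5 (B 4 6 (R 115 11649936536080) (B 4 7 (R 115 11649684877840) (B 4 9 (R
  115 11504226411280) (B 5 6 (R 115 11649935553025) (B 5 7 (R 115 11649683894785) (M
  41837871300114278)))))) (B 4 7 (R 119 11649684877840) (B 4 9 (R 119 11504226411280) (B 5 6 (R
  119 11649935553025) (B 5 7 (R 119 11649683894785) (M 24088802448406402)))))))))⟩,
  ⟨11786891520195576626, 36038552733217009838353096720,
  F 0 (F 1 (F 2 (F 4 (B 5 6 (B 5 7 (F 5 (M 48013969864021345)) (M 37263902660143769)) (M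
  37281494577752729)))))⟩,
  ⟨197751539831543863219274290, 45942073047500052037546090512,
  F 0 (F 1 (F 2 (F 4 (B 5 6 (B 5 7 (F 5 (R 121 11649935553025)) (M 37263903197014647)) (B 5 7 (B 5
  8 (F 5 (M 24052376830782105)) (M 32742985456200328)) (M 37316678949841527))))))⟩,
  ⟨3017444229170067620402, 138291593940981866278494224,
  F 0 (F 1 (F 2 (B 4 7 (F 4 (R 121 11649936536080)) (B 4 8 (F 4 (M 32742916736723609)) (B 4 9 (F 4
  (R 122 11649936536080)) (B 4 10 (R 122 10619144385040) (M 32742916736723609)))))))⟩,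
  ⟨197751244607358965177860658, 45963899825383875537723793424,
  F 0 (F 1 (F 2 (F 4 (B 5 6 (R 123 11649935553025) (M 32813079859341926)))))⟩,
  ⟨3017444229170067620402, 540163635674315394981904,
  F 0 (F 1 (F 2 (B 4 6 (R 123 11649936536080) (B 4 7 (R 123 11649684877840) (B 4 8 (B 4 9 (F 4 (R
  124 11649936536080)) (B 4 10 (R 124 10619144385040) (M 32742916736723609))) (B 5 6 (R 123
  11649935553025) (B 5 7 (R 123 11649683894785) (M 37334271941179238))))))))⟩,
  ⟨197680389505929145823150386, 45944557050172335934878588944,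
  F 0 (F 1 (F 2 (F 4 (B 6 5 (B 6 8 (F 6 (M 47942634466993796)) (M 23753378655939208)) (M
  37281769455659605)))))⟩,
  ⟨197751225003172190501355826, 140775596613265763610992656,
  F 0 (F 1 (F 2 (B 4 8 (F 4 (M 23770901854071449)) (B 4 9 (F 4 (R 126 11649936536080)) (B 4 10 (R
  126 10619144385040) (M 23770901854071449))))))⟩]

def eleven_4 : List Lem := [
  ⟨197751244607060997526733362, 45963899863286170001673887760,
  F 0 (F 1 (F 2 (F 4 (B 6 8 (B 6 5 (F 6 (M 47978922914113106)) (M 32813285480901205)) (B 6 5 (B 6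
  7 (F 6 (M 28802267331209881)) (M 32742917542029926)) (M 32813285480901205))))))⟩,
  ⟨197751244607060997526733362, 160118409727099830406291472,
  F 0 (F 1 (F 2 (B 4 9 (F 4 (R 128 11649936536080)) (B 4 10 (R 128 10619144385040) (M
  32742916736723609)))))⟩,
  ⟨197751225003172190501355826, 540201537968779345076240,
  F 0 (F 1 (F 2 (B 4 7 (R 127 11649936536080) (B 4 8 (R 129 11649936536080) (B 6 5 (B 6 7 (F 6 (M
  28802267331209881)) (B 6 8 (F 6 (B 5 8 (B 5 7 (F 5 (R 127 11649935553025)) (R 129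
  11649935553025)) (M 28802336319122036))) (M 37793116187555618))) (B 6 7 (B 6 8 (F 6 (M
  28837245813303961)) (M 28504366796277923)) (M 28504439811766162)))))))⟩,
  ⟨50624394196875230088192541234, 2110013338671724437520,
  F 0 (F 1 (F 2 (B 5 6 (R 130 11649935553025) (B 5 7 (R 130 11649683894785) (M
  24071210262362002)))))⟩,
  ⟨8314580949836906802, 620740022594595247431696,
  F 0 (F 1 (F 2 (B 3 9 (F 3 (R 120 11649936536080)) (B 3 10 (R 120 10405233894145) (B 4 5 (R 125
  11649936536080) (B 4 6 (R 130 11649936536080) (B 4 7 (R 130 11649684877840) (B 4 8 (B 8 5 (B 8 6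
  (F 8 (M 38407325770361497)) (B 8 7 (F 8 (M 38389733852752537)) (M 23823679217497958))) (B 8 6 (B
  8 7 (F 8 (M 37562899499100825)) (M 37511639064410002)) (M 37511639065454226))) (R 131
  11649936536080)))))))))⟩,
  ⟨11786909190229156690, 47203134089242273591295287312,
  F 0 (F 1 (F 2 (B 8 10 (F 8 (M 38460171848021862)) (B 8 6 (F 8 (M 38442578856684151)) (M
  38442579125119590)))))⟩,
  ⟨1380073778, 2110013338671724437520,
  F 0 (F 1 (F 2 (B 3 4 (R 97 11649936532240) (B 3 5 (R 97 11649935549185) (B 3 6 (R 111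
  11649936536080) (B 3 7 (R 111 11649683894785) (B 3 8 (R 132 11649936536080) (B 3 9 (R 132
  11585511043585) (B 3 10 (R 132 10490294383105) (B 4 5 (R 125 10490295366160) (B 4 6 (R 130
  10490295366160) (B 4 8 (B 5 6 (R 130 10490294383105) (B 5 7 (R 130 10490042724865) (B 5 8 (B 8 9
  (R 133 11649936536080) (B 8 10 (R 133 10619144385040) (M 38407394484595353))) (R 131
  11649683894785)))) (R 131 11649684877840)))))))))))))⟩,
  ⟨50642599474230695069026042418, 559072557156184216379408,
  F 0 (F 1 (B 6 8 (F 6 (M 28291887777491609)) (B 6 9 (F 6 (M 28309479963536008)) (M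
  28327072149576072))))⟩,
  ⟨50642599474230695064747852338, 1850750115323259723792,
  F 0 (F 1 (B 4 7 (F 4 (M 37246447644617369)) (R 44 11649936532240)))⟩,
  ⟨849641830180654842910581094730646066, 701351285390389457002512,
  F 0 (F 1 (F 4 (B 5 6 (R 136 11649935553025) (M 32813079859341926))))⟩,
  ⟨849641830180654842910581094730646066, 2441045925681965375504,
  F 0 (F 1 (B 4 9 (F 4 (R 137 11649936536080)) (B 4 10 (R 137 10619144385040) (M
  32742916736723609))))⟩,
  ⟨12964505465403057936575701926450, 6075707952304562192,
  F 0 (F 1 (B 4 6 (R 136 11649936536080) (B 4 7 (R 136 11649684874000) (B 4 8 (R 138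
  11649936536080) (B 4 9 (R 138 11585512026640) (M 32743054175672712))))))⟩,
  ⟨849641830179379765981333036174819634, 179546225437625550815436816,
  F 0 (F 1 (F 4 (B 6 5 (B 6 7 (F 6 (M 28784675150408345)) (M 23753378924374647)) (M
  32813285480901205))))⟩,
  ⟨217508308526247639785032480532356809010, 625204134660432958922768,
  F 0 (F 1 (B 4 9 (F 4 (R 140 11649936536080)) (B 4 10 (R 140 10490295366160) (M
  23788425320639129))))⟩,
  ⟨849641830180654804931707840382517554, 1851758921639790714896,
  F 0 (F 1 (B 4 7 (R 46 11649936536080) (B 4 8 (R 141 11649936536080) (B 4 9 (R 141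
  11585512026640) (M 23823609692723592)))))⟩,
  ⟨55682126982719397003616798540691386090034, 720262656830455567949840,
  F 0 (F 1 (B 8 10 (F 8 (M 38390902615472035)) (B 8 6 (F 8 (M 38372484990413431)) (M
  38442579125119590))))⟩,
  ⟨55682126982719395785006365931803007730226, 2443279711097141141520,
  F 0 (F 1 (B 5 7 (R 142 11649683890945) (B 5 8 (B 8 9 (R 143 11649936536080) (B 8 10 (R 143
  10619144385040) (M 38372347551459993))) (M 24105222108383348))))⟩,
  ⟨217508308526247639785108761355103715890, 625480835821538602197008,
  F 0 (F 1 (B 5 6 (R 142 11649935553025) (R 144 11649936536080)))⟩,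
  ⟨196537854603321832544289074, 2128460082745433989136,
  F 0 (F 1 (B 3 8 (F 3 (R 134 11641630827265)) (B 3 9 (F 3 (R 134 11573179785985)) (B 3 10 (R 134
  10473936593665) (B 4 5 (R 139 11649936536080) (B 4 6 (R 142 11649936536080) (B 4 7 (R 142
  11649684874000) (B 4 8 (R 145 11649936536080) (B 4 9 (R 145 11585512026640) (M
  23823609692723592))))))))))⟩,
  ⟨55682126982719394576062023292277376565554, 179546520585530730168262672,
  F 0 (F 1 (F 4 (B 5 7 (B 5 8 (B 5 9 (F 5 (R 144 10477209133840)) (M 23788425320639129)) (M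
  23806017506683528)) (M 23806086226160247))))⟩,
  ⟨55682126982719394576062023292277376565554, 625499282565612311748624,
  F 0 (F 1 (B 4 9 (F 4 (R 147 11649936536080)) (B 4 10 (R 147 10619144385040) (M
  23788425320639129))))⟩,
  ⟨55682126982719394576062023292277376565554, 2146906826819143540752,
  F 0 (F 1 (B 4 8 (R 148 11649936536080) (B 4 9 (R 148 11585512026640) (M 23823609692723592))))⟩,
  ⟨1380073778, 7084514268835553296,
  F 0 (F 1 (B 2 7 (F 2 (R 134 11649936536080)) (B 2 8 (F 2 (R 134 11645909021185)) (B 2 9 (F 2 (R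
  134 11577457979905)) (B 2 10 (R 134 10478214787585) (B 3 4 (R 97 11649936532240) (B 3 5 (R 97
  11649935549185) (B 3 6 (B 3 7 (F 3 (R 134 11649935549185)) (B 3 8 (F 3 (R 134 11645909017345))
  (B 3 9 (F 3 (R 134 11577457976065)) (B 3 10 (R 134 10478214783745) (B 6 4 (B 6 5 (F 6 (M
  37773869902244505)) (B 6 7 (F 6 (M 28854837730912921)) (B 6 8 (F 6 (M 28837245813303961)) (M
  28608476805630071)))) (B 6 7 (R 135 11649936536080) (B 6 8 (R 135 11645910004240) (M
  28327072686442615)))))))) (B 3 7 (R 146 11649936536080) (B 3 8 (R 146 11645909021185) (B 3 9 (R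
  146 11577457979905) (B 3 10 (R 146 10478214787585) (B 4 5 (R 139 10478215770640) (B 4 6 (R 142
  10478215770640) (B 4 7 (R 149 11649936536080) (B 4 8 (R 149 11645910004240) (M
  23823747131672695)))))))))))))))))⟩,
  ⟨65, 22870053118615568,
  F 0 (F 1 (B 2 3 (B 2 4 (F 2 (R 30 11649936535840)) (B 2 5 (F 2 (R 30 11649935552545)) (B 2 6 (F
  2 (R 43 11649936536080)) (B 2 7 (F 2 (R 43 11649634742290)) (B 2 8 (F 2 (R 43 11645339840530))
  (B 2 9 (F 2 (R 43 11576620429330)) (B 2 10 (R 43 10477108867090) (B 3 4 (F 3 (R 30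
  11649936531760)) (B 3 6 (F 3 (R 43 11649903108115)) (B 3 7 (F 3 (R 43 11649634738195)) (B 3 8 (F
  3 (R 43 11645339836435)) (B 3 9 (F 3 (R 43 11576620425235)) (B 3 10 (F 3 (R 43 10477108862995))
  (R 49 11649936536080)))))))))))))) (B 2 4 (R 97 11649936536080) (B 2 5 (R 97 11649935553025) (B
  2 6 (R 150 11649936536080) (B 2 7 (R 150 11649683894785) (B 2 8 (R 150 11645405704705) (B 2 9 (R
  150 11576703005185) (B 2 10 (R 150 10477208154625) (B 3 4 (R 97 11649936532240) (B 3 5 (R 97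
  11649935549185) (B 3 6 (R 150 11649935549185) (B 3 7 (R 150 11649683890945) (B 3 8 (R 150
  11645405700865) (B 3 9 (R 150 11576703001345) (B 3 10 (R 150 10477208150785) (R 49
  11649935553025)))))))))))))))))⟩,
  ⟨217508592563870733590113048657668555329, 110313016926224,
  F 0 (B 4 8 (F 4 (M 32795555587467929)) (B 4 9 (F 4 (M 32813147773512328)) (M
  32830739959552392)))⟩,
  ⟨14254643122265832396561631467528817765204545, 110313016926224,
  F 0 (B 4 7 (F 4 (M 37281563028794009)) (R 152 11649936536080))⟩,
  ⟨934192291660813591941063079856040957786322059841, 361854148624,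
  F 0 (B 4 6 (R 153 11649936536080) (B 4 7 (R 153 11649653420560) (B 4 8 (R 153 11645359501840) (M
  28327346490607735))))⟩,
  ⟨239153226665168279536912148443146485194402488861249, 1076895760,
  F 0 (B 4 5 (R 154 11649936536080) (B 4 6 (R 154 11649920807440) (B 4 7 (R 154 11649653420560) (M
  23823747668539238))))⟩,
  ⟨3298551450678340446772404669203009, 70584317779984,
  F 0 (B 3 4 (F 3 (R 30 11649936531760)) (B 3 5 (F 3 (R 151 11649935548675)) (B 3 6 (F 3 (R 151
  11649918836995)) (B 3 7 (F 3 (R 151 11649650467075)) (B 3 8 (F 3 (R 151 11645355565315)) (B 3 9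
  (F 3 (R 151 11576636154115)) (B 3 10 (R 151 10477124591875) (R 155 11649936536080))))))))⟩,
  ⟨3298551450678340446772404651508018, 1832303936462969118736,
  F 0 (F 3 (B 4 6 (F 4 (M 37281563028794009)) (B 4 7 (F 4 (M 37281563028794009)) (B 4 8 (F 4 (M
  32795555587467929)) (M 28327346490607735)))))⟩,
  ⟨12884966604212267370213312381761, 2146979449626600415248,
  F 0 (F 3 (B 4 8 (F 4 (M 28292024679574169)) (B 4 9 (F 4 (M 28309616865618568)) (M
  28327209051658632))))⟩,
  ⟨844429171373655154373735595316035890, 7157137076292427792,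
  F 0 (F 3 (B 4 5 (R 157 11649936536080) (B 4 6 (R 157 11649920807440) (B 4 7 (R 158
  11649936536080) (B 4 8 (R 158 11645894275600) (M 28327346490607735))))))⟩]

def eleven_5 : List Lem := [
  ⟨14254643117052143623387885173103235302637874, 23716741514272784,
  F 0 (B 4 6 (F 4 (R 159 11649936474400)) (B 4 7 (F 4 (R 159 11649684816160)) (B 4 8 (F 4 (R 159
  11645406626080)) (M 28327346490607735))))⟩,
  ⟨934192291660813591941063079856040957786322059570, 72843470577680,
  F 0 (B 4 5 (R 160 11649936536080) (B 4 6 (R 160 10619128656400) (B 4 7 (R 160 10618861269520) (M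
  23823747668539238))))⟩,
  ⟨844429171373655154373735595316035890, 23435266537562128,
  F 0 (B 3 6 (F 3 (R 159 11649936536080)) (B 3 7 (F 3 (R 159 11649684877840)) (B 3 8 (F 3 (R 159
  11645406687760)) (B 3 9 (F 3 (R 159 11576703988240)) (B 3 10 (R 159 10477209137680) (R 161
  11649936536080))))))⟩,
  ⟨3298551450678340446772404669202738, 72843470577680,
  F 0 (B 3 4 (B 3 5 (F 3 (R 151 11649933459715)) (B 3 6 (F 3 (R 151 11649916748035)) (B 3 7 (F 3
  (R 151 11649648378115)) (B 3 10 (F 3 (R 151 10477122502915)) (B 4 5 (F 4 (R 151 11649932407300))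
  (B 4 6 (F 4 (R 151 11649915695620)) (B 4 7 (F 4 (R 151 11649647325700)) (M
  23823747668539238)))))))) (B 3 5 (R 162 11649936536080) (B 3 6 (R 162 11649920807440) (B 3 7 (R
  162 11649653420560) (B 3 8 (R 162 11645359501840) (B 3 9 (R 162 11576641073680) (R 161
  10477130494480)))))))⟩,
  ⟨11642228835693445426, 18647928467955728,
  F 0 (B 2 5 (F 2 (R 151 11649934508290)) (B 2 6 (F 2 (R 151 11649917796610)) (B 2 7 (F 2 (R 151
  11649649426690)) (B 2 8 (F 2 (R 151 11645354524930)) (B 2 9 (F 2 (R 151 11576635113730)) (B 2 10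
  (R 151 10477123551490) (R 163 11649936536080)))))))⟩,
  ⟨11642228710635094322, 141913648961566765096181776,
  F 0 (F 2 (F 3 (B 5 8 (F 5 (M 23700121337244313)) (B 5 9 (F 5 (M 23700121605679752)) (M
  23700121874110856)))))⟩,
  ⟨2980410581937572495937, 139505242055303246037196816,
  F 0 (F 2 (F 3 (B 5 8 (F 5 (M 23788425320639129)) (B 5 9 (F 5 (M 23806017506683528)) (M
  23823609692723592)))))⟩,
  ⟨50002992102144837843727630913, 11846297221451314015954836463632,
  F 0 (F 2 (F 3 (F 5 (B 4 7 (R 152 11649417490960) (B 4 8 (B 4 9 (F 4 (M 47978716755678610)) (M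
  23788425320639129)) (M 23806017506683528))))))⟩,
  ⟨12800765997260050040802169274945, 46274598483319541986207277072,
  F 0 (F 2 (F 3 (F 5 (B 4 6 (R 167 11649936536080) (B 4 7 (R 167 11649684874000) (M
  46518767183755059))))))⟩,
  ⟨3276996095298572810445355334385970, 161332019939126746214899728,
  F 0 (F 2 (F 3 (B 5 9 (F 5 (R 168 11649936536080)) (B 5 10 (R 168 10618892722960) (M
  24034716462131865)))))⟩,
  ⟨195324187898438054844711218, 544885930381065978978320,
  F 0 (F 2 (F 3 (B 5 4 (B 5 6 (F 5 (M 24069900297349785)) (B 5 7 (F 5 (M 24034784913173145)) (B 5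
  8 (F 5 (M 24034716462131865)) (B 5 9 (F 5 (M 24034716730567304)) (M 24034716998998408))))) (B 5
  6 (R 166 11649936536080) (B 5 7 (R 166 11649684874000) (B 5 8 (R 169 11649936536080) (B 5 9 (R
  169 11585260364560) (M 24034716998998408))))))))⟩,
  ⟨50641390529964058194282107186, 1813857209981427851280,
  F 0 (F 2 (B 5 8 (F 5 (M 24034716462131865)) (B 5 9 (F 5 (M 24034716730567304)) (M
  24034716998998408))))⟩,
  ⟨197817931757672085107855666, 1813857209981427851280,
  F 0 (F 2 (B 5 6 (F 5 (M 24069900297349785)) (B 5 7 (F 5 (M 24034784913173145)) (R 171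
  11649936536080))))⟩,
  ⟨50641390529964053778802098753, 2165354153698440323088,
  F 0 (F 2 (B 5 8 (F 5 (M 23788425320639129)) (B 5 9 (F 5 (M 23806017506683528)) (M
  23823609692723592))))⟩,
  ⟨12964195975670798347971596599873, 7085097074422784016,
  F 0 (F 2 (B 5 7 (R 173 11649936536080) (B 5 8 (R 173 11645910004240) (M 23823747131672695))))⟩,
  ⟨762985108976005674058034, 1813784851056779403280,
  F 0 (F 2 (B 3 6 (F 3 (B 5 4 (B 5 7 (F 5 (M 37492394122324633)) (B 5 8 (F 5 (M
  32988794496002713)) (B 5 9 (F 5 (M 32988794497051272)) (M 32988794498095496)))) (B 5 7 (R 165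
  11649936536080) (B 5 8 (R 165 11645910004240) (M 23700121876203639))))) (B 3 7 (F 3 (R 170
  11649936536080)) (B 3 8 (F 3 (R 170 11645406683920)) (B 3 9 (F 3 (R 170 11576703984400)) (B 3 10
  (R 170 10477209133840) (B 5 4 (R 172 11649936536080) (R 174 11649936536080))))))))⟩,
  ⟨50003006565476998447151268673, 11766450088917479045817880879120,
  F 0 (F 2 (F 3 (F 4 (B 5 7 (B 5 8 (F 5 (M 47960226653033860)) (M 32742985456200328)) (M
  37246585083570807)))))⟩,
  ⟨195324187898438063669592370, 40682036806357081973376229392,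
  F 0 (F 2 (F 3 (B 4 7 (F 4 (M 37264039562226329)) (B 4 8 (F 4 (M 32760508654332569)) (B 4 9 (F 4
  (R 176 11649936536080)) (B 4 10 (R 176 10619144385040) (M 37264039562226329)))))))⟩,
  ⟨3276997038260693663110938384023858, 11766451368678795903491733790736,
  F 0 (F 2 (F 3 (F 4 (B 5 7 (B 5 6 (F 5 (M 24034784913173145)) (B 5 8 (F 5 (M 47961330459628930))
  (M 28309686121966165))) (B 5 6 (B 5 8 (F 5 (M 24034716462131865)) (M 37316816388794965)) (M
  28309617670924885))))))⟩,
  ⟨12800765978130631742821052334386, 40683316567673939647229141008,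
  F 0 (F 2 (F 3 (B 4 8 (F 4 (R 177 11640845378320)) (B 4 9 (F 4 (R 178 11649936536080)) (B 4 10 (R
  178 10610053227280) (M 37264039562226329))))))⟩,
  ⟨50002992102000144299415716146, 158914168371955081903415312,
  F 0 (F 2 (F 3 (B 4 6 (R 177 11649936536080) (B 4 7 (R 179 11649936536080) (B 4 8 (R 179
  11640829649680) (B 5 6 (B 5 7 (F 5 (M 24034784913173145)) (B 5 8 (F 5 (M 24034716462131865)) (M
  28239455353604215))) (B 5 7 (B 5 8 (F 5 (B 7 8 (B 7 6 (F 7 (M 32760508654332569)) (M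
  28503129846753945)) (B 7 6 (B 7 9 (F 7 (M 47960226921469300)) (M 33569885582825864)) (M
  28503129846753945)))) (M 37511641212937762)) (M 33008041586615842))))))))⟩,
  ⟨838911241798425745979805153368359218, 40684525549842592814063493136,
  F 0 (F 2 (F 3 (B 5 8 (F 5 (M 23753309936462489)) (B 5 9 (F 5 (M 24053614586660963)) (M
  24053546135619683)))))⟩,
  ⟨50002992102000144299415716146, 620758469620143933693968,
  F 0 (F 2 (F 3 (B 4 5 (R 180 11649936536080) (B 4 6 (R 180 11649920807440) (B 4 7 (R 180
  11640845378320) (B 4 8 (R 180 11640829649680) (B 5 6 (B 5 7 (R 181 11649936536080) (B 5 8 (R 181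
  11645910004240) (M 28239455353604215))) (B 5 7 (B 5 8 (B 5 9 (F 5 (M 24087286869174886)) (M
  24104879055214950)) (M 24053133828196454)) (M 24070726014236518)))))))))⟩,
  ⟨55680797734440891775731084507131051917618, 701352295060986551934992,
  F 0 (F 2 (F 4 (B 5 6 (B 5 7 (F 5 (M 24034784913173145)) (M 28239386365700727)) (B 5 7 (B 5 8 (F
  5 (M 24070106724211044)) (M 28309686121966165)) (M 28309617670924885)))))⟩,
  ⟨55680797734440891775731084507131051917618, 2442055596279060307984,
  F 0 (F 2 (B 4 9 (F 4 (R 183 11649936536080)) (B 4 10 (R 183 10619144385040) (M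
  28292024679574169))))⟩,
  ⟨849621547461561402630371051453956402, 7085378549399494672,
  F 0 (F 2 (B 4 6 (B 4 7 (F 4 (M 37264039562226329)) (R 152 11649920803600)) (B 4 7 (R 152
  11649684877840) (B 4 8 (R 184 11649936536080) (B 4 9 (R 184 11585512026640) (M
  28327209051658632))))))⟩,
  ⟨217503116150159719091969792451178349121, 179546521815314759050928144,
  F 0 (F 2 (F 4 (B 7 5 (B 7 6 (F 7 (M 33639842010147481)) (M 23806018043554406)) (M
  28309617670924885))))⟩,
  ⟨217503116150159719091969792451178349121, 625500512349641194414096,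
  F 0 (F 2 (B 4 9 (F 4 (R 186 11649936536080)) (B 4 10 (R 186 10619144385040) (M
  28292024679574169))))⟩,
  ⟨12964195975633035914625054622273, 2460722453784557592592,
  F 0 (F 2 (B 5 9 (F 5 (M 24087493020265060)) (M 24105085206305124)))⟩,
  ⟨849621547461561402702429753828393537, 7305491981187227664,
  F 0 (F 2 (B 5 7 (B 5 8 (F 5 (M 23788425320639129)) (B 5 9 (F 5 (M 23806017506683528)) (M
  23823609692723592))) (B 5 8 (R 188 11649936536080) (M 24105085474736228))))⟩,
  ⟨849621547459081938938571553510605633, 8458413485794074640,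
  F 0 (F 2 (B 5 8 (B 5 9 (F 5 (M 24053549893707426)) (M 24053618613184146)) (M
  24053618881619586)))⟩,
  ⟨55680797734440892984656756347397453529394, 50939999708477718812644417552,
  F 0 (F 2 (F 4 (B 8 10 (F 8 (R 151 8122337175880)) (B 8 6 (F 8 (M 38372484990413431)) (M
  38442716027202148)))))⟩]

def eleven_6 : List Lem := [
  ⟨14342095690543121341822050602923595978195521, 27674983356506128,
  F 0 (F 2 (B 5 6 (R 189 11649936536080) (B 5 7 (R 190 10490295366160) (M 28309617670924885))))⟩,
  ⟨14254284220016868294587157634109283437265202, 27674983356506128,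
  F 0 (F 2 (B 4 8 (B 4 9 (B 4 10 (B 5 6 (R 189 11649936536080) (B 5 7 (R 190 11649936536080) (B 5
  8 (B 8 9 (R 191 11649936536080) (B 8 10 (R 191 10619144385040) (M 38389939469068953))) (M
  24105085474736228)))) (R 192 11649936536080)) (R 192 10619144385040)) (R 192 9523927724560)))⟩,
  ⟨849621547461561402630371051453956402, 8314298297718218768,
  F 0 (F 2 (B 4 5 (R 185 11649936536080) (B 4 6 (R 185 11649920807440) (B 4 7 (B 4 8 (R 187
  11649936536080) (B 4 9 (R 187 11585512026640) (M 28327209051658632))) (R 193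
  11649936536080)))))⟩,
  ⟨50002992102000144299415716146, 2128460364220410699792,
  F 0 (F 2 (B 3 8 (F 3 (R 182 11649936536080)) (B 3 9 (F 3 (R 182 11572142678800)) (B 3 10 (R 182
  10472647828240) (R 194 11649936536080)))))⟩,
  ⟨217503116150159728776510430040356438322, 27674983356506128,
  F 0 (F 2 (B 4 5 (R 185 10478215770640) (B 4 6 (R 185 10478200042000) (B 4 7 (B 4 8 (B 4 9 (F 4
  (R 193 10478215770640)) (R 193 11577458962960)) (R 193 11645910004240)) (R 193
  11649936536080)))))⟩,
  ⟨2980410581937522098482, 7084795743812263952,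
  F 0 (F 2 (B 3 4 (R 164 11649936532240) (B 3 5 (R 175 11649936536080) (B 3 6 (R 175
  11649920807440) (B 3 7 (R 195 11649936536080) (B 3 8 (R 195 11645910004240) (B 3 9 (R 195
  11577458962960) (B 3 10 (R 195 10478215770640) (R 196 11649936536080)))))))))⟩,
  ⟨14254643122265832396561631467527662184055090, 28520585377095696,
  F 0 (B 5 7 (F 5 (M 23788425320639129)) (B 5 8 (F 5 (M 23788425320639129)) (M
  23823747131672695)))⟩,
  ⟨3649188639300053093519777655687377347892363570, 361854148624,
  F 0 (B 4 6 (R 153 11649936536080) (B 4 7 (R 152 11649684877840) (B 4 8 (R 152 11645406687760) (M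
  28327346490607735))))⟩,
  ⟨239153226665168279536912148443127962733555514229042, 10701806511152177168,
  F 0 (F 4 (B 5 6 (B 5 7 (B 5 8 (F 5 (M 23788425320639129)) (M 23806017506683528)) (M
  23806086226160247)) (B 5 7 (B 5 8 (B 5 9 (F 5 (M 47944768821478400)) (M 23788425320639129)) (M
  23806017506683528)) (M 23806086226160247))))⟩,
  ⟨61223226026283079561449510001450222576532481282031922, 37282593538842640,
  F 0 (B 4 9 (F 4 (R 200 11649936536080)) (B 4 10 (R 200 10619144385040) (M 28292024679574169)))⟩,
  ⟨61223226026283079561449510001450222576532481282031922, 127896613036048,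
  F 0 (B 4 8 (R 201 11649936536080) (B 4 9 (R 201 11585512026640) (M 28327209051658632)))⟩,
  ⟨934192291660813591941063079855968603319614718258, 353264214032,
  F 0 (B 4 5 (R 199 11649936536080) (B 4 6 (R 199 11649920803600) (B 4 7 (R 202 11649936536080) (B
  4 8 (R 202 11645910004240) (M 28327346490607735)))))⟩,
  ⟨216173867871655719519676313500416885042, 7156853337850191888,
  F 0 (B 3 7 (F 3 (R 197 11649417487120)) (B 3 8 (F 3 (R 197 11645139297040)) (B 3 9 (F 3 (R 197
  11576436597520)) (B 3 10 (R 197 10476941746960) (R 203 11649936536080)))))⟩,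
  ⟨2980410581937522098482, 23151528095326224,
  F 0 (B 2 6 (F 2 (R 197 11649936536080)) (B 2 7 (F 2 (R 197 11649684877840)) (B 2 8 (F 2 (R 197
  11645406687760)) (B 2 9 (F 2 (R 197 11576703988240)) (B 2 10 (R 197 10477209137680) (B 3 4 (R
  164 11649936532240) (B 3 5 (B 3 6 (F 3 (R 197 11649936532240)) (B 3 7 (F 3 (R 197
  11649684874000)) (B 3 8 (F 3 (R 197 11645406683920)) (B 3 9 (F 3 (R 197 11576703984400)) (B 3 10
  (R 197 10477209133840) (B 5 4 (B 5 6 (F 5 (M 24069900297349785)) (B 5 7 (F 5 (M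
  24069831846308505)) (B 5 8 (F 5 (M 24052239928699545)) (M 28485196480284791)))) (B 5 6 (R 198
  11649936536080) (B 5 7 (R 198 11649684877840) (M 23823747668539238))))))))) (B 3 6 (R 204
  11649936536080) (B 3 7 (R 204 11649684877840) (B 3 8 (R 204 11645406687760) (B 3 9 (R 204
  11576703988240) (R 203 10477209137680))))))))))))⟩,
  ⟨0, 70580005052432,
  F 0 (B 1 4 (F 1 (R 30 11649936536080)) (B 1 5 (F 1 (R 151 11649936536080)) (B 1 6 (F 1 (R 151
  11649918841345)) (B 1 7 (F 1 (R 151 11649650471425)) (B 1 8 (F 1 (R 151 11645355569665)) (B 1 9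
  (F 1 (R 151 11576636158465)) (B 1 10 (R 151 10477124596225) (B 2 3 (B 2 4 (F 2 (R 30
  11649936535840)) (B 2 5 (F 2 (R 151 11649935552770)) (B 2 6 (F 2 (R 151 11649918841090)) (B 2 7
  (F 2 (R 151 11649650471170)) (B 2 8 (F 2 (R 151 11645355569410)) (B 2 9 (F 2 (R 151
  11576636158210)) (B 2 10 (R 151 10477124595970) (R 156 11649936536080)))))))) (B 2 4 (R 164
  11649936536080) (B 2 5 (R 205 11649936536080) (B 2 6 (R 205 11649920807440) (B 2 7 (R 205
  11649653420560) (B 2 8 (R 205 11645359501840) (B 2 9 (R 205 11576641073680) (B 2 10 (R 205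
  10477130494480) (B 3 4 (R 164 11649936532240) (B 3 5 (R 205 11649936532240) (B 3 6 (R 205
  11649920803600) (B 3 7 (R 205 11649653416720) (B 3 8 (R 205 11645359498000) (B 3 9 (R 205
  11576641069840) (B 3 10 (R 205 10477130490640) (R 156 11649936528160)))))))))))))))))))))))⟩,
  ⟨7233436663786058289, 688029204308634125380365766686220304,
  F 0 (F 1 (F 2 (F 3 (F 4 (B 5 8 (F 5 (B 7 6 (F 7 (M 48015137010906914)) (B 7 9 (F 7 (M
  47960912245585813)) (M 42049937734675063)))) (B 5 9 (F 5 (M 47997617605468689)) (M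
  43212611720864273)))))))⟩,
  ⟨9539858024974401842, 3012132321015293918360017823670288,
  F 0 (F 1 (F 2 (F 3 (F 4 (B 5 7 (B 5 8 (F 5 (M 47996304915191155)) (B 5 9 (F 5 (M
  47961262293800305)) (M 19284482907482709))) (M 19284482907482741))))))⟩,
  ⟨7233436663786058289, 10335699674846695615824633339920,
  F 0 (F 1 (F 2 (F 3 (B 4 8 (F 4 (B 5 8 (R 207 11640829591840) (B 6 7 (R 207 11636818788640) (M
  23788356869597849)))) (B 4 9 (F 4 (R 208 11649936536080)) (B 4 10 (R 208 10490295227440) (B 5 7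
  (B 5 8 (F 5 (M 47996304915191155)) (B 5 9 (F 5 (M 47961262293800305)) (M 43176187958154609))) (M
  28291887777491609))))))))⟩,
  ⟨145566446273089, 10335064988791397935507912597520,
  F 0 (F 1 (F 2 (F 3 (B 5 7 (F 5 (R 206 11649059074405)) (B 5 8 (F 5 (R 206 11644764172645)) (B 5
  9 (F 5 (R 206 11576044761445)) (M 24070106724211044)))))))⟩,
  ⟨625499504123953274831154, 10336009159856516960893358120976,
  F 0 (F 1 (F 2 (F 3 (B 5 8 (F 5 (B 6 7 (B 6 8 (F 6 (M 28804123301292676)) (M 23770764951988889))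
  (M 23788356869597849))) (B 5 9 (F 5 (M 37562764207630916)) (M 37562764476062020))))))⟩,
  ⟨776911460344871843414322, 40371338129830559626066731024,
  F 0 (F 1 (F 2 (F 3 (B 5 6 (R 210 11645910004240) (B 5 7 (R 211 11649936536080) (M
  28291888314362487))))))⟩,
  ⟨108105438409265, 40371338129830559626066731024,
  F 0 (F 1 (F 2 (F 3 (B 4 5 (R 206 11649865371715) (B 4 6 (R 206 11649865310275) (B 4 7 (R 209
  11649936536080) (B 4 8 (R 209 11645910004240) (B 4 9 (B 4 10 (B 5 6 (R 210 11649936536080) (B 5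
  7 (R 211 11649936536080) (B 5 8 (R 211 11645910004240) (B 5 9 (R 211 9322600993840) (M
  24070106724211044))))) (R 212 11649936536080)) (R 212 10619144385040)))))))))⟩,
  ⟨32759211595284786, 688029045217627763920493132522790928,
  F 0 (F 1 (F 2 (F 3 (F 4 (B 5 7 (F 5 (M 24069831048342169)) (B 5 8 (F 5 (B 6 8 (F 6 (F 8 (R 206
  11644763865445))) (M 47978922394015105))) (B 5 9 (F 5 (M 47944842382172785)) (M
  43159836497568369))))))))⟩,
  ⟨2166656275778734469681, 198748234467595473716998522656281141264,
  F 0 (F 1 (F 2 (F 3 (F 4 (F 5 (B 8 6 (F 8 (R 214 11637054579520)) (B 8 7 (F 8 (R 214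
  11636803060000)) (M 37899350060332851))))))))⟩,
  ⟨200178539826053011019477553, 2687613457876579736714662723526672,
  F 0 (F 1 (F 2 (F 3 (F 4 (B 8 6 (R 214 11637054579520) (M 47978922394015105))))))⟩,
  ⟨141993985689455006698254897, 693263095643008654331270674509799440,
  F 0 (F 1 (F 2 (F 3 (F 4 (B 5 9 (F 5 (R 215 11649936536080)) (B 5 10 (R 215 10619144385040) (R
  216 11649936536080)))))))⟩,
  ⟨625499359430413224325681, 771105794954185005976981073790312464,
  F 0 (F 1 (F 2 (F 3 (F 4 (B 5 7 (F 5 (M 24069831048342169)) (B 5 8 (F 5 (M 47944773931131505)) (B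
  5 9 (F 5 (M 47996510536750435)) (M 32795556661209685))))))))⟩,
  ⟨625499359430413224325681, 3012132011535006463497818744102928,
  F 0 (F 1 (F 2 (F 3 (F 4 (B 5 6 (R 218 11649936536080) (B 5 7 (R 218 11585260229680) (M
  37264177538050645)))))))⟩,
  ⟨2146983691620056117809, 10335390194559240753625553772560,
  F 0 (F 1 (F 2 (F 3 (B 4 8 (F 4 (B 5 6 (R 214 11649936536080) (B 5 7 (R 214 11641600156720) (B 5
  8 (R 217 11649936536080) (B 6 7 (B 6 8 (F 6 (R 216 11645894214160)) (R 217 11645894214160)) (M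
  23788356869597849)))))) (B 4 9 (F 4 (R 219 11649936536080)) (B 4 10 (R 219 10490043569200) (B 5
  6 (B 5 7 (F 5 (M 24053133556624008)) (M 37263902660143769)) (B 5 7 (B 5 9 (F 5 (M
  47996309226935665)) (M 43211234891289969)) (M 37263902660143769)))))))))⟩,
  ⟨27974128132764209, 40372617891147417299919642640,
  F 0 (F 1 (F 2 (F 3 (B 4 5 (R 206 11649597001795) (B 4 7 (R 206 11649596878915) (B 4 6 (R 220
  11649936536080) (B 4 8 (R 220 11640845381920) (B 5 7 (B 5 6 (F 5 (M 24069831048342169)) (B 5 8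
  (F 5 (M 46518703045502481)) (B 5 9 (F 5 (M 24034853901085300)) (M 24034922620557684)))) (B 5 6
  (B 5 8 (F 5 (B 6 7 (B 6 8 (F 6 (R 213 11631718653985)) (R 220 11631702986785)) (M
  23788356869597849))) (B 5 9 (F 5 (M 24070038004738660)) (M 24070106724211044))) (B 5 8 (B 5 9 (F
  5 (M 24034853632649860)) (M 24034922352122244)) (B 7 9 (B 7 10 (F 7 (M 38390902615472035)) (M
  32760578179115605)) (M 32760646898587989))))))))))))⟩,
  ⟨3012295423317861587738607281582641, 616017584635837639893008,
  F 0 (F 1 (F 2 (B 5 6 (B 5 8 (F 5 (R 221 11631702986785)) (M 33007764562282658)) (M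
  33007904433923601))))⟩,
  ⟨158914206350832871789376049, 11686913716413824658180055048208,
  F 0 (F 1 (F 2 (F 3 (B 4 8 (F 4 (R 213 11640845320480)) (B 4 9 (F 4 (R 206 11576582443075)) (B 4
  10 (B 5 7 (B 5 6 (F 5 (R 221 11631718715425)) (B 5 8 (F 5 (M 46588728192296465)) (B 5 9 (F 5 (R
  221 9217443975235)) (M 37546819142588723)))) (R 222 11649936536080)) (B 5 7 (B 5 6 (F 5 (R 221
  11631718715425)) (B 5 8 (F 5 (M 47996309226935665)) (M 28274296128318088))) (R 222
  10610053169440))))))))⟩]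

def eleven_7 : List Lem := [
  ⟨2424838071098445738545, 45651996945404502905861513232,
  F 0 (F 1 (F 2 (F 3 (B 4 5 (R 206 11576582688835) (B 4 6 (B 4 7 (F 4 (R 221 11636818788640)) (B 4
  8 (F 4 (R 221 11636803060000)) (B 4 10 (F 4 (R 221 9317300441920)) (B 5 6 (B 5 7 (F 5 (R 221
  11631718715425)) (M 37263903197014647)) (B 5 7 (B 5 8 (F 5 (M 47996309226935665)) (M
  32760578179115605)) (M 37264177538050645)))))) (B 4 7 (R 223 11649936536080) (B 4 8 (R 223
  11645910004240) (B 4 9 (R 206 11576582443075) (B 5 6 (B 5 7 (F 5 (R 222 11645910004240)) (R 222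
  11649936536080)) (B 5 7 (B 5 8 (F 5 (M 46588728192296465)) (R 222 11645910004240)) (R 222
  11649936536080)))))))))))⟩,
  ⟨50953298150757204278030512689, 157700576463138757804105744,
  F 0 (F 1 (F 2 (B 5 7 (F 5 (R 221 11631718715425)) (M 37263902660143769))))⟩,
  ⟨12959843700475175585721996096049, 40373826816967031929094348816,
  F 0 (F 1 (F 2 (B 4 8 (F 4 (R 213 11640845320480)) (B 4 9 (F 4 (R 224 11640845320480)) (B 4 10 (R
  224 10610053169440) (B 5 7 (B 5 6 (F 5 (R 225 11649936536080)) (B 5 8 (F 5 (M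
  47996309226935665)) (M 28274295859882649))) (R 222 11640845320480)))))))⟩,
  ⟨108105438409265, 157700501666777803318698000,
  F 0 (F 1 (F 2 (B 3 6 (F 3 (R 213 11649936536080)) (B 3 7 (F 3 (R 221 11649936536080)) (B 3 8 (F
  3 (R 221 11640829653280)) (B 3 9 (F 3 (R 224 11649936536080)) (B 3 10 (R 224 10619144385040) (B
  4 5 (B 4 6 (F 4 (R 213 11649936474640)) (B 4 7 (F 4 (R 221 11640845320480)) (B 4 8 (F 4 (R 221
  11640829591840)) (B 4 9 (F 4 (R 224 11649936474640)) (B 4 10 (R 224 10619144323600) (B 5 6 (F 5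
  (R 213 11649901023745)) (B 5 7 (F 5 (M 47996309226935665)) (M 37263902660143769)))))))) (B 4 6
  (B 4 7 (F 4 (R 221 11636818788640)) (B 4 8 (F 4 (R 221 11636803060000)) (B 4 9 (F 4 (R 224
  11649920746000)) (B 4 10 (R 224 10619128594960) (B 5 6 (R 225 11649936536080) (B 5 7 (B 5 8 (F 5
  (M 47996309226935665)) (M 32760303301208729)) (M 37263902660143769))))))) (B 4 7 (R 226
  11649936536080) (B 4 8 (R 226 11645910004240) (B 5 6 (B 5 7 (F 5 (R 221 11631718715425)) (B 5 8
  (F 5 (R 221 11631702986785)) (M 28327072686442615))) (B 5 7 (B 5 8 (F 5 (M 46588728192296465))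
  (M 37563937022043665)) (M 33077929580717585))))))))))))))⟩,
  ⟨198889610549745174573101617, 616017876806863465553936,
  F 0 (F 1 (F 2 (B 5 7 (R 227 11631718715425) (B 5 8 (R 227 11631702986785) (M
  24106120024983698)))))⟩,
  ⟨854548980221820666847125380662440497, 2406318687711433662480,
  F 0 (F 1 (F 2 (B 5 6 (R 228 11649936536080) (B 5 7 (B 5 8 (B 5 9 (F 5 (M 24071136449964646)) (M
  24071205169437030)) (M 24106189298099841)) (M 24106258017576561)))))⟩,
  ⟨620758546202370357932593, 50624384713946654185344802832,
  F 0 (F 1 (F 2 (B 4 5 (R 227 11649936474640) (B 4 6 (R 227 11649920746000) (B 4 7 (R 227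
  11640845320480) (B 4 8 (R 227 11640829591840) (B 4 9 (R 206 9304276635715) (B 4 10 (R 206
  9304276574275) (R 229 11649936536080)))))))))⟩,
  ⟨217435310941001174839960290389305406001, 2406318687711433662480,
  F 0 (F 1 (F 2 (B 5 6 (R 228 10615117853200) (B 5 7 (B 5 8 (B 5 9 (F 5 (M 24070037206772326)) (M
  24071205169437030)) (M 24053618898396801)) (M 24071211084441201)))))⟩,
  ⟨620758546202370357932593, 178328113067407983205490704,
  F 0 (F 1 (F 2 (B 3 10 (R 230 11649936536080) (B 4 5 (R 227 11649936474640) (B 4 6 (R 227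
  11649920746000) (B 4 7 (R 227 11640845320480) (B 4 8 (R 227 11640829591840) (B 4 9 (B 4 10 (R
  230 11640845320480) (B 9 5 (B 9 6 (F 9 (M 28239386097265288)) (M 37281495383059046)) (M
  37281564102535765))) (R 231 11649936536080)))))))))⟩,
  ⟨108105438409265, 616017584057494523682832,
  F 0 (F 1 (F 2 (B 3 5 (R 227 11649936536080) (B 3 6 (R 227 11649920807440) (B 3 7 (R 227
  11640845381920) (B 3 8 (R 227 11640829653280) (B 3 9 (R 232 11649936536080) (B 3 10 (R 232
  10610053230880) (B 4 5 (R 227 11649936474640) (B 4 6 (R 227 11649920746000) (B 4 7 (R 227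
  11640845320480) (B 4 8 (R 227 11640829591840) (R 229 11640845320480)))))))))))))⟩,
  ⟨6443570, 2646018672551868665631119658524688,
  F 0 (F 1 (F 2 (F 3 (F 5 (B 7 6 (F 7 (R 206 11649059677555)) (B 7 8 (F 7 (R 233 11631683203090))
  (B 7 9 (F 7 (M 47995205403572053)) (M 43210131067926357))))))))⟩,
  ⟨108114045190450, 2707896487725327903076358698377232,
  F 0 (F 1 (F 2 (F 3 (F 5 (B 7 6 (F 7 (R 234 11631718715425)) (M 23788356869597849))))))⟩,
  ⟨108114045190450, 3032415041383754629859514718953488,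
  F 0 (F 1 (F 2 (F 3 (F 5 (B 7 6 (F 7 (R 206 11649059677555)) (B 7 4 (F 7 (R 235 11640774357250))
  (B 7 8 (F 7 (R 233 11631683203090)) (M 23788357406468727))))))))⟩,
  ⟨108105455255858, 10336010439655736691374277337104,
  F 0 (F 1 (F 2 (F 3 (B 5 4 (F 5 (R 234 11649936536080)) (B 5 8 (F 5 (R 235 11649936536080)) (B 5
  9 (F 5 (R 236 11649936536080)) (B 5 10 (F 5 (R 236 10619144385040)) (M
  24069831048342169))))))))⟩,
  ⟨129078334276161, 693221421629521428995849537900847120,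
  F 0 (F 1 (F 2 (F 3 (F 5 (B 4 9 (F 4 (M 47961326164661635)) (M 43176320280057219))))))⟩,
  ⟨630240316770281207181873, 3032414421133935840074833504313360,
  F 0 (F 1 (F 2 (F 3 (F 5 (B 4 6 (B 4 7 (F 4 (M 19196727600917145)) (B 4 8 (F 4 (M
  47997480957195008)) (B 4 9 (F 4 (M 47997480957195008)) (M 32795556929640789)))) (M
  24070038004738660))))))⟩,
  ⟨2165574548618393760305, 10335390189836946906693062696976,
  F 0 (F 1 (F 2 (F 3 (B 5 8 (F 5 (B 4 6 (B 4 7 (F 4 (M 19196727600917145)) (B 4 9 (F 4 (M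
  47978712729146755)) (M 43193638393501059))) (B 4 7 (R 238 11649936536080) (B 4 8 (R 237
  11645858763265) (B 6 8 (R 238 11645874491905) (M 32830741033289813)))))) (B 5 9 (F 5 (R 239
  11649936536080)) (B 5 10 (R 239 10619144385040) (M 24069694413646489)))))))⟩,
  ⟨554387085025755743203889, 3032656749176425100358188772958224,
  F 0 (F 1 (F 2 (F 3 (F 5 (B 6 7 (R 237 11649920807440) (B 6 8 (B 6 4 (F 6 (R 240 11645874430465))
  (M 23999669268949606)) (M 23788563028028006)))))))⟩,
  ⟨554387085025755743203889, 10577718232326207190048331341840,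
  F 0 (F 1 (F 2 (F 3 (B 5 9 (F 5 (R 241 11649936536080)) (B 5 10 (R 241 10619144385040) (B 6 7 (R
  237 11649920807440) (M 23788356869597849)))))))⟩,
  ⟨27674996545499697, 40372617929050290106985947152,
  F 0 (F 1 (F 2 (F 3 (B 5 6 (R 233 11631718715425) (B 5 7 (R 237 11649936536080) (B 5 4 (R 240
  11649936536080) (B 5 8 (R 242 11649936536080) (B 6 7 (R 237 11649920807440) (B 6 4 (R 240
  11649920807440) (B 6 8 (R 242 11649920807440) (M 28804195780954274)))))))))))⟩,
  ⟨11846316644859554831169749070385, 616017584917312616603664,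
  F 0 (F 1 (F 2 (B 4 7 (B 4 8 (F 4 (R 243 11640845320480)) (M 24035820537153698)) (M
  24035889256626082))))⟩,
  ⟨620758690316394497651249, 11686911227726760821814181568528,
  F 0 (F 1 (F 2 (F 3 (B 5 7 (F 5 (R 243 11649901023745)) (B 5 8 (F 5 (R 243 11645874491905)) (B 5
  9 (F 5 (B 4 6 (B 4 7 (F 4 (R 243 11649936474640)) (B 4 8 (F 4 (R 243 11645909942800)) (M
  37492874353355332))) (M 24070038004738660))) (B 4 6 (B 4 7 (F 4 (R 243 11649936474640)) (B 4 8
  (F 4 (R 243 11645909942800)) (B 4 9 (F 4 (M 37281564102535765)) (M 37511634770499891)))) (R 244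
  11649936536080))))))))⟩,
  ⟨41320420530960470578735166001, 3033765945869476440313756737675280,
  F 0 (F 1 (F 2 (F 3 (F 5 (B 6 4 (R 245 11649920807440) (M 37562764207630916))))))⟩,
  ⟨158914224721576438339285553, 11686914925377547145616296058896,
  F 0 (F 1 (F 2 (F 3 (B 5 8 (F 5 (R 243 11631718715425)) (B 5 9 (F 5 (R 246 11649936536080)) (B 6
  7 (B 6 4 (F 6 (R 245 11649920807440)) (B 6 8 (F 6 (R 243 11631718653985)) (B 6 9 (F 6 (R 246
  11649920807440)) (M 28804602995448195)))) (B 6 4 (R 245 11649920807440) (M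
  33308071108363264))))))))⟩,
  ⟨2424837771966858474033, 45651996983307375712927817744,
  F 0 (F 1 (F 2 (F 3 (B 5 6 (R 233 11631718715425) (B 5 4 (R 245 11649936536080) (B 5 7 (R 247
  11649936536080) (B 5 8 (R 247 11645910004240) (B 6 4 (R 245 11649920807440) (R 244
  10619108872705)))))))))⟩,
  ⟨3017448735033142690098, 157700501739413740472836112,
  F 0 (F 1 (F 2 (B 5 7 (F 5 (R 243 11649901023745)) (B 5 8 (F 5 (R 243 11645874491905)) (B 5 9 (F
  5 (R 248 11649901023745)) (B 5 10 (R 248 10619108872705) (M 24069694413646489)))))))⟩,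
  ⟨12955510910356047498326399070769, 11845371250406075820803383959568,
  F 0 (F 1 (F 2 (F 5 (B 6 7 (B 6 4 (F 6 (R 249 11649900962305)) (M 37562764207630916)) (M
  23700600495581814)))))⟩,
  ⟨12959843700493546329288546005553, 40375035780689519365335359504,
  F 0 (F 1 (F 2 (B 5 8 (F 5 (R 243 11631718715425)) (B 5 9 (F 5 (R 250 11649936536080)) (B 5 10 (R
  250 10619144385040) (R 249 11649901023745))))))⟩,
  ⟨12959846194199426971470447919410, 616017732691675389698064,
  F 0 (F 1 (F 2 (B 6 4 (R 249 11645894275600) (R 244 11649901023745))))⟩,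
  ⟨27674996545499697, 157700539569650610385002512,
  F 0 (F 1 (F 2 (B 3 7 (F 3 (R 243 11649936536080)) (B 3 8 (F 3 (R 243 11645910004240)) (B 3 9 (F
  3 (R 248 11649936536080)) (B 3 10 (R 248 10619144385040) (B 5 6 (R 233 11631718715425) (B 5 4 (R
  249 11649936536080) (B 5 7 (R 251 11649936536080) (B 5 8 (R 251 11645910004240) (R 252
  11649936536080)))))))))))⟩,
  ⟨11846316569006322523694331671089, 157715003045924146992193552,
  F 0 (F 1 (F 2 (B 7 4 (F 7 (R 253 11640774357250)) (B 7 6 (F 7 (R 253 11631683203090)) (M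
  24053481727878801)))))⟩,
  ⟨1649558066, 157700501739413740472836112,
  F 0 (F 1 (F 2 (B 5 6 (F 5 (R 233 11631718715425)) (R 253 11649901023745))))⟩]

def eleven_8 : List Lem := [
  ⟨12005391939649323160674649584177, 11846315426470262490164117970960,
  F 0 (F 1 (F 2 (F 5 (B 7 4 (R 255 11640845381920) (M 33607138003731456)))))⟩,
  ⟨158923669526599771667640881, 3033766890045540626983117471686672,
  F 0 (F 1 (F 2 (F 3 (F 5 (B 7 8 (R 233 11631683203090) (B 7 9 (R 206 11571750270355) (R 256
  11649936536080)))))))⟩,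
  ⟨40684459399818927310387622449, 11687859101441733814977030070288,
  F 0 (F 1 (F 2 (F 3 (B 5 9 (F 5 (R 257 11649936536080)) (B 7 8 (R 233 11631683203090) (B 7 4 (R
  255 11640845381920) (B 7 6 (B 7 9 (F 7 (R 257 11640845381920)) (B 6 8 (R 255 11631702986785) (M
  37810633216915251))) (B 8 9 (B 8 10 (F 8 (M 24070936189761442)) (M 32760647167019093)) (R 256
  11645874491905)))))))))⟩,
  ⟨2424986972396212793905, 11686916139302434404220759253008,
  F 0 (F 1 (F 2 (F 3 (B 7 8 (F 7 (R 233 11631683203090)) (R 258 11640845381920)))))⟩,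
  ⟨2423684850462251627057, 45652001982375019688216305680,
  F 0 (F 1 (F 2 (F 3 (B 5 7 (B 5 4 (F 5 (R 253 11649901023745)) (B 5 6 (F 5 (R 233
  11631718715425)) (B 5 8 (F 5 (R 253 11631718715425)) (B 5 9 (F 5 (R 206 11571750278995)) (R 254
  11649936536080))))) (B 5 4 (R 255 11649936536080) (B 5 6 (R 233 11631718715425) (B 5 8 (R 258
  11649936536080) (B 5 9 (B 7 9 (R 206 11571750270355) (B 7 4 (R 255 11640845381920) (B 7 6 (R 259
  11649936536080) (M 33589408376636416)))) (B 7 4 (R 255 11640845381920) (B 7 6 (R 259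
  11649936536080) (M 24053481727878801)))))))))))⟩,
  ⟨3317719989744218955656963307942449, 41319211844876188726069370896,
  F 0 (F 1 (F 2 (B 5 9 (F 5 (R 260 11631702986785)) (B 5 10 (R 260 10600910835745) (B 7 8 (R 233
  11631683203090) (B 7 4 (R 255 11640845381920) (B 7 6 (B 7 9 (F 7 (R 260 11631667474450)) (M
  43193642705245569)) (M 23788356869597849))))))))⟩,
  ⟨7161376806300365361, 157705538637294585673490448,
  F 0 (F 1 (F 2 (B 3 8 (F 3 (R 253 11640845381920)) (B 3 9 (F 3 (R 260 11649936536080)) (B 3 10 (R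
  260 10610053230880) (B 5 7 (B 5 4 (F 5 (R 255 11649936536080)) (B 5 6 (F 5 (R 233
  11631718715425)) (B 5 8 (F 5 (R 255 11631683203090)) (R 254 11649901023745)))) (B 5 4 (R 255
  11649936536080) (B 5 6 (R 233 11631718715425) (B 5 8 (R 261 11649936536080) (B 7 4 (R 255
  11640845381920) (B 7 6 (B 7 8 (F 7 (R 233 11631683203090)) (R 261 11640845381920)) (M
  37563937022043665))))))))))))⟩,
  ⟨859436957374073010183008722891125297, 180826541314249296311296016,
  F 0 (F 1 (F 2 (B 9 4 (B 9 6 (F 9 (M 24034854437947511)) (B 9 7 (F 9 (M 42313820524292744)) (M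
  42313824820295586))) (B 9 6 (B 9 7 (F 9 (M 43158247063988872)) (M 24088528107370402)) (M
  24088666099967601)))))⟩,
  ⟨2707975715826451475476828569809457, 12960482084401535429313977982992,
  F 0 (F 1 (F 2 (B 5 10 (R 206 9304007551315) (R 263 11649936536080))))⟩,
  ⟨11846316644859478269976083771953, 2406318687711433662480,
  F 0 (F 1 (F 2 (B 4 7 (B 4 8 (R 255 11640758628610) (M 24035820537153698)) (M
  24035889256626082))))⟩,
  ⟨859761638719330604600775608948044337, 616017584635837639893008,
  F 0 (F 1 (F 2 (B 4 6 (B 4 7 (R 262 11649920746000) (B 4 8 (R 262 11636803060000) (R 252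
  11649885295105))) (R 265 11649936536080))))⟩,
  ⟨620758546201206421795377, 178328113067986326321700880,
  F 0 (F 1 (F 2 (B 3 10 (B 5 4 (R 255 11649936536080) (B 5 6 (R 233 11631718715425) (B 5 7 (R 262
  11649901023745) (B 5 8 (R 262 11631702986785) (B 5 9 (R 264 11649936536080) (B 5 10 (R 264
  10619144385040) (R 266 11649936536080))))))) (B 5 4 (R 255 11649936536080) (B 5 6 (R 233
  11631718715425) (B 5 7 (R 262 11649901023745) (B 5 8 (R 262 11631702986785) (B 5 9 (R 263
  11649901023745) (B 4 6 (B 4 7 (R 262 11649920746000) (B 4 8 (R 262 11636803060000) (R 244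
  11649936474640))) (R 265 10619108872705))))))))))⟩,
  ⟨27674996545499697, 616017584635837639893008,
  F 0 (F 1 (F 2 (B 3 6 (R 253 11649936536080) (B 3 7 (R 262 11649936536080) (B 3 8 (R 262
  11640829653280) (B 3 9 (R 267 11649936536080) (B 3 10 (R 267 10619144385040) (B 5 4 (R 255
  11649936536080) (B 5 6 (R 233 11631718715425) (B 5 7 (R 262 11649901023745) (B 5 8 (R 262
  11631702986785) (R 266 11649901023745))))))))))))⟩,
  ⟨10498800768488541437971306459697, 46292884078875049907128967184,
  F 0 (F 1 (F 2 (B 9 6 (F 9 (M 28239386902562935)) (B 9 7 (F 9 (M 42296234241722530)) (M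
  42296234510153634)))))⟩,
  ⟨688049407163665310009883366787199537, 179617615494634667136589840,
  F 0 (F 1 (F 2 (B 9 5 (R 269 11649936536080) (B 9 6 (R 269 11649920807440) (M
  37281838980425301)))))⟩,
  ⟨3012295422108935764182164496790065, 772152055395463603494928,
  F 0 (F 1 (F 2 (B 4 10 (R 270 10610053230880) (R 229 11640845381920))))⟩,
  ⟨50604970788707053018082783793, 2406318687711433662480,
  F 0 (F 1 (F 2 (B 4 5 (R 268 11649936474640) (B 4 6 (R 268 11649920746000) (B 4 7 (R 268
  11640845320480) (B 4 8 (R 268 11640829591840) (B 4 9 (R 271 10619144323600) (R 231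
  11640845381920))))))))⟩,
  ⟨108105438409265, 2406318687711433662480,
  F 0 (F 1 (F 2 (B 3 4 (R 233 11649936536080) (B 3 5 (R 268 11649936536080) (B 3 6 (R 268
  11649920807440) (B 3 7 (R 268 11640845381920) (B 3 8 (R 268 11640829653280) (B 3 9 (B 3 10 (B 4
  5 (R 268 11649936474640) (B 4 6 (R 268 11649920746000) (B 4 7 (R 268 11640845320480) (B 4 8 (R
  268 11640829591840) (B 4 9 (R 270 11649936536080) (R 271 11649936536080)))))) (R 272
  11649936536080)) (R 272 10610053230880)))))))))⟩,
  ⟨50952089206490565139551633714, 469309619632965928689680,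
  F 0 (F 1 (F 3 (B 5 7 (B 5 8 (F 5 (M 47961330744841585)) (B 5 9 (F 5 (M 47961262293800305)) (M
  43176187958154609))) (M 28291887777491609))))⟩,
  ⟨2998929668391682851122, 160047517808764016989904912,
  F 0 (F 1 (F 3 (B 4 9 (F 4 (R 273 11485117513780)) (B 4 10 (F 4 (R 273 10385605951540)) (M
  28274295859882649)))))⟩,
  ⟨11714568939542561074, 138286853055700691845193744,
  F 0 (F 1 (F 3 (B 4 5 (R 206 11649865371715) (B 4 6 (R 206 11649865310275) (B 4 7 (B 4 8 (F 4 (R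
  273 11622556397620)) (B 4 9 (F 4 (R 273 11553836986420)) (B 4 10 (R 273 10454325424180) (R 274
  11649936536080)))) (B 4 8 (R 275 11649936536080) (B 4 9 (R 275 11585512026640) (R 275
  10478215631920))))))))⟩,
  ⟨2998929650795235393841, 160123075672489931313324048,
  F 0 (F 1 (F 3 (B 4 9 (F 4 (R 273 11416414814260)) (B 4 10 (F 4 (R 273 10316903252020)) (M
  23753309936462489)))))⟩,
  ⟨2998929650795235393841, 544867483358880252108816,
  F 0 (F 1 (F 3 (B 4 8 (R 277 11649936536080) (B 4 9 (R 277 11585512026640) (M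
  23753447375411592)))))⟩,
  ⟨767725990320997182550577, 544867483358880252108816,
  F 0 (F 1 (F 3 (B 4 5 (R 206 11649597001795) (B 4 7 (R 206 11649596878915) (B 4 6 (B 4 8 (F 4 (R
  273 11622573170740)) (B 4 9 (F 4 (R 273 11553853759540)) (B 4 10 (R 273 10454342197300) (B 5 6
  (B 5 7 (F 5 (M 24053339440327321)) (M 37263902660143769)) (M 23753309936462489))))) (R 278
  11649936536080))))))⟩,
  ⟨9544362723844895281, 158843314355632257460412432,
  F 0 (F 1 (F 3 (B 4 9 (F 4 (R 273 11485151060020)) (B 4 10 (R 273 10385639497780) (R 279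
  11645406549040)))))⟩,
  ⟨2406463369225611326001, 158843314355632257460412432,
  F 0 (F 1 (F 3 (B 4 8 (F 4 (R 278 11645406549040)) (R 280 11649936536080))))⟩,
  ⟨196537854675678502318060081, 158918872219358171783831568,
  F 0 (F 1 (F 3 (B 4 9 (F 4 (R 273 11416431587380)) (B 4 10 (F 4 (R 273 10316920025140)) (M
  23753309936462489)))))⟩,
  ⟨50952003649258126887323058482, 40680832584384870434081939472,
  F 0 (F 1 (F 3 (B 5 7 (F 5 (R 281 11633039640145)) (M 28309480231971447))))⟩,
  ⟨844123821376058698427871420213178929, 45962690881045462603761000464,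
  F 0 (F 1 (F 3 (B 4 10 (R 273 8117896777780) (B 5 6 (R 283 11649936536080) (B 5 8 (R 283
  11504477934640) (M 32760578179115605))))))⟩,
  ⟨196537854675395919239787057, 158909427486392432493404176,
  F 0 (F 1 (F 3 (B 4 5 (R 206 11645302100035) (B 4 6 (B 4 7 (F 4 (R 279 11649920746000)) (R 281
  11649936536080)) (B 4 7 (R 282 11649936536080) (B 4 8 (R 206 11645301915715) (B 4 9 (R 284
  11649936536080) (B 4 10 (R 284 10405234742320) (R 282 11641380017200)))))))))⟩,
  ⟨12880633747960624734064429052465, 540145188933604644823056,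
  F 0 (F 1 (B 4 6 (F 4 (R 276 11649936474640)) (B 4 7 (F 4 (R 280 11641631675200)) (B 4 8 (F 4 (R
  285 11649936474640)) (B 4 9 (F 4 (R 285 11585511965200)) (M 32760303838075272))))))⟩,
  ⟨3318913399143182980399759565599281, 474031986115835573903376,
  F 0 (F 1 (B 4 8 (F 4 (R 286 8423913628480)) (B 4 9 (F 4 (R 286 8419635438400)) (M
  32760303838075272))))⟩]

def eleven_9 : List Lem := [
  ⟨12964505465403053995930054373937, 2146834772588065005584,
  F 0 (F 1 (B 4 8 (F 4 (M 23753309936462489)) (B 4 9 (F 4 (M 23753378655939208)) (M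
  23753447375411592))))⟩,
  ⟨55682126982719395789710213331525365215793, 45963899806865077232935706640,
  F 0 (F 1 (F 4 (B 5 6 (B 5 7 (F 5 (R 281 11633039640145)) (M 28309480231971447)) (B 5 7 (B 5 8 (F
  5 (R 188 11649885294625)) (M 37563937022043665)) (M 28309480231971447)))))⟩,
  ⟨55682126982719395789710213331525365215793, 160118353306007061668110352,
  F 0 (F 1 (B 4 9 (F 4 (R 289 11649936536080)) (B 4 10 (R 289 10619144385040) (R 286
  9523927663120))))⟩,
  ⟨2998929648522895634993, 540145116876010606895120,
  F 0 (F 1 (B 3 6 (F 3 (R 276 11649936536080)) (B 3 7 (F 3 (R 279 11649936536080)) (B 3 8 (F 3 (R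
  285 11649936536080)) (B 3 9 (F 3 (R 285 11585512026640)) (B 3 10 (R 285 10490295366160) (B 4 5
  (R 286 11649936536080) (B 4 6 (B 4 7 (F 4 (R 280 11637337756480)) (R 287 11649936536080)) (B 4 7
  (R 288 11649936536080) (B 4 8 (R 290 11649936536080) (B 4 9 (R 290 11585512026640) (R 286
  11649936474640))))))))))))⟩,
  ⟨9544363823356523057, 701335081723768114061328,
  F 0 (F 3 (B 4 10 (R 273 6949667770420) (R 291 11431465526320)))⟩,
  ⟨196537853522176446981812785, 158914464456330871731986448,
  F 0 (F 1 (F 3 (B 4 7 (R 206 11640738705475) (B 4 5 (R 291 11649936474640) (B 4 6 (R 291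
  11649920746000) (B 4 8 (R 206 11640738644035) (B 4 9 (R 292 11649936536080) (B 4 10 (R 292
  10619144385040) (R 288 11649920746000)))))))))⟩,
  ⟨217508308525921153979099586041164673585, 45963904843835015672174288912,
  F 0 (F 1 (F 4 (B 7 5 (B 7 6 (F 7 (M 32760303301208729)) (M 23806086494595686)) (M
  28309686121966165))))⟩,
  ⟨55682126982719395718856193345063753953841, 160123390275945500906692624,
  F 0 (F 1 (B 4 9 (F 4 (R 294 11649936536080)) (B 4 10 (R 294 10267027120960) (M
  28239317377788569))))⟩,
  ⟨196537853522176446981812785, 545182086814449845477392,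
  F 0 (F 1 (B 3 8 (F 3 (R 293 11649936536080)) (B 3 9 (F 3 (R 293 11585512026640)) (B 3 10 (R 293
  10490295366160) (B 4 7 (B 4 5 (F 4 (R 292 11503424115760)) (B 4 6 (F 4 (R 292 11499397583920))
  (R 288 11649920807440))) (B 4 5 (R 292 11503424115760) (B 4 6 (R 292 11499397583920) (B 4 8 (R
  295 11649936536080) (B 4 9 (R 295 11585512026640) (M 28239454816737672))))))))))⟩,
  ⟨216106366982512942522045188241583387185, 2110234033809587773456,
  F 0 (F 1 (B 5 7 (R 296 11649901023745) (B 5 8 (B 5 9 (F 5 (M 24088528644241282)) (M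
  24071206235838819)) (M 24088798421878883))))⟩,
  ⟨844164386195266020287817859478995506, 8458130911305736208,
  F 0 (F 1 (B 5 8 (B 5 9 (F 5 (M 24088596843620001)) (M 24071005194446481)) (M
  24088597380490881)))⟩,
  ⟨50313690796901356493634351665, 178332835433890852850704400,
  F 0 (F 1 (F 3 (B 4 5 (R 292 11503424115760) (B 4 6 (R 292 11499397583920) (B 4 7 (R 296
  11649936474640) (B 4 8 (R 206 11503299821635) (B 4 9 (R 206 11503299760195) (B 4 10 (B 5 6 (R
  297 11649936536080) (B 5 7 (R 298 11649936536080) (B 8 9 (R 297 8133216965680) (B 8 10 (R 298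
  8133216965680) (M 38390902078609827))))) (B 5 6 (R 297 11649936536080) (B 5 7 (R 298
  11649936536080) (M 41767708445944405)))))))))))⟩,
  ⟨3671576837066618642943627262997626895976182321, 8241958129191952400,
  F 0 (F 1 (B 5 6 (R 297 10619144385040) (B 5 7 (R 298 9523927663120) (M 28309686121966165))))⟩,
  ⟨50313690796901356493634351665, 620739950540364168896528,
  F 0 (F 1 (B 3 9 (F 3 (R 299 11649936536080)) (B 3 10 (R 299 10619144385040) (B 4 5 (R 292
  11503424115760) (B 4 6 (R 292 11499397583920) (B 4 7 (R 296 11649936474640) (B 4 8 (B 4 9 (F 4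
  (R 299 11649936474640)) (B 4 10 (R 299 10619144323600) (M 28239317377788569))) (B 4 9 (B 4 10 (R
  299 8132697920320) (R 300 11649936536080)) (R 300 10619144385040)))))))))⟩,
  ⟨2998929648522895634993, 2109941284440645902352,
  F 0 (F 1 (B 3 5 (R 291 11649936536080) (B 3 6 (R 291 11649920807440) (B 3 7 (R 296
  11649936536080) (B 3 8 (R 301 11649936536080) (B 3 10 (R 301 10490295366160) (B 4 5 (R 292
  11503424115760) (B 4 6 (R 292 11499397583920) (B 4 7 (R 296 11649936474640) (B 4 8 (R 301
  11649936474640) (B 4 9 (R 301 11585511965200) (R 300 9523927724560))))))))))))⟩,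
  ⟨11714533694789271858, 41303495532520037441154916368,
  F 0 (F 1 (F 3 (F 5 (B 7 6 (R 206 11649059677555) (M 23788356869597849)))))⟩,
  ⟨767725990024129059897650, 141989226281143300759035920,
  F 0 (F 1 (F 3 (B 5 8 (F 5 (R 303 11649936536080)) (B 5 9 (F 5 (R 303 11585512026640)) (B 5 10 (F
  5 (R 303 10490295366160)) (M 24069831048342169))))))⟩,
  ⟨767725990021865595286065, 36349312801372804213563793424,
  F 0 (F 1 (F 3 (B 5 4 (F 5 (B 7 4 (F 7 (R 206 11649595556725)) (B 7 8 (F 7 (R 273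
  11639430062935)) (M 38460240567489908)))) (R 304 11649936536080))))⟩,
  ⟨50313690833938958665193173553, 41301002085186845398569918480,
  F 0 (F 1 (F 3 (F 5 (B 4 6 (B 4 7 (F 4 (M 48014866195178001)) (B 4 8 (F 4 (M 48015073142190848))
  (M 32830741033289813))) (M 24087561471306340)))))⟩,
  ⟨50313690833938958665193173553, 139495778947951258174038032,
  F 0 (F 1 (F 3 (B 5 8 (F 5 (R 306 11649936536080)) (B 5 9 (F 5 (R 306 11585512026640)) (B 5 10 (R
  306 10490295366160) (M 24069694413646489))))))⟩,
  ⟨3297358043777563776379044705153585, 46274598502775392607546712080,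
  F 0 (F 1 (F 3 (F 5 (B 6 4 (R 307 11649920807440) (M 23999669268949606)))))⟩,
  ⟨12880304853488373997736392995377, 11846297287583900626751208890384,
  F 0 (F 1 (F 3 (F 5 (B 6 7 (R 305 11649920807440) (R 308 11649936536080)))))⟩,
  ⟨13122964208262464790928228954673, 139566652275431172764409872,
  F 0 (F 1 (F 3 (B 6 7 (R 305 11649920807440) (M 23788356869597849))))⟩,
  ⟨12880304853488373997736392995377, 41301072958514325313160290320,
  F 0 (F 1 (F 3 (B 5 9 (F 5 (R 309 11649936536080)) (B 5 10 (R 309 10619144385040) (R 310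
  11649936536080)))))⟩,
  ⟨767725990021865595286065, 139566652275431172764409872,
  F 0 (F 1 (F 3 (B 5 6 (R 302 11649901023745) (B 5 7 (R 305 11649936536080) (B 5 4 (R 307
  11649936536080) (B 5 8 (R 311 11649936536080) (B 5 9 (R 311 11585512026640) (R 310
  10490295366160))))))))⟩,
  ⟨767725995407406960689714, 10578009512575406835764845158416,
  F 0 (F 1 (F 3 (F 5 (B 4 9 (F 4 (M 47978922394015105)) (M 43193916509410689)))))⟩,
  ⟨50313690833938958665193173553, 10578026437536881440573291044880,
  F 0 (F 1 (F 3 (F 5 (B 4 6 (B 4 7 (F 4 (R 312 11649936474640)) (R 313 11649936536080)) (M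
  24087561471306340)))))⟩,
  ⟨3297358986739961550320264697426481, 11845677037765110842069994250256,
  F 0 (F 1 (F 3 (F 5 (B 4 6 (B 4 7 (F 4 (R 312 11649936474640)) (B 4 9 (F 4 (R 314
  11585511965200)) (M 32830740764858709))) (M 24052446087129700)))))⟩,
  ⟨50313690797045470517774070321, 40680823139724540631945650192,
  F 0 (F 1 (F 3 (B 5 7 (F 5 (R 312 11649901023745)) (B 5 8 (F 5 (R 314 11649936536080)) (B 5 9 (F
  5 (R 315 11649936536080)) (B 5 10 (R 315 10619144385040) (M 24052239928699545)))))))⟩,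
  ⟨3297358986730258342824061685543473, 11845680735415897165872108740624,
  F 0 (F 1 (F 3 (F 5 (B 6 7 (B 6 4 (F 6 (R 316 11649920807440)) (B 6 8 (F 6 (R 303
  11645894275600)) (M 46553949677848627))) (M 23700531777153654)))))⟩,
  ⟨12880304844043641031997102567985, 40684520790510864434060140560,
  F 0 (F 1 (F 3 (B 5 8 (F 5 (R 303 11645910004240)) (B 5 9 (F 5 (R 317 11649936536080)) (B 5 10 (R
  317 10619144385040) (R 171 11649901023265))))))⟩,
  ⟨3297358042559193223798676240020017, 11846316630397014460818004189200,
  F 0 (F 1 (F 3 (F 5 (B 6 4 (R 316 11649920807440) (M 33094348683913796)))))⟩]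

def eleven_10 : List Lem := [
  ⟨3297358042559193223798676240020017, 41320415771628159379955589136,
  F 0 (F 1 (F 3 (B 5 9 (F 5 (R 319 11649936536080)) (B 5 10 (R 319 10619144385040) (M
  23770764951988889)))))⟩,
  ⟨196537854675096787652522545, 158909465389265239559708688,
  F 0 (F 1 (F 3 (B 5 6 (R 302 11649901023745) (B 5 4 (R 316 11649936536080) (B 5 7 (R 318
  11649936536080) (B 5 8 (R 320 11649936536080) (B 6 4 (R 316 11649920807440) (B 6 7 (R 318
  11649920807440) (B 6 8 (R 320 11649920807440) (M 28804602997540979))))))))))⟩,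
  ⟨3318913399143182904400416342094385, 540145189511947761033232,
  F 0 (F 1 (B 5 7 (F 5 (R 312 11649901023745)) (B 5 8 (F 5 (R 321 11649901023745)) (B 5 9 (F 5 (R
  321 11585476514305)) (M 32988931131742600)))))⟩,
  ⟨55682126982719396998654403689721089831473, 46274593780408909737901498384,
  F 0 (F 1 (F 5 (B 6 4 (R 322 11649920807440) (M 33094348683913796))))⟩,
  ⟨55682126982719396998654403689721089831473, 161327317028494497909121040,
  F 0 (F 1 (B 5 9 (F 5 (R 323 11649936536080)) (B 5 10 (R 323 10619144385040) (M
  23770764951988889))))⟩,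
  ⟨767725990021865595286065, 540183019748817673199632,
  F 0 (F 1 (B 3 7 (F 3 (R 312 11649936536080)) (B 3 8 (F 3 (R 321 11649936536080)) (B 3 9 (F 3 (R
  321 11585512026640)) (B 3 10 (R 321 10490295366160) (B 5 6 (R 302 11649901023745) (B 5 4 (R 322
  11649936536080) (B 5 7 (B 5 8 (F 5 (M 23770764951988889)) (B 5 9 (F 5 (M 23770765220424328)) (M
  23770765488855432))) (B 5 8 (R 324 11649936536080) (B 5 9 (R 324 11585512026640) (M
  23770765488855432)))))))))))⟩,
  ⟨196537909006806430691504689, 11845680740414964809847397228560,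
  F 0 (F 1 (F 3 (F 5 (B 7 4 (F 7 (R 273 11441945191255)) (M 24034853901085300)))))⟩,
  ⟨45760034920088114, 540145189511947761033232,
  F 0 (F 1 (B 5 6 (F 5 (R 302 11649901023745)) (R 325 11649901023745)))⟩,
  ⟨3297358042493043199550353787925041, 11846316635396082104793292677136,
  F 0 (F 1 (F 3 (F 5 (B 7 8 (R 206 11640469747075) (B 7 4 (B 7 6 (F 7 (M 47981951176544512)) (M
  23806086494595686)) (B 7 6 (B 7 9 (F 7 (M 47978717040891265)) (M 32760509996505429)) (M
  23806086494595686)))))))⟩,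
  ⟨196537853522175283045675569, 158914464456909214848196624,
  F 0 (F 1 (F 3 (B 5 7 (B 5 4 (F 5 (R 325 11649901023745)) (B 5 6 (F 5 (R 302 11649901023745)) (B
  5 8 (F 5 (R 206 11640469751635)) (B 5 9 (F 5 (R 326 11649936536080)) (B 5 10 (R 326
  10619144385040) (M 23753309936462489)))))) (B 5 4 (R 327 11649936536080) (B 5 6 (R 302
  11649901023745) (B 5 8 (B 5 9 (F 5 (R 328 11649936536080)) (B 5 10 (R 328 10619144385040) (M
  24034784913173145))) (B 7 4 (B 7 6 (F 7 (M 33006387753691801)) (B 7 8 (F 7 (M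
  33604728231340697)) (M 33307102307977267))) (B 7 6 (B 7 9 (F 7 (M 32760578179115605)) (M
  32760646898587989)) (B 7 8 (B 7 9 (F 7 (M 32760578179115605)) (M 33589408376636416)) (M
  33307102307977267))))))))))⟩,
  ⟨12880633747959471513428234940977, 554626820358532252114960,
  F 0 (F 1 (B 5 4 (F 5 (R 327 11649936536080)) (B 5 6 (F 5 (R 302 11649901023745)) (B 5 8 (F 5 (R
  329 11649901023745)) (B 5 9 (F 5 (R 329 11585476514305)) (M 23753447375411592))))))⟩,
  ⟨55682126982719396932504379441398637736497, 46274598779476553713189986320,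
  F 0 (F 1 (F 5 (B 7 4 (B 7 6 (F 7 (M 47981951176544512)) (M 23806086494595686)) (B 7 6 (B 7 8 (F
  7 (M 32760303301208729)) (M 32760578715977813)) (M 23806086494595686)))))⟩,
  ⟨55682126982719396932504379441398637736497, 161332316096138473197608976,
  F 0 (F 1 (B 5 9 (F 5 (R 331 11649936536080)) (B 5 10 (R 331 10619144385040) (R 330
  9523892212225))))⟩,
  ⟨196537853522175283045675569, 545182087392792961687568,
  F 0 (F 1 (B 3 8 (F 3 (R 329 11649936536080)) (B 3 9 (F 3 (R 329 11585512026640)) (B 3 10 (R 329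
  10490295366160) (B 5 7 (R 330 11649936536080) (B 5 4 (R 327 11649936536080) (B 5 6 (R 302
  11649901023745) (B 5 8 (R 332 11649936536080) (B 5 9 (R 332 11585512026640) (R 330
  11649901023745))))))))))⟩,
  ⟨45326800697239352106446565937, 13118302524207274424547523239952,
  F 0 (F 1 (F 3 (F 5 (B 8 6 (F 8 (R 273 7872844284760)) (B 8 7 (F 8 (R 273 6773332722520)) (M
  37810225195022226))))))⟩,
  ⟨3297354016770063882835202016358961, 178342593762084188319719440,
  F 0 (F 1 (F 3 (B 5 9 (F 5 (R 206 11503030802515)) (B 5 10 (B 8 4 (R 334 11649936536080) (B 8 6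
  (R 334 10619108872705) (M 24071005194446481))) (B 8 4 (B 8 6 (F 8 (R 333 11485116433795)) (M
  23770971110419046)) (M 24034853632649860))))))⟩,
  ⟨55324559195801817294900330247627313590833, 2110161976215549845520,
  F 0 (F 1 (B 4 7 (R 333 11649920746000) (B 4 8 (B 4 9 (F 4 (M 24106120293414802)) (M
  24053614318229859)) (M 24053614586660963))))⟩,
  ⟨14163087154125265227499226366005299105575473, 696611409493874670903312,
  F 0 (F 1 (F 3 (B 4 7 (B 4 8 (B 4 9 (F 4 (M 24106189298099841)) (M 24036022132185459)) (M
  24036022400616563)) (B 4 8 (B 4 9 (B 4 10 (B 8 9 (B 8 10 (F 8 (R 206 8131213044100)) (M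
  37562764207630916)) (B 8 10 (B 8 6 (F 8 (M 24053614586660963)) (M 38374753001576803)) (M
  38409386818836899))) (M 24106120293414802)) (M 24053614318229859)) (M 24053614586660963)))))⟩,
  ⟨50313690796901355329698214449, 178332835434469195966914576,
  F 0 (F 1 (F 3 (B 5 4 (R 327 11649936536080) (B 5 6 (R 302 11649901023745) (B 5 7 (R 333
  11649901023745) (B 5 8 (R 335 11649936536080) (B 5 9 (R 335 11585512026640) (B 4 6 (R 336
  11649936536080) (R 337 11649936536080)))))))))⟩,
  ⟨14429209305723318550016626426283304606122290, 8241958129191952400,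
  F 0 (F 1 (B 4 6 (R 336 9523892212225) (M 24052446087129700)))⟩,
  ⟨55682126982877853323683008365415354220850, 705742547810360898953232,
  F 0 (F 1 (B 5 10 (R 338 9523892212225) (R 339 11649936536080)))⟩,
  ⟨50313690796901355329698214449, 620739951118707285106704,
  F 0 (F 1 (B 3 9 (F 3 (R 338 11649936536080)) (B 3 10 (R 338 10619144385040) (B 5 4 (R 327
  11649936536080) (B 5 6 (R 302 11649901023745) (B 5 7 (R 333 11649901023745) (B 5 8 (B 5 9 (F 5
  (R 338 11649901023745)) (B 5 10 (R 338 10619108872705) (M 24034784913173145))) (B 5 9 (R 340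
  11649936536080) (R 340 10490259853825)))))))))⟩,
  ⟨767725990021865595286065, 2109941862783762112528,
  F 0 (F 1 (B 3 6 (R 325 11649936536080) (B 3 7 (R 333 11649936536080) (B 3 8 (R 341
  11649936536080) (B 3 10 (R 341 10490295366160) (B 5 4 (R 327 11649936536080) (B 5 6 (R 302
  11649901023745) (B 5 7 (R 333 11649901023745) (B 5 8 (R 341 11649901023745) (B 5 9 (R 341
  11585476514305) (R 339 9459467702785)))))))))))⟩,
  ⟨50313690501677170431656800817, 11687224420128478281351982817296,
  F 0 (F 1 (F 3 (F 7 (B 4 5 (R 342 11649936474640) (B 4 6 (R 342 11649920746000) (M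
  33270751579646532))))))⟩,
  ⟨12880304858505964384029102912049, 11688479285129238266435327827984,
  F 0 (F 1 (F 3 (F 7 (B 4 5 (R 342 11649936474640) (M 33605003109247572)))))⟩,
  ⟨50313690501677170431656800817, 45653215650236781009064501264,
  F 0 (F 1 (F 3 (B 7 5 (F 7 (R 343 11649936536080)) (B 7 6 (F 7 (R 343 11649920807440)) (B 7 8 (F
  7 (R 344 11649936536080)) (B 7 9 (F 7 (R 344 11585496298000)) (B 4 6 (R 342 11649920746000) (B 4
  8 (B 4 9 (F 4 (M 28239386365700727)) (M 33606034438265171)) (M 33606103157737555)))))))))⟩,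
  ⟨12880304858487517639955393360433, 11688479289851604749304973041680,
  F 0 (F 1 (F 3 (F 7 (B 5 4 (R 342 11649936474640) (M 33605003109247572)))))⟩,
  ⟨12880304848729113745244351967793, 45653220372603263878709714960,
  F 0 (F 1 (F 3 (B 7 6 (F 7 (B 5 6 (R 302 11649901023745) (B 5 4 (R 342 11649885295105) (B 5 8 (B
  5 9 (F 5 (R 345 11649901023745)) (M 32742779834641049)) (M 32760578179115605))))) (B 7 8 (F 7 (R
  346 11649936536080)) (B 7 9 (F 7 (R 346 11585512026640)) (B 5 4 (R 342 11649936474640) (B 5 8 (B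
  5 9 (F 5 (M 23753378924374647)) (M 33588442252220771)) (M 33588510971693155))))))))⟩,
  ⟨12880290346655315782699604652593, 45658122189012482570441531408,
  F 0 (F 1 (F 3 (B 7 9 (F 7 (R 206 11430016358515)) (B 7 10 (B 8 4 (B 8 5 (F 8 (R 273
  6704614163320)) (B 8 6 (F 8 (R 273 5605102601080)) (M 32830946923275861))) (B 8 5 (B 8 6 (F 8 (R
  273 4505590977400)) (M 33641016695219873)) (M 33641085414692257))) (B 8 4 (B 8 5 (F 8 (R 342
  11412353648515)) (M 33605003109247573)) (M 33604728499776132))))))⟩,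
  ⟨50313690501677170431656800817, 178332855110133017995190288,
  F 0 (F 1 (F 3 (B 7 4 (R 345 11649936536080) (B 7 5 (R 347 11649936536080) (B 7 6 (R 347
  11649920807440) (B 7 8 (R 348 11649936536080) (B 7 9 (R 348 11585512026640) (B 4 5 (R 342
  11649936474640) (B 4 6 (R 342 11649920746000) (B 4 8 (B 4 9 (B 4 10 (B 8 9 (B 8 10 (F 8 (R 206
  8131213044100)) (M 33393416114047044)) (B 8 10 (B 8 5 (F 8 (M 38411793604843875)) (M
  38411862324320595)) (M 38410486329416099))) (M 33676201067308673)) (M 33606034438265171)) (M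
  33606103157737555)))))))))))⟩,
  ⟨849641747546891643759337132798325297, 183097722891348490015809552,
  F 0 (F 1 (F 7 (B 4 5 (R 342 11649936474640) (M 33604934658206292))))⟩,
  ⟨3318913399137887458787956864660017, 549924129539484635176976,
  F 0 (F 1 (B 7 5 (F 7 (M 33270270543309465)) (B 7 6 (F 7 (M 32988795567647385)) (B 7 8 (F 7 (M
  33604728231340697)) (B 7 9 (F 7 (R 350 11649936536080)) (B 7 10 (R 350 10619128656400) (M
  33604728231340697)))))))⟩]

def eleven_11 : List Lem := [
  ⟨849641747546891625312593059088773681, 183102445257831359661023248,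
  F 0 (F 1 (F 7 (B 5 4 (R 342 11649936474640) (M 33604934658206292))))⟩,
  ⟨3318913399138201129716928615625265, 554646496022354280390672,
  F 0 (F 1 (B 7 6 (F 7 (M 32760303301208729)) (B 7 8 (F 7 (M 32760303301208729)) (B 7 9 (F 7 (R
  352 11649936536080)) (B 7 10 (R 352 10619144385040) (M 32760303301208729))))))⟩,
  ⟨217508308525923652424639671580273816113, 46896062228297862845340655632,
  F 0 (F 1 (F 7 (B 8 4 (B 8 5 (F 8 (R 353 11411816784775)) (M 32813148578818645)) (M
  33604728499776132))))⟩,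
  ⟨217508308527485589010800351263798214962, 9538994821874655248,
  F 0 (F 1 (B 4 9 (B 4 10 (F 4 (B 8 9 (B 8 10 (R 206 8131213044100) (M 33393416114047044)) (M
  33375824196438084))) (M 23806086494595686)) (M 23823678680635750)))⟩,
  ⟨55682126983036310867045119850841334952497, 8241958129191952400,
  F 0 (F 1 (B 4 5 (R 342 11649936474640) (B 4 6 (R 342 11649920746000) (B 4 8 (R 355
  11649936536080) (M 37334546282210901)))))⟩,
  ⟨50313690501677170431656800817, 620759626782529313382416,
  F 0 (F 1 (B 3 9 (F 3 (R 349 11649936536080)) (B 3 10 (R 349 10619144385040) (B 7 4 (R 351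
  11649936536080) (B 7 5 (R 353 11649936536080) (B 7 6 (R 353 11649920807440) (B 7 8 (B 7 9 (F 7
  (R 354 11649936536080)) (B 7 10 (R 354 10619144385040) (M 33604728231340697))) (R 356
  11649936536080))))))))⟩,
  ⟨50313690501677170431656800817, 2129617526605790388240,
  F 0 (F 1 (B 3 8 (R 357 11649936536080) (B 3 9 (R 357 11585512026640) (B 3 10 (R 357
  10490295366160) (B 7 4 (R 351 10490295366160) (B 7 5 (R 353 10490295366160) (B 7 6 (R 353
  10490279637520) (B 7 8 (B 7 9 (F 7 (R 356 10490295366160)) (R 356 11585512026640)) (R 356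
  11649936536080)))))))))⟩,
  ⟨677360493741588227933294609668583985, 162626579007736929721589776,
  F 0 (F 1 (F 8 (B 5 9 (B 5 10 (F 5 (M 33570510249940369)) (M 46518359179683345)) (M
  42014759552312849))))⟩,
  ⟨55320508878623775082352523243845308199473, 9611052415912583184,
  F 0 (F 1 (B 5 9 (B 5 10 (F 5 (M 37792635170084113)) (M 46518359161862034)) (M
  42014759534491554)))⟩,
  ⟨14164108006418245672048262212091133158306353, 2461658919932562317328,
  F 0 (F 1 (B 5 7 (B 5 9 (F 5 (R 358 11649901023745)) (M 37810701933254963)) (R 360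
  11649936536080)))⟩,
  ⟨55328546817832111842993203963477207626289, 161412911149916258547343376,
  F 0 (F 1 (B 8 6 (F 8 (B 5 6 (R 302 11649901023745) (R 359 11649936536080))) (R 361
  11649936536080)))⟩,
  ⟨55328546817832111842993203963477207626289, 625777141170578311421968,
  F 0 (F 1 (B 8 5 (R 362 11649936536080) (B 8 6 (R 362 11649920807440) (M 37792635170084113))))⟩,
  ⟨216095656597929920655555630133560816177, 45982119326183591238260826128,
  F 0 (F 1 (B 8 9 (B 8 5 (F 8 (R 206 11502476411800)) (B 8 6 (F 8 (R 206 11498181510040)) (M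
  37792635170084113))) (R 363 11649936536080)))⟩,
  ⟨56022403831631837928648991248943547494961, 161412911149916258547343376,
  F 0 (F 1 (B 8 6 (F 8 (R 363 11649936536080)) (B 8 7 (F 8 (R 363 11649936536080)) (M
  37898188267484962))))⟩,
  ⟨216095656597929920655555630133560816177, 50624394473503767269132541968,
  F 0 (F 1 (B 4 9 (R 364 11649936536080) (B 4 10 (R 364 10619144385040) (B 8 5 (R 365
  11649936536080) (B 8 6 (R 365 10619128656400) (M 46288969247254101))))))⟩,
  ⟨3671484959414939898371065423198359393482650161, 184387224089077082511974416,
  F 0 (F 1 (B 8 10 (F 8 (R 360 11649936536080)) (B 8 6 (F 8 (R 355 11649920746000)) (R 361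
  10619144385040))))⟩,
  ⟨55682121464710899465185616641511779283505, 625777141170578311421968,
  F 0 (F 1 (B 8 5 (R 365 11649936474640) (B 8 6 (R 365 11649920746000) (M 32830946923275861))))⟩,
  ⟨3318913708622915803159085998883378, 8241958129191952400,
  F 0 (F 1 (B 5 6 (R 302 11649901023745) (B 5 7 (R 358 11649901023745) (M 24088803002050161))))⟩,
  ⟨3318913070239229026365776666374705, 2719913336964496039952,
  F 0 (F 1 (B 4 5 (R 342 11649936474640) (B 4 6 (R 342 11649920746000) (B 4 7 (R 358
  11649936474640) (B 4 9 (R 368 11585512026640) (R 369 11649936536080))))))⟩,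
  ⟨12880304844006747262374706754097, 2424765431785143214096,
  F 0 (F 1 (B 3 9 (B 3 10 (B 4 5 (R 342 11649936474640) (B 4 6 (R 342 11649920746000) (B 4 7 (R
  358 11649936474640) (B 4 8 (R 366 11649936536080) (B 4 9 (R 366 11585512026640) (B 4 10 (R 366
  10490295366160) (B 5 6 (R 302 11649901023745) (B 5 7 (R 358 11649901023745) (B 5 8 (B 8 9 (R 367
  11649936536080) (B 8 10 (R 367 10619144385040) (M 38390902078614169))) (M
  24106321888446563)))))))))) (R 370 11649936536080)) (R 370 10490295366160)))⟩,
  ⟨108105438409265, 8241958129191952400,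
  F 0 (F 1 (B 2 8 (F 2 (R 273 11649936536080)) (B 2 9 (F 2 (R 273 11562963791890)) (B 2 10 (R 273
  10463452229650) (B 3 4 (R 302 11649936536080) (B 3 5 (R 342 11649936536080) (B 3 6 (R 342
  11649920807440) (B 3 7 (R 358 11649936536080) (B 3 9 (R 371 11585512026640) (B 4 5 (R 342
  11649936474640) (B 4 6 (R 342 11649920746000) (B 4 7 (R 358 11649936474640) (B 4 8 (R 371
  11649936474640) (R 369 10490295366160))))))))))))))⟩,
  ⟨217508308526247635062742278480894964273, 7012460037757018128,
  F 0 (F 1 (B 4 7 (R 288 11649936536080) (B 4 8 (R 288 11645910004240) (M 28327072686442615))))⟩,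
  ⟨767725994543121833210417, 1795337828871052533776,
  F 0 (F 1 (B 3 6 (F 3 (B 4 5 (R 206 11649865371715) (B 4 6 (R 206 11649865310275) (B 4 7 (R 372
  11649865372675) (B 4 8 (R 372 11645838840835) (B 4 9 (R 372 11577387799555) (R 274
  10478215770640))))))) (B 3 7 (F 3 (R 279 11649936536080)) (B 3 8 (F 3 (R 279 11645910004240)) (B
  3 9 (F 3 (R 279 11577458962960)) (B 3 10 (R 279 10478215770640) (B 4 5 (R 172 10478215770400) (B
  4 6 (B 4 7 (F 4 (R 372 11649328571140)) (R 287 11649936536080)) (R 373 11649936536080)))))))))⟩,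
  ⟨50313690778454612419924800049, 620758397284437878448144,
  F 0 (F 1 (F 3 (B 4 6 (R 374 11649920746000) (B 4 7 (R 206 11640738705475) (B 4 8 (R 206
  11640738644035) (B 4 9 (R 372 11431359050755) (B 4 10 (R 372 10332115858435) (R 373
  11649936474640))))))))⟩,
  ⟨217508308526247630082049039510301389361, 2441982677767417831440,
  F 0 (F 1 (B 4 9 (F 4 (R 375 11517060923920)) (B 4 10 (F 4 (R 375 10421844263440)) (M
  28291887777491609))))⟩,
  ⟨50313690778454612419924800049, 2128388028514355453968,
  F 0 (F 1 (B 3 8 (F 3 (R 375 11649936536080)) (B 3 9 (F 3 (R 375 11585512026640)) (B 3 10 (R 375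
  10490295366160) (B 4 5 (R 374 11649936474640) (B 4 6 (R 374 11649920746000) (B 4 7 (R 288
  11649920807440) (B 4 8 (R 376 11649936536080) (B 4 9 (R 376 11585496298000) (R 376
  10478199980560))))))))))⟩,
  ⟨767725994543121833210417, 7012460037757018128,
  F 0 (F 1 (B 3 5 (R 374 11649936536080) (B 3 6 (R 374 11649920807440) (B 3 7 (R 377
  11649936536080) (B 3 8 (R 377 11645910004240) (B 3 9 (R 377 11577458962960) (B 3 10 (R 377
  10478215770640) (R 163 11649936528160))))))))⟩,
  ⟨50313690778598726444064518705, 139495778947951258174038032,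
  F 0 (F 1 (F 3 (B 5 7 (F 5 (B 4 6 (B 4 7 (F 4 (R 313 11645910004240)) (R 307 11649885295105)) (M
  24087493020265060))) (R 307 11649936536080))))⟩,
  ⟨3297358042554470857315806594806321, 46274598502775392607546712080,
  F 0 (F 1 (F 3 (F 5 (B 6 4 (R 379 11649920807440) (B 6 7 (R 304 11649920807440) (R 308
  11649936536080))))))⟩,
  ⟨3297358042554470857315806594806321, 161332039394977367554334736,
  F 0 (F 1 (F 3 (B 5 9 (F 5 (R 380 11649936536080)) (B 5 10 (R 380 10619144385040) (R 172
  11645874491425)))))⟩,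
  ⟨196537854603039193614594609, 544905386231687318413328,
  F 0 (F 1 (F 3 (B 5 6 (R 378 11649901023745) (B 5 4 (R 379 11649936536080) (B 5 7 (R 304
  11649936536080) (B 5 8 (R 381 11649936536080) (B 5 9 (R 381 11585512026640) (R 172
  10478180257825))))))))⟩,
  ⟨849641830180654824463255310381953585, 7013038380873228304,
  F 0 (F 1 (B 5 6 (R 378 11649901023745) (B 5 4 (B 5 7 (F 5 (R 382 11649901023745)) (B 5 8 (F 5 (R
  382 11645874491905)) (B 5 9 (F 5 (R 382 11577423450625)) (M 32988931131742600)))) (R 174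
  11649936535840))))⟩]

def eleven_12 : List Lem := [
  ⟨196537854603039193614594609, 1833240701678118838288,
  F 0 (F 1 (B 3 7 (F 3 (R 382 11649936536080)) (B 3 8 (F 3 (R 382 11645910004240)) (B 3 9 (F 3 (R
  382 11577458962960)) (B 3 10 (R 382 10478215770640) (R 383 11649936536080))))))⟩,
  ⟨11714569008531522098, 1795410464808206671888,
  F 0 (F 1 (B 5 6 (F 5 (R 378 11649901023745)) (R 384 11649901023745)))⟩,
  ⟨12880304777893616783674650473009, 158923927636619027848175632,
  F 0 (F 1 (F 3 (B 5 9 (F 5 (R 335 10478215770640)) (R 335 11577458962960))))⟩,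
  ⟨3297358989219240847598714295038513, 2147055464362968948752,
  F 0 (F 1 (B 4 9 (F 4 (M 24106321888446563)) (M 24088798421878883)))⟩,
  ⟨3297358986739703147847395013898801, 40683316605504476748240199696,
  F 0 (F 1 (F 3 (B 4 8 (F 4 (M 23753309936462489)) (R 387 11649936536080))))⟩,
  ⟨844123900605425416145340773303468338, 11766778992612809649074378711056,
  F 0 (F 1 (F 3 (F 4 (B 7 8 (B 7 9 (F 7 (R 206 11429747923060)) (M 23805949324077687)) (B 7 9 (B 7
  6 (F 7 (M 33588304544836232)) (R 355 11649936536080)) (M 33588304813262995))))))⟩,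
  ⟨55320503950077161286168695146552102040113, 13118919000522266254332947144720,
  F 0 (F 1 (F 3 (B 4 8 (B 4 9 (F 4 (R 389 11649936536080)) (B 4 10 (R 389 10619144385040) (M
  23753309936462489))) (B 4 9 (B 4 10 (B 7 9 (B 7 10 (F 7 (R 206 9230724671860)) (M
  33006388022127240)) (M 33006388290558344)) (R 387 10413739958785)) (R 387 11512983151105)))))⟩,
  ⟨56362686260509835382712383947077087998513, 620758397862780994658320,
  F 0 (F 1 (F 3 (B 4 6 (B 4 7 (R 388 11649936536080) (M 24034853901085300)) (R 337
  10478215770640))))⟩,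
  ⟨50313690778454611255988662833, 620758397862780994658320,
  F 0 (F 1 (F 3 (B 5 4 (R 385 11649936536080) (B 5 6 (R 378 11649901023745) (B 5 7 (R 386
  11649936536080) (B 5 8 (R 386 11645910004240) (B 5 9 (B 5 10 (B 4 6 (B 4 7 (R 388
  11649936536080) (B 6 9 (R 388 9322565620225) (M 28608341243631940))) (B 4 7 (R 390
  11649936536080) (B 9 6 (R 390 9322565620225) (M 42296161497798051)))) (R 391 11649936536080)) (R
  391 10619144385040))))))))⟩,
  ⟨849641830179384488496169720062554673, 2460430000184243593232,
  F 0 (F 1 (B 5 9 (F 5 (R 392 11517025473025)) (B 5 10 (R 392 10421808812545) (M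
  24034784913173145))))⟩,
  ⟨50313690778454611255988662833, 2128388606857471664144,
  F 0 (F 1 (B 3 8 (F 3 (R 392 11649936536080)) (B 3 9 (F 3 (R 392 11585512026640)) (B 3 10 (R 392
  10490295366160) (B 5 4 (R 385 11649936536080) (B 5 6 (R 378 11649901023745) (B 5 7 (R 173
  11649936535840) (B 5 8 (R 393 11649936536080) (B 5 9 (R 393 11585512026640) (R 393
  10478180258305))))))))))⟩,
  ⟨196537854603039193614594609, 7013038380873228304,
  F 0 (F 1 (B 3 6 (R 384 11649936536080) (B 3 7 (R 394 11649936536080) (B 3 8 (R 394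
  11645910004240) (B 3 9 (R 394 11577458962960) (B 3 10 (R 394 10478215770640) (R 383
  11649936536080)))))))⟩,
  ⟨216106366819085438927418855523130356273, 45653220391122065546457194512,
  F 0 (F 1 (F 3 (B 7 6 (F 7 (B 5 6 (R 378 11649901023745) (B 5 8 (B 5 9 (F 5 (M
  46606247077639987)) (M 42119140124686148)) (M 24088802733614721)))) (B 7 9 (F 7 (M
  33270270543309460)) (M 33289511996791091)))))⟩,
  ⟨216106366819085438927418855523130356273, 178332873628934685742669840,
  F 0 (F 1 (F 3 (B 7 5 (R 396 11649936536080) (B 7 6 (R 396 11649920807440) (M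
  41838077190104661)))))⟩,
  ⟨844123657948555103801538706323616305, 178332873628934685742669840,
  F 0 (F 1 (F 3 (B 4 8 (B 4 9 (F 4 (B 7 5 (B 7 6 (F 7 (B 5 6 (R 378 11649901023745) (R 359
  10478215770640))) (M 19196933756201574)) (M 19196933757250133))) (R 397 11649936536080)) (R 397
  11585512026640))))⟩,
  ⟨12880304839284380779505061540401, 696612710471217027555344,
  F 0 (F 1 (F 3 (B 4 5 (R 395 11649936474640) (B 4 6 (R 395 11649920746000) (B 4 7 (R 398
  11649936536080) (B 4 8 (R 398 11645910004240) (B 4 9 (R 398 11577458962960) (R 193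
  10478215708960))))))))⟩,
  ⟨14254624507596447094660817524070135126635057, 701058375792981029494800,
  F 0 (F 1 (B 4 10 (R 399 9523927663120) (B 7 5 (B 7 6 (F 7 (M 48012728601704292)) (M
  37316679218276966)) (M 37316747937753685))))⟩,
  ⟨55682126982635196448629851336405019603505, 620778145584197060861968,
  F 0 (F 1 (B 4 8 (B 4 9 (F 4 (R 399 11649936474640)) (B 4 10 (R 399 10619144323600) (M
  28239317377788569))) (B 4 9 (R 400 11649936536080) (R 400 10490295304720))))⟩,
  ⟨12880304839284380779505061540401, 2424837489379181142032,
  F 0 (F 1 (B 3 9 (F 3 (R 399 11649936536080)) (B 3 10 (R 399 10619144385040) (B 4 5 (R 395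
  11649936474640) (B 4 6 (R 395 11649920746000) (B 4 7 (R 401 11649936536080) (B 4 8 (R 401
  11645910004240) (B 5 6 (R 378 11649901023745) (B 5 7 (R 190 11649936535840) (M
  24071211084441201))))))))))⟩,
  ⟨12880304839284380779505061540401, 8314015723229880336,
  F 0 (F 1 (B 3 8 (R 402 11649936536080) (B 3 9 (R 402 11585512026640) (B 3 10 (R 402
  10490295366160) (R 194 11649936535840)))))⟩,
  ⟨16689, 27392408868167696,
  F 0 (F 1 (B 2 3 (R 206 11649936535840) (B 2 4 (R 206 11649936474400) (B 2 5 (R 206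
  11649901023265) (B 2 6 (R 206 11649900961825) (B 2 7 (R 372 11649936536080) (B 2 8 (R 372
  11645874491905) (B 2 9 (R 372 11577423450625) (B 2 10 (R 372 10478180258305) (B 3 4 (R 378
  11649936536080) (B 3 5 (R 395 11649936536080) (B 3 6 (R 395 11649920807440) (B 3 7 (R 403
  11649936536080) (B 3 8 (R 403 11645910004240) (B 3 9 (R 403 11577458962960) (B 3 10 (R 403
  10478215770640) (R 196 11649936535840)))))))))))))))))⟩,
  ⟨196608987491031911776727601, 1832303954128421265424,
  F 0 (F 5 (B 3 7 (F 3 (M 24069900297349785)) (B 3 8 (F 3 (M 24052376830782105)) (B 3 9 (F 3 (M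
  24052445550258824)) (M 24052514269731208)))))⟩,
  ⟨196608987491031838273647153, 1869125102047184560144,
  F 0 (F 5 (B 3 7 (F 3 (R 404 11649597002755)) (B 3 8 (F 3 (R 404 11645302100995)) (B 3 9 (F 3 (R
  404 11576582689795)) (M 23771039293020552)))))⟩,
  ⟨50331900797704168254984106545, 2128676838406418866192,
  F 0 (F 5 (B 3 8 (F 3 (M 23753309936462489)) (B 3 9 (F 3 (M 23753378655939208)) (M
  23753447375411592))))⟩,
  ⟨12884966604212267370200191545905, 7301269929820430352,
  F 0 (F 5 (B 3 4 (R 406 11649936536080) (B 3 6 (R 406 10478177104405) (B 3 7 (R 407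
  11649936536080) (B 3 8 (R 407 11645871338005) (M 23753447912278135))))))⟩,
  ⟨860027534038659764879619546440348209, 109209210331152,
  F 0 (B 3 8 (F 3 (M 24052376830782105)) (B 3 9 (F 3 (M 24052445550258824)) (M
  24052514269731208)))⟩,
  ⟨220167048713896899809182602840827310641, 109209210331152,
  F 0 (B 3 7 (F 3 (M 24069900297349785)) (R 409 11649936536080))⟩,
  ⟨12884966604212267370204704617009, 23452931989708816,
  F 0 (B 5 4 (F 5 (B 3 6 (R 405 11649936536080) (B 3 7 (R 405 11649684877840) (B 3 8 (R 405
  11645406687760) (M 24034922888988791))))) (B 5 6 (F 5 (R 408 11649936536080)) (B 5 7 (F 5 (R 408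
  11649629499925)) (B 5 8 (F 5 (R 408 11645334598165)) (B 5 9 (F 5 (R 408 11576615186965)) (B 5 10
  (R 408 10477103624725) (B 3 6 (R 410 11649936536080) (B 3 7 (R 410 11649684877840) (B 3 8 (R 410
  11645406687760) (M 24034922888988791))))))))))⟩,
  ⟨50331900797704150598356644401, 554387156519300281409552,
  F 0 (F 5 (B 3 7 (F 3 (R 404 11649328571395)) (B 3 8 (F 3 (R 404 11645033669635)) (B 3 9 (F 3 (R
  404 11576314258435)) (M 23771039293020552)))))⟩,
  ⟨12884966604212267634027130860081, 620795579299842743083024,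
  F 0 (F 5 (B 3 9 (F 3 (R 404 11503299822595)) (B 3 10 (F 3 (R 404 10403788260355)) (M
  23770901854071449))))⟩,
  ⟨12884966604212267071077177438769, 2165570043919220088848,
  F 0 (F 5 (B 3 7 (R 412 11649684877840) (B 3 8 (R 413 11649936536080) (B 3 9 (R 413
  11585512026640) (M 23771039293020552)))))⟩,
  ⟨216173867871655719519676313440270496305, 158923927929354176422748176,
  F 0 (F 3 (F 5 (B 6 4 (B 6 8 (F 6 (R 404 11622567725110)) (B 6 9 (F 6 (M 47997264847726227)) (M
  37598083872238182))) (M 37510329099397785))))⟩]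

def eleven_13 : List Lem := [
  ⟨55340510175143864197037136539780722537009, 554645559837754536239120,
  F 0 (F 5 (B 3 8 (F 3 (R 415 11649936536080)) (B 3 9 (F 3 (R 415 11585512026640)) (B 3 10 (R 415
  10490295366160) (M 23788425320639129)))))⟩,
  ⟨14167170604836829545206297476178475225264689, 178332891067436565670141968,
  F 0 (F 3 (F 5 (B 6 4 (B 6 7 (F 6 (R 414 11649075864085)) (R 416 11649075864085)) (M
  24052446087129700))))⟩,
  ⟨14167170604836829545206297476178475225264689, 620795584086076988334096,
  F 0 (F 5 (B 3 9 (F 3 (R 417 11649936536080)) (B 3 10 (R 417 10619144385040) (M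
  23770901854071449))))⟩,
  ⟨55340510175143864197037136539780722537009, 2165574830153465339920,
  F 0 (F 5 (B 3 7 (R 416 11649936536080) (B 3 8 (R 418 11649936536080) (B 3 9 (R 418
  11585512026640) (M 23771039293020552)))))⟩,
  ⟨216173867871655719519676314608501600817, 8459257984008069136,
  F 0 (F 5 (B 3 4 (R 414 11649936536080) (B 3 6 (R 419 11649936536080) (B 3 7 (R 419
  11649684877840) (B 4 6 (R 419 11649936474640) (B 4 7 (R 419 11649684816400) (M
  19197002744100710)))))))⟩,
  ⟨844429409385780780048775280249090609, 109140490854416,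
  F 0 (B 3 7 (F 3 (R 404 11649328571395)) (B 3 8 (F 3 (R 404 11645033669635)) (B 3 9 (F 3 (R 404
  11576314258435)) (M 23771039293020552))))⟩,
  ⟨945610273883026045396227919693293857535149814321, 288839704592,
  F 0 (B 3 6 (R 421 11649936536080) (B 3 7 (R 421 7252712108560) (B 3 8 (R 421 7248433918480) (M
  24034922888988791))))⟩,
  ⟨242076230114054667621434347441483227529002665194033, 9472025918243348496,
  F 0 (F 3 (B 6 4 (B 6 7 (F 6 (R 404 11622584502070)) (B 6 8 (F 6 (R 404 11622567725110)) (B 6 9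
  (F 6 (M 28839305527995016)) (M 28839305529039240)))) (M 24087561471306340)))⟩,
  ⟨242076230114054667621434347441483227529002665194033, 32481099274788880,
  F 0 (B 3 8 (F 3 (R 423 11649936536080)) (B 3 9 (F 3 (R 423 11585512026640)) (B 3 10 (R 423
  10490295366160) (M 23788425320639129))))⟩,
  ⟨242076230114054667621434347441483227529002665194033, 111476953063440,
  F 0 (B 3 7 (R 424 11649936536080) (B 3 8 (R 424 11645910004240) (B 3 9 (R 424 11577458962960) (M
  23771039293020552))))⟩,
  ⟨61971514909197994911087192945024447997699419612983857, 10629466424230289424,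
  F 0 (F 3 (B 4 6 (R 425 11649936474640) (M 23982008361331268)))⟩,
  ⟨61971514909197994911087192945024447997699419612983857, 37000100654882832,
  F 0 (B 3 9 (F 3 (R 426 11649936536080)) (B 3 10 (R 426 10619144385040) (M 24034784913173145)))⟩,
  ⟨61971514909197994911087192945024447997699419612983857, 126878705786896,
  F 0 (B 3 8 (R 427 11649936536080) (B 3 9 (R 427 11585512026640) (M 24034922352122248)))⟩,
  ⟨216173867871655719519676314608501600817, 28519481570500624,
  F 0 (B 5 7 (F 5 (R 420 11649936536080)) (B 5 8 (F 5 (R 420 11644780962325)) (B 5 9 (F 5 (R 420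
  11576061551125)) (B 5 10 (R 420 10476549988885) (B 3 4 (R 422 11649936536080) (B 3 6 (R 425
  11649936536080) (B 3 7 (R 428 11649936536080) (B 3 8 (R 428 11645910004240) (M
  24034922888988791)))))))))⟩,
  ⟨14428867621111406313899869546955811812618801, 37000092064948240,
  F 0 (F 3 (B 4 6 (B 4 7 (B 4 8 (F 4 (M 47944842103304960)) (M 24087492483394180)) (M
  24087561202870900)) (M 24087561471306340)))⟩,
  ⟨61971514909197994911087192945033892730665158903411249, 126870115852304,
  F 0 (B 3 8 (F 3 (R 430 11649936536080)) (B 3 9 (F 3 (R 430 9515119686160)) (B 3 10 (R 430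
  9446416986640) (M 24069900297349785))))⟩,
  ⟨61971514909197994911087192945033892730665158903411249, 426278658064,
  F 0 (B 3 7 (R 431 11649936536080) (B 3 8 (R 431 11645910004240) (B 3 9 (R 431 11577458962960) (M
  24052514269731208))))⟩,
  ⟨3298551450678340446772404399714865, 90508922724368,
  F 0 (B 5 3 (R 411 11649936536080) (B 5 4 (R 411 11649936474640) (B 5 6 (R 429 11649936536080) (B
  5 7 (R 429 11649684877840) (B 5 8 (R 429 11645406687760) (B 5 9 (R 429 11576703988240) (B 5 10
  (R 429 10477209137680) (B 3 4 (R 422 10477209137680) (B 3 6 (R 432 11649936536080) (B 3 7 (R 432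
  11649684877840) (B 3 8 (R 432 11645406687760) (M 24034922888988791))))))))))))⟩,
  ⟨2980410581937270370865, 23170284217507856,
  F 0 (B 2 6 (F 2 (R 404 11649901023490)) (B 2 7 (F 2 (R 404 11649632653570)) (B 2 8 (F 2 (R 404
  11645337751810)) (B 2 9 (F 2 (R 404 11576618340610)) (B 2 10 (R 404 10477106778370) (R 433
  11649936536080))))))⟩,
  ⟨844429250929446306792215201397682737, 110240002482192,
  F 0 (B 4 7 (F 4 (R 404 11649328571140)) (B 4 8 (F 4 (R 404 11645033669380)) (B 4 9 (F 4 (R 404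
  11576314258180)) (M 23771039293020552))))⟩,
  ⟨14167171939561521449455577245975910262321713, 22873416078008336,
  F 0 (B 4 6 (R 435 11649936536080) (B 4 7 (R 435 11649684877840) (B 4 8 (R 435 11645406687760) (R
  435 7179668104000))))⟩,
  ⟨12884966604212267370199889556017, 6003653721226027024,
  F 0 (B 3 6 (F 3 (R 404 11649865372675)) (B 3 7 (F 3 (R 404 11649597002755)) (B 3 8 (F 3 (R 404
  11645302100995)) (B 3 9 (F 3 (R 404 11576582689795)) (B 3 10 (R 404 10477071127555) (B 4 5 (R
  434 11649936397360) (R 436 11649936536080)))))))⟩,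
  ⟨55682199696350907799068800565567450853937, 22873416078008336,
  F 0 (B 4 5 (R 437 11649936474640) (R 436 8424684532240))⟩,
  ⟨3298551450678340446773503911342641, 8309496730439720976,
  F 0 (B 3 8 (F 3 (R 404 11640738706435)) (B 3 9 (F 3 (R 404 11572019295235)) (B 3 10 (F 3 (R 404
  10472507732995)) (R 438 11649936536080))))⟩,
  ⟨3298551450678340446773503911342641, 22873416078008336,
  F 0 (B 3 7 (R 439 11649936536080) (B 3 8 (R 439 11645910004240) (B 3 9 (R 439 11577458962960) (R
  438 10478215770640))))⟩,
  ⟨45360721973279739160754729521, 2128681343105557864464,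
  F 0 (F 3 (B 5 4 (F 5 (R 404 11648605886005)) (B 5 8 (F 5 (R 404 11631426278965)) (B 5 9 (F 5 (R
  404 11562706867765)) (M 23823609692723592)))))⟩,
  ⟨216173867871655733686991933731808293425, 630203275227455644770320,
  F 0 (F 3 (F 5 (B 4 6 (B 4 7 (F 4 (M 19196727332481689)) (M 24087561202870900)) (M
  24087561471306340))))⟩,
  ⟨216173867871655719519892485122872652337, 2128533005792831348752,
  F 0 (F 3 (B 5 7 (F 5 (R 404 11648589109045)) (B 5 8 (F 5 (R 442 11649936536080)) (B 5 9 (F 5 (R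
  442 11585512026640)) (B 5 10 (R 442 10490295366160) (R 410 11649936536080))))))⟩,
  ⟨11612344825159613243849221157425, 2166583637569507958800,
  F 0 (F 3 (B 5 8 (F 5 (R 404 11631409502005)) (B 5 9 (F 5 (R 404 11562690090805)) (M
  23823609692723592))))⟩,
  ⟨14167170604836830164176372459099734291853873, 180760150401747852349939728,
  F 0 (F 3 (F 5 (B 6 4 (R 443 11649920807200) (B 6 7 (R 444 11649920807200) (M
  46553949678892851)))))⟩,
  ⟨14167170604836830164176372459099734291853873, 630203279168105318719504,
  F 0 (F 3 (B 5 9 (F 5 (R 445 11649936536080)) (B 5 10 (R 445 10619144385040) (M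
  23788425320639129))))⟩,
  ⟨844429171373655154373437562988606001, 2128536946442505297936,
  F 0 (F 3 (B 5 6 (R 441 11649936536080) (B 5 4 (R 443 11649936536080) (B 5 7 (R 444
  11649936536080) (B 5 8 (R 446 11649936536080) (B 5 9 (R 446 11585512026640) (M
  23823609692723592)))))))⟩]

def eleven_14 : List Lem := [
  ⟨217508592563870733590113348841792221745, 23735506478047248,
  F 0 (B 5 8 (F 5 (M 24052376830782105)) (B 5 9 (F 5 (M 24052445550258824)) (M
  24052514269731208)))⟩,
  ⟨14254643122265832396561612944208028126753329, 33024180709498896,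
  F 0 (B 5 8 (F 5 (M 23788425320639129)) (B 5 9 (F 5 (M 23806017506683528)) (M
  23823609692723592)))⟩,
  ⟨3298551123054444187564450693329457, 620758686376904430198800,
  F 0 (F 3 (F 5 (B 4 7 (B 4 8 (F 4 (M 48014034003318115)) (M 41996336540723844)) (M
  41996405260200564))))⟩,
  ⟨844429171373655154374017005616443953, 2424833832476791021584,
  F 0 (F 3 (B 5 6 (F 5 (R 450 11649936536080)) (B 5 7 (F 5 (R 441 7325189681680)) (B 5 8 (F 5 (R
  441 7324938023440)) (B 5 9 (F 5 (R 450 11443828437520)) (B 5 10 (F 5 (R 450 10344333586960)) (R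
  409 11649684877840)))))))⟩,
  ⟨55340510175143867828813810803105819865649, 180750705812897301135368208,
  F 0 (F 3 (F 5 (B 6 4 (B 6 7 (F 6 (M 28784675150408345)) (M 23753378924374647)) (B 6 7 (B 6 8 (F
  6 (M 47943738273588866)) (M 23806086494595686)) (M 23806018043554406)))))⟩,
  ⟨14167170604897760338596737193809069887009329, 2424914634495394586640,
  F 0 (F 3 (B 4 8 (F 4 (M 23753309936462489)) (B 4 9 (F 4 (M 24106321888446563)) (M
  24088798421878883))))⟩,
  ⟨14167169213301272076842549713959206147666481, 701354682005154815811600,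
  F 0 (F 3 (F 4 (B 7 8 (B 7 9 (F 7 (R 404 11416376002615)) (M 23806086226160247)) (B 7 9 (B 7 6 (F
  7 (R 404 11347706657095)) (M 33588579422734435)) (M 33588578617428115)))))⟩,
  ⟨237685681347220383116953541272126013149430803411505, 620778141643547386912784,
  F 0 (F 3 (B 4 8 (B 4 9 (F 4 (R 454 11649936536080)) (B 4 10 (R 454 10619144385040) (R 435
  7325158024000))) (B 4 9 (B 4 10 (B 7 9 (B 7 10 (F 7 (R 206 9230724671860)) (M
  33006866910980744)) (M 33006935630453128)) (M 24106321888446563)) (M 24088798421878883))))⟩,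
  ⟨14167170604836829234455711884167315781136945, 2424833548729507192848,
  F 0 (F 3 (B 5 7 (R 444 7324938023440) (B 5 8 (R 444 7325189681680) (B 4 6 (B 4 7 (R 453
  11649936536080) (B 4 8 (R 453 11645910004240) (M 23999737721030775))) (B 4 7 (R 455
  11649936536080) (B 4 8 (R 455 11645910004240) (M 23999737721030775)))))))⟩,
  ⟨216173867871655719519748369934796796465, 620758469920375032586256,
  F 0 (F 3 (B 5 4 (R 451 11649936536080) (B 5 6 (B 5 7 (F 5 (R 444 7324938023440)) (B 5 9 (F 5 (R
  452 11649936536080)) (B 5 10 (F 5 (R 452 10619144385040)) (M 23753309936462489)))) (R 456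
  11649936536080))))⟩,
  ⟨61223226026283079561449668457779991918433452066681393, 10774109291988131856,
  F 0 (F 5 (B 4 7 (B 4 8 (B 4 9 (F 4 (M 47944631919395840)) (M 23788425320639129)) (M
  23806017506683528)) (M 23999669000514167)))⟩,
  ⟨61223226026283079561449668457779991918433452066681393, 37527780336869392,
  F 0 (B 5 9 (F 5 (R 458 11649936536080)) (B 5 10 (R 458 10619144385040) (M 24034784913173145)))⟩,
  ⟨3649188639300053093519772913865046060209091121, 91608434352144,
  F 0 (B 5 4 (B 5 6 (F 5 (M 37492736913353369)) (B 5 7 (F 5 (M 24069900297349785)) (R 448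
  11649684877840))) (B 5 6 (B 5 8 (F 5 (M 23788425320639129)) (B 5 9 (F 5 (M 23806017506683528))
  (M 23823609692723592))) (B 5 7 (R 449 11649936536080) (B 5 8 (R 459 11649936536080) (B 5 9 (R
  459 11585512026640) (M 24034922352122248))))))⟩,
  ⟨216173867871655719519748369934796796465, 2128460664451509592080,
  F 0 (B 3 8 (F 3 (R 457 11649936536080)) (B 3 9 (F 3 (R 457 11585512026640)) (B 3 10 (R 457
  10490295366160) (R 460 11649936536080))))⟩,
  ⟨844429171373655154373437562988606001, 7085095974911156240,
  F 0 (B 3 6 (B 3 7 (F 3 (R 447 11649936536080)) (B 3 8 (F 3 (R 447 11645910004240)) (B 3 9 (F 3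
  (R 447 11577458962960)) (B 3 10 (R 447 10478215770640) (B 5 6 (B 5 4 (F 5 (M 37492530755971737))
  (B 5 7 (F 5 (M 23788425320639129)) (B 5 8 (F 5 (M 23788425320639129)) (M 23823747131672695))))
  (B 5 4 (B 5 7 (F 5 (M 24069900297349785)) (R 448 11649936536080)) (B 5 7 (R 449 11649936536080)
  (B 5 8 (R 449 11645910004240) (M 23823747131672695))))))))) (B 3 7 (R 461 11649936536080) (B 3 8
  (R 461 11645910004240) (B 3 9 (R 461 11577458962960) (R 460 10478215770640)))))⟩,
  ⟨55340504678526989899473792957293374026289, 179617653618487394437177360,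
  F 0 (F 3 (F 4 (B 7 5 (B 5 8 (B 5 9 (F 5 (M 47925734062183793)) (M 19196865574644309)) (M
  19196865306208853)) (M 19196933757250133))))⟩,
  ⟨197481273389739191264442100366943793713, 2721436155290720411664,
  F 0 (F 3 (B 7 5 (F 7 (R 404 11416442849335)) (B 7 6 (F 7 (R 404 11347723438135)) (M
  33289516312712465))))⟩,
  ⟨14167173211369852218929698842992388870320689, 178332910671923502474338320,
  F 0 (F 3 (F 7 (B 5 6 (B 5 8 (F 5 (R 404 11622317045335)) (M 37599595699664691)) (M
  41838076921673557))))⟩,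
  ⟨237685726039913106088676029696073129275188733620785, 696612859971886340120592,
  F 0 (F 3 (B 7 6 (F 7 (R 465 11649936536080)) (B 7 9 (F 7 (R 404 11416426072375)) (M
  33288962240977203))))⟩,
  ⟨928459867343384587703440819690834183272666313265, 696612787614125627809808,
  F 0 (F 3 (B 7 8 (R 464 11649936536080) (B 7 5 (R 466 11649936536080) (B 7 6 (R 466
  11649920807200) (M 33289516312712465)))))⟩,
  ⟨3626795674838228284019453316527516182760206897, 696612787614125627809808,
  F 0 (F 3 (B 4 8 (B 4 9 (F 4 (R 463 11649936536080)) (R 467 11649936536080)) (R 467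
  11585512026640)))⟩,
  ⟨237685726039909118404847456474528422864442976449073, 33043971918798864,
  F 0 (B 5 8 (F 5 (M 24071000882714979)) (B 5 9 (F 5 (M 24088593068755043)) (M
  32743054175672712)))⟩,
  ⟨55340520581209344185938492748760704238145, 2721436156390232039440,
  F 0 (F 3 (B 7 9 (F 7 (R 206 11430016358515)) (B 7 6 (F 7 (R 404 11279003965495)) (M
  33641012651923814))))⟩,
  ⟨3626795674838228284019453316527516182760206897, 2721143401377703141392,
  F 0 (F 3 (B 4 7 (R 468 11649936536080) (B 4 8 (R 468 11645910004240) (B 4 9 (R 468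
  11577458962960) (B 5 6 (B 5 7 (R 469 11649936536080) (B 5 8 (R 469 11645910004240) (M
  41750253430409335))) (B 5 7 (B 7 8 (R 470 11649936536080) (B 7 9 (R 470 11585512026640) (M
  33588578617432456))) (M 24088660714485667)))))))⟩,
  ⟨55340510175143864197055583001279943750193, 696612710752692004266000,
  F 0 (F 3 (B 4 5 (R 462 11649936474640) (B 4 6 (R 462 11649920745760) (R 471 11649936536080))))⟩,
  ⟨3671576855681002800941433925661140488913236529, 33060610622103568,
  F 0 (B 7 6 (F 7 (M 47982157326471777)) (M 23806018043554406))⟩,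
  ⟨240620460813910205059114069027983638684325371785777, 128038346956816,
  F 0 (B 7 5 (R 473 11649936536080) (M 28309686121966165))⟩,
  ⟨61223226026283080890677426232997793989408399539909169, 701058376074456006205456,
  F 0 (B 4 10 (R 472 9523927663120) (R 474 11649936536080))⟩,
  ⟨239153226665168274323143821905821066884657008685617, 620778145865672037572624,
  F 0 (B 4 8 (B 4 9 (F 4 (R 472 11649936474640)) (B 4 10 (R 472 10619144323600) (R 435
  7325158024240))) (B 4 9 (R 475 11649936536080) (R 475 10490295304720)))⟩,
  ⟨3649188639300053251648474082019196352839365169, 33043971918798864,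
  F 0 (B 5 9 (F 5 (M 24087493020265060)) (M 24105085206305124))⟩,
  ⟨934192291660813571574780554318676511156768682545, 33043971918798864,
  F 0 (B 5 8 (F 5 (M 23753309936462489)) (R 477 11649936536080))⟩,
  ⟨239153226665168284729208696222646695739765137945137, 111399643652112,
  F 0 (B 5 7 (R 478 11649936536080) (B 5 8 (R 478 11645910004240) (M 24035953144268963)))⟩]

def eleven_15 : List Lem := [
  ⟨61223226026283080890677585014533312727384573914198577, 348969246736,
  F 0 (B 5 7 (B 5 8 (R 477 11641380155920) (M 24053545061877923)) (M 24071137247917987))⟩,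
  ⟨15673145862728468708013461763719328817003830556376511025, 348969246736,
  F 0 (B 5 6 (R 479 11649936536080) (R 480 11649936536080))⟩,
  ⟨55340510175143864197055583001279943750193, 2424837770854157852688,
  F 0 (B 3 9 (F 3 (R 472 11649936536080)) (B 3 10 (R 472 10619144385040) (B 4 5 (R 462
  11649936474640) (B 4 6 (R 462 11649920745760) (B 4 7 (R 476 11649936536080) (B 4 8 (R 476
  11645910004240) (R 481 11649936536080)))))))⟩,
  ⟨61223226003890456789166189953112919421097529460208177, 9539276296851365904,
  F 0 (B 4 9 (R 482 11517060923920) (R 481 11585512026640))⟩,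
  ⟨55340510175143864197055583001279943750193, 8314297198206590992,
  F 0 (B 3 8 (R 482 11649936536080) (B 3 9 (R 482 11585512026640) (B 3 10 (R 482 10490295366160)
  (B 4 5 (R 462 11649936474640) (B 4 6 (R 462 11649920745760) (B 4 7 (B 4 8 (R 482 11649936474640)
  (B 4 9 (R 482 11585511965200) (R 474 9523927724560))) (B 4 8 (R 483 11649936536080) (R 483
  9515874599440))))))))⟩,
  ⟨762985108976009952178737, 27673883844878352,
  F 0 (B 2 7 (F 2 (R 404 11649364222210)) (B 2 8 (F 2 (R 404 11645069320450)) (B 2 9 (F 2 (R 404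
  11576349909250)) (B 2 10 (R 404 10476838347010) (B 3 4 (B 3 6 (R 437 11649920807200) (R 440
  11649936536080)) (B 3 5 (R 462 11649936536080) (B 3 6 (R 462 11649920807200) (B 3 9 (R 484
  11577458962960) (B 3 10 (R 484 10478215770640) (B 4 5 (R 462 11649936474640) (B 4 6 (R 462
  11649920745760) (B 4 7 (R 484 11649936474640) (B 4 8 (R 484 11645909942800) (R 481
  11649936536080))))))))))))))⟩,
  ⟨216173867871655719519676312340758868529, 2128532722045547520016,
  F 0 (F 3 (B 5 4 (R 451 11645406687760) (B 5 8 (B 5 9 (F 5 (R 456 10477209137680)) (R 456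
  11576703988240)) (R 456 11645406687760))))⟩,
  ⟨216173867871655719519676312340758868529, 7157153568949084176,
  F 0 (B 3 7 (F 3 (R 486 11649936536080)) (B 3 8 (F 3 (R 486 11645910004240)) (B 3 9 (F 3 (R 486
  11577458962960)) (B 3 10 (R 486 10478215770640) (R 460 10477209137680)))))⟩,
  ⟨216173867871655719519676312340758868529, 23451759194218512,
  F 0 (B 3 6 (R 487 11649936536080) (B 3 7 (R 487 11649684877840) (B 3 8 (R 487 11645406687760) (B
  3 9 (R 487 11576703988240) (R 460 9305740030480)))))⟩,
  ⟨3626795674848634348893760660529917404179935793, 179541799449413604340670480,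
  F 0 (F 3 (F 4 (B 6 7 (R 464 10477130494240) (B 6 5 (R 466 10477209137680) (M
  37316816388794965)))))⟩,
  ⟨14167170604836829234441506954200361956618801, 620778146448486484156432,
  F 0 (F 3 (B 4 8 (F 4 (R 463 11576703988240)) (B 4 9 (F 4 (R 489 11649936536080)) (B 4 10 (R 489
  10490295304720) (R 152 11649401700880)))))⟩,
  ⟨240614728215029328978879899243453964830130305053233, 2424838353668604436496,
  F 0 (F 3 (B 6 5 (B 6 7 (F 6 (R 473 11649653420320)) (R 466 10477209137680)) (R 480
  11649936536080)))⟩,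
  ⟨14167170604836829234441506954200361956618801, 2424838353668604436496,
  F 0 (F 3 (B 4 7 (R 490 11649936536080) (B 4 8 (R 490 11645910004240) (B 4 9 (B 4 10 (B 6 5 (B 6
  7 (F 6 (R 465 9523676004880)) (B 6 8 (F 6 (R 465 8424181154320)) (B 6 9 (F 6 (R 465
  11576703988240)) (M 28838345861793939)))) (R 480 11649936536080)) (R 491 11649936536080)) (R 491
  10619144385040)))))⟩,
  ⟨14167169208108974907552358638928161268711729, 41320434994437607292065030160,
  F 0 (F 3 (F 5 (B 6 8 (F 6 (R 206 11636174784355)) (B 6 9 (F 6 (R 470 11576641073440)) (M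
  28803504281782419)))))⟩,
  ⟨55340510175143864197037136257206234198577, 2424838052329134563344,
  F 0 (F 3 (B 4 5 (R 488 11649936474640) (B 4 6 (R 492 11649936536080) (B 4 7 (R 492
  11649684877840) (B 4 8 (R 492 11645406687760) (B 5 6 (B 5 7 (B 5 8 (F 5 (B 6 7 (R 493
  11649936536080) (B 6 8 (R 493 10615117853200) (M 28803504818653303)))) (R 480 11645406687760))
  (R 480 11649684877840)) (R 480 11649936536080)))))))⟩,
  ⟨61223226026283079561449589229603272724128904698212913, 2442203932492275195920,
  F 0 (B 4 9 (F 4 (R 494 11517060923920)) (B 4 10 (R 494 10421844263440) (R 474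
  10477209137680)))⟩,
  ⟨239153226665168279536911837678337440755382099194417, 2128609283239212818448,
  F 0 (B 4 7 (R 152 11649401762320) (B 4 8 (R 495 11649936536080) (B 4 9 (R 495 11585512026640) (R
  495 10478215709200))))⟩,
  ⟨15673145862728468367731094842780860631262740254963085873, 10701767950666375184,
  F 0 (B 4 10 (R 494 8154403521040) (R 481 10477209137680))⟩,
  ⟨55340510175143864197037136257206234198577, 8314578673183301648,
  F 0 (B 3 8 (F 3 (R 494 11649936536080)) (B 3 9 (F 3 (R 494 11585512026640)) (B 3 10 (R 494
  10490295366160) (B 4 5 (R 488 11649936474640) (B 4 6 (R 496 11649936536080) (B 4 7 (R 496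
  11649684877840) (B 4 8 (B 4 9 (R 497 11649936536080) (R 497 10405234819600)) (R 497
  9305739969040))))))))⟩,
  ⟨55340510175143864197037136257206234198577, 27955358821589008,
  F 0 (B 3 7 (R 498 11649936536080) (B 3 8 (R 498 11645910004240) (B 3 9 (R 498 11577458962960) (B
  3 10 (R 498 10478215770640) (R 203 11649936535840)))))⟩,
  ⟨16689, 89336127234064,
  F 0 (B 1 6 (F 1 (R 404 11649936536080)) (B 1 7 (F 1 (R 404 11649632653825)) (B 1 8 (F 1 (R 404
  11645337752065)) (B 1 9 (F 1 (R 404 11576618340865)) (B 1 10 (R 404 10477106778625) (B 2 3 (R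
  206 11649936535840) (B 2 4 (R 206 11649936474400) (B 2 5 (R 434 11649936536080) (B 2 6 (R 485
  11649936536080) (B 2 7 (R 485 11649684877840) (B 2 8 (R 485 11645406687760) (B 2 9 (R 485
  11576703988240) (B 2 10 (R 485 10477209137680) (B 3 4 (B 3 6 (B 3 7 (F 3 (R 440 11645406687760))
  (R 440 11649684877840)) (R 440 11649936536080)) (B 3 5 (R 488 11649936536080) (B 3 6 (R 499
  11649936536080) (B 3 7 (R 499 11649684877840) (B 3 8 (R 499 11645406687760) (B 3 9 (R 499
  11576703988240) (R 203 10477209137440))))))))))))))))))))⟩,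
  ⟨844429171373654858068387654866645553, 2128609286619621498896,
  F 0 (F 3 (B 4 7 (F 4 (M 19196795783522969)) (R 152 11649920807440)))⟩,
  ⟨0, 2128681344213659426832,
  F 0 (F 3 (B 5 7 (F 5 (R 206 11649059681875)) (R 500 11648509609555)))⟩,
  ⟨50331895539224667776811745857, 701353524264490744422416,
  F 0 (F 3 (F 4 (B 5 6 (R 502 11649936536080) (B 5 7 (R 502 11649684877840) (B 5 8 (R 502
  11504478011920) (M 24036022400612227))))))⟩,
  ⟨3626795674838228442800984132282219709203558961, 2443284799783252795408,
  F 0 (F 3 (B 4 9 (F 4 (R 503 11649936536080)) (B 4 10 (R 503 10340306993680) (R 199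
  11645406626320))))⟩,
  ⟨55340510175143864197037135974631745860145, 8314582053591982096,
  F 0 (F 3 (B 4 6 (R 501 11649936536080) (B 4 7 (R 501 11649684877840) (B 4 8 (R 504
  11649936536080) (B 4 9 (R 504 11585512026640) (R 199 10477209076240))))))⟩,
  ⟨12884965258041514953067360109121, 8315161496219820048,
  F 0 (F 3 (B 5 7 (R 206 11649059681875) (B 5 8 (R 500 11631333934675) (M 24036022400612227))))⟩,
  ⟨55340504678527610139829479032669000122945, 32478831532056592,
  F 0 (F 3 (B 5 6 (R 506 11649936536080) (B 5 7 (R 506 9459251556880) (M 23999738525284198))))⟩,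
  ⟨55340510175143864197037135974631745860145, 32478831532056592,
  F 0 (F 3 (B 4 5 (R 505 11649936536080) (B 4 6 (R 505 11649920807440) (B 4 7 (R 505
  11649653420560) (R 507 11649936536080)))))⟩,
  ⟨239153226665168279536911837687801556931343103898161, 145634827968528,
  F 0 (B 4 9 (F 4 (R 508 11431465665040)) (B 4 10 (F 4 (R 508 10332222472720)) (M
  28292024679574169)))⟩,
  ⟨15673145862728468367731074560371256979592033733223461425, 32760306508767248,
  F 0 (B 4 8 (R 509 11649936536080) (B 4 9 (R 509 11577443234320) (R 509 10468574052880)))⟩,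
  ⟨55340510175143864197037135974631745860145, 109209210331152,
  F 0 (B 3 7 (F 3 (R 508 11649936536080)) (B 3 8 (F 3 (R 508 11645910004240)) (B 3 9 (F 3 (R 508
  11577458962960)) (B 3 10 (R 508 10478215770640) (B 4 5 (R 199 11649936536080) (B 4 6 (R 199
  11649920807440) (B 4 7 (R 510 11649936536080) (B 4 8 (R 510 11645910004240) (R 509
  9300376502800)))))))))⟩]

def eleven_16 : List Lem := [
  ⟨55340510175143864197037135974631745860145, 357559181328,
  F 0 (B 3 6 (R 511 11649936536080) (B 3 7 (R 511 11649684877840) (B 3 8 (R 511 11645406687760) (B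
  3 9 (R 511 11576703988240) (B 3 10 (R 511 10477209137680) (R 203 10477209129760))))))⟩,
  ⟨55340510175143864197037135974631745860145, 1076895760,
  F 0 (B 3 5 (R 512 11649936536080) (B 3 6 (R 512 11649920807440) (B 3 7 (R 512 11649653420560) (B
  3 8 (R 512 11645359501840) (B 3 9 (R 512 11576641073680) (B 3 10 (R 512 10477130494480) (R 155
  11649936536080)))))))⟩,
  ⟨0, 275685384208,
  F 0 (B 1 3 (R 206 11649936536080) (B 1 4 (R 206 11649936474640) (B 1 5 (R 500 11649936536080) (B
  1 6 (R 500 11649920807440) (B 1 7 (R 500 11649653420560) (B 1 8 (R 500 11645359501840) (B 1 9 (R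
  500 11576641073680) (B 1 10 (R 500 10477130494480) (B 2 3 (R 206 11649936535840) (B 2 4 (R 206
  11649936474400) (B 2 5 (R 500 11649936535840) (B 2 6 (R 500 11649920807200) (B 2 7 (R 500
  11649653420320) (B 2 8 (R 500 11645359501600) (B 2 9 (R 500 11576641073440) (B 2 10 (R 500
  10477130494240) (B 3 4 (B 3 5 (R 500 11649936397360) (B 3 6 (R 500 11649920668720) (B 3 7 (R 500
  11649653281840) (B 3 8 (R 500 11645359363120) (B 3 9 (R 500 11576640934960) (B 3 10 (R 500
  10477130355760) (R 163 11649936532240))))))) (R 513 11649936536080))))))))))))))))))⟩,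
  ⟨8459241426926055713, 2341544206900921512867858337505296,
  F 0 (F 1 (F 2 (F 3 (F 5 (B 6 7 (F 6 (F 7 (R 514 11649077806945))) (B 6 4 (F 6 (B 4 7 (F 4 (F 7
  (M 33608040231108864))) (M 28804535342377588))) (M 41995992945437284)))))))⟩,
  ⟨33059451032453425, 2666062760559348239651014358081552,
  F 0 (F 1 (F 2 (F 3 (F 5 (B 6 4 (F 6 (R 515 11649076913410)) (M 24052446087129700))))))⟩,
  ⟨8459241426926055713, 9067102480979414113924439613456,
  F 0 (F 1 (F 2 (F 5 (B 3 7 (F 3 (R 515 11649936536080)) (B 3 10 (F 3 (R 516 10490290123285)) (B 6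
  4 (F 6 (R 515 11649076913410)) (M 24052446087129700)))))))⟩,
  ⟨2166584182862867738913, 2991928519390488756123137796481040,
  F 0 (F 1 (F 2 (F 3 (F 5 (B 4 6 (R 517 11649931231765) (M 24052446087129700))))))⟩,
  ⟨771912320890615037571361, 35418364324575578137599942672,
  F 0 (F 1 (F 2 (F 5 (B 4 6 (R 517 11649931231765) (M 24052446087129700)))))⟩,
  ⟨33043907511202081, 35418364324575578137599942672,
  F 0 (F 1 (F 2 (F 5 (B 3 4 (R 514 11649936397360) (B 3 6 (R 517 11649936536080) (B 3 7 (R 517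
  11649679634965) (B 3 8 (B 3 10 (F 3 (R 518 10618887483925)) (R 519 11649936536080)) (R 519
  9523670823445))))))))⟩,
  ⟨554645555599072803565857, 2992086975720259034773990732210192,
  F 0 (F 1 (F 2 (F 3 (F 5 (B 6 7 (F 6 (R 514 11649077806945)) (B 6 4 (F 6 (R 520 11649076909570))
  (M 42066361689614948)))))))⟩,
  ⟨8459260118623727905, 10572763983463482453744793165840,
  F 0 (F 1 (F 2 (F 5 (B 3 7 (F 3 (B 6 7 (F 6 (F 7 (R 514 11649077806945))) (B 6 4 (F 6 (R 520
  11649060132355)) (M 41995992945437284)))) (B 3 4 (F 3 (R 514 11649936397360)) (B 3 8 (F 3 (R 514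
  11644765079635)) (B 3 9 (F 3 (R 521 11649936536080)) (B 3 10 (R 521 10601959535125) (M
  23770488203422361)))))))))⟩,
  ⟨158914224793617535390069025, 10572763988185848936614438379536,
  F 0 (F 1 (F 2 (F 5 (B 6 8 (F 6 (M 23752896017377945)) (B 6 9 (F 6 (M 46851436294735956)) (M
  42347836668414036))))))⟩,
  ⟨8459260118623727905, 41299859291881484913426309136,
  F 0 (F 1 (F 2 (F 5 (B 3 6 (R 522 11649936536080) (B 3 7 (R 522 11632500027925) (B 3 4 (R 514
  11649936397360) (B 3 8 (R 514 11645334198325) (B 6 4 (R 523 11649936536080) (B 6 8 (R 523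
  11632751686165) (M 28274639725693013))))))))))⟩,
  ⟨781948646722097414025505, 35418369066325553803447771152,
  F 0 (F 1 (F 2 (B 3 7 (F 3 (B 6 7 (F 6 (F 7 (R 514 11649077806945))) (B 6 4 (F 6 (R 520
  11649060132355)) (M 41995992945437284)))) (B 3 4 (F 3 (R 514 11649936397360)) (B 3 8 (F 3 (M
  23770488203422361)) (B 3 9 (F 3 (M 23770488204470920)) (M 23770488205515144)))))))⟩,
  ⟨13118921423096564703748444729905, 11687220778869096421026937446416,
  F 0 (F 1 (F 2 (F 3 (B 6 4 (R 409 11648826302545) (M 24052446087129700)))))⟩,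
  ⟨3358443884312720564159601850855713, 40680889272238794775976747024,
  F 0 (F 1 (F 2 (B 3 9 (F 3 (R 526 11649936536080)) (B 3 10 (R 526 10619144385040) (M
  23752896017377945)))))⟩,
  ⟨33043907511202081, 138352985642590773030428688,
  F 0 (F 1 (F 2 (B 5 4 (F 5 (R 520 11649936536080)) (B 5 8 (F 5 (R 524 11649936536080)) (B 5 9 (F
  5 (R 524 11564032274965)) (B 5 10 (R 524 10464520712725) (B 3 6 (R 525 11649936536080) (B 3 7 (R
  525 11649684877840) (B 3 4 (R 514 11649936397360) (B 3 8 (R 527 11649936536080) (B 3 9 (R 527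
  11585512026640) (M 23752896019470728))))))))))))⟩,
  ⟨2165570609063918711073, 46274594038739326186342588432,
  F 0 (F 1 (F 2 (F 5 (B 6 7 (R 514 11649077806945) (B 6 3 (R 528 11649920807440) (B 6 4 (R 528
  11649920746000) (B 6 8 (R 528 11284765049365) (B 6 9 (R 528 11284764987925) (B 7 3 (R 528
  11649653420560) (B 7 4 (R 528 11649653359120) (M 28892367717217024)))))))))))⟩,
  ⟨3379998897495109711360032343470369, 540441350165266114289680,
  F 0 (F 1 (F 2 (B 7 3 (R 528 11649653420560) (M 42049869015198323))))⟩,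
  ⟨13118903288932420984788629991713, 181879314292359642320216080,
  F 0 (F 1 (F 2 (B 6 10 (F 6 (R 529 9085819458070)) (R 530 11649936536080))))⟩,
  ⟨2165570609063918711073, 161327575358910946350211088,
  F 0 (F 1 (F 2 (B 5 9 (F 5 (R 529 11649936536080)) (B 5 10 (R 529 10185347858965) (B 6 7 (R 514
  11649077806945) (B 6 3 (R 528 11649920807440) (B 6 4 (R 528 11649920746000) (B 6 8 (B 6 9 (F 6
  (R 529 11284842643990)) (B 6 10 (R 529 10185331081750) (R 409 11632971810385))) (B 6 9 (R 531
  11649936536080) (R 531 10490279637520))))))))))⟩,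
  ⟨284561649953, 540441350165266114289680,
  F 0 (F 1 (F 2 (B 5 6 (R 514 11649077937745) (B 5 7 (R 514 11649077872465) (B 5 3 (R 528
  11649936536080) (B 5 4 (R 528 11649936474640) (B 5 8 (R 532 11649936536080) (B 5 9 (R 532
  11585512026640) (B 6 7 (R 514 11649077806945) (B 6 3 (R 528 11649920807440) (B 6 4 (R 528
  11649920746000) (B 6 8 (R 532 11649920807440) (R 530 9459503215120)))))))))))))⟩,
  ⟨41320430235105280653216789025, 46270962262136840079818104848,
  F 0 (F 1 (F 2 (F 5 (B 6 7 (R 514 11649077806945) (M 46553885540644625)))))⟩,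
  ⟨3054049612775203247342376690266401, 13192248799518906205885028114448,
  F 0 (F 1 (F 2 (B 4 10 (F 4 (R 514 10467675671140)) (M 28784606704605525))))⟩,
  ⟨41632337855826124038037717281, 864953692936711138106499433623461904,
  F 0 (F 1 (F 2 (F 5 (F 6 (B 4 10 (R 514 10476817881670) (R 535 10619128594960))))))⟩,
  ⟨161341761121841499990995489, 11845368827813623365774475272208,
  F 0 (F 1 (F 2 (F 5 (B 3 8 (F 3 (B 6 7 (R 514 11649077806945) (B 6 8 (R 514 11644781791330) (M
  23806018043554406)))) (B 3 9 (F 3 (R 514 11571750701395)) (B 3 10 (B 6 7 (R 514 11649077806945)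
  (B 6 4 (R 536 11584653452545) (B 6 8 (R 514 11644781791330) (B 6 9 (R 536 11564520792145) (R 534
  11495800332370))))) (B 6 7 (R 514 11649077806945) (B 6 8 (R 514 11644781791330) (M
  23806018043554406)))))))))⟩,
  ⟨630241254365623340904737, 46270962262136840079818104848,
  F 0 (F 1 (F 2 (F 5 (B 3 6 (B 3 4 (F 3 (R 514 11649936397360)) (B 3 7 (F 3 (R 533
  11649936532240)) (B 3 8 (F 3 (R 533 11645909996320)) (B 6 4 (F 6 (R 533 11649077958145)) (R 534
  11649936536080))))) (B 3 4 (R 514 11649936397360) (B 3 7 (R 537 11649936536080) (B 3 8 (R 537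
  11645910004000) (B 6 4 (B 6 7 (F 6 (R 537 11515932992770)) (R 537 11584653452545)) (R 534
  11645910004000)))))))))⟩,
  ⟨51245786808970939308311654961, 11686910018820324701154004967440,
  F 0 (F 1 (F 2 (F 3 (B 6 4 (F 6 (R 533 11649077958145)) (M 24052446087129700)))))⟩,
  ⟨859761638719325882306333836353614113, 11686912502785094690587387371536,
  F 0 (F 1 (F 2 (F 3 (B 6 7 (R 514 11649077806945) (B 6 4 (B 6 8 (F 6 (R 514 11644781791330)) (B 6
  9 (F 6 (R 538 11491522138210)) (M 28804608625248370))) (M 24069901102656100))))))⟩,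
  ⟨3358443884307998197676732205642017, 40372613188237064336426672144,
  F 0 (F 1 (F 2 (B 3 8 (F 3 (M 24034716462131865)) (B 3 9 (F 3 (R 540 11649936536080)) (B 3 10 (R
  540 10490043704080) (R 409 11649936531760))))))⟩,
  ⟨859761638719330844628845672959914545, 615999213891180437708816,
  F 0 (F 1 (F 2 (B 6 4 (B 6 8 (F 6 (R 514 11644781791330)) (B 6 9 (F 6 (R 538 11491522138210)) (M
  42313827235170338))) (B 6 7 (R 514 11649077806945) (M 24035889541838737)))))⟩,
  ⟨32199482581070113, 157695798756424839825727504,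
  F 0 (F 1 (F 2 (B 5 4 (F 5 (R 533 11649077961985)) (B 5 7 (F 5 (R 514 11649077872465)) (B 5 8 (F
  5 (R 514 11644781856850)) (B 5 9 (F 5 (R 538 11649936536080)) (B 5 10 (R 538 10396557140050) (B
  3 6 (B 3 4 (F 3 (R 514 11649936397360)) (B 3 7 (F 3 (R 533 11649936532240)) (B 3 9 (F 3 (R 539
  11649936536080)) (B 3 10 (F 3 (R 539 10421844316960)) (M 23700121337244313))))) (B 3 4 (R 514
  11649936397360) (B 3 7 (R 541 11649936536080) (B 3 8 (R 541 11645910004000) (R 542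
  11649936536080))))))))))))⟩]

def eleven_17 : List Lem := [
  ⟨698474724792171760961362758698349089, 2424842010644278419472,
  F 0 (F 1 (B 3 9 (F 3 (M 28804608113591296)) (M 28804539394114560)))⟩,
  ⟨56686955582968314487616717255474273137185, 157705520266549928471306256,
  F 0 (F 1 (F 2 (B 3 8 (R 544 11649936536080) (B 3 9 (B 3 10 (B 7 9 (R 514 9230993721715) (M
  28803504818648963)) (M 28803509113620594)) (M 28803440662579314)))))⟩,
  ⟨56686955582968314487616717255469960409377, 615999213891180437708816,
  F 0 (F 1 (F 2 (B 3 4 (R 514 11649936397360) (B 3 7 (R 545 11649936536080) (B 3 8 (R 545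
  11645910004000) (R 542 11645894275360))))))⟩,
  ⟨161341761117618271515980065, 51245772566858407267057803280,
  F 0 (F 1 (F 2 (B 6 3 (R 543 11645894275360) (B 6 4 (R 543 11645894213920) (B 6 7 (R 514
  11649077806945) (B 6 8 (R 514 11644781791330) (B 6 9 (R 543 4636424180005) (B 6 10 (R 543
  4636424118565) (R 546 11649936536080)))))))))⟩,
  ⟨161341761117618271515980065, 180745946336470927468929040,
  F 0 (F 1 (F 2 (B 5 10 (R 547 11649936536080) (B 6 3 (R 543 11645894275360) (B 6 4 (R 543
  11645894213920) (B 6 7 (R 514 11649077806945) (B 6 8 (R 514 11644781791330) (B 6 9 (B 6 10 (R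
  547 4636501774630) (B 9 3 (B 9 4 (F 9 (M 48017211817800192)) (M 28804397903424148)) (M
  28804397903424147))) (B 3 4 (R 514 11649936397360) (B 3 7 (B 3 8 (R 544 11649936536080) (M
  28892431605908480)) (M 28892363422254080)))))))))))⟩,
  ⟨125628887216417, 615999213891180437708816,
  F 0 (F 1 (F 2 (B 5 6 (R 514 11649077937745) (B 5 3 (R 543 11649936536080) (B 5 4 (R 543
  11645909942560) (B 5 7 (R 514 11649077872465) (B 5 8 (R 514 11644781856850) (B 5 9 (R 548
  11649936536080) (B 5 10 (R 548 10615117852960) (B 6 3 (R 543 11645894275360) (B 6 4 (R 543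
  11645894213920) (B 6 7 (R 514 11649077806945) (B 6 8 (R 514 11644781791330) (R 546
  11645894275360))))))))))))))⟩,
  ⟨180821875445708534416814369, 2091643176820109484048,
  F 0 (F 1 (B 3 4 (F 3 (R 514 11649936397360)) (B 3 7 (F 3 (R 533 11649936532240)) (B 3 8 (F 3 (R
  549 11645909999920)) (B 3 9 (F 3 (R 549 11577458958640)) (M 23700121874110856))))))⟩,
  ⟨220166805083255653594785197976021185073, 178332817063725638276358160,
  F 0 (F 1 (F 3 (B 6 4 (R 409 11648826302545) (M 24052446087129700))))⟩,
  ⟨56362702101313447320265010681861423378721, 158904724576039469000433680,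
  F 0 (F 1 (B 3 9 (F 3 (R 551 11649936536080)) (B 3 10 (R 551 10619144385040) (R 550
  9523927720720))))⟩,
  ⟨767725994546351630856481, 535442206523047113924624,
  F 0 (F 1 (B 5 4 (F 5 (R 533 11649077961985)) (B 5 7 (F 5 (R 514 11649077872465)) (B 5 8 (F 5 (R
  549 11632971833425)) (B 5 9 (F 5 (R 549 11564520792145)) (B 5 10 (R 549 10465277599825) (B 3 6
  (R 550 11649936536080) (B 3 4 (R 514 11649936397360) (B 3 7 (R 409 11649684877600) (B 3 8 (R 552
  11649936536080) (B 3 9 (R 552 11585512026640) (R 550 11649936532240))))))))))))⟩,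
  ⟨51237120739402930593014202646557707350305, 8318536988327157776,
  F 0 (F 1 (B 3 8 (B 3 9 (F 3 (B 7 8 (R 514 11430016911475) (M 28803435830736803))) (M
  28767014513318212)) (M 28767014781749316)))⟩,
  ⟨14163427441684562887350827816446770059292961, 706094192811088456720400,
  F 0 (F 1 (F 5 (B 3 4 (R 514 11649936397360) (B 3 7 (R 554 11649936536080) (M
  28892363422254080)))))⟩,
  ⟨12880304853728397844571929850145, 180760113435919536404570128,
  F 0 (F 1 (F 5 (B 6 3 (R 553 11649920807440) (B 6 4 (R 553 11649920746000) (B 6 7 (R 514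
  11649077806945) (B 6 8 (R 553 11284765049365) (B 6 9 (R 553 11284764987925) (R 555
  11649936536080))))))))⟩,
  ⟨56707039713954382582888045917308271604001, 31913673965445136,
  F 0 (F 1 (B 3 4 (R 514 11649936397360) (B 3 7 (R 554 9523911995920) (M 24035952078924407))))⟩,
  ⟨56362702101072049007863548318904925434145, 710446543548573341982736,
  F 0 (F 1 (B 6 10 (F 6 (R 556 9085819458070)) (R 557 11649936536080)))⟩,
  ⟨12880304853728397844571929850145, 630166313339789373349904,
  F 0 (F 1 (B 5 9 (F 5 (R 556 11649936536080)) (B 5 10 (R 556 10185347858965) (B 6 3 (R 553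
  11649920807440) (B 6 4 (R 553 11649920746000) (B 6 7 (R 514 11649077806945) (B 6 8 (B 6 9 (F 6
  (R 556 11284842643990)) (B 6 10 (R 556 10185331081750) (R 409 11632971810385))) (B 6 9 (R 558
  11649936536080) (R 558 10490279637520)))))))))⟩,
  ⟨284561649953, 2091571118126559928336,
  F 0 (F 1 (B 2 7 (F 2 (R 533 11649936536080)) (B 2 8 (F 2 (R 549 11649936536080)) (B 2 9 (F 2 (R
  549 11577458962720)) (B 2 10 (R 549 10478215770400) (B 5 6 (R 514 11649077937745) (B 5 3 (R 553
  11649936536080) (B 5 4 (R 553 11649936474640) (B 5 7 (R 514 11649077872465) (B 5 8 (R 559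
  11649936536080) (B 5 9 (R 559 11585512026640) (B 6 3 (R 553 11649920807440) (B 6 4 (R 553
  11649920746000) (B 6 7 (R 514 11649077806945) (B 6 8 (R 559 11649920807440) (R 557
  9459503215120))))))))))))))))⟩,
  ⟨0, 177119168801628796232933392,
  F 0 (F 1 (F 2 (B 5 6 (F 5 (R 560 11503048164610)) (B 5 7 (F 5 (R 560 11503048164610)) (R 560
  11649077961985)))))⟩,
  ⟨11850653052052857686295758123297, 691871753130258392424464,
  F 0 (F 1 (F 2 (B 6 7 (R 514 11649077806945) (B 8 9 (R 514 11503047870850) (M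
  37810500072937762)))))⟩,
  ⟨101, 2091715812757263622160,
  F 0 (F 1 (B 6 7 (F 6 (R 514 11649077806945)) (R 560 11648558913025)))⟩,
  ⟨11850653052071304430369467674913, 177119168949684633982738448,
  F 0 (F 1 (F 2 (B 6 4 (R 563 11649936536080) (R 562 11649936536080))))⟩,
  ⟨776359097823061603507641343179632929, 45343796715571845230180179984,
  F 0 (F 1 (F 2 (B 3 9 (F 3 (R 560 11503424246560)) (B 3 10 (B 6 8 (R 514 10399224825955) (B 6 4
  (R 561 10619128529680) (R 562 11649936536080))) (B 6 8 (B 6 4 (F 6 (R 560 11648558913025)) (B 6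
  9 (F 6 (R 514 11498735343670)) (M 24036026427152754))) (R 564 11649936536080))))))⟩,
  ⟨3032652724600961455472180299182369, 177119168949684633982738448,
  F 0 (F 1 (F 2 (B 3 7 (R 560 11649417487120) (B 3 8 (R 565 11649936536080) (B 3 9 (R 565
  11504226414880) (B 6 10 (B 6 8 (F 6 (R 564 11585512026640)) (R 564 11649936536080)) (B 6 4 (R
  563 11649936536080) (B 6 7 (R 514 11649077806945) (B 6 8 (B 8 9 (R 514 11503047870850) (B 8 10
  (B 8 4 (F 8 (M 33606106915820962)) (M 28574329934485794)) (M 46818869185168384))) (R 564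
  11649936536080))))))))))⟩,
  ⟨56005129120909966465023809300603994255649, 3055490073664223715344,
  F 0 (F 1 (B 10 6 (B 10 7 (F 10 (M 24106189012900194)) (M 24106325931751297)) (M
  24106326200182401)))⟩,
  ⟨32196184046186785, 691871753130258392424464,
  F 0 (F 1 (F 2 (B 5 3 (R 561 11649936536080) (B 5 4 (R 561 11649936474640) (B 5 6 (R 514
  11649077937745) (B 5 7 (R 514 11649077872465) (B 5 8 (R 514 11503048132690) (B 5 9 (R 514
  11503048067410) (B 5 10 (B 3 4 (R 514 11649936397360) (B 3 6 (R 566 11649936536080) (B 3 7 (R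
  566 11649684877840) (B 3 8 (R 566 11504478073120) (B 3 9 (R 566 11504226414880) (B 3 10 (B 10 4
  (B 10 6 (F 10 (M 47098899690723720)) (B 10 7 (F 10 (M 46817424715061640)) (B 10 8 (F 10 (M
  47098901301336354)) (M 47098901569767458)))) (R 567 11649936536080)) (B 4 7 (R 566
  11649684816400) (B 4 8 (R 566 11504478011680) (M 24053618881628258))))))))) (B 3 4 (R 514
  11649936397360) (B 3 6 (R 566 11649936536080) (B 3 7 (R 566 11649684877840) (B 3 8 (R 566
  11504478073120) (B 3 9 (R 566 11504226414880) (R 555 11503048164610)))))))))))))))⟩,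
  ⟨0, 2091495119882848051216,
  F 0 (F 1 (B 5 6 (F 5 (R 563 11649653351440)) (R 563 11649920738320)))⟩,
  ⟨3420567760640151273967318666981665, 31913673965445136,
  F 0 (F 1 (B 3 4 (R 514 11649936397360) (B 3 6 (B 3 7 (R 569 11649062106625) (M
  38373379148917363)) (M 38373447868394083))))⟩,
  ⟨782187084456343987433761, 161408170264632893950140432,
  F 0 (F 1 (B 8 4 (F 8 (R 514 11645284005160)) (B 8 6 (F 8 (R 514 11644747265320)) (B 8 7 (F 8 (R
  514 11640452363560)) (B 8 10 (F 8 (R 514 10403501978920)) (R 570 11649936536080))))))⟩,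
  ⟨13122944728204565944173874786593, 2424693954806528614416,
  F 0 (F 1 (B 3 9 (F 3 (R 568 11500184150320)) (B 3 10 (F 3 (R 568 10400940958000)) (B 6 4 (R 569
  11649920680720) (M 24087493020265060)))))⟩,
  ⟨860026340629256059028884006602093105, 8170481150577352720,
  F 0 (F 1 (B 3 7 (R 569 11649062106625) (B 6 9 (B 6 7 (F 6 (R 514 11649077806945)) (R 572
  11584653452545)) (B 6 4 (R 569 11649920680720) (B 6 7 (R 514 11649077806945) (M
  42315201642578944))))))⟩,
  ⟨859823516551358151985346841355039281, 50624403919394175778127093776,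
  F 0 (F 1 (F 3 (B 8 7 (F 8 (R 568 5778713514115)) (M 38392143888335872))))⟩,
  ⟨56362691716715704522907998382849809003057, 31913673965445136,
  F 0 (F 1 (B 4 6 (R 573 11649936474640) (B 4 7 (R 573 11649684816400) (M 24035958261315457))))⟩]

def eleven_18 : List Lem := [
  ⟨3297358971009500321352107968049441, 706038852578867328065552,
  F 0 (F 1 (B 5 10 (R 568 9086693761105) (B 3 4 (R 514 11649936397360) (B 3 6 (R 573
  11649936536080) (B 3 7 (R 573 11649684877840) (B 3 8 (B 3 9 (B 3 10 (B 8 9 (R 514 8131482093955)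
  (B 8 4 (R 569 8133216911920) (B 8 6 (R 574 11649936536080) (R 574 7102424945200)))) (B 8 9 (B 8
  6 (F 8 (R 514 11498718374200)) (M 23770971110419046)) (B 8 4 (B 8 6 (F 8 (M 48000642338394368))
  (M 23770971110419046)) (B 8 6 (B 8 7 (F 8 (M 47996377141106065)) (M 23753378924374647)) (M
  23770971110419046))))) (B 8 4 (B 8 6 (F 8 (M 38373583703026295)) (B 8 7 (F 8 (M
  38373583704074854)) (M 24087699178682214))) (B 8 6 (B 8 7 (F 8 (M 37281564370966869)) (M
  24071141559662497)) (M 24071141828093601)))) (B 3 9 (B 9 4 (B 9 6 (F 9 (M 43212190779484791)) (B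
  9 7 (F 9 (M 43212190780533350)) (M 23788632284362598))) (R 567 10490295366160)) (R 575
  11649936536080))))))))⟩,
  ⟨32196184046186785, 2406246631290191224848,
  F 0 (F 1 (B 2 9 (F 2 (R 568 11649936536080)) (B 2 10 (R 568 10405234880800) (B 5 3 (R 569
  11649936536080) (B 5 4 (R 569 11649936474640) (B 5 6 (R 514 11649077937745) (B 5 7 (R 514
  11649077872465) (B 5 8 (B 5 9 (F 5 (R 568 11285431803985)) (B 5 10 (R 568 10186188611665) (B 8 3
  (R 571 11649936536080) (B 8 4 (R 571 10619144323600) (B 8 6 (R 571 10618285810945) (B 8 9 (B 8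
  10 (F 8 (R 514 8126900901160)) (R 570 11649077900545)) (R 570 10618285749505))))))) (B 5 9 (R
  576 11649936536080) (B 5 10 (R 576 10489436792065) (B 3 4 (R 514 11649936397360) (B 3 6 (R 573
  10619144385040) (B 3 7 (R 573 10618892726800) (B 3 8 (B 3 9 (B 3 10 (B 8 4 (R 569 8133216911920)
  (B 8 6 (B 8 7 (F 8 (R 576 8133217096240)) (R 570 8133217096240)) (R 570 7102424945200))) (R 575
  10618892726800)) (R 575 11649684877840)) (B 4 6 (R 573 10619144323600) (B 4 7 (R 573
  10618892665360) (M 24035889541838737)))))))))))))))))⟩,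
  ⟨284561649953, 8169901707949514768,
  F 0 (F 1 (B 2 6 (R 560 11649936536080) (B 2 7 (R 560 11649684877840) (B 2 8 (R 577
  11649936536080) (B 2 9 (R 577 11585512026640) (B 2 10 (R 577 10490295366160) (B 5 3 (R 569
  11649936536080) (B 5 4 (R 569 11649936474640) (B 5 6 (R 514 11649077937745) (B 5 7 (R 514
  11649077872465) (B 5 8 (R 577 11649077961985) (B 5 9 (R 577 11584653452545) (B 3 4 (R 514
  11649936397360) (B 3 6 (R 573 9523927724560) (B 3 7 (R 573 9523676066320) (B 4 6 (R 573
  9523927663120) (B 4 7 (R 573 9523676004880) (M 24000361310222209))))))))))))))))))⟩,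
  ⟨8242240712556556577, 767725994260543015231504,
  F 0 (F 1 (B 3 4 (R 514 11649936397360) (B 3 5 (R 578 11649936532240) (B 3 6 (R 578
  11649920803600) (B 3 7 (R 578 11649653416720) (B 3 8 (R 578 8133217096480) (B 3 9 (R 578
  8133201367840) (B 3 10 (R 578 8132933980960) (B 4 5 (R 578 11649936466960) (B 4 6 (R 578
  11649920738320) (B 4 7 (R 578 11649653351440) (B 4 8 (R 578 8133217031200) (B 4 9 (R 578
  8133201302560) (R 507 10619144246320))))))))))))))⟩,
  ⟨50642447764735105745609175329, 161412912307359028251467792,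
  F 0 (F 1 (F 8 (B 4 6 (R 578 11649920738320) (M 38055345415826020))))⟩,
  ⟨792241656552897008444324090836300065, 31913673965445136,
  F 0 (F 1 (B 4 5 (R 578 11649936466960) (M 38443820118988193)))⟩,
  ⟨849642216706733643195873727809204513, 625778298613348015546384,
  F 0 (F 1 (B 8 5 (F 8 (R 580 11649936536080)) (B 8 6 (F 8 (R 580 11649417490960)) (B 8 7 (F 8 (R
  580 11649401762320)) (B 4 9 (B 4 5 (F 4 (R 578 11502747211780)) (B 4 6 (F 4 (R 578
  11498452248580)) (M 38091700456941073))) (R 581 11649936536080))))))⟩,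
  ⟨3318908719310462338926551011307809, 162626560493456527071387664,
  F 0 (F 1 (F 8 (B 5 6 (R 514 11649077937745) (B 5 9 (B 5 4 (F 5 (R 578 11648794846465)) (M
  38055345415825988)) (B 5 4 (R 578 11649936466960) (M 37281564102535765))))))⟩,
  ⟨792261938961291734295133408912879905, 31913673965445136,
  F 0 (F 1 (B 5 4 (R 578 11649936466960) (M 38444919641162752)))⟩,
  ⟨217508408824130199296896902713784283425, 177133670328832077167861776,
  F 0 (F 1 (B 8 6 (F 8 (R 583 11649936536080)) (B 8 7 (F 8 (R 583 11649684877840)) (B 8 10 (B 5 9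
  (B 5 4 (F 5 (R 579 8111635644805)) (B 5 6 (F 5 (R 578 7973096796760)) (M 38091700456941073))) (R
  584 11649936536080)) (B 5 9 (B 5 4 (F 5 (R 584 10619144385040)) (M 38407464009378388)) (R 584
  11649936536080))))))⟩,
  ⟨50314828868776966343498019105, 161412912307359028251467792,
  F 0 (F 1 (F 8 (B 4 5 (R 578 11649936466960) (B 4 6 (R 578 11649920738320) (B 4 7 (R 578
  11649653351440) (M 38442921922426726))))))⟩,
  ⟨3297432624744168423714858426577185, 177128947962349207522648080,
  F 0 (F 1 (B 8 5 (F 8 (R 586 11649936536080)) (B 8 6 (F 8 (R 586 11649920807440)) (B 8 7 (F 8 (R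
  586 11649653420560)) (B 8 9 (F 8 (R 514 11503281649960)) (B 4 5 (R 578 11649936466960) (B 4 6 (R
  578 11649920738320) (R 581 11649684816400))))))))⟩,
  ⟨844144099140893755224232151831687457, 162626560493456527071387664,
  F 0 (F 1 (F 8 (B 5 6 (R 514 11649077937745) (B 5 4 (R 578 11649936466960) (B 5 7 (R 514
  11649077872465) (B 5 9 (B 5 10 (R 579 4615639097425) (M 24071141559662497)) (M
  24070936474974097)))))))⟩,
  ⟨3420321718838658076525458671939873, 31913673965445136,
  F 0 (F 1 (B 5 4 (R 578 11649936466960) (B 5 6 (R 514 11649077937745) (M 38373452448556689))))⟩,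
  ⟨844144099140893755224232151831687457, 197685409262280773137866768,
  F 0 (F 1 (B 8 6 (F 8 (R 588 11649936536080)) (B 8 7 (F 8 (R 588 11649684877840)) (B 8 10 (F 8 (R
  514 10403501648440)) (R 589 11649936536080)))))⟩,
  ⟨216100911009684791627827083210791203105, 691891429373523048538128,
  F 0 (F 1 (B 8 6 (R 590 10619128652560) (B 8 9 (B 8 10 (F 8 (R 514 8131464280360)) (R 589
  11649653420560)) (R 589 10618861265680))))⟩,
  ⟨12870691390311780099306877497633, 691891429373523048538128,
  F 0 (F 1 (B 3 9 (B 3 10 (R 579 8133217100080) (B 8 9 (B 8 4 (F 8 (R 514 11503281649960)) (B 8 5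
  (F 8 (R 514 11503013280040)) (B 8 6 (F 8 (R 514 11498718378280)) (B 8 7 (F 8 (R 514
  11429998967080)) (B 8 10 (R 514 8131464280360) (R 430 11640829645600)))))) (B 8 4 (R 582
  11649936536080) (B 8 5 (R 585 11649936536080) (B 8 6 (R 585 11649920807440) (B 8 7 (R 585
  11649653420560) (B 9 4 (R 582 11585512026640) (R 581 11649936536080)))))))) (B 8 4 (R 587
  11649936536080) (B 8 5 (R 590 10619144381200) (R 591 11649936536080)))))⟩,
  ⟨12942815966486132690152859735510256035442977, 11777301502147698704,
  F 0 (F 1 (B 4 10 (R 433 10477130355760) (R 507 10619144246080)))⟩,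
  ⟨8242240712556556577, 2702624035660490612752,
  F 0 (F 1 (B 2 10 (R 579 11649936536080) (B 3 4 (R 514 11649936397360) (B 3 5 (R 578
  11649936532240) (B 3 6 (R 578 11649920803600) (B 3 7 (R 578 11649653416720) (B 3 8 (R 592
  11649936536080) (B 3 9 (R 592 11585512026640) (B 3 10 (B 4 5 (R 578 11649936466960) (B 4 6 (R
  578 11649920738320) (B 4 7 (R 578 11649653351440) (B 4 8 (R 592 11649936474640) (B 4 9 (R 592
  11585511965200) (R 593 11649936536080)))))) (B 4 5 (R 578 11649936466960) (B 4 6 (R 578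
  11649920738320) (B 4 7 (R 578 11649653351440) (B 4 8 (R 592 11649936474640) (B 4 9 (R 592
  11585511965200) (R 507 10619144246320)))))))))))))))⟩,
  ⟨3297353396581654159377264882626849, 2425922874554847338512,
  F 0 (F 1 (B 3 9 (R 594 11649936532240) (B 3 10 (R 594 10619144381200) (R 433
  11645359493920))))⟩,
  ⟨844123737503127589289470611036451105, 2721070779734200164368,
  F 0 (F 1 (B 3 10 (R 594 9523927720720) (B 4 5 (R 578 11649936466960) (B 4 6 (R 578
  11649920738320) (B 4 7 (R 578 11649653351440) (B 4 8 (R 595 11649936474640) (B 4 9 (R 595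
  11585511899920) (R 471 11503424246560))))))))⟩,
  ⟨8242240712556556577, 9399400898896076816,
  F 0 (F 1 (B 2 9 (R 594 11649936536080) (B 2 10 (R 594 10619144385040) (B 3 4 (R 514
  11649936397360) (B 3 5 (R 578 11649936532240) (B 3 6 (R 578 11649920803600) (B 3 7 (R 578
  11649653416720) (B 3 8 (R 595 11649936536080) (B 3 9 (R 596 11649936536080) (B 3 10 (R 596
  10619144385040) (B 4 5 (R 578 11649936466960) (B 4 6 (R 578 11649920738320) (B 4 7 (R 578
  11649653351440) (R 593 9523927655440))))))))))))))⟩,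
  ⟨4272417, 31913673965445136,
  F 0 (F 1 (B 2 3 (R 514 11649936528160) (B 2 4 (R 514 11649936462880) (B 2 5 (R 578
  11649936536080) (B 2 6 (R 578 11649920807440) (B 2 7 (R 578 11649653420560) (B 2 8 (R 597
  11649936536080) (B 2 9 (R 597 11585512026640) (B 2 10 (R 597 10490295366160) (B 3 4 (R 514
  11649936397360) (B 3 5 (R 578 11649936532240) (B 3 6 (R 578 11649920803600) (B 3 7 (R 578
  11649653416720) (B 3 8 (R 597 11649936532240) (B 3 9 (R 597 11585512022800) (B 3 10 (R 597
  10490295362320) (R 513 11649936528160)))))))))))))))))⟩,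
  ⟨196538132465881685999890721, 2165426211365762113552,
  F 0 (F 5 (B 3 4 (F 3 (R 598 11649629495605)) (B 3 7 (F 3 (R 598 11649060136195)) (B 3 8 (F 3 (R
  598 11644765234435)) (B 3 9 (F 3 (R 598 11576045823235)) (M 23700669214005640))))))⟩,
  ⟨11714569012304294177, 620795291352101209251856,
  F 0 (F 5 (B 3 9 (F 3 (R 598 11503031387395)) (B 3 10 (F 3 (R 598 10403519825155)) (R 599
  9523117363765))))⟩,
  ⟨178750133252385, 2165282096177686257680,
  F 0 (F 5 (B 3 4 (R 514 11649936397360) (B 3 7 (R 514 11649629165365) (B 3 8 (R 600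
  11649936536080) (B 3 9 (R 600 11585512026640) (R 599 11649126175285))))))⟩,
  ⟨3033691379401035109461041827950881, 109209210331152,
  F 0 (B 3 4 (F 3 (R 514 11649936397360)) (B 3 7 (F 3 (R 598 11649060136195)) (B 3 8 (F 3 (R 598
  11644765234435)) (B 3 9 (F 3 (R 598 11576045823235)) (M 23700119458191752)))))⟩,
  ⟨3298551450678340446775569772851489, 7013039553668718608,
  F 0 (B 5 4 (F 5 (B 3 4 (R 514 11649936397360) (B 3 6 (B 3 7 (F 3 (R 598 11649060136195)) (B 3 8
  (F 3 (R 598 11644765234435)) (B 3 9 (F 3 (R 598 11576045823235)) (B 3 10 (R 598 10476534260995)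
  (M 37509985503062681))))) (B 3 7 (R 409 11649684877840) (B 3 8 (R 409 11645406687760) (M
  24034922888988791)))))) (B 5 7 (F 5 (R 601 11649936536080)) (B 5 8 (F 5 (R 601 11645910004240))
  (B 5 9 (F 5 (R 601 11577458962960)) (B 5 10 (R 601 10478215770640) (B 3 6 (R 602 11649936536080)
  (B 3 7 (R 602 7252712108560) (B 3 8 (R 602 7248433918480) (M 24034922888988791)))))))))⟩,
  ⟨216173867871655719519888827043374313761, 630240100316084211556368,
  F 0 (F 5 (B 6 3 (R 603 11649920807440) (B 6 4 (R 603 11649920746000) (B 6 7 (R 603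
  11631583588885) (B 6 8 (R 603 11631583527445) (B 3 4 (R 514 11649936397360) (B 3 7 (B 3 8 (B 3 9
  (F 3 (R 598 11430016943875)) (M 28892500591723520)) (M 33270820567550020)) (M
  37774420194916164))))))))⟩,
  ⟨14167174598017671475607609832274081573122337, 2183804838495107686416,
  F 0 (B 6 8 (F 6 (R 604 11631661183510)) (B 6 9 (F 6 (R 604 11562941772310)) (M
  28239454816737672)))⟩,
  ⟨216173867871655719519888827043374313761, 2165358094421398134800,
  F 0 (B 5 8 (F 5 (R 604 11649936536080)) (B 5 9 (F 5 (R 604 11562958549525)) (B 5 10 (R 604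
  10463446987285) (B 6 3 (R 603 11649920807440) (B 6 4 (R 603 11649920746000) (B 6 8 (R 605
  8424684532240) (B 6 9 (R 605 8420658000400) (R 605 11649920807440))))))))⟩,
  ⟨2980410581804108624161, 7089037797380595728,
  F 0 (B 2 7 (F 2 (R 598 11649076913410)) (B 2 8 (F 2 (R 598 11644782011650)) (B 2 9 (F 2 (R 598
  11576062600450)) (B 2 10 (R 598 10476551038210) (B 5 6 (B 5 3 (F 5 (R 514 11649897670165)) (B 5
  7 (F 5 (R 514 11649075848725)) (B 5 8 (F 5 (R 514 11644780946965)) (B 5 9 (F 5 (R 514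
  11576061535765)) (B 5 10 (F 5 (R 514 10476549973525)) (B 6 3 (F 6 (R 514 11649897669910)) (B 6 7
  (F 6 (R 514 11649075848470)) (B 6 8 (F 6 (R 514 11644780946710)) (M 24034922888988791)))))))))
  (B 5 3 (R 603 11649936536080) (B 5 4 (R 603 11649936474640) (B 5 7 (R 606 11649936536080) (B 5 8
  (R 606 11645910004240) (B 5 9 (R 606 11577458962960) (B 5 10 (R 606 10478215770640) (B 6 3 (R
  603 11649920807440) (B 6 4 (R 603 11649920746000) (B 6 7 (R 606 11649920807440) (B 6 8 (R 606
  11645894275600) (M 24034922888988791))))))))))))))))⟩]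

def eleven_19 : List Lem := [
  ⟨768003857386774430101793, 2422599764487126917136,
  F 0 (F 5 (B 3 9 (F 3 (R 598 11503031387395)) (B 3 10 (F 3 (R 598 10403519825155)) (M
  24034784913173145))))⟩,
  ⟨928459692759921165559339423839733490210231693601, 2721278491774338211856,
  F 0 (F 5 (B 3 10 (R 598 9304008201475) (B 4 6 (B 4 7 (B 4 8 (F 4 (R 598 11635906868740)) (M
  23753378655939208)) (M 24034510580525687)) (M 24052445021776486))))⟩,
  ⟨216173867871655733686992217401495531809, 630184684085619371024400,
  F 0 (F 5 (B 3 4 (R 514 11649936397360) (B 3 6 (R 607 11649936532240) (B 3 7 (R 607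
  11649684869920) (B 3 8 (R 514 11645334198325) (B 3 9 (R 609 11649936536080) (R 609
  10327903703845)))))))⟩,
  ⟨220167048713896899808316771458396336417, 9462997750958268432,
  F 0 (B 3 9 (F 3 (R 607 11503031386195)) (B 3 10 (F 3 (R 607 10403519823955)) (M
  24034784913173145)))⟩,
  ⟨12884966604212267072099076682017, 2109941863956557602832,
  F 0 (B 5 4 (F 5 (B 3 4 (R 514 11649936397360) (B 3 6 (R 607 11649936532240) (B 3 8 (R 608
  11649936536080) (B 3 9 (R 608 11585512026640) (R 608 10473937572640)))))) (B 5 6 (F 5 (R 601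
  11649684877600)) (B 5 7 (F 5 (R 601 11649936536080)) (B 5 8 (F 5 (R 610 11649936536080)) (B 5 9
  (F 5 (R 610 11564032274965)) (B 5 10 (R 610 10464520712725) (B 3 4 (R 514 11649936397360) (B 3 6
  (R 607 11649936532240) (B 3 8 (R 611 11649936536080) (B 3 9 (R 611 11585512026640) (R 611
  10473937572640)))))))))))⟩,
  ⟨860027534038659708670172732700373281, 9684253575327260688,
  F 0 (B 6 9 (F 6 (R 514 11494171968790)) (B 6 10 (F 6 (R 514 10394660406550)) (M
  28802267331209881)))⟩,
  ⟨844429171373655134842171499211796769, 7305210579494379536,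
  F 0 (B 5 7 (F 5 (R 514 11649075848725)) (B 5 8 (F 5 (R 514 11644780946965)) (B 5 9 (F 5 (R 514
  11576061535765)) (B 5 10 (R 514 10476549973525) (B 6 3 (B 6 4 (F 6 (R 514 11649864185110)) (B 6
  7 (F 6 (R 514 11649059075350)) (B 6 8 (F 6 (R 514 11644764173590)) (B 6 9 (F 6 (R 514
  11576044762390)) (M 28803504281786760))))) (B 6 7 (B 6 8 (F 6 (R 514 11631610852630)) (B 6 9 (F
  6 (R 514 11562891441430)) (M 24034922352122248))) (B 6 8 (R 613 11649936536080) (B 6 9 (R 613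
  11585512026640) (M 28802404770158984)))))))))⟩,
  ⟨3318834169771724228727949791211809, 2185030397036380299280,
  F 0 (B 6 4 (F 6 (R 612 11649920680720)) (R 614 11649417486640))⟩,
  ⟨14167169197703147733448592147482041342112033, 180760445549370457214427152,
  F 0 (F 5 (B 3 9 (F 3 (R 598 11498736420355)) (B 3 10 (R 598 10399224858115) (B 6 8 (R 615
  11645910004240) (B 6 4 (R 612 11645894148880) (B 6 7 (B 6 9 (F 6 (M 47961330459628930)) (M
  37811739453113344)) (M 23805949324077687)))))))⟩,
  ⟨237685703647285016913814034043412417129754150449441, 180760131954721204152049680,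
  F 0 (F 5 (B 6 7 (B 6 8 (F 6 (R 616 10478200038160)) (M 28309823560910933)) (M
  46553541656999714)))⟩,
  ⟨14167170604836830162910721964411753789010209, 180760131954721204152049680,
  F 0 (F 5 (B 3 7 (B 3 8 (F 3 (R 598 11636175304195)) (B 3 9 (F 3 (R 598 11567455892995)) (B 3 10
  (R 598 10467944330755) (B 6 7 (R 615 11649936536080) (B 6 4 (R 612 11649920680720) (B 6 8 (B 6 9
  (F 6 (M 47943665259144851)) (M 23806086494595686)) (M 23788563028028006))))))) (B 3 8 (R 616
  11649936536080) (B 3 9 (R 616 11585512026640) (B 3 10 (B 6 4 (R 612 10478199915280) (R 617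
  11649936536080)) (B 6 4 (R 603 11649920680720) (R 617 11649936536080)))))))⟩,
  ⟨55340510175143867823870007673479100510497, 706094264868682494648336,
  F 0 (F 5 (B 3 4 (R 514 11649936397360) (B 3 6 (R 618 11649936536080) (B 3 7 (R 618
  11649684877600) (B 4 6 (R 618 11649936474640) (B 4 7 (R 618 11649684816160) (M
  46518359161861922)))))))⟩,
  ⟨220167048713896880640772384287678935329, 144462301896720,
  F 0 (B 3 9 (F 3 (R 598 11498736420355)) (B 3 10 (F 3 (R 598 10399224858115)) (M
  23770764951988889)))⟩,
  ⟨3693790132355570331048688697842898097375686945, 10620439347866902544,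
  F 0 (B 3 10 (R 598 9299713234435) (B 6 4 (R 612 11577443107600) (M 24070038004738660)))⟩,
  ⟨3693790132355570251820516462144433658898034977, 27973024291495952,
  F 0 (B 3 7 (B 3 8 (F 3 (R 598 11636175304195)) (B 3 9 (F 3 (R 598 11567455892995)) (B 3 10 (R
  598 10467944330755) (R 602 8424684524320)))) (B 3 8 (R 620 11649936536080) (B 3 9 (R 621
  11649936536080) (B 3 10 (R 621 10619144385040) (R 602 8424684524320)))))⟩,
  ⟨242081962451940359809024949852591296695327461093665, 37581871154995216,
  F 0 (B 8 6 (F 8 (M 47977613217531989)) (M 23770971110419046))⟩,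
  ⟨15865083491250363420444300791889393751652400135605989665, 146798764105744,
  F 0 (B 8 4 (R 623 11649936536080) (M 24034853632649860))⟩,
  ⟨61971514909197990917967361036181032490216775549595937, 146798764105744,
  F 0 (B 3 9 (B 3 10 (R 598 8131482130435) (R 624 11649936536080)) (R 624 10619144385040))⟩,
  ⟨61971514909197992252631201684687155807348313098957089, 8241959301987442704,
  F 0 (B 4 6 (R 622 11649936474640) (B 4 7 (R 622 11649684816160) (M 24035889256626082)))⟩,
  ⟨55340510175143867823870007673479100510497, 2461658921105357807632,
  F 0 (B 5 9 (F 5 (R 619 11649936536080)) (B 5 10 (R 619 10185347858965) (B 3 4 (R 514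
  11649936397360) (B 3 6 (R 622 11649936536080) (B 3 7 (R 622 11649684877600) (B 3 8 (R 625
  11649936536080) (R 626 11649936536080)))))))⟩,
  ⟨762985108977040726569249, 8241959301987442704,
  F 0 (B 2 8 (F 2 (R 598 11640487048450)) (B 2 9 (F 2 (R 598 11571767637250)) (B 2 10 (R 598
  10472256075010) (B 5 3 (R 612 11649936536080) (B 5 4 (R 612 11649936474640) (B 5 6 (R 614
  11649936536080) (B 5 7 (R 614 11649684877600) (B 5 8 (R 627 11649936536080) (B 5 9 (R 627
  11585512026640) (B 5 10 (R 627 10490295366160) (B 3 4 (R 514 11649936397360) (B 3 7 (R 622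
  10490043707680) (B 3 8 (B 3 9 (B 3 10 (F 3 (R 598 8131482130435)) (R 626 10490295366160)) (R 626
  11585512026640)) (R 626 11649936536080))))))))))))))⟩,
  ⟨12884966604212267370066727809313, 7013039553668718608,
  F 0 (B 5 6 (F 5 (R 514 11649897670165)) (R 603 11649936536080))⟩,
  ⟨844429171372375372516208441665138977, 630240172373678249484304,
  F 0 (F 5 (B 3 7 (R 628 11649920803600) (B 3 9 (R 628 11577443230480) (B 3 10 (R 628
  10478200038160) (R 602 9523927716640)))))⟩,
  ⟨3649188637965347494967942144257733159069823265, 2461880160437052383248,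
  F 0 (F 5 (B 7 4 (R 623 11645910004240) (M 24069832383179380)))⟩,
  ⟨14167170604815358078412762475202339092443425, 2461880160437052383248,
  F 0 (F 5 (B 3 8 (R 620 11649684877840) (B 3 9 (B 3 10 (R 598 9230993757955) (R 631
  11649936536080)) (R 631 10619144385040))))⟩,
  ⟨55340510175143864197092548829591576391969, 2461875093887471591440,
  F 0 (F 5 (B 3 4 (R 514 11649936397360) (B 3 6 (R 630 11649936536080) (B 3 7 (R 632
  11649936536080) (B 3 8 (R 632 11645910004240) (B 4 6 (R 630 11649936474640) (B 4 7 (R 632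
  11649936474640) (M 28292231911733077))))))))⟩,
  ⟨61972982387696732126708673692741824832018349997306145, 107001597141008,
  F 0 (B 4 6 (R 622 10478215709200) (M 24052446087129700))⟩,
  ⟨242076230114054667621433728471462647791071247085857, 107001597141008,
  F 0 (B 3 8 (B 3 9 (B 3 10 (F 3 (R 598 8131482130435)) (R 634 11649936536080)) (R 634
  10619144385040)) (R 634 9523927724560))⟩,
  ⟨55340510175143864197092548829591576391969, 8458132084101226512,
  F 0 (B 5 8 (F 5 (R 633 11649936536080)) (B 5 9 (F 5 (R 633 11562958549525)) (B 5 10 (R 633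
  10463446987285) (B 3 4 (R 514 11649936397360) (B 3 6 (R 622 10478215770640) (B 3 7 (B 3 8 (R 620
  11649684877840) (R 625 11645910004240)) (R 635 11649936536080)))))))⟩,
  ⟨2980410581804108624161, 27393581663658000,
  F 0 (B 2 6 (R 607 11649936536080) (B 2 7 (R 628 11649936536080) (B 2 8 (R 628 11645910004240) (B
  2 9 (R 628 11577458962960) (B 2 10 (R 628 10478215770640) (B 5 3 (R 629 11649936536080) (B 5 4
  (R 629 11649936474640) (B 5 6 (R 614 10478215770640) (B 5 7 (R 636 11649936536080) (B 5 8 (R 636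
  11645910004240) (B 5 9 (R 636 11577458962960) (B 5 10 (R 636 10478215770640) (B 3 4 (R 514
  11649936397360) (B 3 6 (R 622 9322601132560) (B 3 7 (B 3 8 (R 620 11649684877840) (R 635
  11645910004240)) (R 635 11649936536080))))))))))))))))⟩,
  ⟨60847534424801646069203252497851024996079515894690081, 46042398382366736,
  F 0 (B 4 9 (R 637 9304418686000) (B 4 10 (R 637 9304402957360) (B 5 6 (R 479 11645909935120) (B
  5 7 (B 5 8 (B 5 9 (F 5 (M 24071004926011041)) (M 24071005194446481)) (M 24106189298099841)) (M
  24106258017576561)))))⟩,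
  ⟨14167170604857111953534909186840755285668129, 772466807768961346707472,
  F 0 (B 4 5 (R 637 11649936466960) (B 4 6 (R 637 11649920738320) (B 4 7 (R 637 11640845308960) (B
  4 8 (R 637 11640829580320) (R 638 11649936536080)))))⟩]

def eleven_20 : List Lem := [
  ⟨14167170604857111953534909186840755285668129, 2721071061209176875024,
  F 0 (B 3 10 (R 639 11649936536080) (B 4 5 (R 637 11649936466960) (B 4 6 (R 637 11649920738320)
  (B 4 7 (R 637 11640845308960) (B 4 8 (R 637 11640829580320) (B 4 9 (B 4 10 (R 639
  11649936474640) (R 433 11576640934960)) (R 481 9304418686000)))))))⟩,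
  ⟨195324187898140022734467361, 9399682373872787472,
  F 0 (B 2 9 (F 2 (R 598 11430033721090)) (B 2 10 (R 598 10330522158850) (B 3 4 (R 514
  11649936397360) (B 3 5 (R 637 11649936532240) (B 3 6 (R 637 11649920803600) (B 3 7 (R 637
  11640845374240) (B 3 8 (R 637 11640829645600) (B 3 9 (R 640 11649936536080) (B 3 10 (R 640
  10619144385040) (B 4 5 (R 637 11649936466960) (B 4 6 (R 637 11649920738320) (B 4 7 (R 637
  11640845308960) (B 4 8 (R 637 11640829580320) (R 638 6986174501920))))))))))))))⟩,
  ⟨55340510175143862921997176778113531654433, 8318818463303868432,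
  F 0 (B 3 8 (R 641 11649936532240) (B 3 9 (R 641 11585512022800) (B 3 10 (R 641 10490295362320)
  (R 433 11649653412640))))⟩,
  ⟨14167170604836829543931257516416808034382113, 9471739967910715408,
  F 0 (B 3 9 (R 641 11517060981520) (B 3 10 (R 641 10421844321040) (B 4 5 (R 637 11649936466960)
  (B 4 6 (R 637 11649920738320) (B 4 7 (R 642 11649936474640) (B 4 8 (R 642 11645909877520) (R 481
  11640845374240)))))))⟩,
  ⟨195324187898140022734467361, 32195148942155792,
  F 0 (B 2 8 (R 641 11649936536080) (B 2 9 (R 641 11585512026640) (B 2 10 (R 641 10490295366160)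
  (B 3 4 (R 514 11649936397360) (B 3 5 (R 637 11649936532240) (B 3 6 (R 637 11649920803600) (B 3 7
  (R 642 11649936536080) (B 3 8 (R 643 11649936536080) (B 3 9 (R 643 11585512026640) (B 3 10 (R
  643 10490295366160) (B 4 5 (R 637 11649936466960) (B 4 6 (R 637 11649920738320) (B 4 7 (R 642
  11649936474640) (B 4 8 (R 643 11649936474640) (R 638 6986174501920)))))))))))))))⟩,
  ⟨4272417, 107001597141008,
  F 0 (B 1 7 (F 1 (R 598 11649936536080)) (B 1 8 (F 1 (R 598 11644783060225)) (B 1 9 (F 1 (R 598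
  11576063649025)) (B 1 10 (R 598 10476552086785) (B 2 3 (R 514 11649936528160) (B 2 4 (R 514
  11649936462880) (B 2 5 (R 637 11649936536080) (B 2 6 (R 637 11649920807440) (B 2 7 (R 644
  11649936536080) (B 2 8 (R 644 11645910004240) (B 2 9 (R 644 11577458962960) (B 2 10 (R 644
  10478215770640) (B 3 4 (R 514 11649936397360) (B 3 5 (R 637 11649936532240) (B 3 6 (R 637
  11649920803600) (B 3 7 (R 644 11649936532240) (B 3 8 (R 644 11645910000400) (B 3 9 (R 644
  11577458959120) (B 3 10 (R 644 10478215766800) (R 513 11649936528160))))))))))))))))))))⟩,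
  ⟨762985108975941214941473, 90508922724368,
  F 0 (B 2 6 (R 645 11649936535840) (B 2 7 (R 645 11649684877600) (B 2 8 (R 645 11645406687520) (B
  2 9 (R 645 11576703988000) (B 2 10 (R 645 10477209137440) (R 433 11649936536080))))))⟩,
  ⟨61223226026191201987696813094648637693745890966188577, 145484504113168,
  F 0 (B 4 9 (R 645 11503424184640) (R 481 11585260364560))⟩,
  ⟨14167170604836829234446229248327665600049441, 32477723430494224,
  F 0 (B 3 8 (R 645 11640845377840) (B 3 9 (R 645 11572142678320) (B 3 10 (R 645 10472647827760)
  (B 4 5 (R 646 11649936466960) (B 4 6 (R 646 11649920734240) (B 4 7 (R 646 11649653281840) (B 4 8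
  (R 647 11649936536080) (R 647 9511093023760))))))))⟩,
  ⟨195324187897858547757756705, 108101108768784,
  F 0 (B 2 7 (R 645 11649417490720) (B 2 8 (R 645 11645139300640) (B 2 9 (R 645 11576436601120) (B
  2 10 (R 645 10476941750560) (B 3 4 (R 514 11649936397360) (B 3 5 (R 646 11649936532240) (B 3 6
  (R 646 11649920799520) (B 3 7 (R 648 11649936536080) (B 3 8 (R 648 11645910004240) (B 3 9 (R 648
  11577458962960) (B 3 10 (R 648 10478215770640) (R 203 11649936531760))))))))))))⟩,
  ⟨4272417, 348969246736,
  F 0 (B 1 6 (R 645 11649936536080) (B 1 7 (R 645 11649684877840) (B 1 8 (R 645 11645406687760) (B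
  1 9 (R 645 11576703988240) (B 1 10 (R 645 10477209137680) (B 2 3 (R 514 11649936528160) (B 2 4
  (R 514 11649936462880) (B 2 5 (R 646 11649936536080) (B 2 6 (R 649 11649936536080) (B 2 7 (R 649
  11649684877840) (B 2 8 (R 649 11645406687760) (B 2 9 (R 649 11576703988240) (B 2 10 (R 649
  10477209137680) (B 3 4 (R 514 11649936397360) (B 3 5 (R 646 11649936532240) (B 3 6 (R 649
  11649936532240) (B 3 7 (R 649 11649684874000) (B 3 8 (R 649 11645406683920) (B 3 9 (R 649
  11576703984400) (R 203 10477209137440))))))))))))))))))))⟩,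
  ⟨0, 1076895760,
  F 0 (B 1 2 (R 514 11649936536080) (B 1 3 (R 514 11649936532240) (B 1 4 (R 514 11649936466960) (B
  1 5 (R 650 11649936536080) (B 1 6 (R 650 11649920807440) (B 1 7 (R 650 11649653420560) (B 1 8 (R
  650 11645359501840) (B 1 9 (R 650 11576641073680) (B 1 10 (R 650 10477130494480) (B 2 3 (R 514
  11649936528160) (B 2 4 (R 514 11649936462880) (B 2 5 (R 650 11649936535840) (B 2 6 (R 650
  11649920807200) (B 2 7 (R 650 11649653420320) (B 2 8 (R 650 11645359501600) (B 2 9 (R 650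
  11576641073440) (B 2 10 (R 650 10477130494240) (B 3 4 (R 514 11649936397360) (R 513
  11649936536080)))))))))))))))))))⟩,
  ⟨215677499537156432777995564365398126929301368619328, 7627860,
  B 4 8 (F 4 (R 651 11627030672980)) (B 4 9 (F 4 (R 651 11558311261780)) (M 19267164519307656))⟩,
  ⟨14134640609667083978538717306250731646583388085191590208, 25684,
  B 4 7 (R 652 11649936536080) (B 4 8 (R 652 11645107843600) (M 19302348891392119))⟩,
  ⟨3618467996074773498505911630400498000423234805559193649472, 84,
  B 4 6 (R 653 11649936536080) (B 4 7 (R 653 11649684877840) (M 19302486330341222))⟩,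
  ⟨3618467996074773498505911630400498000423234805559193649472, 0,
  B 4 5 (R 654 11649936536080) (B 4 6 (R 654 11649920807440) (M 19302486867207765))⟩,
  ⟨12767926775697124187125916916020031074222400, 3289392,
  B 3 4 (F 3 (R 651 11649936531715)) (B 3 5 (F 3 (R 651 11649935548675)) (B 3 6 (F 3 (R 651
  11649918836995)) (B 3 7 (F 3 (R 651 11649650467075)) (B 3 8 (F 3 (R 651 11645355565315)) (B 3 9
  (F 3 (R 651 11576636154115)) (R 655 11649936536080))))))⟩,
  ⟨45050023296753213575292535104, 215573602592,
  B 2 4 (F 2 (R 651 11649936535810)) (B 2 5 (F 2 (R 651 11649935552770)) (B 2 6 (F 2 (R 651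
  11649918841090)) (B 2 7 (F 2 (R 651 11649650471170)) (B 2 8 (F 2 (R 651 11645355569410)) (B 2 9
  (F 2 (R 651 11576636158210)) (R 656 11649936536080))))))⟩,
  ⟨842490232567017315538734474404448962225612341298, 6575170,
  B 4 7 (F 4 (R 651 11648773874980)) (B 4 8 (F 4 (R 651 11644478973220)) (B 4 9 (F 4 (R 651
  11575759562020)) (M 19249641052739976)))⟩,
  ⟨55213439881512046791166864477546661383408967772880946, 21570,
  B 4 6 (R 658 11649936536080) (B 4 7 (R 658 11573180772880) (B 4 8 (R 658 11504478073360) (M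
  19302348891392119)))⟩,
  ⟨67315649224711725124398330986175544664991531266912881750566846514, 66,
  B 4 5 (R 659 11649936536080) (B 4 6 (R 659 6225679102480) (B 4 7 (R 659 6225663373840) (M
  19302280977217382)))⟩,
  ⟨60847614374110067586361679847732189135350679537270834, 1396846896,
  B 3 6 (F 3 (R 651 11649899974915)) (B 3 7 (F 3 (R 651 11649631604995)) (B 3 8 (F 3 (R 651
  11645336703235)) (B 3 9 (F 3 (R 651 11576617292035)) (B 3 10 (R 651 10477105729795) (R 660
  11649936536080)))))⟩,
  ⟨60847614374110067586361679847732189135350679537270834, 4337968,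
  B 3 5 (R 661 11649936536080) (B 3 6 (R 661 11649920807440) (B 3 7 (R 661 11649653420560) (B 3 8
  (R 661 11645359501840) (B 3 9 (R 661 11576641073680) (R 660 10477130494480)))))⟩,
  ⟨839216512566655484283916744099184690, 72779028307984,
  B 2 5 (F 2 (R 651 11649934508290)) (B 2 6 (F 2 (R 651 11649917796610)) (B 2 7 (F 2 (R 651
  11649649426690)) (B 2 8 (F 2 (R 651 11645354524930)) (B 2 9 (F 2 (R 651 11576635113730)) (B 2 10
  (R 651 10477123551490) (B 3 4 (B 3 5 (F 3 (R 651 11649933459715)) (B 3 6 (F 3 (R 651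
  11649916748035)) (B 3 7 (F 3 (R 651 11649648378115)) (B 3 8 (F 3 (R 651 11645353476355)) (B 3 9
  (F 3 (R 651 11576634065155)) (B 3 10 (R 651 10477122502915) (R 657 5126167531570))))))) (R 662
  11649936536080)))))))⟩,
  ⟨45194877589278784, 211260874768,
  B 1 4 (F 1 (R 651 11649936536065)) (B 1 5 (F 1 (R 651 11649935553025)) (B 1 6 (F 1 (R 651
  11649918841345)) (B 1 7 (F 1 (R 651 11649650471425)) (B 1 8 (F 1 (R 651 11645355569665)) (B 1 9
  (F 1 (R 651 11576636158465)) (B 1 10 (R 651 10477124596225) (B 2 3 (R 657 11649936536080) (B 2 4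
  (R 663 11649936536080) (B 2 5 (R 663 11649935553040) (B 2 6 (R 663 11649918841360) (B 2 7 (R 663
  11649650471440) (B 2 8 (R 663 11645355569680) (B 2 9 (R 663 11576636158480) (B 3 4 (R 663
  11649936532240) (B 3 5 (R 663 11649935549200) (B 3 6 (R 663 11649918837520) (B 3 7 (R 663
  11649650467600) (B 3 8 (R 663 11645355565840) (B 3 9 (R 663 11576636154640) (R 657
  11649936527410))))))))))))))))))))⟩,
  ⟨842490232567017315539042684338351009048935019057, 6570817,
  B 4 7 (F 4 (R 651 11649327522580)) (B 4 8 (F 4 (R 651 11645032620820)) (B 4 9 (F 4 (R 651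
  11576313209620)) (M 19267164519307656)))⟩,
  ⟨1020853569814761353841159363138717136504081024782108142350897, 17217,
  B 4 5 (B 4 6 (F 4 (R 651 11649864323860)) (B 4 7 (F 4 (R 651 11649595953940)) (B 4 8 (F 4 (R 651
  11645301052180)) (M 28204268843468919)))) (B 4 6 (R 665 11649936536080) (B 4 7 (R 665
  11573180772880) (B 4 8 (R 665 11504478073360) (M 19249778491689079))))⟩,
  ⟨237685993648867451509225311905203863808859550265905, 1665351984,
  B 3 7 (F 3 (R 651 11649328571395)) (B 3 8 (F 3 (R 651 11645033669635)) (B 3 9 (F 3 (R 651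
  11576314258435)) (B 3 10 (F 3 (R 651 10476802696195)) (R 666 7325189681680))))⟩,
  ⟨237685993648867451509225311905203863808859550265905, 4407600,
  B 3 6 (R 667 11649936536080) (B 3 7 (R 667 11649684877840) (B 3 8 (R 667 11645406687760) (B 3 9
  (R 667 11576703988240) (R 666 11649936536080))))⟩,
  ⟨262951754784030176267180980414727859383437549213240033131115057, 25665,
  B 4 8 (R 658 6225427444000) (B 4 9 (R 658 6221149253920) (M 19319941077440904))⟩,
  ⟨4438664059614231127957236447003681699138724991517977192122339469308465, 82,
  B 5 6 (R 669 11649935552800) (M 19284757242227285)⟩,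
  ⟨17232806201526201631845972732462268662233306221323305221347388437041, 2491699777,
  B 4 10 (F 4 (R 651 8131212646420)) (R 670 11649936536080)⟩]

def eleven_21 : List Lem := [
  ⟨15576989279772177302108590041019440418721831555596038705, 495587574064,
  B 3 8 (F 3 (R 651 11636175304195)) (B 3 9 (F 3 (R 651 11567455892995)) (B 3 10 (R 651
  10467944330755) (B 4 5 (R 668 11649934508065) (B 4 6 (R 669 11649936536080) (B 4 7 (R 669
  11649684877840) (B 4 8 (B 4 9 (R 671 11649936536080) (R 671 10404731503105)) (R 671
  9305488310785)))))))⟩,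
  ⟨67315649224711725124398330986175544664990317599343008825204552241, 21057,
  B 4 5 (R 668 11649934508065) (B 4 6 (R 669 10478215770640) (B 4 7 (R 669 11649684877840) (R 670
  8351200326160)))⟩,
  ⟨15576989279772177302108590041019440418721831555596038705, 1666335024,
  B 3 7 (R 672 11649936536080) (B 3 8 (R 672 11645910004240) (B 3 9 (R 672 11577458962960) (B 3 10
  (R 672 10478215770640) (R 673 11649936536080))))⟩,
  ⟨214839427217063803976682686489408057905, 353280991520,
  B 2 6 (F 2 (R 651 11649901023490)) (B 2 7 (F 2 (R 651 11649632653570)) (B 2 8 (F 2 (R 651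
  11645337751810)) (B 2 9 (F 2 (R 651 11576618340610)) (B 2 10 (R 651 10477106778370) (B 3 4 (R
  668 11649936536080) (B 3 5 (R 668 11649935552800) (B 3 6 (R 674 11649936536080) (B 3 7 (R 674
  11649684877840) (B 3 8 (R 674 11645406687760) (B 3 9 (R 674 11576703988240) (R 673
  10477209137680)))))))))))⟩,
  ⟨67315649224711725124398330986175544664990317599270951231166624305, 5456176,
  B 4 5 (R 659 7325189681440) (B 4 6 (R 669 10478215770640) (B 4 7 (R 669 11649684877840) (B 4 8
  (R 669 11645406687760) (R 669 9305677054465))))⟩,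
  ⟨15576989279772177302108590041019440418649773961558110769, 1666400560,
  B 3 7 (F 3 (R 651 11649060136195)) (B 3 8 (F 3 (R 651 11644765234435)) (B 3 9 (F 3 (R 651
  11576045823235)) (B 3 10 (R 651 10476534260995) (R 676 11649936536080))))⟩,
  ⟨15576989279772177302108590041019440418649773961558110769, 5456176,
  B 3 6 (R 677 11649936536080) (B 3 7 (R 677 11649684877840) (B 3 8 (R 677 11645406687760) (B 3 9
  (R 677 11576703988240) (R 676 10477209137680))))⟩,
  ⟨60847614374110067586361679847732189135350679520424497, 16688,
  B 3 4 (R 668 10477130494480) (B 3 5 (R 678 11649936536080) (B 3 6 (R 678 11649920807440) (B 3 7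
  (R 678 11649653420560) (B 3 8 (R 678 11645359501840) (B 3 9 (R 678 11576641073680) (R 660
  10477130494240))))))⟩,
  ⟨236218470722861762618462465322499744179845098123825, 1093672976,
  B 2 10 (R 675 10477123551265) (R 679 11649936536080)⟩,
  ⟨11569888662855368753, 279980351504,
  B 1 5 (F 1 (R 651 11649934508545)) (B 1 6 (F 1 (R 651 11649917796865)) (B 1 7 (F 1 (R 651
  11649649426945)) (B 1 8 (F 1 (R 651 11645354525185)) (B 1 9 (F 1 (R 651 11576635113985)) (B 1 10
  (R 651 10477123551745) (B 2 3 (R 664 11649936535840) (B 2 4 (R 664 11649936474145) (B 2 5 (R 675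
  11649936536080) (B 2 6 (R 675 11649920807440) (B 2 7 (R 675 11649653420560) (B 2 8 (R 675
  11645359501840) (B 2 9 (R 675 11576641073680) (R 680 11649936536080)))))))))))))⟩,
  ⟨17232806201526201631845972732460939434237832004329697728140817740337, 17200,
  B 4 5 (R 659 11649936532240) (B 4 6 (R 659 6225679098640) (B 4 7 (R 659 6225663370000) (B 4 8 (R
  659 6225395983120) (R 666 10477130432770))))⟩,
  ⟨15576989279772177302108590041019440418649773957246366257, 5456688,
  B 3 6 (F 3 (R 651 11649865372675)) (B 3 7 (F 3 (R 651 11649597002755)) (B 3 8 (F 3 (R 651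
  11645302100995)) (B 3 9 (F 3 (R 651 11576582689795)) (B 3 10 (R 651 10477071127555) (R 682
  11649936536080)))))⟩,
  ⟨15576989279772177302108590041019440418649773957246366257, 17200,
  B 3 5 (R 683 11649936536080) (B 3 6 (R 683 11649920807440) (B 3 7 (R 683 11649653420560) (B 3 8
  (R 683 11645359501840) (B 3 9 (R 683 11576641073680) (R 682 10477130494480)))))⟩,
  ⟨15576989279772177302108590041019440418649773957246366257, 3153936,
  B 3 4 (R 684 11649936536080) (B 3 5 (R 684 11649935553040) (B 3 6 (R 684 11649918841360) (B 3 7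
  (R 684 11649650471440) (B 3 8 (R 684 11645355569680) (B 3 9 (R 684 11576636158480) (R 656
  11649936524065))))))⟩,
  ⟨45194877589278784, 807477264,
  B 1 3 (R 664 11649936536080) (B 1 4 (R 681 11649936536080) (B 1 5 (R 681 11649935553040) (B 1 6
  (R 681 11649918841360) (B 1 7 (R 681 11649650471440) (B 1 8 (R 681 11645355569680) (B 1 9 (R 681
  11576636158480) (B 1 10 (R 681 10477124596240) (B 2 3 (R 664 11649936535840) (B 2 4 (R 681
  11649936535840) (B 2 5 (R 681 11649935552800) (B 2 6 (R 681 11649918841120) (B 2 7 (R 681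
  11649650471200) (B 2 8 (R 681 11645355569440) (B 2 9 (R 681 11576636158240) (B 2 10 (R 681
  10477124596000) (R 685 11649936536080))))))))))))))))⟩,
  ⟨939901195658299466615769919024299579938455040289, 5456688,
  B 3 6 (F 3 (R 651 11649865372675)) (B 3 7 (F 3 (R 651 11649597002755)) (B 3 8 (F 3 (R 651
  11645302100995)) (M 19249848284907639)))⟩,
  ⟨928437392032002599752602149043812608442509701409, 1128415536,
  B 4 6 (F 4 (R 651 11649914647060)) (B 4 7 (F 4 (R 651 11649646277140)) (B 4 8 (F 4 (R 651
  11645351375380)) (B 4 9 (F 4 (R 651 11576631964180)) (B 4 10 (R 651 10477120401940) (B 3 5 (R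
  687 11649936536080) (B 3 6 (R 687 11649920807440) (B 3 7 (R 687 11649653420560) (M
  19232187110946662))))))))⟩,
  ⟨216168675495567813233516806327848022305, 110304713392400,
  B 4 7 (F 4 (R 651 11649344299540)) (B 4 8 (F 4 (R 651 11645049397780)) (B 4 9 (F 4 (R 651
  11576329986580)) (B 4 10 (F 4 (R 651 10476818424340)) (R 688 7325187395650))))⟩,
  ⟨839216512566655484283916739534795041, 23170293093638160,
  B 2 6 (F 2 (R 651 11649882149890)) (B 2 7 (F 2 (R 651 11649613779970)) (B 2 8 (F 2 (R 651
  11645318878210)) (B 2 9 (F 2 (R 651 11576599467010)) (B 2 10 (R 651 10477087904770) (B 4 5 (R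
  686 11649934296385) (B 4 3 (R 688 11649936536080) (B 4 6 (R 689 11649936536080) (B 4 7 (R 689
  11649684877840) (B 4 8 (R 689 11645406687760) (B 4 9 (R 689 11576703988240) (R 689
  10477091463700)))))))))))⟩,
  ⟨14341413801774611448802792245328119574049313, 144458326880288,
  B 3 9 (F 3 (R 651 11503031387395)) (B 3 10 (F 3 (R 651 10403519825155)) (R 665 6225663247105))⟩,
  ⟨14341754084161814798078833105453966746988833, 144531307704336,
  B 3 9 (F 3 (R 651 11430016943875)) (B 3 10 (F 3 (R 651 10330505381635)) (R 665 7325158032130))⟩,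
  ⟨3671489045545424588325110979374001196015563041, 495284465680,
  B 3 8 (R 692 11649936536080) (B 3 9 (R 692 11585512026640) (R 665 7252680459010))⟩,
  ⟨264564994550600984565517100703381730834895708795193161721983265, 1362108432,
  B 5 6 (R 693 11649682658305) (M 19267302226700885)⟩,
  ⟨264558692828663310961966765940081125016188894490700303939285281, 1362108432,
  B 3 8 (B 3 9 (B 3 10 (F 3 (R 651 8131482130435)) (R 694 11649936536080)) (R 694 10619144385040))
  (R 694 9523927724560)⟩,
  ⟨67727025364137807606263492080655596941363096627034045577470030113, 348986023952,
  B 3 7 (R 693 11649936536080) (R 695 11649936536080)⟩,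
  ⟨15576989279772177302108590041021858270433399882925617441, 8386354801120649232,
  B 4 8 (F 4 (R 651 11640754434580)) (B 4 9 (F 4 (R 651 11572035023380)) (B 4 10 (R 651
  10472523461140) (B 3 5 (B 3 6 (B 3 7 (F 3 (R 651 11649060136195)) (B 3 8 (F 3 (R 665
  9523408675600)) (B 3 9 (F 3 (R 665 10618625336080)) (R 665 11649417487120)))) (B 3 8 (R 691
  11649936536080) (B 3 9 (R 691 11585512026640) (R 665 6153185673985)))) (R 696
  11649936536080))))⟩,
  ⟨214839427217063803976682687588885213473, 27673892721008656,
  B 2 7 (F 2 (R 651 11649345348610)) (B 2 8 (F 2 (R 651 11645050446850)) (B 2 9 (F 2 (R 651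
  11576331035650)) (B 2 10 (R 651 10476819473410) (B 4 3 (B 4 5 (F 4 (R 690 11649917477890)) (R
  690 11649934316545)) (B 4 5 (R 686 11649934296385) (B 4 6 (R 686 11649917453890) (B 4 7 (R 697
  11649936536080) (B 4 8 (R 697 11645910004240) (B 4 9 (R 697 11577458962960) (B 4 10 (R 697
  10478215770640) (B 3 5 (B 3 6 (B 3 7 (F 3 (R 687 11517060977440)) (B 3 8 (F 3 (R 687
  11585512018720)) (B 3 9 (F 3 (R 687 11649936528160)) (R 687 10619144377120)))) (R 696
  10478200041760)) (R 696 10478215770640))))))))))))⟩,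
  ⟨839216512566655484283916739534795041, 89345003364368,
  B 2 5 (R 690 11649936536080) (B 2 6 (R 698 11649936536080) (B 2 7 (R 698 11649684877840) (B 2 8
  (R 698 11645406687760) (B 2 9 (R 698 11576703988240) (B 2 10 (R 698 10477209137680) (B 4 3 (B 4
  5 (F 4 (R 689 11649917476930)) (R 690 11649934316545)) (B 4 5 (R 686 11649934296385) (B 4 6 (R
  698 11649934316545) (B 4 7 (R 698 11649682658305) (B 4 8 (R 698 11645404468225) (B 4 9 (R 698
  11576701768705) (B 4 10 (R 698 10477206918145) (B 3 5 (B 3 6 (R 698 11649935549200) (B 3 7 (R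
  698 11649683890960) (B 3 8 (R 698 11645405700880) (R 687 9446416978720)))) (R 696
  9305740030480))))))))))))))⟩,
  ⟨15673145936921740275657558630862451491024965100608041249, 499899253008,
  B 4 8 (F 4 (R 651 11635905820180)) (B 4 9 (F 4 (R 651 11567186408980)) (B 4 10 (R 651
  10467674846740) (B 6 5 (R 699 11648797902145) (M 41785300363553365))))⟩,
  ⟨4012325359857719190283463843014386079823527526829340635425, 7496224,
  B 6 7 (R 686 11649363806050) (M 28574327521703714)⟩,
  ⟨262951754783654564325010810937765829271483588515313916144922913, 8242821319120396304,
  B 4 7 (R 700 11649936536080) (B 4 8 (R 700 11516557668880) (B 4 9 (R 700 11512279478800) (B 4 10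
  (B 6 5 (R 699 10476274976065) (R 701 11649936536080)) (R 695 11649684877840))))⟩,
  ⟨17232806201501585530532644205279874487957956406656917533992196124961, 32196248470560784,
  B 5 6 (R 702 11649935553040) (R 701 11649936536080)⟩]

def eleven_22 : List Lem := [
  ⟨3987709255621677389339804242798144767030310811391677837601, 2721143119902743207952,
  B 3 10 (R 651 8131482130435) (B 4 5 (R 686 11649934296385) (B 4 7 (R 702 11649684877840) (B 4 8
  (R 702 11504478069520) (R 703 11649936536080))))⟩,
  ⟨262951754784030176267093526449680957590173648113997703845916961, 32196248470560784,
  B 4 5 (R 686 11649934296385) (B 4 6 (R 702 10619144385040) (B 4 8 (B 4 9 (R 700 11504226411280)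
  (R 703 11585260368400)) (R 703 10618892726800)))⟩,
  ⟨3987709255621677389339804242798144767030310811391677837601, 9471741067439120400,
  B 3 9 (R 704 11649936536080) (B 3 10 (R 704 10619144385040) (R 705 11649936536080))⟩,
  ⟨54998893367568333818030768022763439534369, 32196248470560784,
  B 2 8 (F 2 (R 651 11636192081410)) (B 2 9 (F 2 (R 651 11567472670210)) (B 2 10 (R 651
  10467961107970) (B 3 4 (R 699 11649936532240) (B 3 5 (R 699 11649935549200) (B 3 6 (R 699
  11649368331040) (B 3 7 (R 699 11649367348000) (B 3 8 (R 706 11649936536080) (B 3 9 (R 706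
  11585512026640) (R 705 10490295366160)))))))))⟩,
  ⟨3987709255621677389339799050501286232202682280895348617505, 32477723447271440,
  B 3 8 (R 707 11641631810320) (B 3 9 (R 707 11573180769040) (B 3 10 (R 707 10473937576720) (R 680
  8424666829600)))⟩,
  ⟨54998893367568333818030768022763439534369, 108101125546000,
  B 2 7 (R 707 11649936536080) (B 2 8 (R 707 11645910004240) (B 2 9 (R 707 11577458962960) (B 2 10
  (R 707 10478215770640) (B 3 4 (R 699 11649936532240) (B 3 5 (R 699 11649935549200) (B 3 6 (B 3 7
  (R 707 11649936532240) (B 3 8 (R 707 11645910000400) (B 3 9 (R 707 11577458959120) (B 3 10 (R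
  707 10478215766800) (R 662 11649918525490))))) (B 3 7 (R 708 11649936536080) (B 3 8 (R 708
  11645910004240) (B 3 9 (R 708 11577458962960) (R 680 11649918833440))))))))))⟩,
  ⟨2961891497690974400801, 348986023952,
  B 1 6 (F 1 (R 651 11649883198465)) (B 1 7 (F 1 (R 651 11649614828545)) (B 1 8 (F 1 (R 651
  11645319926785)) (B 1 9 (F 1 (R 651 11576600515585)) (B 1 10 (R 651 10477088953345) (B 2 3 (R
  686 11649936528160) (B 2 4 (R 699 11649936536080) (B 2 5 (R 699 11649935553040) (B 2 6 (R 709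
  11649936536080) (B 2 7 (R 709 11649684877840) (B 2 8 (R 709 11645406687760) (B 2 9 (R 709
  11576703988240) (B 2 10 (R 709 10477209137680) (B 3 4 (R 699 11649936532240) (B 3 5 (R 699
  11649935549200) (B 3 6 (R 709 11649936532240) (B 3 7 (R 709 11649684874000) (B 3 8 (R 709
  11645406683920) (B 3 9 (R 709 11576703984400) (B 3 10 (R 709 10477209133840) (R 685
  11649936528160))))))))))))))))))))⟩,
  ⟨54998893367568333818030767741288462823713, 353280991248,
  B 2 6 (R 710 11649904095520) (B 2 7 (R 710 11649636708640) (B 2 8 (R 710 11645342789920) (B 2 9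
  (R 710 11576624361760) (B 2 10 (R 710 10477113782560) (R 680 6225679102480)))))⟩,
  ⟨2961891497690974400801, 1093672976,
  B 1 5 (R 710 11649936536080) (B 1 6 (R 710 11649920807440) (B 1 7 (R 710 11649653420560) (B 1 8
  (R 710 11645359501840) (B 1 9 (R 710 11576641073680) (B 1 10 (R 710 10477130494480) (B 2 3 (R
  686 11649936528160) (B 2 4 (B 2 5 (R 710 11649936535840) (B 2 6 (R 710 11649920807200) (B 2 7 (R
  710 11649653420320) (B 2 8 (R 710 11645359501600) (B 2 9 (R 710 11576641073440) (B 2 10 (R 710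
  10477130494240) (B 4 3 (B 4 5 (F 4 (R 688 11576641073440)) (R 688 11649936535840)) (R 662
  11649936474145)))))))) (B 2 5 (R 711 11649936536080) (B 2 6 (R 711 11649920807440) (B 2 7 (R 711
  11649653420560) (B 2 8 (R 711 11645359501840) (B 2 9 (R 711 11576641073680) (R 680
  11649936536080)))))))))))))⟩,
  ⟨0, 3153936,
  B 0 4 (F 0 (R 651 11649936536080)) (B 0 5 (F 0 (R 651 11649935553040)) (B 0 6 (F 0 (R 651
  11649918841360)) (B 0 7 (F 0 (R 651 11649650471440)) (B 0 8 (F 0 (R 651 11645355569680)) (B 0 9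
  (F 0 (R 651 11576636158480)) (B 0 10 (R 651 10477124596240) (B 1 2 (R 686 11649936536080) (B 1 3
  (R 686 11649936532240) (B 1 4 (R 712 11649936536080) (B 1 5 (R 712 11649935553040) (B 1 6 (R 712
  11649918841360) (B 1 7 (R 712 11649650471440) (B 1 8 (R 712 11645355569680) (B 1 9 (R 712
  11576636158480) (B 1 10 (R 712 10477124596240) (B 2 3 (R 686 11649936528160) (B 2 4 (R 712
  11649936535840) (B 2 5 (R 712 11649935552800) (B 2 6 (R 712 11649918841120) (B 2 7 (R 712
  11649650471200) (B 2 8 (R 712 11645355569440) (B 2 9 (R 712 11576636158240) (B 2 10 (R 712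
  10477124596000) (R 685 11649936536080))))))))))))))))))))))))⟩,
  ⟨17232806201526201631845972732460939434237832004329625373674327650608, 67,
  B 4 6 (R 659 6225679098640) (B 4 7 (R 659 6225663370000) (B 4 8 (R 659 6225395983120) (M
  28204201188296823)))⟩,
  ⟨15576989279772177302108590041019440418577419490756276528, 21315,
  B 3 6 (R 713 11649864983875) (B 3 7 (R 713 11649596552515) (B 3 8 (R 713 11645301589315) (B 3 9
  (R 713 11576582116675) (B 3 10 (R 713 10477070492995) (R 714 11649936536080)))))⟩,
  ⟨3987709255621677389339799050500976747174342133055069761840, 67,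
  B 3 5 (R 715 11649936536080) (B 3 6 (R 715 11649920807440) (B 3 7 (R 715 11649653420560) (B 3 8
  (R 715 11645359501840) (B 3 9 (R 715 11576641073680) (R 714 10477130494480)))))⟩,
  ⟨3987709255621677389339799050500976747174342133055069761840, 0,
  B 3 4 (R 716 11649936536080) (B 3 5 (R 716 11649935553040) (B 3 6 (R 716 11649918841360) (B 3 7
  (R 716 11649650471440) (B 3 8 (R 716 11645355569680) (B 3 9 (R 716 11576636158480) (R 655
  11649936536080))))))⟩,
  ⟨214839427217063803976682686489391280432, 8480,
  B 2 3 (R 713 11649936535810) (B 2 4 (R 713 11649936474370) (B 2 5 (R 713 11649935429890) (B 2 6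
  (R 713 11649918656770) (B 2 7 (R 713 11649650225410) (B 2 8 (R 713 11645355262210) (B 2 9 (R 713
  11576635789570) (B 2 10 (R 713 10477124165890) (R 717 11649936536080))))))))⟩,
  ⟨45050023296753213575292535104, 3289376,
  B 2 4 (R 713 11649936343810) (B 2 5 (R 713 11649935299330) (B 2 6 (R 713 11649918526210) (B 2 7
  (R 713 11649650094850) (B 2 8 (R 713 11645355131650) (B 2 9 (R 713 11576635659010) (B 3 4 (R 713
  11649936278035) (B 3 5 (R 713 11649935233555) (B 3 6 (R 713 11649918460435) (B 3 7 (R 713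
  11649650029075) (B 3 8 (R 713 11645355065875) (B 3 9 (R 713 11576635593235) (R 655
  11649936536080))))))))))))⟩,
  ⟨214839427217063803976682686489391280688, 4337952,
  B 2 5 (R 713 11649934251010) (B 2 6 (R 713 11649917477890) (B 2 7 (R 713 11649649046530) (B 2 8
  (R 713 11645354083330) (B 2 9 (R 713 11576634610690) (B 2 10 (R 713 10477122987010) (R 679
  11649936535585))))))⟩,
  ⟨2961891497690974400545, 3219472,
  B 1 4 (R 713 11649936409345) (B 1 5 (R 713 11649935364865) (B 1 6 (R 713 11649918591745) (B 1 7
  (R 713 11649650160385) (B 1 8 (R 713 11645355197185) (B 1 9 (R 713 11576635724545) (B 1 10 (R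
  713 10477124100865) (B 2 3 (R 719 11649936536080) (B 2 4 (R 720 11649936536080) (B 2 5 (R 720
  11649935553040) (B 2 6 (R 720 11649918841360) (B 2 7 (R 720 11649650471440) (B 2 8 (R 720
  11645355569680) (B 2 9 (R 720 11576636158480) (B 3 4 (R 720 11649936532225) (B 3 5 (R 720
  11649935549185) (B 3 6 (R 720 11649918837505) (B 3 7 (R 720 11649650467585) (B 3 8 (R 720
  11645355565825) (B 3 9 (R 720 11576636154625) (R 719 11649936527410))))))))))))))))))))⟩,
  ⟨0, 8208,
  B 0 3 (R 713 11649936536080) (B 0 4 (R 713 11649936474640) (B 0 5 (R 713 11649935430160) (B 0 6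
  (R 713 11649918657040) (B 0 7 (R 713 11649650225680) (B 0 8 (R 713 11645355262480) (B 0 9 (R 713
  11576635789840) (B 0 10 (R 713 10477124166160) (B 1 2 (B 1 3 (R 713 11649936536065) (B 1 4 (R
  713 11649936474625) (B 1 5 (R 713 11649935430145) (B 1 6 (R 713 11649918657025) (B 1 7 (R 713
  11649650225665) (B 1 8 (R 713 11645355262465) (B 1 9 (R 713 11576635789825) (B 1 10 (R 713
  10477124166145) (R 718 11649936536080))))))))) (B 1 3 (R 721 11649936536080) (B 1 4 (R 721
  11649936474640) (B 1 5 (R 721 11649935430160) (B 1 6 (R 721 11649918657040) (B 1 7 (R 721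
  11649650225680) (B 1 8 (R 721 11645355262480) (B 1 9 (R 721 11576635789840) (B 1 10 (R 721
  10477124166160) (B 2 3 (R 721 11649936535840) (B 2 4 (R 721 11649936474400) (B 2 5 (R 721
  11649935429920) (B 2 6 (R 721 11649918656800) (B 2 7 (R 721 11649650225440) (B 2 8 (R 721
  11645355262240) (B 2 9 (R 721 11576635789600) (B 2 10 (R 721 10477124165920) (R 718
  11649936535585)))))))))))))))))))))))))⟩,
  ⟨45050023296753213575292535104, 50,
  B 2 4 (R 722 11649936327730) (B 2 5 (R 722 11649935279410) (B 2 6 (R 722 11649918502450) (B 2 7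
  (R 722 11649650067250) (B 2 8 (R 722 11645355100210) (B 2 9 (R 722 11576635623730) (B 3 4 (R 722
  11649936327715) (B 3 5 (R 722 11649935279395) (B 3 6 (R 722 11649918502435) (B 3 7 (R 722
  11649650067235) (B 3 8 (R 722 11645355100195) (B 3 9 (R 722 11576635623715) (R 655
  11649936536080))))))))))))⟩,
  ⟨214839427217063803976682686489391280432, 0,
  B 2 3 (R 723 11649936536080) (B 2 4 (R 723 11649936474640) (B 2 5 (R 723 11649935430160) (B 2 6
  (R 723 11649918657040) (B 2 7 (R 723 11649650225680) (B 2 8 (R 723 11645355262480) (B 2 9 (R 723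
  11576635789840) (B 2 10 (R 723 10477124166160) (R 717 11649936536080))))))))⟩,
  ⟨0, 16,
  B 0 3 (R 722 11649936532240) (B 0 4 (R 722 11649936466960) (B 0 5 (R 722 11649935418640) (B 0 6
  (R 722 11649918641680) (B 0 7 (R 722 11649650206480) (B 0 8 (R 722 11645355239440) (B 0 9 (R 722
  11576635762960) (B 0 10 (R 722 10477124135440) (B 1 3 (R 722 11649936532225) (B 1 4 (R 722
  11649936466945) (B 1 5 (R 722 11649935418625) (B 1 6 (R 722 11649918641665) (B 1 7 (R 722
  11649650206465) (B 1 8 (R 722 11645355239425) (B 1 9 (R 722 11576635762945) (B 1 10 (R 722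
  10477124135425) (R 724 11649936536080))))))))))))))))⟩,
  ⟨0, 0,
  B 0 2 (R 725 11649936535840) (B 0 3 (R 725 11649936531760) (B 0 4 (R 725 11649936466240) (B 0 5
  (R 725 11649935417680) (B 0 6 (R 725 11649918640480) (B 0 7 (R 725 11649650205040) (B 0 8 (R 725
  11645355237760) (B 0 9 (R 725 11576635761040) (B 1 2 (R 725 11649936535585) (B 1 3 (R 725
  11649936531505) (B 1 4 (R 725 11649936465985) (B 1 5 (R 725 11649935417425) (B 1 6 (R 725
  11649918640225) (B 1 7 (R 725 11649650204785) (B 1 8 (R 725 11645355237505) (B 1 9 (R 725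
  11576635760785) (R 724 10477124135440))))))))))))))))⟩]

def eleven : ℕ → Lem := look [eleven_0, eleven_1, eleven_2, eleven_3, eleven_4, eleven_5,
  eleven_6, eleven_7, eleven_8, eleven_9, eleven_10, eleven_11, eleven_12, eleven_13, eleven_14,
  eleven_15, eleven_16, eleven_17, eleven_18, eleven_19, eleven_20, eleven_21, eleven_22]


end KCert

namespace KCert

/-- Every vertex has at most `n - 6` non-neighbours (counting itself). -/
def Dense {n : ℕ} (H : SimpleGraph (Fin n)) : Prop :=
  ∀ v, {w | ¬ H.Adj v w}.ncard + 6 ≤ n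

/-- The conclusion of the local lemma. -/
def Concl {n : ℕ} (H : SimpleGraph (Fin n)) : Prop :=
  H.HasMinor K7m ∨
    (8 ≤ n ∧ (∃ y, n ≤ {w | ¬ H.Adj y w}.ncard + 6) ∧
      ∀ a b, a ≠ b → ¬ H.Adj a b → (H ⊔ SimpleGraph.edge a b).HasMinor K7m)

/-- Consistency of the edge part of a state. -/
def ConsE {n : ℕ} (H : SimpleGraph (Fin n)) (E : ℕ) : Prop :=
  ∀ i j : Fin n, tb E (16 * i.val + j.val) = true → H.Adj i j

/-- Consistency of the non-edge part of a state. -/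
def ConsN {n : ℕ} (H : SimpleGraph (Fin n)) (N : ℕ) : Prop :=
  ∀ i j : Fin n, tb N (16 * i.val + j.val) = true → ¬ H.Adj i j

theorem ConsE.ins {n : ℕ} (hn : n ≤ 16) {H : SimpleGraph (Fin n)} {E : ℕ} (h : ConsE H E)
    {i j : Fin n} (hij : H.Adj i j) : ConsE H (ins E i j) := by
  intro a b hab
  rcases tb_ins (by omega) (by omega) (by omega) hab with h1 | ⟨h1, h2⟩ | ⟨h1, h2⟩
  · exact h _ _ h1
  · rw [Fin.ext h1, Fin.ext h2]; exact hij
  · rw [Fin.ext h1, Fin.ext h2]; exact hij.symm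

theorem ConsN.ins {n : ℕ} (hn : n ≤ 16) {H : SimpleGraph (Fin n)} {E : ℕ} (h : ConsN H E)
    {i j : Fin n} (hij : ¬ H.Adj i j) : ConsN H (ins E i j) := by
  intro a b hab
  rcases tb_ins (by omega) (by omega) (by omega) hab with h1 | ⟨h1, h2⟩ | ⟨h1, h2⟩
  · exact h _ _ h1
  · rw [Fin.ext h1, Fin.ext h2]; exact hij
  · rw [Fin.ext h1, Fin.ext h2]; exact fun h => hij h.symm

theorem blt_iff {a b : ℕ} : Nat.blt a b = true ↔ a < b := by rw [Nat.blt_eq]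

theorem beq_iff {a b : ℕ} : Nat.beq a b = true ↔ a = b := Nat.beq_eq ▸ Iff.rfl

theorem connected_pair {V : Type*} (G : SimpleGraph V) (a b : V) (h : a = b ∨ G.Adj a b) :
    (G.induce {a, b}).Connected := by
  rcases h with rfl | h
  · have : ({a, a} : Set V) = {a} := by simp
    rw [this]
    exact { preconnected := fun x y => by rw [Subsingleton.elim x y], nonempty := ⟨⟨a, rfl⟩⟩ }
  · exact SimpleGraph.induce_pair_connected_of_adj h

theorem chkM_sound {n : ℕ} {H : SimpleGraph (Fin n)} {E m : ℕ} (hE : ConsE H E)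
    (h : chkM n E m = true) : H.HasMinor K7m := by
  unfold chkM at h
  simp only [allB_iff, force_eq, Bool.and_eq_true, Bool.or_eq_true, Bool.not_eq_true',
    blt_iff, beq_iff, ix] at h
  have hE' : ∀ {a b : ℕ} (ha : a < n) (hb : b < n), tb E (Nat.add (Nat.mul 16 a) b) = true →
      H.Adj ⟨a, ha⟩ ⟨b, hb⟩ := fun ha hb hh => hE ⟨_, ha⟩ ⟨_, hb⟩ hh
  have hA : ∀ j : Fin 7, mA m j < n := fun j => (h j j.2).1.1
  have hB : ∀ j : Fin 7, mB m j < n := fun j => (h j j.2).1.2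
  have hne : ∀ {a b : ℕ}, Nat.beq a b = false → a ≠ b := by
    intro a b h1 h2
    rw [← beq_iff] at h2
    rw [h1] at h2; cases h2
  have key : ∀ i j : Fin 7, i < j →
      Disjoint ({⟨mA m i, hA i⟩, ⟨mB m i, hB i⟩} : Set (Fin n)) {⟨mA m j, hA j⟩, ⟨mB m j, hB j⟩} := by
    intro i j hij
    obtain ⟨⟨⟨h1, h2⟩, h3, h4⟩, -⟩ := (h j j.2).2.2 i hij
    have h1 := hne h1; have h2 := hne h2; have h3 := hne h3; have h4 := hne h4
    rw [Set.disjoint_left]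
    simp only [Set.mem_insert_iff, Set.mem_singleton_iff, not_or]
    rintro x (rfl | rfl)
    · simp only [Fin.mk.injEq]; exact ⟨h1.symm, h3.symm⟩
    · simp only [Fin.mk.injEq]; exact ⟨h2.symm, h4.symm⟩
  have key2 : ∀ i j : Fin 7, i < j → K7m.Adj i j →
      ∃ v₁ ∈ ({⟨mA m i, hA i⟩, ⟨mB m i, hB i⟩} : Set (Fin n)),
      ∃ v₂ ∈ ({⟨mA m j, hA j⟩, ⟨mB m j, hB j⟩} : Set (Fin n)), H.Adj v₁ v₂ := by
    intro i j hij hadj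
    obtain ⟨-, h1⟩ := (h j j.2).2.2 i hij
    rcases h1 with ((h1 | h1) | (h1 | h1)) | h1
    · exact ⟨⟨mA m i, hA i⟩, by simp, ⟨mA m j, hA j⟩, by simp, (hE' _ _ h1).symm⟩
    · exact ⟨⟨mB m i, hB i⟩, by simp, ⟨mA m j, hA j⟩, by simp, (hE' _ _ h1).symm⟩
    · exact ⟨⟨mA m i, hA i⟩, by simp, ⟨mB m j, hB j⟩, by simp, (hE' _ _ h1).symm⟩
    · exact ⟨⟨mB m i, hB i⟩, by simp, ⟨mB m j, hB j⟩, by simp, (hE' _ _ h1).symm⟩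
    · exfalso
      have hj : j = 1 := Fin.ext h1
      have hi : i = 0 := by subst hj; omega
      subst hj hi
      simp [K7m] at hadj
  refine ⟨fun j => {⟨mA m j, hA j⟩, ⟨mB m j, hB j⟩}, fun w => ⟨_, Set.mem_insert _ _⟩, ?_, ?_, ?_⟩
  · intro i j hij
    rcases lt_or_gt_of_ne hij with h1 | h1
    · exact key i j h1
    · exact (key j i h1).symm
  · intro j
    apply connected_pair
    rcases (h j j.2).2.1 with h1 | h1
    · left; exact Fin.ext h1
    · right; exact hE' _ _ h1
  · intro i j hij
    rcases lt_or_gt_of_ne hij.ne with h1 | h1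
    · exact key2 i j h1 hij
    · obtain ⟨x, hx, y, hy, hxy⟩ := key2 j i h1 hij.symm
      exact ⟨y, hy, x, hx, hxy.symm⟩

theorem rowN_sound {n : ℕ} {H : SimpleGraph (Fin n)} {N : ℕ} (hN : ConsN H N) (v w : Fin n)
    (h : rowN N v w = true) : ¬ H.Adj v w := by
  unfold rowN at h
  rw [Bool.or_eq_true, beq_iff] at h
  rcases h with h | h
  · exact hN v w h
  · rw [Fin.ext h]; exact H.loopless.irrefl v

theorem cnt_fin {n : ℕ} (p : ℕ → Bool) : cnt n p = {w : Fin n | p w = true}.ncard := by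
  rw [cnt_eq, Set.ncard_eq_toFinset_card']
  apply Finset.card_bij' (fun a ha => ⟨a, by simpa using (Finset.mem_filter.1 ha).1⟩)
    (fun a _ => a.val) <;> simp

theorem rowN_count {n : ℕ} {H : SimpleGraph (Fin n)} {N : ℕ} (hN : ConsN H N) (v : Fin n)
    (h : n ≤ cnt n (rowN N v) + 6) : n ≤ {w | ¬ H.Adj v w}.ncard + 6 := by
  rw [cnt_fin] at h
  have := Set.ncard_le_ncard (s := {w : Fin n | rowN N v w = true}) (t := {w | ¬ H.Adj v w})
    (fun w hw => rowN_sound hN v w hw)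
  omega

theorem rowN_full {n : ℕ} {H : SimpleGraph (Fin n)} {N : ℕ} (hH : Dense H) (hN : ConsN H N)
    (v : Fin n) (h : n ≤ cnt n (rowN N v) + 6) (w : Fin n) (hw : rowN N v w = false) :
    H.Adj v w := by
  by_contra hvw
  rw [cnt_fin] at h
  have h1 := Set.ncard_lt_ncard (s := {w : Fin n | rowN N v w = true}) (t := {w | ¬ H.Adj v w})
    (Set.ssubset_iff_of_subset (fun w hw => rowN_sound hN v w hw) |>.2
      ⟨w, hvw, fun (hh : rowN N v w = true) => by rw [hw] at hh; cases hh⟩)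
  have := hH v
  omega

theorem fillE_sound {n : ℕ} (hn : n ≤ 16) {H : SimpleGraph (Fin n)} {E N : ℕ} (hE : ConsE H E)
    (v : Fin n) (h : ∀ w : Fin n, rowN N v w = false → H.Adj v w) (k : ℕ) (hk : k ≤ n) :
    ConsE H (fillE N v k E) := by
  induction k with
  | zero => exact hE
  | succ k ih =>
    have h1 := ih (by omega)
    change ConsE H (cond (rowN N v k) (fillE N v k E) (ins (fillE N v k E) v k))
    cases h2 : rowN N v k with
    | true => exact h1
    | false => exact h1.ins hn (h ⟨k, by omega⟩ h2)

/-- A lemma is good when its facts imply the conclusion. -/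
def Good (n : ℕ) (L : Lem) : Prop :=
  ∀ H : SimpleGraph (Fin n), Dense H →
    (∀ i j : Fin n, 16 * i.val + j.val ∈ L.le → H.Adj i j) →
    (∀ i j : Fin n, 16 * i.val + j.val ∈ L.lf → ¬ H.Adj i j) → Concl H

theorem HasMinor.map_iso {V V' W : Type*} {G : SimpleGraph V} {G' : SimpleGraph V'}
    {K : SimpleGraph W} (e : G ≃g G') (h : G.HasMinor K) : G'.HasMinor K := by
  obtain ⟨B, h1, h2, h3, h4⟩ := h
  refine ⟨fun w => e '' B w, fun w => (h1 w).image e, ?_, ?_, ?_⟩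
  · intro i j hij
    exact Set.disjoint_image_of_injective e.injective (h2 hij)
  · intro w
    let f : G.induce (B w) →g G'.induce (e '' B w) :=
      { toFun := fun x => ⟨e x, Set.mem_image_of_mem _ x.2⟩
        map_rel' := fun {a b} hab => e.map_adj_iff.2 hab }
    have hf : Function.Surjective f := by
      rintro ⟨_, x, hx, rfl⟩
      exact ⟨⟨x, hx⟩, rfl⟩
    exact (h3 w).map f hf
  · intro a b hab
    obtain ⟨x, hx, y, hy, hxy⟩ := h4 a b hab
    exact ⟨e x, Set.mem_image_of_mem _ hx, e y, Set.mem_image_of_mem _ hy, e.map_adj_iff.2 hxy⟩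

theorem ncard_iso {V V' : Type*} {G : SimpleGraph V} {G' : SimpleGraph V'} (e : G ≃g G') (y : V) :
    {w | ¬ G'.Adj (e y) w}.ncard = {w | ¬ G.Adj y w}.ncard := by
  rw [← Set.ncard_image_of_injective _ e.injective]
  congr 1
  ext w
  constructor
  · intro h
    refine ⟨e.symm w, ?_, by simp⟩
    intro h2
    apply h
    have := e.map_adj_iff.2 h2
    simpa using this
  · rintro ⟨x, hx, rfl⟩ h
    exact hx (e.map_adj_iff.1 h)

/-- Isomorphisms respect adding an edge. -/
def isoEdge {V V' : Type*} {G : SimpleGraph V} {G' : SimpleGraph V'} (e : G ≃g G') (a b : V) :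
    (G ⊔ SimpleGraph.edge a b) ≃g (G' ⊔ SimpleGraph.edge (e a) (e b)) where
  toEquiv := e.toEquiv
  map_rel_iff' := by
    intro x y
    have h : G'.Adj (e x) (e y) ↔ G.Adj x y := e.map_adj_iff
    simp [SimpleGraph.edge_adj, h]

theorem Concl.iso {n : ℕ} {H H' : SimpleGraph (Fin n)} (e : H ≃g H') (h : Concl H) :
    Concl H' := by
  rcases h with h | ⟨h8, ⟨y, hy⟩, h⟩
  · exact Or.inl (HasMinor.map_iso e h)
  · refine Or.inr ⟨h8, ⟨e y, by rw [ncard_iso]; exact hy⟩, ?_⟩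
    intro a b hab hadj
    have h1 := h (e.symm a) (e.symm b) (fun hh => hab (e.symm.injective hh))
      (fun hh => hadj (e.symm.map_adj_iff.1 hh))
    have h2 := HasMinor.map_iso (isoEdge e _ _) h1
    simpa using h2

theorem facts_iff {S p : ℕ} {l : List ℕ} (h : facts S p l = true) (i j : ℕ) (hj : j < 16)
    (hl : 16 * i + j ∈ l) : tb S (16 * pv p i + pv p j) = true := by
  unfold facts at h
  rw [List.all_eq_true] at h
  have h1 := h _ hl
  have e1 : Nat.div (16 * i + j) 16 = i := by
    change (16 * i + j) / 16 = i
    omega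
  have e2 : Nat.mod (16 * i + j) 16 = j := by
    change (16 * i + j) % 16 = j
    omega
  rw [e1, e2] at h1
  exact h1

theorem perm_sound {n p : ℕ} (h : perm n p = true) :
    ∃ σ : Fin n ≃ Fin n, ∀ i, (σ i).val = pv p i := by
  unfold perm at h
  simp only [allB_iff, force_eq, Bool.and_eq_true, Bool.not_eq_true', blt_iff] at h
  have hlt : ∀ i : Fin n, pv p i < n := fun i => (h i i.2).1
  have hinj : ∀ i j : Fin n, j < i → pv p j ≠ pv p i := by
    intro i j hij heq
    have h1 := (h i i.2).2 j hij
    rw [← beq_iff] at heq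
    rw [heq] at h1; cases h1
  let f : Fin n → Fin n := fun i => ⟨pv p i, hlt i⟩
  have hf : Function.Injective f := by
    intro i j hij
    have hij : pv p i = pv p j := congrArg Fin.val hij
    rcases lt_trichotomy i j with h1 | h1 | h1
    · exact absurd hij (hinj j i h1)
    · exact h1
    · exact absurd hij.symm (hinj i j h1)
  exact ⟨Equiv.ofBijective f (Finite.injective_iff_bijective.1 hf), fun i => rfl⟩

theorem chk_sound {n : ℕ} (hn : n ≤ 16) (hn0 : 0 < n) {D : ℕ → Lem} {c : ℕ}
    (hD : ∀ k < c, Good n (D k))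
    (t : Tr) : ∀ (E N : ℕ) (H : SimpleGraph (Fin n)), Dense H → ConsE H E → ConsN H N →
      chk n D c t E N = true → Concl H := by
  induction t with
  | B i j s t ihs iht =>
    intro E N H hH hE hN h
    change (and (and (Nat.blt i n) (Nat.blt j n)) <|
      and (force (ins N i j) fun N' => chk n D c s E N')
        (force (ins E i j) fun E' => chk n D c t E' N)) = true at h
    simp only [force_eq, Bool.and_eq_true, blt_iff] at h
    obtain ⟨⟨hi, hj⟩, h1, h2⟩ := h
    by_cases hadj : H.Adj ⟨i, hi⟩ ⟨j, hj⟩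
    · exact iht _ _ H hH (hE.ins hn hadj) hN h2
    · exact ihs _ _ H hH hE (hN.ins hn hadj) h1
  | F v t ih =>
    intro E N H hH hE hN h
    change (and (and (Nat.blt v n) (Nat.ble n (Nat.add (cnt n (rowN N v)) 6))) <|
      force (fillE N v n E) fun E' => chk n D c t E' N) = true at h
    simp only [force_eq, Bool.and_eq_true, blt_iff, Nat.ble_eq] at h
    obtain ⟨⟨hv, h1⟩, h2⟩ := h
    exact ih _ _ H hH (fillE_sound hn hE ⟨v, hv⟩ (rowN_full hH hN ⟨v, hv⟩ h1) n le_rfl) hN h2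
  | M m =>
    intro E N H hH hE hN h
    exact Or.inl (chkM_sound hE h)
  | R k p =>
    intro E N H hH hE hN h
    change (and (and (Nat.blt k c) (perm n p))
      (and (facts E p (D k).le) (facts N p (D k).lf))) = true at h
    simp only [Bool.and_eq_true, blt_iff] at h
    obtain ⟨⟨hk, hp⟩, h1, h2⟩ := h
    obtain ⟨σ, hσ⟩ := perm_sound hp
    let e : H.comap σ ≃g H := { toEquiv := σ, map_rel_iff' := Iff.rfl }
    refine Concl.iso e (hD k hk (H.comap σ) ?_ ?_ ?_)
    · intro v
      rw [← ncard_iso e]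
      exact hH _
    · intro i j hl
      apply hE
      rw [hσ, hσ]
      exact facts_iff h1 i j (by omega) hl
    · intro i j hl
      apply hN
      rw [hσ, hσ]
      exact facts_iff h2 i j (by omega) hl
  | X l =>
    intro E N H hH hE hN h
    change (and (and (Nat.ble 8 n) (Nat.ble n (Nat.add (cnt n (rowN N 0)) 6))) <|
      allB n fun i => allB n fun j => or (or (Nat.beq i j) (tb E (ix i j))) <|
        l.any fun m => force (ins E i j) fun E' => chkM n E' m) = true at h
    simp only [force_eq, Bool.and_eq_true, Bool.or_eq_true, beq_iff, Nat.ble_eq, allB_iff,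
      List.any_eq_true] at h
    obtain ⟨⟨h8, h1⟩, h2⟩ := h
    refine Or.inr ⟨h8, ⟨⟨0, hn0⟩, rowN_count hN ⟨0, hn0⟩ h1⟩, ?_⟩
    intro a b hab hadj
    rcases h2 a a.2 b b.2 with (h3 | h3) | ⟨m, -, h3⟩
    · exact absurd (Fin.ext h3) hab
    · exact absurd (hE a b h3) hadj
    · refine chkM_sound (E := ins E a b) (ConsE.ins hn ?_ ?_) h3
      · intro i j hij
        exact Or.inl (hE i j hij)
      · right
        simp [SimpleGraph.edge_adj, hab]

theorem ini_sound (l : List ℕ) (hl : ∀ f ∈ l, f < 256)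
    (i j : ℕ) (hj : j < 16) (h : tb (ini l) (16 * i + j) = true) :
    16 * i + j ∈ l ∨ 16 * j + i ∈ l := by
  induction l with
  | nil =>
    have : tb 0 (16 * i + j) = true := h
    rw [tb_eq] at this
    simp at this
  | cons f l ih =>
    have h1 : tb (ins (ini l) (f / 16) (f % 16)) (16 * i + j) = true := h
    have hf : f < 256 := hl f (by simp)
    rcases tb_ins (by omega) (by omega) hj h1 with h2 | ⟨h2, h3⟩ | ⟨h2, h3⟩
    · rcases ih (fun f hf => hl f (by simp [hf])) h2 with h | h
      · left; simp [h]
      · right; simp [h]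
    · left
      have : 16 * i + j = f := by omega
      simp [this]
    · right
      have : 16 * j + i = f := by omega
      simp [this]

theorem chkL_sound {n : ℕ} (hn : n ≤ 16) (hn0 : 0 < n) {D : ℕ → Lem} {c : ℕ}
    (hD : ∀ k < c, Good n (D k)) (h : chkL n D c = true) : Good n (D c) := by
  unfold chkL at h
  simp only [force_eq, Bool.and_eq_true, List.all_eq_true, blt_iff] at h
  obtain ⟨⟨h1, h2⟩, h3⟩ := h
  intro H hH hE hN
  refine chk_sound hn hn0 hD _ _ _ H hH ?_ ?_ h3
  · intro i j hij
    rcases ini_sound _ h1 i j (by omega) hij with h | h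
    · exact hE _ _ h
    · exact (hE _ _ h).symm
  · intro i j hij
    rcases ini_sound _ h2 i j (by omega) hij with h | h
    · exact hN _ _ h
    · exact fun hh => hN _ _ h hh.symm

theorem all_sound {n : ℕ} (hn : n ≤ 16) (hn0 : 0 < n) {D : ℕ → Lem} {c : ℕ}
    (h : allB c (chkL n D) = true) : ∀ k < c, Good n (D k) := by
  rw [allB_iff] at h
  intro k
  induction k using Nat.strong_induction_on with
  | _ k ih =>
    intro hk
    exact chkL_sound hn hn0 (fun i hi => ih i hi (by omega)) (h k hk)

/-- If the last lemma has no hypotheses, every dense graph satisfies the conclusion. -/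
theorem root_sound {n : ℕ} (hn : n ≤ 16) (hn0 : 0 < n) {D : ℕ → Lem} (c : ℕ)
    (h : allB (c + 1) (chkL n D) = true) (he : (D c).e = 0) (hf : (D c).f = 0)
    (H : SimpleGraph (Fin n)) (hH : Dense H) : Concl H := by
  have hu : unp 60 0 = [] := rfl
  refine all_sound hn hn0 h c (by omega) H hH ?_ ?_
  · intro i j hij
    rw [Lem.le, he, hu] at hij
    simp at hij
  · intro i j hij
    rw [Lem.lf, hf, hu] at hij
    simp at hij

end KCert

namespace KCert

set_option maxRecDepth 100000 in
theorem ok_seven : allB (0 + 1) (chkL 7 seven) = true := by decide +kernel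
set_option maxRecDepth 100000 in
theorem ok_eight : allB (4 + 1) (chkL 8 eight) = true := by decide +kernel
set_option maxRecDepth 100000 in
theorem ok_nine : allB (19 + 1) (chkL 9 nine) = true := by decide +kernel
set_option maxRecDepth 100000 in
theorem ok_ten : allB (96 + 1) (chkL 10 ten) = true := by decide +kernel
set_option maxRecDepth 100000 in
theorem ok_eleven : allB (726 + 1) (chkL 11 eleven) = true := by decide +kernel

theorem small_sound {n : ℕ} (h7 : 7 ≤ n) (h11 : n ≤ 11) (H : SimpleGraph (Fin n)) (hH : Dense H) :
    Concl H := by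
  have hn : n = 7 ∨ n = 8 ∨ n = 9 ∨ n = 10 ∨ n = 11 := by omega
  rcases hn with rfl | rfl | rfl | rfl | rfl
  · exact root_sound (by omega) (by omega) 0 ok_seven (by decide +kernel) (by decide +kernel) H hH
  · exact root_sound (by omega) (by omega) 4 ok_eight (by decide +kernel) (by decide +kernel) H hH
  · exact root_sound (by omega) (by omega) 19 ok_nine (by decide +kernel) (by decide +kernel) H hH
  · exact root_sound (by omega) (by omega) 96 ok_ten (by decide +kernel) (by decide +kernel) H hH
  · exact root_sound (by omega) (by omega) 726 ok_eleven (by decide +kernel) (by decide +kernel) H hH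

theorem ncard_compl_nbr {W : Type*} [Finite W] (Q : SimpleGraph W) (v : W) :
    (Q.neighborSet v).ncard + {w | ¬ Q.Adj v w}.ncard = Nat.card W :=
  Set.ncard_add_ncard_compl (Q.neighborSet v)

/-- The local lemma on small graphs of minimum degree at least six. -/
theorem local_lemma {W : Type*} [Finite W] (Q : SimpleGraph W) (h7 : 7 ≤ Nat.card W)
    (h11 : Nat.card W ≤ 11) (hd : ∀ v, 6 ≤ (Q.neighborSet v).ncard) :
    Q.HasMinor K7m ∨ (8 ≤ Nat.card W ∧ (∃ y, (Q.neighborSet y).ncard ≤ 6) ∧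
      ∀ a b, a ≠ b → ¬ Q.Adj a b → (Q ⊔ SimpleGraph.edge a b).HasMinor K7m) := by
  let σ : W ≃ Fin (Nat.card W) := Finite.equivFin W
  let H : SimpleGraph (Fin (Nat.card W)) := Q.comap σ.symm
  let e : H ≃g Q := { toEquiv := σ.symm, map_rel_iff' := Iff.rfl }
  have hH : Dense H := by
    intro v
    rw [← ncard_iso e]
    have h1 := ncard_compl_nbr Q (e v)
    have h2 := hd (e v)
    omega
  rcases small_sound h7 h11 H hH with h | ⟨h8, ⟨y, hy⟩, h⟩
  · exact Or.inl (HasMinor.map_iso e h)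
  · refine Or.inr ⟨h8, ⟨e y, ?_⟩, ?_⟩
    · rw [← ncard_iso e] at hy
      have h1 := ncard_compl_nbr Q (e y)
      omega
    · intro a b hab hadj
      have h1 := h (e.symm a) (e.symm b) (fun hh => hab (e.symm.injective hh))
        (fun hh => hadj (e.symm.map_adj_iff.1 hh))
      have h2 := HasMinor.map_iso (isoEdge e _ _) h1
      simpa using h2

end KCert

namespace KMin

variable {V W U : Type*}

theorem reach_mono {G : SimpleGraph V} {S T : Set V} (h : S ⊆ T)
    (hS : (G.induce S).Connected) {a b : V} (ha : a ∈ S) (hb : b ∈ S) :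
    (G.induce T).Reachable ⟨a, h ha⟩ ⟨b, h hb⟩ :=
  (hS.preconnected ⟨a, ha⟩ ⟨b, hb⟩).map (SimpleGraph.induceHomOfLE G h).toHom

theorem connected_biUnion {G : SimpleGraph V} {Q : SimpleGraph W} (R : W → Set V) (S : Set W)
    (hS : (Q.induce S).Connected) (hR : ∀ w, (G.induce (R w)).Connected)
    (hadj : ∀ w w', Q.Adj w w' → ∃ a ∈ R w, ∃ b ∈ R w', G.Adj a b) :
    (G.induce (⋃ w ∈ S, R w)).Connected := by
  have hsub : ∀ w ∈ S, R w ⊆ ⋃ w ∈ S, R w := fun w hw => Set.subset_biUnion_of_mem hw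
  have key : ∀ w w' : S, (Q.induce S).Walk w w' → ∀ a (ha : a ∈ R w) b (hb : b ∈ R w'),
      (G.induce (⋃ w ∈ S, R w)).Reachable ⟨a, hsub w w.2 ha⟩ ⟨b, hsub w' w'.2 hb⟩ := by
    intro w w' p
    induction p with
    | nil => intro a ha b hb; exact reach_mono (hsub _ (Subtype.mem _)) (hR _) ha hb
    | @cons u v w h p ih =>
      intro a ha b hb
      obtain ⟨c, hc, d, hd, hcd⟩ := hadj u v h
      refine (reach_mono (hsub _ u.2) (hR _) ha hc).trans (SimpleGraph.Reachable.trans ?_ (ih d hd b hb))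
      exact SimpleGraph.Adj.reachable hcd
  obtain ⟨w0⟩ := hS.nonempty
  obtain ⟨a0⟩ := (hR w0).nonempty
  refine { preconnected := ?_, nonempty := ⟨⟨a0, hsub _ w0.2 a0.2⟩⟩ }
  rintro ⟨a, ha⟩ ⟨b, hb⟩
  obtain ⟨w, hw, ha'⟩ := Set.mem_iUnion₂.1 ha
  obtain ⟨w', hw', hb'⟩ := Set.mem_iUnion₂.1 hb
  obtain ⟨p⟩ := hS.preconnected ⟨w, hw⟩ ⟨w', hw'⟩
  exact key _ _ p a ha' b hb'

theorem lift_model {G : SimpleGraph V} {Q : SimpleGraph W} {K : SimpleGraph U} (R : W → Set V)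
    (hdis : Pairwise fun w w' => Disjoint (R w) (R w'))
    (hR : ∀ w, (G.induce (R w)).Connected)
    (hadj : ∀ w w', Q.Adj w w' → ∃ a ∈ R w, ∃ b ∈ R w', G.Adj a b)
    (h : Q.HasMinor K) :
    ∃ B : U → Set V, (∀ u, ∃ w, R w ⊆ B u) ∧ (∀ u, B u ⊆ ⋃ w, R w) ∧
    (∀ w, (B w).Nonempty) ∧
    (Pairwise fun w₁ w₂ => Disjoint (B w₁) (B w₂)) ∧
    (∀ w, (G.induce (B w)).Connected) ∧
    (∀ w₁ w₂, K.Adj w₁ w₂ → ∃ v₁ ∈ B w₁, ∃ v₂ ∈ B w₂, G.Adj v₁ v₂) := by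
  obtain ⟨B, h1, h2, h3, h4⟩ := h
  have hsub : ∀ u, ∀ w ∈ B u, R w ⊆ ⋃ w ∈ B u, R w := fun u w hw => Set.subset_biUnion_of_mem hw
  refine ⟨fun u => ⋃ w ∈ B u, R w, ?_, ?_, ?_, ?_, ?_, ?_⟩
  · intro u
    obtain ⟨w, hw⟩ := h1 u
    exact ⟨w, hsub u w hw⟩
  · intro u
    exact Set.iUnion₂_subset fun w _ => Set.subset_iUnion R w
  · intro u
    obtain ⟨w, hw⟩ := h1 u
    obtain ⟨a⟩ := (hR w).nonempty
    exact ⟨a, hsub u w hw a.2⟩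
  · intro u u' huu
    simp only [Set.disjoint_iUnion_left, Set.disjoint_iUnion_right]
    intro w hw w' hw'
    apply hdis
    rintro rfl
    exact Set.disjoint_left.1 (h2 huu) hw' hw
  · intro u
    exact connected_biUnion R (B u) (h3 u) hR hadj
  · intro u u' huu
    obtain ⟨w, hw, w', hw', hww⟩ := h4 u u' huu
    obtain ⟨a, ha, b, hb, hab⟩ := hadj w w' hww
    exact ⟨a, hsub u w hw ha, b, hsub u' w' hw' hb, hab⟩

theorem minor_of_model {G : SimpleGraph V} {Q : SimpleGraph W} {K : SimpleGraph U} (R : W → Set V)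
    (hdis : Pairwise fun w w' => Disjoint (R w) (R w'))
    (hR : ∀ w, (G.induce (R w)).Connected)
    (hadj : ∀ w w', Q.Adj w w' → ∃ a ∈ R w, ∃ b ∈ R w', G.Adj a b)
    (h : Q.HasMinor K) : G.HasMinor K := by
  obtain ⟨B, -, -, hB⟩ := lift_model R hdis hR hadj h
  exact ⟨B, hB⟩

theorem conn_singleton (G : SimpleGraph V) (a : V) : (G.induce {a}).Connected :=
  { preconnected := fun x y => by rw [Subsingleton.elim x y], nonempty := ⟨⟨a, rfl⟩⟩ }

theorem minor_of_hom {G : SimpleGraph V} {Q : SimpleGraph W} {K : SimpleGraph U} (f : W → V)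
    (hf : Function.Injective f) (hadj : ∀ w w', Q.Adj w w' → G.Adj (f w) (f w'))
    (h : Q.HasMinor K) : G.HasMinor K := by
  refine minor_of_model (fun w => {f w}) ?_ (fun w => conn_singleton G _) ?_ h
  · intro w w' hww
    simpa using fun hh => hww (hf hh)
  · intro w w' hww
    exact ⟨_, rfl, _, rfl, hadj w w' hww⟩

theorem K8_castSucc (i j : Fin 7) : K8minus.Adj i.castSucc j.castSucc → K7m.Adj i j := by
  revert i j
  simp only [K8minus, K7m, SimpleGraph.deleteEdges_adj, SimpleGraph.top_adj,
    Set.mem_singleton_iff]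
  decide

/-- Adding an apex vertex turns a `K7m` minor into a `K8minus` minor. -/
theorem apex {G : SimpleGraph V} {Q : SimpleGraph W} (x : V) (R : W → Set V)
    (hdis : Pairwise fun w w' => Disjoint (R w) (R w'))
    (hR : ∀ w, (G.induce (R w)).Connected)
    (hadj : ∀ w w', Q.Adj w w' → ∃ a ∈ R w, ∃ b ∈ R w', G.Adj a b)
    (hx : ∀ w, x ∉ R w) (hxa : ∀ w, ∃ a ∈ R w, G.Adj x a)
    (h : Q.HasMinor K7m) : G.HasMinor K8minus := by
  obtain ⟨B, h1, h2, h3, h4, h5, h6⟩ := lift_model R hdis hR hadj h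
  have hxB : ∀ u, x ∉ B u := by
    intro u hu
    obtain ⟨w, hw⟩ := Set.mem_iUnion.1 (h2 u hu)
    exact hx w hw
  have hxa' : ∀ u, ∃ a ∈ B u, G.Adj x a := by
    intro u
    obtain ⟨w, hw⟩ := h1 u
    obtain ⟨a, ha, hxa⟩ := hxa w
    exact ⟨a, hw ha, hxa⟩
  obtain ⟨C, hl, hc⟩ : ∃ C : Fin 8 → Set V, C (Fin.last 7) = {x} ∧ ∀ i : Fin 7, C i.castSucc = B i :=
    ⟨Fin.lastCases (motive := fun _ => Set V) {x} B, Fin.lastCases_last, fun i =>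
      Fin.lastCases_castSucc i⟩
  refine ⟨C, ?_, ?_, ?_, ?_⟩
  · intro w
    refine Fin.lastCases ?_ (fun i => ?_) w
    · rw [hl]; exact ⟨x, rfl⟩
    · rw [hc]; exact h3 i
  · intro w w'
    refine Fin.lastCases ?_ (fun i => ?_) w <;> refine Fin.lastCases ?_ (fun j => ?_) w'
    · intro h; exact absurd rfl h
    · intro _; rw [hl, hc]; simpa using hxB j
    · intro _; rw [hl, hc]; simpa using hxB i
    · intro hij
      rw [hc, hc]
      exact h4 (fun hh => hij (by rw [hh]))
  · intro w
    refine Fin.lastCases ?_ (fun i => ?_) w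
    · rw [hl]; exact conn_singleton G x
    · rw [hc]; exact h5 i
  · intro w w'
    refine Fin.lastCases ?_ (fun i => ?_) w <;> refine Fin.lastCases ?_ (fun j => ?_) w'
    · intro hh; exact absurd hh (SimpleGraph.irrefl _)
    · intro _
      obtain ⟨a, ha, hxa⟩ := hxa' j
      rw [hl, hc]
      exact ⟨x, rfl, a, ha, hxa⟩
    · intro _
      obtain ⟨a, ha, hxa⟩ := hxa' i
      rw [hl, hc]
      exact ⟨a, ha, x, rfl, hxa.symm⟩
    · intro hij
      rw [hc, hc]
      exact h6 i j (K8_castSucc i j hij)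

/-- Contraction of the edge `uv`, keeping `u`, before removal of `v`. -/
def addNbrs (G : SimpleGraph V) (u v : V) : SimpleGraph V where
  Adj a b := G.Adj a b ∨ (a = u ∧ b ≠ u ∧ G.Adj v b) ∨ (b = u ∧ a ≠ u ∧ G.Adj v a)
  symm := ⟨by
    intro a b h
    rcases h with h | h | h
    · exact Or.inl h.symm
    · exact Or.inr (Or.inr h)
    · exact Or.inr (Or.inl h)⟩
  loopless := ⟨by
    intro a h
    rcases h with h | h | h
    · exact G.irrefl h
    · exact h.2.1 h.1
    · exact h.2.1 h.1⟩

theorem minor_of_contract {G : SimpleGraph V} {K : SimpleGraph U} {u v : V} (huv : G.Adj u v)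
    (h : ((addNbrs G u v).induce {v}ᶜ).HasMinor K) : G.HasMinor K := by
  classical
  refine minor_of_model (fun w => if w.1 = u then {u, v} else {w.1}) ?_ ?_ ?_ h
  · rintro ⟨w, hw⟩ ⟨w', hw'⟩ hww
    simp only [ne_eq, Subtype.mk.injEq] at hww
    simp only [Set.mem_compl_iff, Set.mem_singleton_iff] at hw hw'
    simp only
    split_ifs with h1 h2 h2
    · exact absurd (h1.trans h2.symm) hww
    · simp [h2, hw']
    · simp [h1, hw]
    · simp [hww]
  · rintro ⟨w, hw⟩
    by_cases h1 : w = u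
    · change (G.induce (if w = u then ({u, v} : Set V) else {w})).Connected
      rw [if_pos h1]
      exact KCert.connected_pair G u v (Or.inr huv)
    · change (G.induce (if w = u then ({u, v} : Set V) else {w})).Connected
      rw [if_neg h1]
      exact conn_singleton G w
  · rintro ⟨w, hw⟩ ⟨w', hw'⟩ hww
    have hww : (addNbrs G u v).Adj w w' := hww
    simp only
    rcases hww with hww | ⟨rfl, h1, h2⟩ | ⟨rfl, h1, h2⟩
    · exact ⟨w, by split_ifs with h <;> simp [h], w', by split_ifs with h <;> simp [h], hww⟩
    · exact ⟨v, by simp, w', by simp [h1], h2⟩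
    · exact ⟨w, by simp [h1], v, by simp, h2.symm⟩

end KMin

namespace KMin

variable {V : Type*}

theorem ncard_induce_nbr (G : SimpleGraph V) (S : Set V) (v : S) :
    ((G.induce S).neighborSet v).ncard = (S ∩ G.neighborSet v).ncard := by
  rw [← Set.ncard_image_of_injective _ Subtype.val_injective]
  congr 1
  ext w
  simp only [Set.mem_image, SimpleGraph.mem_neighborSet, SimpleGraph.comap_adj,
    Function.Embedding.subtype_apply, Subtype.exists, Set.mem_inter_iff]
  constructor
  · rintro ⟨a, ha, h, rfl⟩; exact ⟨ha, h⟩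
  · rintro ⟨h1, h2⟩; exact ⟨w, h1, h2, rfl⟩

theorem conn_insert {G : SimpleGraph V} {D : Set V} {a d : V} (hD : (G.induce D).Connected)
    (hd : d ∈ D) (h : G.Adj a d) : (G.induce (insert a D)).Connected := by
  rw [← Set.singleton_union]
  exact SimpleGraph.connected_induce_union (v := a) (w := d) (conn_singleton G a).preconnected
    hD.preconnected rfl hd h

/-- Structure lemma: a `K8minus` minor or a clique cutset around a small-degree vertex. -/
theorem structure_lemma [Finite V] (G : SimpleGraph V)
    (htri : ∀ u v, G.Adj u v → 6 ≤ (G.neighborSet u ∩ G.neighborSet v).ncard) (x : V)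
    (hx1 : 1 ≤ (G.neighborSet x).ncard) (hx11 : (G.neighborSet x).ncard ≤ 11)
    (hmin : ∀ y, G.Adj x y → (G.neighborSet x).ncard ≤ (G.neighborSet y).ncard) :
    G.HasMinor K8minus ∨ ∃ D : Set V, D.Nonempty ∧ x ∉ D ∧ (∀ d ∈ D, ¬ G.Adj x d) ∧
      (∀ d ∈ D, ∀ w, w ∉ D → G.Adj d w → G.Adj x w) ∧
      (∀ a b, a ∉ D → b ∉ D → a ≠ b → (∃ d ∈ D, G.Adj d a) → (∃ d ∈ D, G.Adj d b) → G.Adj a b) := by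
  classical
  set N := G.neighborSet x with hN
  have h7 : 7 ≤ N.ncard := by
    obtain ⟨y, hy⟩ := (Set.ncard_pos).1 hx1
    have h1 : 6 ≤ (N ∩ G.neighborSet y).ncard := htri x y hy
    have h2 : insert y (N ∩ G.neighborSet y) ⊆ N := by
      intro z hz
      rcases hz with rfl | hz
      · exact hy
      · exact hz.1
    have h3 := Set.ncard_le_ncard h2
    rw [Set.ncard_insert_of_notMem (by simp)] at h3
    omega
  have hxN : x ∉ N := by simp [hN]
  have hd : ∀ v : N, 6 ≤ ((G.induce N).neighborSet v).ncard := by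
    intro v
    rw [ncard_induce_nbr]
    exact htri x v v.2
  have hcard : Nat.card N = N.ncard := rfl
  rcases KCert.local_lemma (G.induce N) (by omega) (by omega) hd with h | ⟨h8, ⟨y, hy⟩, h⟩
  · left
    refine apex x (fun w : N => {w.1}) ?_ (fun w => conn_singleton G _) ?_ ?_ ?_ h
    · intro w w' hww
      simpa using fun hh => hww (Subtype.ext hh)
    · intro w w' hww
      exact ⟨_, rfl, _, rfl, hww⟩
    · intro w hw
      have : x = w.1 := hw
      exact hxN (this ▸ w.2)
    · intro w
      exact ⟨_, rfl, w.2⟩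
  · rw [ncard_induce_nbr] at hy
    have hz : ∃ z, G.Adj y z ∧ z ∉ insert x N := by
      by_contra hcon
      push Not at hcon
      have h1 : G.neighborSet y ⊆ insert x (N ∩ G.neighborSet y) := by
        intro z hz
        rcases hcon z hz with h | h
        · exact Or.inl h
        · exact Or.inr ⟨h, hz⟩
      have h2 := Set.ncard_le_ncard h1
      have h3 := Set.ncard_insert_le x (N ∩ G.neighborSet y)
      have h4 := hmin y y.2
      omega
    obtain ⟨z, hyz, hz⟩ := hz
    obtain ⟨D, hDmax⟩ := (Set.toFinite {D : Set V | z ∈ D ∧ Disjoint D (insert x N) ∧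
      (G.induce D).Connected}).exists_maximal ⟨{z}, rfl, by simpa using hz, conn_singleton G z⟩
    obtain ⟨⟨hzD, hDN, hDc⟩, hmax⟩ := hDmax
    have hxD : x ∉ D := fun hh => Set.disjoint_left.1 hDN hh (Or.inl rfl)
    have hND : ∀ d ∈ D, d ∉ N := fun d hd hh => Set.disjoint_left.1 hDN hd (Or.inr hh)
    have hnb : ∀ d ∈ D, ∀ w, w ∉ D → G.Adj d w → w ∈ N := by
      intro d hdD w hw hdw
      by_contra hwN
      have hwx : w ≠ x := by
        rintro rfl
        exact hND d hdD hdw.symm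
      have := hmax (y := insert w D) ⟨Or.inr hzD, ?_, conn_insert hDc hdD hdw.symm⟩
        (Set.subset_insert w D)
      · exact hw (this (Or.inl rfl))
      · rw [Set.disjoint_insert_left]
        refine ⟨?_, hDN⟩
        rintro (h | h)
        · exact hwx h
        · exact hwN h
    by_cases hcl : ∀ a b, a ∉ D → b ∉ D → a ≠ b → (∃ d ∈ D, G.Adj d a) → (∃ d ∈ D, G.Adj d b) →
        G.Adj a b
    · exact Or.inr ⟨D, ⟨z, hzD⟩, hxD, fun d hd hh => hND d hd hh, hnb, hcl⟩
    · left
      push Not at hcl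
      obtain ⟨a, b, ha, hb, hab, ⟨d, hd, hda⟩, ⟨d', hd', hdb⟩, hnab⟩ := hcl
      have haN := hnb d hd a ha hda
      have hbN := hnb d' hd' b hb hdb
      have hQ := h ⟨a, haN⟩ ⟨b, hbN⟩ (by simpa using hab) hnab
      refine apex x (fun w : N => if w.1 = a then insert a D else {w.1}) ?_ ?_ ?_ ?_ ?_ hQ
      · rintro ⟨w, hw⟩ ⟨w', hw'⟩ hww
        simp only [ne_eq, Subtype.mk.injEq] at hww
        have hwD : w ∉ D := fun hh => hND w hh hw
        have hwD' : w' ∉ D := fun hh => hND w' hh hw'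
        simp only
        split_ifs with h1 h2 h2
        · exact absurd (h1.trans h2.symm) hww
        · simp [h2, hwD']
        · simp [h1, hwD]
        · simp [hww]
      · rintro ⟨w, hw⟩
        by_cases h1 : w = a
        · change (G.induce (if w = a then insert a D else {w})).Connected
          rw [if_pos h1]
          exact conn_insert hDc hd hda.symm
        · change (G.induce (if w = a then insert a D else {w})).Connected
          rw [if_neg h1]
          exact conn_singleton G w
      · rintro ⟨w, hw⟩ ⟨w', hw'⟩ hww
        simp only
        rw [SimpleGraph.sup_adj, SimpleGraph.edge_adj] at hww
        rcases hww with hww | ⟨⟨h1, h2⟩ | ⟨h1, h2⟩, -⟩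
        · exact ⟨w, by split_ifs with h <;> simp [h], w', by split_ifs with h <;> simp [h], hww⟩
        · simp only [Subtype.mk.injEq] at h1 h2
          subst h1 h2
          exact ⟨d', by simp [hd'], w', by simp [Ne.symm hab], hdb⟩
        · simp only [Subtype.mk.injEq] at h1 h2
          subst h1 h2
          exact ⟨w, by simp [Ne.symm hab], d', by simp [hd'], hdb.symm⟩
      · rintro ⟨w, hw⟩ hh
        have hwx : x ≠ w := by rintro rfl; exact hxN hw
        have hax : x ≠ a := by rintro rfl; exact hxN haN
        simp only at hh
        split_ifs at hh
        · rcases hh with hh | hh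
          · exact hax hh
          · exact hxD hh
        · exact hwx hh
      · rintro ⟨w, hw⟩
        exact ⟨w, by simp only; split_ifs with h <;> simp [h], hw⟩

end KMin

namespace KMin

/-- Number of ordered adjacent pairs inside `S`. -/
noncomputable def pc {V : Type*} (G : SimpleGraph V) (S : Set V) : ℕ :=
  {p : V × V | G.Adj p.1 p.2 ∧ p.1 ∈ S ∧ p.2 ∈ S}.ncard

theorem pc_induce {V : Type*} (G : SimpleGraph V) (S : Set V) :
    pc (G.induce S) Set.univ = pc G S := by
  unfold pc
  rw [← Set.ncard_image_of_injective _
    (Function.Injective.prodMap (Subtype.val_injective (p := fun x => x ∈ S))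
      (Subtype.val_injective (p := fun x => x ∈ S)))]
  congr 1
  ext ⟨a, b⟩
  constructor
  · rintro ⟨⟨⟨a', ha⟩, ⟨b', hb⟩⟩, ⟨h, -⟩, heq⟩
    simp only [Prod.map_apply, Prod.mk.injEq] at heq
    obtain ⟨rfl, rfl⟩ := heq
    exact ⟨h, ha, hb⟩
  · rintro ⟨h, ha, hb⟩
    exact ⟨⟨⟨a, ha⟩, ⟨b, hb⟩⟩, ⟨h, trivial, trivial⟩, rfl⟩

theorem pc_remove {V : Type*} [Finite V] (G : SimpleGraph V) (S : Set V) {u : V} (hu : u ∈ S) :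
    pc G S = pc G (S \ {u}) + 2 * (S ∩ G.neighborSet u).ncard := by
  have h1 : {p : V × V | G.Adj p.1 p.2 ∧ p.1 ∈ S ∧ p.2 ∈ S} =
      {p : V × V | G.Adj p.1 p.2 ∧ p.1 ∈ S \ {u} ∧ p.2 ∈ S \ {u}} ∪
      ((fun w => (u, w)) '' (S ∩ G.neighborSet u) ∪ (fun w => (w, u)) '' (S ∩ G.neighborSet u)) := by
    ext ⟨a, b⟩
    simp only [Set.mem_setOf_eq, Set.mem_diff, Set.mem_singleton_iff, Set.mem_union, Set.mem_image,
      Set.mem_inter_iff, SimpleGraph.mem_neighborSet, Prod.mk.injEq]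
    constructor
    · rintro ⟨h, ha, hb⟩
      by_cases hau : a = u
      · subst hau
        exact Or.inr (Or.inl ⟨b, ⟨hb, h⟩, rfl, rfl⟩)
      · by_cases hbu : b = u
        · subst hbu
          exact Or.inr (Or.inr ⟨a, ⟨ha, h.symm⟩, rfl, rfl⟩)
        · exact Or.inl ⟨h, ⟨ha, hau⟩, hb, hbu⟩
    · rintro (⟨h, ⟨ha, -⟩, hb, -⟩ | ⟨w, ⟨hw, h⟩, rfl, rfl⟩ | ⟨w, ⟨hw, h⟩, rfl, rfl⟩)
      · exact ⟨h, ha, hb⟩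
      · exact ⟨h, hu, hw⟩
      · exact ⟨h.symm, hw, hu⟩
  unfold pc
  rw [h1, Set.ncard_union_eq, Set.ncard_union_eq, Set.ncard_image_of_injective,
    Set.ncard_image_of_injective]
  · omega
  · intro a b h; simpa using h
  · intro a b h; simpa using h
  · rw [Set.disjoint_left]
    rintro _ ⟨w, ⟨_, hw⟩, rfl⟩ ⟨w', ⟨_, hw'⟩, h⟩
    simp only [Prod.mk.injEq] at h
    rw [h.1] at hw'
    exact G.irrefl hw'
  · rw [Set.disjoint_left]
    rintro ⟨a, b⟩ ⟨_, ⟨_, ha⟩, _, hb⟩ (⟨w, _, h⟩ | ⟨w, _, h⟩)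
    · simp only [Prod.mk.injEq] at h
      exact ha h.1.symm
    · simp only [Prod.mk.injEq] at h
      exact hb h.2.symm

theorem pc_mono {V : Type*} [Finite V] {G : SimpleGraph V} {S T : Set V} (h : S ⊆ T) :
    pc G S ≤ pc G T :=
  Set.ncard_le_ncard fun _ hp => ⟨hp.1, h hp.2.1, h hp.2.2⟩

theorem pc_sum {V : Type*} [Fintype V] (G : SimpleGraph V) :
    pc G Set.univ = ∑ v, (G.neighborSet v).ncard := by
  classical
  unfold pc
  rw [Set.ncard_eq_toFinset_card']
  have : ∀ v, (G.neighborSet v).ncard = (Finset.univ.filter (fun w => G.Adj v w)).card := by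
    intro v
    rw [Set.ncard_eq_toFinset_card']
    congr 1
    ext; simp
  simp only [this, Finset.card_filter]
  rw [← Finset.sum_product', ← Finset.card_filter]
  congr 1
  ext; simp

theorem pc_clique {V : Type*} [Finite V] (G : SimpleGraph V) (S : Set V)
    (h : ∀ a ∈ S, ∀ b ∈ S, a ≠ b → G.Adj a b) : pc G S + S.ncard = S.ncard * S.ncard := by
  have h1 : S ×ˢ S = {p : V × V | G.Adj p.1 p.2 ∧ p.1 ∈ S ∧ p.2 ∈ S} ∪ (fun a => (a, a)) '' S := by
    ext ⟨a, b⟩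
    simp only [Set.mem_prod, Set.mem_union, Set.mem_setOf_eq, Set.mem_image, Prod.mk.injEq]
    constructor
    · rintro ⟨ha, hb⟩
      by_cases hab : a = b
      · exact Or.inr ⟨a, ha, rfl, hab⟩
      · exact Or.inl ⟨h a ha b hb hab, ha, hb⟩
    · rintro (⟨_, ha, hb⟩ | ⟨c, hc, rfl, rfl⟩)
      · exact ⟨ha, hb⟩
      · exact ⟨hc, hc⟩
  rw [← Set.ncard_prod, h1, Set.ncard_union_eq, Set.ncard_image_of_injective]
  · rfl
  · intro a b h; simpa using h
  · rw [Set.disjoint_left]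
    rintro _ ⟨h, -⟩ ⟨c, _, rfl⟩
    exact G.irrefl h

theorem pc_le {V : Type*} [Finite V] (G : SimpleGraph V) (S : Set V) :
    pc G S + S.ncard ≤ S.ncard * S.ncard := by
  rw [← pc_clique ⊤ S (fun a _ b _ hab => hab)]
  have : pc G S ≤ pc ⊤ S := Set.ncard_le_ncard fun p hp => ⟨hp.1.ne, hp.2⟩
  omega

theorem pc_delete {V : Type*} [Finite V] (G : SimpleGraph V) {a b : V} (hab : G.Adj a b) :
    pc G Set.univ = pc (G.deleteEdges {s(a, b)}) Set.univ + 2 := by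
  have h1 : {p : V × V | G.Adj p.1 p.2 ∧ p.1 ∈ Set.univ ∧ p.2 ∈ Set.univ} =
      {p : V × V | (G.deleteEdges {s(a, b)}).Adj p.1 p.2 ∧ p.1 ∈ Set.univ ∧ p.2 ∈ Set.univ} ∪
      {(a, b), (b, a)} := by
    ext ⟨c, d⟩
    simp only [Set.mem_setOf_eq, Set.mem_univ, and_true, Set.mem_union, Set.mem_insert_iff,
      Set.mem_singleton_iff, SimpleGraph.deleteEdges_adj, Prod.mk.injEq, Sym2.eq_iff]
    constructor
    · intro h
      by_cases h2 : c = a ∧ d = b ∨ c = b ∧ d = a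
      · exact Or.inr h2
      · exact Or.inl ⟨h, h2⟩
    · rintro (h | ⟨rfl, rfl⟩ | ⟨rfl, rfl⟩)
      · exact h.1
      · exact hab
      · exact hab.symm
  unfold pc
  rw [h1, Set.ncard_union_eq, Set.ncard_pair]
  · intro h
    simp only [Prod.mk.injEq] at h
    exact hab.ne h.1
  · rw [Set.disjoint_left]
    rintro ⟨c, d⟩ ⟨h, -⟩ hh
    simp only [Set.mem_insert_iff, Set.mem_singleton_iff, Prod.mk.injEq] at hh
    rw [SimpleGraph.deleteEdges_adj] at h
    apply h.2
    simpa using hh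

theorem pc_contract {V : Type*} [Finite V] (G : SimpleGraph V) {u v : V} (huv : G.Adj u v) :
    pc (addNbrs G u v) {v}ᶜ + 2 + 2 * (G.neighborSet u ∩ G.neighborSet v).ncard
      = pc G Set.univ := by
  have e1 := pc_remove (addNbrs G u v) {v}ᶜ (u := u) (by simpa using huv.ne)
  have e2 := pc_remove G Set.univ (u := v) trivial
  have e3 := pc_remove G (Set.univ \ {v}) (u := u) (by simpa using huv.ne)
  have hset : Set.univ \ {v} = ({v}ᶜ : Set V) := (Set.compl_eq_univ_diff _).symm
  rw [hset] at e2 e3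
  have e4 : pc (addNbrs G u v) ({v}ᶜ \ {u}) = pc G ({v}ᶜ \ {u}) := by
    unfold pc
    congr 1
    ext ⟨a, b⟩
    simp only [Set.mem_setOf_eq, Set.mem_diff, Set.mem_singleton_iff, addNbrs]
    tauto
  have e5 : ({v}ᶜ ∩ (addNbrs G u v).neighborSet u) =
      ({v}ᶜ ∩ G.neighborSet u) ∪ (G.neighborSet v \ {u}) := by
    ext w
    simp only [addNbrs, Set.mem_inter_iff, Set.mem_compl_iff, Set.mem_singleton_iff,
      SimpleGraph.mem_neighborSet, Set.mem_union, Set.mem_diff]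
    constructor
    · rintro ⟨h1, h2 | ⟨-, h3, h4⟩ | ⟨h3, h4, h5⟩⟩
      · exact Or.inl ⟨h1, h2⟩
      · exact Or.inr ⟨h4, h3⟩
      · exact absurd rfl h4
    · rintro (⟨h1, h2⟩ | ⟨h1, h2⟩)
      · exact ⟨h1, Or.inl h2⟩
      · exact ⟨h1.ne.symm, Or.inr (Or.inl ⟨trivial, h2, h1⟩)⟩
  have e6 := Set.ncard_union_add_ncard_inter ({v}ᶜ ∩ G.neighborSet u) (G.neighborSet v \ {u})
  have e7 : ({v}ᶜ ∩ G.neighborSet u) ∩ (G.neighborSet v \ {u}) =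
      G.neighborSet u ∩ G.neighborSet v := by
    ext w
    simp only [Set.mem_inter_iff, Set.mem_compl_iff, Set.mem_singleton_iff,
      SimpleGraph.mem_neighborSet, Set.mem_diff]
    constructor
    · rintro ⟨⟨-, h1⟩, h2, -⟩; exact ⟨h1, h2⟩
    · rintro ⟨h1, h2⟩; exact ⟨⟨h2.ne.symm, h1⟩, h2, h1.ne.symm⟩
  have e8 := Set.ncard_diff_singleton_add_one (s := G.neighborSet v) (a := u) huv.symm
  rw [e5] at e1
  rw [e7] at e6
  rw [Set.univ_inter] at e2
  omega

theorem extremal_aux (k : ℕ) : ∀ {V : Type*} [Finite V] (G : SimpleGraph V),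
    Nat.card V + pc G Set.univ ≤ k → 6 ≤ Nat.card V → 12 * Nat.card V ≤ pc G Set.univ + 41 →
    G.HasMinor K8minus := by
  induction k with
  | zero => intro V _ G h1 h2 h3; omega
  | succ k ih =>
    intro V _ G hk h6 h12
    have hle := pc_le G Set.univ
    rw [Set.ncard_univ] at hle
    have h7 : 7 ≤ Nat.card V := by
      by_contra hcon
      have : Nat.card V = 6 := by omega
      rw [this] at hle h12
      omega
    have hsub : ∀ S : Set V, (G.induce S).HasMinor K8minus → G.HasMinor K8minus := fun S h =>
      minor_of_hom Subtype.val Subtype.val_injective (fun _ _ h => h) h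
    have hcompl : ∀ v : V, Nat.card ({v}ᶜ : Set V) + 1 = Nat.card V := by
      intro v
      have := Set.ncard_add_ncard_compl ({v} : Set V)
      rw [Set.ncard_singleton] at this
      change ({v}ᶜ : Set V).ncard + 1 = _
      omega
    -- delete an edge
    by_cases hdel : 12 * Nat.card V ≤ pc G Set.univ + 39
    · have hpos : 0 < pc G Set.univ := by omega
      obtain ⟨⟨a, b⟩, hab, -⟩ := (Set.ncard_pos).1 hpos
      have hab' : G.Adj a b := hab
      have h1 := pc_delete G hab'
      exact minor_of_hom id Function.injective_id
        (fun _ _ h => (SimpleGraph.deleteEdges_le (G := G) {s(a, b)}) h)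
        (ih (G.deleteEdges {s(a, b)}) (by omega) h6 (by omega))
    -- delete a vertex
    by_cases hv : ∃ v, (G.neighborSet v).ncard ≤ 6
    · obtain ⟨v, hv⟩ := hv
      have h1 := pc_remove G Set.univ (u := v) trivial
      rw [Set.univ_inter, (Set.compl_eq_univ_diff _).symm] at h1
      have h3 := pc_induce G {v}ᶜ
      have h2 := hcompl v
      exact hsub _ (ih (G.induce {v}ᶜ) (by omega) (by omega) (by omega))
    push Not at hv
    -- contract an edge
    by_cases hc : ∃ u v, G.Adj u v ∧ (G.neighborSet u ∩ G.neighborSet v).ncard ≤ 5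
    · obtain ⟨u, v, huv, hc⟩ := hc
      have h1 := pc_contract G huv
      have h3 := pc_induce (addNbrs G u v) {v}ᶜ
      have h2 := hcompl v
      exact minor_of_contract huv (ih _ (by omega) (by omega) (by omega))
    push Not at hc
    have : Nonempty V := (Nat.card_pos_iff.1 (by omega)).1
    obtain ⟨x, hx⟩ := Finite.exists_min (fun v => (G.neighborSet v).ncard)
    have hx11 : (G.neighborSet x).ncard ≤ 11 := by
      by_contra hcon
      have := Fintype.ofFinite V
      have h1 := pc_sum G
      have h2 := Finset.card_nsmul_le_sum Finset.univ (fun v => (G.neighborSet v).ncard) 12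
        (fun v _ => by have := hx v; omega)
      rw [Finset.card_univ, ← Nat.card_eq_fintype_card, smul_eq_mul] at h2
      omega
    rcases structure_lemma G (fun u v h => hc u v h) x (by have := hv x; omega) hx11
      (fun y _ => hx y) with h | ⟨D, ⟨d, hd⟩, hxD, hxd, hDn, hcl⟩
    · exact h
    · set C : Set V := {w | w ∉ D ∧ ∃ d ∈ D, G.Adj d w} with hC
      have hDC : Disjoint D C := Set.disjoint_left.2 fun w h1 h2 => h2.1 h1
      have hxA : x ∉ D ∪ C := by
        rintro (h | ⟨-, d, hd, h⟩)
        · exact hxD h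
        · exact hxd d hd h.symm
      -- sizes
      have s1 : (D ∪ C).ncard = D.ncard + C.ncard := Set.ncard_union_eq hDC
      have s2 : D.ncard + Dᶜ.ncard = Nat.card V := Set.ncard_add_ncard_compl D
      have s3 : (D ∪ C).ncard < Nat.card V := by
        rw [← Set.ncard_univ]
        exact Set.ncard_lt_ncard (Set.ssubset_univ_iff.2 fun h => hxA (h ▸ trivial))
      have s4 : 0 < D.ncard := (Set.ncard_pos).2 ⟨d, hd⟩
      have s5 : 8 ≤ (D ∪ C).ncard := by
        have h1 : insert d (G.neighborSet d) ⊆ D ∪ C := by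
          rintro w (rfl | hw)
          · exact Or.inl hd
          · by_cases hwD : w ∈ D
            · exact Or.inl hwD
            · exact Or.inr ⟨hwD, d, hd, hw⟩
        have h2 := Set.ncard_le_ncard h1
        rw [Set.ncard_insert_of_notMem (by simp)] at h2
        have := hv d
        omega
      have s6 : 8 ≤ Dᶜ.ncard := by
        have h1 : insert x (G.neighborSet x) ⊆ Dᶜ := by
          rintro w (rfl | hw)
          · exact hxD
          · exact fun h => hxd w h hw
        have h2 := Set.ncard_le_ncard h1
        rw [Set.ncard_insert_of_notMem (by simp)] at h2
        have := hv x
        omega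
      -- edges
      have p1 : pc G (D ∪ C) + pc G Dᶜ = pc G Set.univ + pc G C := by
        have hU : {p : V × V | G.Adj p.1 p.2 ∧ p.1 ∈ Set.univ ∧ p.2 ∈ Set.univ} =
            {p : V × V | G.Adj p.1 p.2 ∧ p.1 ∈ D ∪ C ∧ p.2 ∈ D ∪ C} ∪
            {p : V × V | G.Adj p.1 p.2 ∧ p.1 ∈ Dᶜ ∧ p.2 ∈ Dᶜ} := by
          ext ⟨a, b⟩
          simp only [Set.mem_setOf_eq, Set.mem_univ, and_true, Set.mem_union, Set.mem_compl_iff]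
          constructor
          · intro h
            by_cases ha : a ∈ D
            · left
              refine ⟨h, Or.inl ha, ?_⟩
              by_cases hb : b ∈ D
              · exact Or.inl hb
              · exact Or.inr ⟨hb, a, ha, h⟩
            · by_cases hb : b ∈ D
              · exact Or.inl ⟨h, Or.inr ⟨ha, b, hb, h.symm⟩, Or.inl hb⟩
              · exact Or.inr ⟨h, ha, hb⟩
          · rintro (h | h) <;> exact h.1
        have hI : {p : V × V | G.Adj p.1 p.2 ∧ p.1 ∈ C ∧ p.2 ∈ C} =
            {p : V × V | G.Adj p.1 p.2 ∧ p.1 ∈ D ∪ C ∧ p.2 ∈ D ∪ C} ∩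
            {p : V × V | G.Adj p.1 p.2 ∧ p.1 ∈ Dᶜ ∧ p.2 ∈ Dᶜ} := by
          ext ⟨a, b⟩
          simp only [Set.mem_setOf_eq, Set.mem_inter_iff, Set.mem_union, Set.mem_compl_iff]
          constructor
          · rintro ⟨h, ha, hb⟩
            exact ⟨⟨h, Or.inr ha, Or.inr hb⟩, h, ha.1, hb.1⟩
          · rintro ⟨⟨h, ha, hb⟩, -, ha', hb'⟩
            exact ⟨h, ha.resolve_left ha', hb.resolve_left hb'⟩
        unfold pc
        rw [hU, hI, Set.ncard_union_add_ncard_inter]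
      have p2 := pc_clique G C (fun a ha b hb hab => hcl a b ha.1 hb.1 hab ha.2 hb.2)
      have p3 : pc G (D ∪ C) ≤ pc G Set.univ := pc_mono (Set.subset_univ _)
      have p4 : pc G Dᶜ ≤ pc G Set.univ := pc_mono (Set.subset_univ _)
      by_cases hA : 12 * (D ∪ C).ncard ≤ pc G (D ∪ C) + 41
      · have h3 := pc_induce G (D ∪ C)
        have hcA : Nat.card (D ∪ C : Set V) = (D ∪ C).ncard := rfl
        exact hsub _ (ih (G.induce (D ∪ C)) (by omega) (by omega) (by omega))
      by_cases hB : 12 * Dᶜ.ncard ≤ pc G Dᶜ + 41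
      · have h3 := pc_induce G Dᶜ
        have hcB : Nat.card (Dᶜ : Set V) = Dᶜ.ncard := rfl
        exact hsub _ (ih (G.induce Dᶜ) (by omega) (by omega) (by omega))
      exfalso
      have key : C.ncard * C.ncard + 43 ≤ 13 * C.ncard := by omega
      have key2 : (C.ncard : ℤ) * C.ncard + 43 ≤ 13 * C.ncard := by exact_mod_cast key
      nlinarith [sq_nonneg (2 * (C.ncard : ℤ) - 13)]

/-- Every finite graph with at least six vertices and many edges has a `K8minus` minor. -/
theorem extremal {V : Type*} [Finite V] (G : SimpleGraph V) (h6 : 6 ≤ Nat.card V)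
    (h12 : 12 * Nat.card V ≤ pc G Set.univ + 41) : G.HasMinor K8minus :=
  extremal_aux _ G le_rfl h6 h12

end KMin

namespace KMin

/-- `f`-style proper colouring of the part of `G` inside `S`. -/
def PCol {V : Type*} (G : SimpleGraph V) (S : Set V) (n : ℕ) : Prop :=
  ∃ f : V → Fin n, ∀ a ∈ S, ∀ b ∈ S, G.Adj a b → f a ≠ f b

theorem pcol_of_colorable {V : Type*} (G : SimpleGraph V) (S : Set V) (n : ℕ) [NeZero n]
    (h : (G.induce S).Colorable n) : PCol G S n := by
  classical
  obtain ⟨c⟩ := h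
  refine ⟨fun a => if h : a ∈ S then c ⟨a, h⟩ else 0, ?_⟩
  intro a ha b hb hab
  simp only [ha, hb, dif_pos]
  exact c.valid (v := ⟨a, ha⟩) (w := ⟨b, hb⟩) hab

theorem colorable_of_pcol {V : Type*} (G : SimpleGraph V) (n : ℕ)
    (h : PCol G Set.univ n) : G.Colorable n := by
  obtain ⟨f, hf⟩ := h
  exact ⟨SimpleGraph.Coloring.mk f (fun {a b} hab => hf a trivial b trivial hab)⟩

theorem PCol.mono {V : Type*} {G : SimpleGraph V} {S T : Set V} {n : ℕ} (h : PCol G T n)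
    (hST : S ⊆ T) : PCol G S n := by
  obtain ⟨f, hf⟩ := h
  exact ⟨f, fun a ha b hb => hf a (hST ha) b (hST hb)⟩

theorem pcol_remove {V : Type*} (G : SimpleGraph V) (u v : V)
    (h : PCol G ({u, v}ᶜ) 6) : PCol G ({u}ᶜ) 7 := by
  classical
  obtain ⟨f, hf⟩ := h
  refine ⟨fun a => if a = v then Fin.last 6 else (f a).castSucc, ?_⟩
  intro a ha b hb hab
  simp only
  split_ifs with h1 h2 h2
  · exact absurd (h1.trans h2.symm) hab.ne
  · exact (Fin.castSucc_ne_last _).symm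
  · exact Fin.castSucc_ne_last _
  · intro h
    exact hf a (by simp_all) b (by simp_all) hab (Fin.castSucc_injective _ h)

theorem triangles {V : Type*} [Finite V] (G : SimpleGraph V) (hno : ¬ PCol G Set.univ 7) {u v : V}
    (huv : G.Adj u v) (h : PCol G ({u, v}ᶜ) 6) :
    6 ≤ (G.neighborSet u ∩ G.neighborSet v).ncard := by
  classical
  by_contra hcon
  apply hno
  obtain ⟨f, hf⟩ := h
  obtain ⟨c, hc⟩ : ∃ c, c ∉ f '' (G.neighborSet u ∩ G.neighborSet v) := by
    by_contra hall
    push Not at hall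
    have h1 : f '' (G.neighborSet u ∩ G.neighborSet v) = Set.univ := Set.eq_univ_of_forall hall
    have h2 := Set.ncard_image_le (f := f) (Set.toFinite (G.neighborSet u ∩ G.neighborSet v))
    rw [h1, Set.ncard_univ, Nat.card_eq_fintype_card, Fintype.card_fin] at h2
    omega
  have hc' : ∀ w, G.Adj u w → G.Adj v w → f w ≠ c := fun w h1 h2 h3 => hc ⟨w, ⟨h1, h2⟩, h3⟩
  have hl : ∀ x : Fin 6, x.castSucc ≠ Fin.last 6 := fun x => Fin.castSucc_ne_last x
  let g : V → Fin 7 := fun w => if w = u then Fin.last 6 else if w = v then c.castSucc else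
    if f w = c ∧ G.Adj v w then Fin.last 6 else (f w).castSucc
  have hgu : g u = Fin.last 6 := by simp [g]
  have hgv : g v = c.castSucc := by simp [g, huv.ne.symm]
  have hg1 : ∀ w, w ≠ u → w ≠ v → f w = c → G.Adj v w → g w = Fin.last 6 := by
    intro w h1 h2 h3 h4; simp [g, h1, h2, h3, h4]
  have hg2 : ∀ w, w ≠ u → w ≠ v → ¬ (f w = c ∧ G.Adj v w) → g w = (f w).castSucc := by
    intro w h1 h2 h3; simp only [g, h1, h2, h3, if_false]
  have key1 : ∀ w, G.Adj u w → g u ≠ g w := by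
    intro w hw
    rw [hgu]
    by_cases hwv : w = v
    · rw [hwv, hgv]; exact (hl _).symm
    · rw [hg2 w hw.ne.symm hwv (fun h => hc' w hw h.2 h.1)]
      exact (hl _).symm
  have key2 : ∀ w, w ≠ u → G.Adj v w → g v ≠ g w := by
    intro w hwu hw
    rw [hgv]
    by_cases hfc : f w = c
    · rw [hg1 w hwu hw.ne.symm hfc hw]; exact hl _
    · rw [hg2 w hwu hw.ne.symm (fun h => hfc h.1)]
      exact fun h => hfc (Fin.castSucc_injective _ h).symm
  refine ⟨g, ?_⟩
  intro a _ b _ hab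
  by_cases hau : a = u
  · subst hau; exact key1 b hab
  by_cases hbu : b = u
  · subst hbu; exact (key1 a hab.symm).symm
  by_cases hav : a = v
  · subst hav; exact key2 b hbu hab
  by_cases hbv : b = v
  · subst hbv; exact (key2 a hau hab.symm).symm
  have hfab : f a ≠ f b := hf a (by simp [hau, hav]) b (by simp [hbu, hbv]) hab
  by_cases h1 : f a = c ∧ G.Adj v a
  · rw [hg1 a hau hav h1.1 h1.2, hg2 b hbu hbv (fun h => hfab (h1.1.trans h.1.symm))]
    exact (hl _).symm
  · rw [hg2 a hau hav h1]
    by_cases h2 : f b = c ∧ G.Adj v b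
    · rw [hg1 b hbu hbv h2.1 h2.2]; exact hl _
    · rw [hg2 b hbu hbv h2]
      exact fun h => hfab (Fin.castSucc_injective _ h)

theorem glue {V : Type*} (G : SimpleGraph V) (D C : Set V) (n : ℕ)
    (hC : C = {w | w ∉ D ∧ ∃ d ∈ D, G.Adj d w})
    (hcl : ∀ a ∈ C, ∀ b ∈ C, a ≠ b → G.Adj a b)
    (h1 : PCol G Dᶜ n) (h2 : PCol G (D ∪ C) n) : PCol G Set.univ n := by
  classical
  obtain ⟨f, hf⟩ := h1
  obtain ⟨g, hg⟩ := h2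
  have hCD : ∀ a ∈ C, a ∉ D := by
    intro a ha; rw [hC] at ha; exact ha.1
  have fi : Set.InjOn f C := by
    intro a ha b hb hab
    by_contra hne
    exact hf a (hCD a ha) b (hCD b hb) (hcl a ha b hb hne) hab
  have gi : Set.InjOn g C := by
    intro a ha b hb hab
    by_contra hne
    exact hg a (Or.inr ha) b (Or.inr hb) (hcl a ha b hb hne) hab
  let e : {x // x ∈ g '' C} ≃ {x // x ∈ f '' C} :=
    (Equiv.Set.imageOfInjOn g C gi).symm.trans (Equiv.Set.imageOfInjOn f C fi)
  let s : Equiv.Perm (Fin n) := e.extendSubtype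
  have hs : ∀ c ∈ C, s (g c) = f c := by
    intro c hc
    have hm : g c ∈ g '' C := ⟨c, hc, rfl⟩
    have h3 : s (g c) = e ⟨g c, hm⟩ := Equiv.extendSubtype_apply_of_mem e (g c) hm
    have h4 : (Equiv.Set.imageOfInjOn g C gi).symm ⟨g c, hm⟩ = ⟨c, hc⟩ := by
      rw [Equiv.symm_apply_eq]; rfl
    rw [h3]
    simp only [e, Equiv.trans_apply, h4]
    rfl
  have cross : ∀ a b, a ∈ D → b ∉ D → G.Adj a b → s (g a) ≠ f b := by
    intro a b ha hb hab h
    have hbC : b ∈ C := by rw [hC]; exact ⟨hb, a, ha, hab⟩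
    rw [← hs b hbC] at h
    exact hg a (Or.inl ha) b (Or.inr hbC) hab (s.injective h)
  refine ⟨fun w => if w ∈ D then s (g w) else f w, ?_⟩
  intro a _ b _ hab
  simp only
  split_ifs with ha hb hb
  · exact fun h => hg a (Or.inl ha) b (Or.inl hb) hab (s.injective h)
  · exact cross a b ha hb hab
  · exact (cross b a hb ha hab.symm).symm
  · exact hf a ha b hb hab

theorem main {V : Type*} [Fintype V] (G : SimpleGraph V)
    (hG : G.DoubleCritical 8) : G.HasMinor K8minus := by
  obtain ⟨hconn, hchi, hdc⟩ := hG
  have hno : ¬ PCol G Set.univ 7 := by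
    intro h
    have := (colorable_of_pcol G 7 h).chromaticNumber_le
    rw [hchi] at this
    exact absurd this (by decide)
  have h6 : ∀ u v, G.Adj u v → PCol G ({u, v}ᶜ) 6 := by
    intro u v huv
    apply pcol_of_colorable
    exact SimpleGraph.chromaticNumber_le_iff_colorable.1 (by simpa using hdc u v huv)
  have htri : ∀ u v, G.Adj u v → 6 ≤ (G.neighborSet u ∩ G.neighborSet v).ncard :=
    fun u v huv => triangles G hno huv (h6 u v huv)
  have hne : Nonempty V := hconn.nonempty
  have hnt : Nontrivial V := by
    by_contra hcon
    rw [not_nontrivial_iff_subsingleton] at hcon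
    exact hno ⟨fun _ => 0, fun a _ b _ hab => absurd (Subsingleton.elim a b) hab.ne⟩
  have hnb : ∀ u, ∃ v, G.Adj u v := fun u => hconn.preconnected.exists_adj_of_nontrivial u
  have h7 : ∀ u, PCol G ({u}ᶜ) 7 := by
    intro u
    obtain ⟨v, hv⟩ := hnb u
    exact pcol_remove G u v (h6 u v hv)
  obtain ⟨x, hx⟩ := Finite.exists_min (fun v => (G.neighborSet v).ncard)
  obtain ⟨y, hy⟩ := hnb x
  by_cases hx11 : (G.neighborSet x).ncard ≤ 11
  · have hx1 : 1 ≤ (G.neighborSet x).ncard := (Set.ncard_pos).2 ⟨y, hy⟩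
    rcases structure_lemma G htri x hx1 hx11 (fun y _ => hx y) with
      h | ⟨D, ⟨d, hd⟩, hxD, hxd, hDn, hcl⟩
    · exact h
    · exfalso
      apply hno
      refine glue G D {w | w ∉ D ∧ ∃ d ∈ D, G.Adj d w} 7 rfl
        (fun a ha b hb hab => hcl a b ha.1 hb.1 hab ha.2 hb.2)
        ((h7 d).mono ?_) ((h7 x).mono ?_)
      · rintro w hw rfl
        exact hw hd
      · rintro w hw rfl
        rcases hw with h | ⟨-, d, hd, h⟩
        · exact hxD h
        · exact hxd d hd h.symm
  · have h1 := pc_sum G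
    have h2 := Finset.card_nsmul_le_sum Finset.univ (fun v => (G.neighborSet v).ncard) 12
      (fun v _ => by have := hx v; omega)
    rw [Finset.card_univ, ← Nat.card_eq_fintype_card, smul_eq_mul] at h2
    have h3 : (G.neighborSet x).ncard ≤ Nat.card V := by
      rw [← Set.ncard_univ]; exact Set.ncard_le_ncard (Set.subset_univ _)
    exact extremal G (by omega) (by omega)

end KMin

/-- Every double-critical 8-chromatic graph contains a `K₈⁻` minor. -/
theorem double_critical_eight_chromatic_hasMinor_K8minus
    {V : Type*} [Fintype V] (G : SimpleGraph V)
    (hG : G.DoubleCritical 8) :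
    G.HasMinor K8minus := by
  exact KMin.main G hG
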